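/- There exist radial Schwartz functions a_n, b_n, ã_n, b̃_n : ℝ²⁴ → ℂ, indexed by integers n ≥ 2, with the following property: for every radial Schwartz function f : ℝ²⁴ → ℂ and every x ∈ ℝ²⁴, each of the four series Σ_{n≥2} f(√(2n))·a_n(x), Σ_{n≥2} f′(√(2n))·b_n(x), Σ_{n≥2} f̂(√(2n))·ã_n(x), and Σ_{n≥2} f̂′(√(2n))·b̃_n(x) converges absolutely, and f(x) equals the sum of these four series. -/

import Mathlib

noncomputable section

/-- A function on `ℝ²⁴` is radial if its value depends only on the norm of the argument. -/
def IsRadial (f : EuclideanSpace ℝ (Fin 24) → ℂ) : Prop :=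
  ∀ x y : EuclideanSpace ℝ (Fin 24), ‖x‖ = ‖y‖ → f x = f y

/-- The first standard basis vector of `ℝ²⁴`. -/
def e₁ : EuclideanSpace ℝ (Fin 24) := EuclideanSpace.single 0 1

/-- The radial value `f(r) = f(r·e₁)` of a Schwartz function. -/
def radVal (f : SchwartzMap (EuclideanSpace ℝ (Fin 24)) ℂ) (r : ℝ) : ℂ := f (r • e₁)

/-- The radial derivative `f′(r)`, the derivative at `t = r` of `t ↦ f(t·e₁)`. -/
def radDeriv (f : SchwartzMap (EuclideanSpace ℝ (Fin 24)) ℂ) (r : ℝ) : ℂ :=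
  deriv (fun t : ℝ => f (t • e₁)) r

/-- The Fourier transform `f̂(y) = ∫ f(x) e^{-2πi⟨x,y⟩} dx` of a Schwartz function. -/
def FT (f : SchwartzMap (EuclideanSpace ℝ (Fin 24)) ℂ) :
    SchwartzMap (EuclideanSpace ℝ (Fin 24)) ℂ :=
  SchwartzMap.fourierTransformCLM ℂ f

section A1
namespace I24
open Complex Filter Topology MeasureTheory Set

/-- Holomorphic functions on the upper half plane have primitives. -/
theorem exists_primitive {f : ℂ → ℂ} (hf : DifferentiableOn ℂ f {z | 0 < z.im}) :
    ∃ F : ℂ → ℂ, ∀ z : ℂ, 0 < z.im → HasDerivAt F (f z) z := by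
  have him : ∀ w : ℂ, ‖w‖ < 1 → 0 < (I * (1 + w) / (1 - w)).im := by
    intro w hw
    have h1 : (1 - w) ≠ 0 := by
      intro h
      have : w = 1 := by linear_combination -h
      rw [this] at hw; simp at hw
    have h2 : 0 < normSq (1 - w) := normSq_pos.2 h1
    have h3 : normSq w < 1 := by
      rw [normSq_eq_norm_sq]; nlinarith [norm_nonneg w]
    rw [div_im]
    simp only [normSq_apply, mul_re, mul_im, I_re, I_im, add_re, add_im, one_re, one_im, sub_re, sub_im] at *
    rw [← sub_div]
    apply div_pos _ h2
    nlinarith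
  have hd : DifferentiableOn ℂ (fun w => f (I * (1 + w) / (1 - w)) * (2 * I / (1 - w) ^ 2))
      (Metric.ball 0 1) := by
    intro w hw
    have hw' : ‖w‖ < 1 := by simpa using hw
    have h1 : (1 - w) ≠ 0 := by
      intro h
      have : w = 1 := by linear_combination -h
      rw [this] at hw'; simp at hw'
    apply DifferentiableAt.differentiableWithinAt
    have hopen : IsOpen {z : ℂ | 0 < z.im} := isOpen_lt continuous_const continuous_im
    have h2 : DifferentiableAt ℂ f (I * (1 + w) / (1 - w)) :=
      (hf _ (him w hw')).differentiableAt (hopen.mem_nhds (him w hw'))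
    have h3 : DifferentiableAt ℂ (fun w : ℂ => I * (1 + w) / (1 - w)) w := by
      apply DifferentiableAt.div (by fun_prop) (by fun_prop) h1
    refine (DifferentiableAt.comp w h2 h3).mul ?_
    have h4 : (1 - w) ^ 2 ≠ 0 := pow_ne_zero _ h1
    fun_prop (disch := assumption)
  obtain ⟨P, hP⟩ := hd.isExactOn_ball
  refine ⟨fun τ => P ((τ - I) / (τ + I)), fun z hz => ?_⟩
  have hz1 : z + I ≠ 0 := by
    intro h
    have := congrArg Complex.im h
    simp at this; linarith
  have hw : ‖(z - I) / (z + I)‖ < 1 := by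
    rw [norm_div, div_lt_one (norm_pos_iff.2 hz1)]
    apply lt_of_pow_lt_pow_left₀ 2 (norm_nonneg _)
    rw [← normSq_eq_norm_sq, ← normSq_eq_norm_sq]
    simp only [normSq_apply, add_re, add_im, sub_re, sub_im, I_re, I_im]
    nlinarith
  have h1 := hP ((z - I) / (z + I)) (by simpa using hw)
  have h2 : HasDerivAt (fun τ : ℂ => (τ - I) / (τ + I)) (2 * I / (z + I) ^ 2) z := by
    refine (((hasDerivAt_id z).sub_const I).div ((hasDerivAt_id z).add_const I) hz1).congr_deriv ?_
    congr 1; simp only [id]; ring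
  have h3 := HasDerivAt.comp z h1 h2
  refine h3.congr_deriv ?_
  have e1 : 1 - (z - I) / (z + I) = 2 * I / (z + I) := by field_simp; ring
  have e2 : 1 + (z - I) / (z + I) = 2 * z / (z + I) := by field_simp; ring
  have e3 : I * (1 + (z - I) / (z + I)) / (1 - (z - I) / (z + I)) = z := by
    rw [e1, e2]; field_simp
  dsimp only
  rw [e3, e1, div_pow, mul_pow, I_sq]; field_simp; rw [I_sq]; ring

theorem hasDerivAt_vert {F f : ℂ → ℂ} {x t : ℝ} (h : HasDerivAt F (f (x + t * I)) (x + t * I)) :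
    HasDerivAt (fun s : ℝ => F (x + s * I)) (f (x + t * I) * I) t := by
  have h2 : HasDerivAt (fun s : ℂ => (x : ℂ) + s * I) I (t : ℂ) := by
    simpa using ((hasDerivAt_id (t : ℂ)).mul_const I).const_add (x : ℂ)
  have h3 : HasDerivAt F (f (x + t * I)) ((fun s : ℂ => (x : ℂ) + s * I) t) := h
  exact (HasDerivAt.comp (t : ℂ) h3 h2).comp_ofReal

theorem hasDerivAt_horiz {F f : ℂ → ℂ} {x : ℝ} {c : ℂ} (h : HasDerivAt F (f (x + c)) (x + c)) :
    HasDerivAt (fun s : ℝ => F (s + c)) (f (x + c)) x := by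
  have h2 : HasDerivAt (fun s : ℂ => s + c) 1 (x : ℂ) := by
    simpa using ((hasDerivAt_id (x : ℂ)).add_const c)
  have h3 : HasDerivAt F (f (x + c)) ((fun s : ℂ => s + c) x) := h
  simpa using (HasDerivAt.comp (x : ℂ) h3 h2).comp_ofReal

/-- Vertical integrals of functions with exponential decay. -/
theorem integrableOn_vert {f : ℂ → ℂ} {C κ y0 x t0 : ℝ} (hκ : 0 < κ) (hy0 : 0 < y0)
    (hf : ContinuousOn f {z | 0 < z.im})
    (hb : ∀ z : ℂ, y0 ≤ z.im → ‖f z‖ ≤ C * Real.exp (-κ * z.im)) (ht : y0 ≤ t0) :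
    IntegrableOn (fun t : ℝ => f (x + t * I) * I) (Ioi t0) := by
  have h1 : IntegrableOn (fun t : ℝ => C * Real.exp (-κ * t)) (Ioi t0) :=
    (exp_neg_integrableOn_Ioi t0 hκ).const_mul C
  refine Integrable.mono' h1 ?_ ?_
  · refine ContinuousOn.aestronglyMeasurable ?_ measurableSet_Ioi
    refine ContinuousOn.mul ?_ continuousOn_const
    refine hf.comp (by fun_prop) ?_
    intro t ht'
    simp only [mem_ofPred_eq, add_im, ofReal_im, mul_im, ofReal_re, I_im, I_re]
    have : t0 < t := ht'
    simp; linarith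
  · refine (ae_restrict_iff' measurableSet_Ioi).2 (ae_of_all _ fun t ht' => ?_)
    have h2 : t0 < t := ht'
    have := hb (x + t * I) (by simp; linarith)
    simpa using this

/-- Primitive with decay at infinity. -/
theorem exists_primitive_decay {f : ℂ → ℂ} {C κ y0 : ℝ} (hκ : 0 < κ) (hy0 : 0 < y0)
    (hf : DifferentiableOn ℂ f {z | 0 < z.im})
    (hb : ∀ z : ℂ, y0 ≤ z.im → ‖f z‖ ≤ C * Real.exp (-κ * z.im)) :
    ∃ F : ℂ → ℂ, (∀ z : ℂ, 0 < z.im → HasDerivAt F (f z) z) ∧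
      (∀ x t0 : ℝ, y0 ≤ t0 → ∫ t in Ioi t0, f (x + t * I) * I = - F (x + t0 * I)) ∧
      ∀ z : ℂ, y0 ≤ z.im → ‖F z‖ ≤ C / κ * Real.exp (-κ * z.im) := by
  obtain ⟨Q, hQ⟩ := exists_primitive hf
  have hintg : ∀ x t0 : ℝ, y0 ≤ t0 → IntegrableOn (fun t : ℝ => f (x + t * I) * I) (Ioi t0) :=
    fun x t0 ht => integrableOn_vert hκ hy0 hf.continuousOn hb ht
  have hd : ∀ x t : ℝ, y0 ≤ t → HasDerivAt (fun s : ℝ => Q (x + s * I)) (f (x + t * I) * I) t :=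
    fun x t ht => hasDerivAt_vert (hQ _ (by simp; linarith))
  have hl0 : ∀ x : ℝ, ∃ l, Tendsto (fun s : ℝ => Q (x + s * I)) atTop (𝓝 l) := fun x =>
    ⟨_, tendsto_limUnder_of_hasDerivAt_of_integrableOn_Ioi (fun t ht => hd x t (le_of_lt ht))
      (hintg x y0 le_rfl)⟩
  obtain ⟨l, hl⟩ := hl0 0
  have hlx : ∀ x : ℝ, Tendsto (fun s : ℝ => Q (x + s * I)) atTop (𝓝 l) := by
    intro x
    have hdiff : Tendsto (fun s : ℝ => Q (x + s * I) - Q ((0 : ℝ) + s * I)) atTop (𝓝 0) := by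
      have hz : Tendsto (fun s : ℝ => C * Real.exp (-κ * s) * ‖(x : ℂ)‖) atTop (𝓝 0) := by
        have h1 : Tendsto (fun s : ℝ => Real.exp (-κ * s)) atTop (𝓝 0) := by
          apply Real.tendsto_exp_atBot.comp
          exact tendsto_id.const_mul_atTop_of_neg (by linarith)
        simpa using (h1.const_mul C).mul_const ‖(x : ℂ)‖
      refine squeeze_zero_norm' ?_ hz
      filter_upwards [eventually_ge_atTop y0] with s hs
      have hconv : Convex ℝ {z : ℂ | z.im = s} := by
        intro a ha b hb' p q hp hq hpq
        simp only [mem_ofPred_eq] at *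
        simp [ha, hb']
        rw [← add_mul, hpq, one_mul]
      have := hconv.norm_image_sub_le_of_norm_hasDerivWithin_le (f := Q) (f' := f)
        (C := C * Real.exp (-κ * s)) (x := ((0 : ℝ) : ℂ) + s * I) (y := x + s * I)
        (fun z hz => (hQ z (by simp only [mem_ofPred_eq] at hz; linarith)).hasDerivWithinAt)
        (fun z hz => by
          simp only [mem_ofPred_eq] at hz
          have := hb z (by linarith)
          rwa [hz] at this) (by simp) (by simp)
      simpa using this
    have := hdiff.add hl
    simpa using this
  have hI : ∀ x t0 : ℝ, y0 ≤ t0 →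
      ∫ t in Ioi t0, f (x + t * I) * I = - (Q (x + t0 * I) - l) := by
    intro x t0 ht
    rw [integral_Ioi_of_hasDerivAt_of_tendsto' (fun t ht' => hd x t (le_trans ht ht')) (hintg x t0 ht) (hlx x)]
    ring
  refine ⟨fun z => Q z - l, fun z hz => (hQ z hz).sub_const l, hI, ?_⟩
  intro z hz
  have h1 := hI z.re z.im hz
  have h2 : (z.re : ℂ) + z.im * I = z := re_add_im z
  rw [h2] at h1
  have h3 : ‖Q z - l‖ = ‖∫ t in Ioi z.im, f (z.re + t * I) * I‖ := by rw [h1, norm_neg]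
  rw [h3]
  have h4 : ‖∫ t in Ioi z.im, f (z.re + t * I) * I‖ ≤ ∫ t in Ioi z.im, C * Real.exp (-κ * t) := by
    refine norm_integral_le_of_norm_le ((exp_neg_integrableOn_Ioi z.im hκ).const_mul C) ?_
    refine (ae_restrict_iff' measurableSet_Ioi).2 (ae_of_all _ fun t ht' => ?_)
    have h2 : z.im < t := ht'
    have := hb (z.re + t * I) (by simp; linarith)
    simpa using this
  refine h4.trans (le_of_eq ?_)
  rw [integral_const_mul, integral_exp_mul_Ioi (by linarith)]
  field_simp

end I24
end A1

section A2
namespace I24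
open Complex Filter Topology MeasureTheory Set
open scoped FourierTransform

abbrev E24 := EuclideanSpace ℝ (Fin 24)

/-- The exponential `exp (π i z u)`. -/
def gs (z : ℂ) (u : ℝ) : ℂ := cexp (Real.pi * I * z * u)

theorem norm_gs (z : ℂ) (u : ℝ) : ‖gs z u‖ = Real.exp (-Real.pi * z.im * u) := by
  rw [gs, norm_exp]; congr 1; simp

theorem norm_gs_le {z : ℂ} {u : ℝ} (hz : 0 ≤ z.im) (hu : 0 ≤ u) : ‖gs z u‖ ≤ 1 := by
  rw [norm_gs]
  apply Real.exp_le_one_iff.2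
  have := mul_nonneg (mul_nonneg Real.pi_pos.le hz) hu
  linarith

theorem gs_add (z w : ℂ) (u : ℝ) : gs (z + w) u = gs z u * gs w u := by
  rw [gs, gs, gs, ← Complex.exp_add]; congr 1; ring

theorem continuous_gs : Continuous (fun p : ℂ × ℝ => gs p.1 p.2) := by
  unfold gs; fun_prop

theorem hasDerivAt_gs_u (z : ℂ) (u : ℝ) :
    HasDerivAt (fun v : ℝ => gs z v) (Real.pi * I * z * gs z u) u := by
  have h : HasDerivAt (fun v : ℂ => cexp (Real.pi * I * z * v)) (cexp (Real.pi * I * z * u) * (Real.pi * I * z)) (u : ℂ) := by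
    have := ((hasDerivAt_id (u : ℂ)).const_mul (Real.pi * I * z)).cexp
    simpa using this
  have h2 := h.comp_ofReal
  unfold gs
  refine h2.congr_deriv (by ring)

theorem hasDerivAt_gs_z (z : ℂ) (u : ℝ) :
    HasDerivAt (fun w : ℂ => gs w u) (Real.pi * I * u * gs z u) z := by
  unfold gs
  have := (((hasDerivAt_id z).const_mul (Real.pi * I)).mul_const (u : ℂ)).cexp
  refine this.congr_deriv ?_
  simp; ring

/-- Fourier transform of the complex Gaussian in dimension 24. -/
theorem fourier_gs {z : ℂ} (hz : 0 < z.im) (y : E24) :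
    𝓕 (fun x : E24 => gs z (‖x‖ ^ 2)) y = (z ^ 12)⁻¹ * gs (-1 / z) (‖y‖ ^ 2) := by
  have hz0 : z ≠ 0 := by rintro rfl; simp at hz
  have hb : 0 < (-(Real.pi * I * z)).re := by
    simp; positivity
  have h := fourier_gaussian_innerProductSpace (V := E24) hb y
  have e1 : (fun x : E24 => gs z (‖x‖ ^ 2)) = fun v : E24 => cexp (- -(Real.pi * I * z) * ‖v‖ ^ 2) := by
    ext x; simp [gs]
  have hpi : (Real.pi : ℂ) ≠ 0 := by exact_mod_cast Real.pi_ne_zero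
  rw [e1, h]
  congr 1
  · have e2 : (Module.finrank ℝ E24 / 2 : ℂ) = ((12 : ℕ) : ℂ) := by simp; norm_num
    rw [e2, cpow_natCast]
    have e3 : (Real.pi : ℂ) / -(Real.pi * I * z) = I / z := by
      field_simp; simp
    rw [e3, div_pow]
    have : I ^ 12 = 1 := by
      rw [show 12 = 4 * 3 from rfl, pow_mul, I_pow_four]; simp
    rw [this, one_div]
  · unfold gs
    congr 1
    push_cast
    field_simp; simp

theorem integrable_gs {z : ℂ} (hz : 0 < z.im) : Integrable (fun x : E24 => gs z (‖x‖ ^ 2)) := by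
  have hb : 0 < (-(Real.pi * I * z)).re := by
    simp; positivity
  have := GaussianFourier.integrable_cexp_neg_mul_sq_norm_add (V := E24) hb 0 0
  refine this.congr (ae_of_all _ fun x => ?_)
  simp [gs]

theorem integral_norm_gs {z : ℂ} (hz : 0 < z.im) :
    ∫ x : E24, ‖gs z (‖x‖ ^ 2)‖ = (z.im ^ 12)⁻¹ := by
  have h := GaussianFourier.integral_rexp_neg_mul_sq_norm (V := E24) (b := Real.pi * z.im) (by positivity)
  simp_rw [norm_gs]
  have e1 : ∀ x : E24, -Real.pi * z.im * ‖x‖ ^ 2 = -(Real.pi * z.im) * ‖x‖ ^ 2 := fun x => by ring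
  simp_rw [e1]
  rw [h]
  have e2 : (Module.finrank ℝ E24 / 2 : ℝ) = ((12 : ℕ) : ℝ) := by simp; norm_num
  rw [e2, Real.rpow_natCast]
  have e3 : Real.pi / (Real.pi * z.im) = (z.im)⁻¹ := by
    have := Real.pi_ne_zero; field_simp
  rw [e3, inv_pow]

/-- Fourier transform of a superposition of Gaussians. -/
theorem FT_super {μ : Measure ℝ} [SFinite μ] {m z : ℝ → ℂ} (hm : AEStronglyMeasurable m μ)
    (hz : AEStronglyMeasurable z μ) (hpos : ∀ᵐ t ∂μ, 0 < (z t).im)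
    (hintg : Integrable (fun t => ‖m t‖ * ((z t).im ^ 12)⁻¹) μ)
    (f : SchwartzMap E24 ℂ) (hf : ∀ x, f x = ∫ t, m t * gs (z t) (‖x‖ ^ 2) ∂μ) (y : E24) :
    FT f y = ∫ t, m t * ((z t) ^ 12)⁻¹ * gs (-1 / z t) (‖y‖ ^ 2) ∂μ := by
  have h1 : FT f y = ∫ x : E24, 𝐞 (-inner ℝ x y) • f x := by
    unfold FT
    rw [SchwartzMap.fourierTransformCLM_apply, SchwartzMap.fourier_coe, Real.fourier_eq]
  rw [h1]
  have h2 : ∀ x : E24, 𝐞 (-inner ℝ x y) • f x =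
      ∫ t, 𝐞 (-inner ℝ x y) • (m t * gs (z t) (‖x‖ ^ 2)) ∂μ := by
    intro x
    simp only [hf x, Circle.smul_def, integral_smul]
  simp_rw [h2]
  have hmeas : AEStronglyMeasurable (fun p : E24 × ℝ => 𝐞 (-inner ℝ p.1 y) • (m p.2 * gs (z p.2) (‖p.1‖ ^ 2)))
      ((volume : Measure E24).prod μ) := by
    have hc : Continuous fun x : E24 => ((𝐞 (-inner ℝ x y) : Circle) : ℂ) := by
      have h := Real.continuous_fourierChar
      exact continuous_subtype_val.comp (h.comp (by fun_prop))
    have e : (fun p : E24 × ℝ => 𝐞 (-inner ℝ p.1 y) • (m p.2 * gs (z p.2) (‖p.1‖ ^ 2))) =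
      fun p : E24 × ℝ => ((𝐞 (-inner ℝ p.1 y) : Circle) : ℂ) * (m p.2 * gs (z p.2) (‖p.1‖ ^ 2)) := by
      ext p; rw [Circle.smul_def, smul_eq_mul]
    rw [e]
    refine (hc.comp continuous_fst).aestronglyMeasurable.mul (hm.comp_snd.mul ?_)
    have : AEStronglyMeasurable (fun p : E24 × ℝ => ((z p.2, ‖p.1‖ ^ 2) : ℂ × ℝ))
        ((volume : Measure E24).prod μ) := by
      refine hz.comp_snd.prodMk ?_
      exact (by fun_prop : Continuous fun p : E24 × ℝ => ‖p.1‖ ^ 2).aestronglyMeasurable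
    exact continuous_gs.comp_aestronglyMeasurable this
  rw [integral_integral_swap]
  · refine integral_congr_ae ?_
    filter_upwards [hpos] with t ht
    have := fourier_gs ht y
    rw [Real.fourier_eq] at this
    rw [mul_assoc, ← this, ← integral_const_mul]
    refine integral_congr_ae (ae_of_all _ fun x => ?_)
    simp only [Circle.smul_def, smul_eq_mul]; ring
  · refine (integrable_prod_iff' hmeas).2 ⟨?_, ?_⟩
    · filter_upwards [hpos] with t ht
      have h3 := ((integrable_gs ht).const_mul (m t))
      refine (Real.fourierIntegral_convergent_iff y).2 h3
    · refine hintg.congr ?_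
      filter_upwards [hpos] with t ht
      rw [← integral_norm_gs ht, ← integral_const_mul]
      simp

/-- Differentiating a superposition of exponentials. -/
theorem hasDerivAt_super {μ : Measure ℝ} {m z : ℝ → ℂ} (hm : AEStronglyMeasurable m μ)
    (hz : AEStronglyMeasurable z μ) {b : ℝ → ℝ} {u : ℝ} {s : Set ℝ} (hs : s ∈ 𝓝 u)
    (hb : ∀ᵐ t ∂μ, ∀ v ∈ s, ‖m t‖ * ‖gs (z t) v‖ ≤ b t)
    (hi : Integrable b μ) (hi' : Integrable (fun t => ‖z t‖ * b t) μ) :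
    HasDerivAt (fun v => ∫ t, m t * gs (z t) v ∂μ)
      (∫ t, (Real.pi * I * z t * m t) * gs (z t) u ∂μ) u := by
  have hg : ∀ v : ℝ, AEStronglyMeasurable (fun t => gs (z t) v) μ := fun v =>
    continuous_gs.comp_aestronglyMeasurable (hz.prodMk aestronglyMeasurable_const)
  have hu : u ∈ s := mem_of_mem_nhds hs
  refine (hasDerivAt_integral_of_dominated_loc_of_deriv_le (F := fun v t => m t * gs (z t) v)
    (F' := fun v t => (Real.pi * I * z t * m t) * gs (z t) v)
    (bound := fun t => Real.pi * (‖z t‖ * b t)) hs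
    (Eventually.of_forall fun v => hm.mul (hg v)) ?_ ?_ ?_ (hi'.const_mul _) ?_).2
  · refine hi.mono' (hm.mul (hg u)) ?_
    filter_upwards [hb] with t ht
    rw [norm_mul]; exact ht u hu
  · exact ((hz.const_mul _).mul hm).mul (hg u)
  · filter_upwards [hb] with t ht v hv
    have := ht v hv
    rw [norm_mul, norm_mul, norm_mul, norm_mul, norm_I, norm_real, Real.norm_of_nonneg Real.pi_pos.le, mul_one]
    have h3 : Real.pi * ‖z t‖ * ‖m t‖ * ‖gs (z t) v‖ = Real.pi * (‖z t‖ * (‖m t‖ * ‖gs (z t) v‖)) := by ring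
    rw [h3]
    gcongr
  · refine ae_of_all _ fun t v hv => ?_
    exact ((hasDerivAt_gs_u (z t) v).const_mul (m t)).congr_deriv (by ring)

theorem norm_e₁ : ‖e₁‖ = 1 := by simp [e₁]

theorem radVal_of {f : SchwartzMap E24 ℂ} {G : ℝ → ℂ} (h : ∀ x, f x = G (‖x‖ ^ 2)) (r : ℝ) :
    radVal f r = G (r ^ 2) := by
  rw [radVal, h, norm_smul, norm_e₁]; simp

theorem radDeriv_of {f : SchwartzMap E24 ℂ} {G : ℝ → ℂ} (h : ∀ x, f x = G (‖x‖ ^ 2)) {r : ℝ} {g : ℂ}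
    (hG : HasDerivAt G g (r ^ 2)) : radDeriv f r = 2 * r * g := by
  have e : (fun t : ℝ => f (t • e₁)) = fun t => G (t ^ 2) := by
    ext t; rw [h, norm_smul, norm_e₁]; simp
  rw [radDeriv, e]
  have h1 : HasDerivAt (fun t : ℝ => t ^ 2) (2 * r) r := by simpa using hasDerivAt_pow 2 r
  have h2 := HasDerivAt.scomp (h := fun t : ℝ => t ^ 2) r hG h1
  have h3 := h2.deriv
  simp only [Function.comp_def] at h3
  rw [h3]; simp

theorem isRadial_of {f : SchwartzMap E24 ℂ} {G : ℝ → ℂ} (h : ∀ x, f x = G (‖x‖ ^ 2)) : IsRadial f := by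
  intro x y hxy; rw [h, h, hxy]

end I24
end A2

section A3
namespace I24
open Complex Filter Topology MeasureTheory Set
open scoped ContDiff

theorem integrableOn_poly_exp (N : ℕ) {c : ℝ} (hc : 0 < c) (t0 : ℝ) :
    IntegrableOn (fun t : ℝ => (1 + t) ^ N * Real.exp (-c * t)) (Ioi t0) := by
  apply integrable_of_isBigO_exp_neg (b := c / 2) (by positivity)
  · fun_prop
  · have h := (isLittleO_pow_exp_pos_mul_atTop N (b := c / 2) (by positivity)).isBigO
    have h2 : (fun t : ℝ => (1 + t) ^ N) =O[atTop] (fun t : ℝ => t ^ N) := by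
      apply Asymptotics.IsBigO.pow
      apply Asymptotics.IsBigO.of_bound 2
      filter_upwards [eventually_ge_atTop 1] with t ht
      rw [Real.norm_of_nonneg (by linarith), Real.norm_of_nonneg (by linarith)]; linarith
    have h3 := (h2.trans h).mul (Asymptotics.isBigO_refl (fun t : ℝ => Real.exp (-c * t)) atTop)
    refine h3.congr_right ?_
    intro t
    rw [← Real.exp_add]; congr 1; ring

/-- a family of functions closed under derivatives with rapid decay consists of Schwartz functions -/
theorem schwartz_of_class (K : (ℝ → ℂ) → Prop) (hd : ∀ f, K f → Differentiable ℝ f)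
    (hK : ∀ f, K f → K (deriv f)) (hb : ∀ f, K f → ∀ k : ℕ, ∃ C : ℝ, ∀ x : ℝ, |x| ^ k * ‖f x‖ ≤ C)
    (f : ℝ → ℂ) (hf : K f) : ∃ g : SchwartzMap ℝ ℂ, ∀ x, g x = f x := by
  have hit : ∀ n : ℕ, K (iteratedDeriv n f) := by
    intro n
    induction n with
    | zero => simpa using hf
    | succ n ih => rw [iteratedDeriv_succ]; exact hK _ ih
  refine ⟨⟨f, ?_, ?_⟩, fun x => rfl⟩
  · apply contDiff_of_differentiable_iteratedDeriv (n := (⊤ : ℕ∞))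
    intro m _
    exact hd _ (hit m)
  · intro k n
    obtain ⟨C, hC⟩ := hb _ (hit n) k
    refine ⟨C, fun x => ?_⟩
    rw [norm_iteratedFDeriv_eq_norm_iteratedDeriv]
    exact hC x

/-- admissible weights -/
def Wt (t0 : ℝ) (m : ℝ → ℂ) : Prop :=
  AEStronglyMeasurable m (volume.restrict (Ioi t0)) ∧
    ∃ (C : ℝ) (N : ℕ), 0 ≤ C ∧ ∀ t, t0 < t → ‖m t‖ ≤ C * (1 + t) ^ N * Real.exp (-Real.pi * t)

/-- admissible paths -/
structure GPath (t0 : ℝ) (z : ℝ → ℂ) (A : ℝ) : Prop where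
  t00 : 0 ≤ t0
  A0 : 0 ≤ A
  meas : AEStronglyMeasurable z (volume.restrict (Ioi t0))
  norm : ∀ t, t0 < t → ‖z t‖ ≤ A * (1 + t)
  im : ∀ t, t0 < t → 0 < (z t).im
  inv : ∀ t, t0 < t → (z t).im⁻¹ ≤ A * (1 + t)
  le : ∀ t, t0 < t → (z t).im ≤ t + A

theorem Wt.mul {t0 A : ℝ} {z m : ℝ → ℂ} (hz : GPath t0 z A) (hm : Wt t0 m) :
    Wt t0 (fun t => Real.pi * I * z t * m t) := by
  obtain ⟨h1, C, N, hC, h2⟩ := hm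
  refine ⟨((aestronglyMeasurable_const.mul hz.meas).mul h1), Real.pi * A * C, N + 1,
    by have := Real.pi_pos; have := hz.A0; positivity, fun t ht => ?_⟩
  have ht0 : 0 ≤ t := hz.t00.trans ht.le
  rw [norm_mul, norm_mul, norm_mul, Complex.norm_I, Complex.norm_real,
    Real.norm_of_nonneg Real.pi_pos.le, mul_one]
  calc Real.pi * ‖z t‖ * ‖m t‖ ≤ Real.pi * (A * (1 + t)) * (C * (1 + t) ^ N * Real.exp (-Real.pi * t)) := by
        have := Real.pi_pos; have := hz.A0
        gcongr
        · exact hz.norm t ht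
        · exact h2 t ht
    _ = _ := by ring

theorem Wt.bound {t0 A : ℝ} {z m : ℝ → ℂ} (hz : GPath t0 z A) (hm : Wt t0 m) :
    ∃ b : ℝ → ℝ, IntegrableOn b (Ioi t0) ∧ IntegrableOn (fun t => ‖z t‖ * b t) (Ioi t0) ∧
      (∀ t, t0 < t → ∀ v ∈ Ioi (-3/4 : ℝ), ‖m t‖ * ‖gs (z t) v‖ ≤ b t) := by
  obtain ⟨h1, C, N, hC, h2⟩ := hm
  have hpi := Real.pi_pos
  let B := C * Real.exp (3 / 4 * Real.pi * A)
  let b : ℝ → ℝ := fun t => B * ((1 + t) ^ N * Real.exp (-(Real.pi / 4) * t))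
  have hB : 0 ≤ B := by positivity
  refine ⟨b, (integrableOn_poly_exp N (by positivity) t0).const_mul _, ?_, ?_⟩
  · have h3 : IntegrableOn (fun t => A * B * ((1 + t) ^ (N + 1) * Real.exp (-(Real.pi / 4) * t))) (Ioi t0) :=
      (integrableOn_poly_exp (N + 1) (by positivity) t0).const_mul _
    refine h3.mono' (hz.meas.norm.mul (by fun_prop)) ?_
    rw [ae_restrict_iff' measurableSet_Ioi]
    refine ae_of_all _ fun t ht => ?_
    have ht0 : 0 ≤ t := hz.t00.trans (le_of_lt ht)
    have hb : 0 ≤ b t := by positivity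
    rw [norm_mul, norm_norm, Real.norm_of_nonneg hb]
    calc ‖z t‖ * b t ≤ (A * (1 + t)) * b t := by gcongr; exact hz.norm t ht
      _ = _ := by simp only [b]; ring
  · intro t ht v hv
    have ht0 : 0 ≤ t := hz.t00.trans (le_of_lt ht)
    rw [norm_gs]
    have h4 : -Real.pi * (z t).im * v ≤ 3 / 4 * Real.pi * (t + A) := by
      have a1 := hz.im t ht
      have a2 := hz.le t ht
      have a3 : -v ≤ 3/4 := by have : -3/4 < v := hv; linarith
      calc -Real.pi * (z t).im * v = Real.pi * (z t).im * (-v) := by ring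
        _ ≤ Real.pi * (z t).im * (3/4) := by gcongr
        _ ≤ Real.pi * (t + A) * (3/4) := by gcongr
        _ = _ := by ring
    calc ‖m t‖ * Real.exp (-Real.pi * (z t).im * v) ≤
        (C * (1 + t) ^ N * Real.exp (-Real.pi * t)) * Real.exp (3 / 4 * Real.pi * (t + A)) := by
          gcongr; exact h2 t ht
      _ = C * (1 + t) ^ N * Real.exp (-Real.pi * t + 3 / 4 * Real.pi * (t + A)) := by
          rw [Real.exp_add]; ring
      _ = C * (1 + t) ^ N * Real.exp (3 / 4 * Real.pi * A + -(Real.pi / 4) * t) := by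
          congr 2; ring
      _ = _ := by rw [Real.exp_add]; simp only [b, B]; ring

theorem Wt.hasDerivAt {t0 A : ℝ} {z m : ℝ → ℂ} (hz : GPath t0 z A) (hm : Wt t0 m) {u : ℝ} (hu : -3/4 < u) :
    HasDerivAt (fun v => ∫ t in Ioi t0, m t * gs (z t) v)
      (∫ t in Ioi t0, (Real.pi * I * z t * m t) * gs (z t) u) u := by
  obtain ⟨b, h1, h2, h3⟩ := hm.bound hz
  refine hasDerivAt_super hm.1 hz.meas (Ioi_mem_nhds hu) ?_ h1 h2
  rw [ae_restrict_iff' measurableSet_Ioi]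
  exact ae_of_all _ h3

theorem Wt.integrable {t0 A : ℝ} {z m : ℝ → ℂ} (hz : GPath t0 z A) (hm : Wt t0 m) {u : ℝ} (hu : -3/4 < u) :
    IntegrableOn (fun t => m t * gs (z t) u) (Ioi t0) := by
  obtain ⟨b, h1, h2, h3⟩ := hm.bound hz
  refine h1.mono' (hm.1.mul ?_) ?_
  · exact (continuous_gs.comp (continuous_id.prodMk continuous_const)).comp_aestronglyMeasurable hz.meas
  rw [ae_restrict_iff' measurableSet_Ioi]
  refine ae_of_all _ fun t ht => ?_
  rw [norm_mul]; exact h3 t ht u hu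

theorem pow_mul_exp_le (k : ℕ) {c u : ℝ} (hc : 0 < c) (hu : 0 ≤ u) :
    u ^ k * Real.exp (-c * u) ≤ k.factorial * (c⁻¹) ^ k := by
  have h := Real.pow_div_factorial_le_exp (c * u) (by positivity) k
  have h1 : (c * u) ^ k ≤ Real.exp (c * u) * k.factorial := by
    rwa [div_le_iff₀ (by positivity)] at h
  have h2 : u ^ k = (c⁻¹) ^ k * (c * u) ^ k := by
    rw [← mul_pow]; congr 1; field_simp
  rw [h2]
  calc c⁻¹ ^ k * (c * u) ^ k * Real.exp (-c * u) ≤ c⁻¹ ^ k * (Real.exp (c * u) * k.factorial) * Real.exp (-c * u) := by gcongr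
    _ = k.factorial * c⁻¹ ^ k * (Real.exp (c * u) * Real.exp (-c * u)) := by ring
    _ = _ := by rw [← Real.exp_add]; simp

theorem Wt.decay {t0 A : ℝ} {z m : ℝ → ℂ} (hz : GPath t0 z A) (hm : Wt t0 m) (k : ℕ) :
    ∃ C : ℝ, ∀ u : ℝ, -1/2 ≤ u → |u| ^ k * ‖∫ t in Ioi t0, m t * gs (z t) u‖ ≤ C := by
  obtain ⟨b, h1, h2, h3⟩ := hm.bound hz
  obtain ⟨hm1, C, N, hC, hm2⟩ := hm
  have hpi := Real.pi_pos
  have hA := hz.A0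
  have h5 : IntegrableOn (fun t => C * A ^ k * k.factorial * Real.pi⁻¹ ^ k *
      ((1 + t) ^ (N + k) * Real.exp (-Real.pi * t))) (Ioi t0) :=
    (integrableOn_poly_exp (N + k) hpi t0).const_mul _
  refine ⟨(∫ t in Ioi t0, b t) + ∫ t in Ioi t0, C * A ^ k * k.factorial * Real.pi⁻¹ ^ k *
      ((1 + t) ^ (N + k) * Real.exp (-Real.pi * t)), fun u hu => ?_⟩
  rw [← integral_add h1 h5]
  have e1 : |u| ^ k * ‖∫ t in Ioi t0, m t * gs (z t) u‖ =
      ‖∫ t in Ioi t0, ((|u| ^ k : ℝ) : ℂ) * (m t * gs (z t) u)‖ := by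
    rw [integral_const_mul, norm_mul, Complex.norm_real, Real.norm_of_nonneg (by positivity)]
  rw [e1]
  refine norm_integral_le_of_norm_le (h1.add h5) ?_
  rw [ae_restrict_iff' measurableSet_Ioi]
  refine ae_of_all _ fun t ht => ?_
  have ht' : t0 < t := ht
  have ht0 : 0 ≤ t := hz.t00.trans (le_of_lt ht)
  have hbu := h3 t ht u (by simp; linarith)
  have hb0 : 0 ≤ b t := le_trans (by positivity) hbu
  rw [norm_mul, norm_mul, Complex.norm_real, Real.norm_of_nonneg (by positivity)]
  rcases le_total u 0 with h | h
  · have : |u| ^ k ≤ 1 := pow_le_one₀ (abs_nonneg _) (by rw [abs_of_nonpos h]; linarith)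
    calc |u| ^ k * (‖m t‖ * ‖gs (z t) u‖) ≤ 1 * b t := by gcongr
      _ ≤ _ := by rw [one_mul]; linarith [show 0 ≤ C * A ^ k * k.factorial * Real.pi⁻¹ ^ k *
      ((1 + t) ^ (N + k) * Real.exp (-Real.pi * t)) by positivity]
  · rw [norm_gs, abs_of_nonneg h]
    have q := pow_mul_exp_le k (c := Real.pi * (z t).im) (by have := hz.im t ht'; positivity) h
    have q2 : (Real.pi * (z t).im)⁻¹ ≤ Real.pi⁻¹ * (A * (1 + t)) := by
      rw [mul_inv]; have := hz.inv t ht'; gcongr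
    have q3 : 0 ≤ (Real.pi * (z t).im)⁻¹ := by have := hz.im t ht'; positivity
    calc u ^ k * (‖m t‖ * Real.exp (-Real.pi * (z t).im * u))
        = ‖m t‖ * (u ^ k * Real.exp (-(Real.pi * (z t).im) * u)) := by
          rw [show -Real.pi * (z t).im * u = -(Real.pi * (z t).im) * u by ring]; ring
      _ ≤ (C * (1 + t) ^ N * Real.exp (-Real.pi * t)) * (k.factorial * (Real.pi⁻¹ * (A * (1 + t))) ^ k) := by
          exact mul_le_mul (hm2 t ht') (q.trans (by gcongr)) (by positivity) (by positivity)
      _ = C * A ^ k * k.factorial * Real.pi⁻¹ ^ k *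
      ((1 + t) ^ (N + k) * Real.exp (-Real.pi * t)) := by rw [mul_pow, mul_pow]; ring
      _ ≤ _ := by linarith

/-- admissible cutoffs -/
structure Cut (χ : ℝ → ℂ) : Prop where
  smooth : ContDiff ℝ ∞ χ
  zero : ∀ u, u < -1/2 → χ u = 0
  const : ∃ c, ∀ u, 0 < u → χ u = c

theorem Cut.deriv {χ : ℝ → ℂ} (h : Cut χ) : Cut (deriv χ) := by
  refine ⟨?_, ?_, 0, ?_⟩
  · exact (contDiff_infty_iff_deriv.1 h.smooth).2
  · intro u hu
    have : χ =ᶠ[𝓝 u] fun _ => 0 := by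
      filter_upwards [Iio_mem_nhds hu] with v hv using h.zero v hv
    rw [this.deriv_eq]; simp
  · obtain ⟨c, hc⟩ := h.const
    intro u hu
    have : χ =ᶠ[𝓝 u] fun _ => c := by
      filter_upwards [Ioi_mem_nhds hu] with v hv using hc v hv
    rw [this.deriv_eq]; simp

theorem Cut.bdd {χ : ℝ → ℂ} (h : Cut χ) : ∃ C, ∀ u, ‖χ u‖ ≤ C := by
  obtain ⟨c, hc⟩ := h.const
  obtain ⟨C, hC⟩ := (isCompact_Icc (a := (-1/2 : ℝ)) (b := 0)).exists_bound_of_continuousOn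
    h.smooth.continuous.continuousOn
  refine ⟨max C ‖c‖, fun u => ?_⟩
  rcases lt_or_ge u (-1/2) with h1 | h1
  · rw [h.zero u h1]; simp
  rcases lt_or_ge 0 u with h2 | h2
  · rw [hc u h2]; exact le_max_right _ _
  · exact (hC u ⟨h1, h2⟩).trans (le_max_left _ _)

/-- the class of functions generated -/
inductive KC (t0 : ℝ) (z : ℝ → ℂ) : (ℝ → ℂ) → Prop
  | base (χ m : ℝ → ℂ) (hχ : Cut χ) (hm : Wt t0 m) : KC t0 z (fun u => χ u * ∫ t in Ioi t0, m t * gs (z t) u)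
  | add (f g : ℝ → ℂ) (hf : KC t0 z f) (hg : KC t0 z g) : KC t0 z (fun u => f u + g u)

theorem KC.hd {t0 A : ℝ} {z χ m : ℝ → ℂ} (hz : GPath t0 z A) (hχ : Cut χ) (hm : Wt t0 m) (u : ℝ) :
    HasDerivAt (fun u => χ u * ∫ t in Ioi t0, m t * gs (z t) u)
      ((deriv χ u * ∫ t in Ioi t0, m t * gs (z t) u) +
        χ u * ∫ t in Ioi t0, (Real.pi * I * z t * m t) * gs (z t) u) u := by
  rcases lt_or_ge u (-1/2) with h | h
  · rw [hχ.deriv.zero u h, hχ.zero u h]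
    have : (fun u => χ u * ∫ t in Ioi t0, m t * gs (z t) u) =ᶠ[𝓝 u] fun _ => 0 := by
      filter_upwards [Iio_mem_nhds h] with v hv
      rw [hχ.zero v hv, zero_mul]
    refine HasDerivAt.congr_of_eventuallyEq ?_ this
    simpa using hasDerivAt_const u (0:ℂ)
  · exact ((hχ.smooth.differentiable (by simp)) u).hasDerivAt.mul (hm.hasDerivAt hz (by linarith))

theorem KC.schwartz {t0 A : ℝ} {z f : ℝ → ℂ} (hz : GPath t0 z A) (hf : KC t0 z f) :
    ∃ g : SchwartzMap ℝ ℂ, ∀ x, g x = f x := by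
  have hD : ∀ f, KC t0 z f → Differentiable ℝ f := by
    intro f hf
    induction hf with
    | base χ m hχ hm => exact fun u => (KC.hd hz hχ hm u).differentiableAt
    | add f g hf hg h1 h2 => exact h1.add h2
  apply schwartz_of_class (KC t0 z) hD _ _ f hf
  · intro f hf
    induction hf with
    | base χ m hχ hm =>
      have : deriv (fun u => χ u * ∫ t in Ioi t0, m t * gs (z t) u) = fun u =>
        ((deriv χ u * ∫ t in Ioi t0, m t * gs (z t) u) +
        χ u * ∫ t in Ioi t0, (Real.pi * I * z t * m t) * gs (z t) u) := by
        ext u; exact (KC.hd hz hχ hm u).deriv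
      rw [this]
      exact KC.add _ _ (KC.base _ _ hχ.deriv hm) (KC.base _ _ hχ (hm.mul hz))
    | add f g hf hg h1 h2 =>
      have : deriv (fun u => f u + g u) = fun u => deriv f u + deriv g u := by
        ext u; exact deriv_add (hD f hf u) (hD g hg u)
      rw [this]; exact KC.add _ _ h1 h2
  · intro f hf k
    induction hf with
    | base χ m hχ hm =>
      obtain ⟨C, hC⟩ := hχ.bdd
      obtain ⟨D, hD⟩ := hm.decay hz k
      have hC0 : 0 ≤ C := (norm_nonneg _).trans (hC 0)
      have hD0 : 0 ≤ D := le_trans (by positivity) (hD 0 (by norm_num))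
      refine ⟨C * D, fun u => ?_⟩
      rcases lt_or_ge u (-1/2) with h | h
      · simp only [hχ.zero u h]; simp; positivity
      · rw [norm_mul]
        calc |u| ^ k * (‖χ u‖ * _) = ‖χ u‖ * (|u| ^ k * ‖∫ t in Ioi t0, m t * gs (z t) u‖) := by ring
          _ ≤ C * D := by gcongr; exacts [hC u, hD u h]
    | add f g hf hg h1 h2 =>
      obtain ⟨C, hC⟩ := h1
      obtain ⟨D, hD⟩ := h2
      refine ⟨C + D, fun u => ?_⟩
      calc |u| ^ k * ‖f u + g u‖ ≤ |u| ^ k * (‖f u‖ + ‖g u‖) := by gcongr; exact norm_add_le _ _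
        _ = |u| ^ k * ‖f u‖ + |u| ^ k * ‖g u‖ := by ring
        _ ≤ _ := add_le_add (hC u) (hD u)

theorem exists_cut : ∃ χ : ℝ → ℂ, Cut χ ∧ ∀ u, 0 ≤ u → χ u = 1 := by
  refine ⟨fun u => (Real.smoothTransition (2 * u + 1) : ℝ), ⟨?_, ?_, 1, ?_⟩, ?_⟩
  · have h : ContDiff ℝ ∞ (fun u : ℝ => Real.smoothTransition (2 * u + 1)) :=
      Real.smoothTransition.contDiff.comp (by fun_prop)
    exact Complex.ofRealCLM.contDiff.comp h
  · intro u hu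
    rw [Real.smoothTransition.zero_of_nonpos (by linarith)]; simp
  · intro u hu
    rw [Real.smoothTransition.one_of_one_le (by linarith)]; simp
  · intro u hu
    simp only [Real.smoothTransition.one_of_one_le (show 1 ≤ 2 * u + 1 by linarith)]; simp

/-- compose a one-variable Schwartz function with the squared norm -/
theorem schwartz_normSq (g : SchwartzMap ℝ ℂ) : ∃ f : SchwartzMap E24 ℂ, ∀ x, f x = g (‖x‖ ^ 2) := by
  refine ⟨SchwartzMap.compCLM ℂ (g := fun x : E24 => ‖x‖ ^ 2) (Function.hasTemperateGrowth_norm_sq E24) ⟨1, 1, ?_⟩ g, fun x => rfl⟩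
  intro x
  rw [Real.norm_of_nonneg (by positivity)]
  nlinarith [sq_nonneg (‖x‖ - 1), norm_nonneg x]

theorem Wt.schwartz {t0 A : ℝ} {z m : ℝ → ℂ} (hz : GPath t0 z A) (hm : Wt t0 m) :
    ∃ f : SchwartzMap E24 ℂ, ∀ x, f x = ∫ t in Ioi t0, m t * gs (z t) (‖x‖ ^ 2) := by
  obtain ⟨χ, hχ, h1⟩ := exists_cut
  obtain ⟨g, hg⟩ := KC.schwartz hz (KC.base χ m hχ hm)
  obtain ⟨f, hf⟩ := schwartz_normSq g
  refine ⟨f, fun x => ?_⟩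
  rw [hf, hg, h1 _ (by positivity), one_mul]

theorem Wt.integrable_inv {t0 A : ℝ} {z m : ℝ → ℂ} (hz : GPath t0 z A) (hm : Wt t0 m) (k : ℕ) :
    IntegrableOn (fun t => ‖m t‖ * ((z t).im ^ k)⁻¹) (Ioi t0) := by
  obtain ⟨hm1, C, N, hC, hm2⟩ := hm
  have hA := hz.A0
  have h5 : IntegrableOn (fun t => C * A ^ k * 
      ((1 + t) ^ (N + k) * Real.exp (-Real.pi * t))) (Ioi t0) :=
    (integrableOn_poly_exp (N + k) Real.pi_pos t0).const_mul _
  refine h5.mono' (hm1.norm.mul ?_) ?_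
  · have : AEMeasurable (fun t => ((z t).im ^ k)⁻¹) (volume.restrict (Ioi t0)) :=
      ((Complex.measurable_im.comp_aemeasurable hz.meas.aemeasurable).pow_const k).inv
    exact this.aestronglyMeasurable
  rw [ae_restrict_iff' measurableSet_Ioi]
  refine ae_of_all _ fun t ht => ?_
  have ht' : t0 < t := ht
  have ht0 : 0 ≤ t := hz.t00.trans (le_of_lt ht)
  have := hz.im t ht'
  rw [Real.norm_of_nonneg (by positivity), ← inv_pow]
  calc ‖m t‖ * (z t).im⁻¹ ^ k ≤ (C * (1 + t) ^ N * Real.exp (-Real.pi * t)) * (A * (1 + t)) ^ k := by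
        gcongr; exacts [hm2 t ht', hz.inv t ht']
    _ = _ := by rw [mul_pow]; ring

end I24
end A3

section D1
namespace I24
open Complex Filter Topology MeasureTheory Set

theorem gpathA {a b t0 : ℝ} (ha : |a| ≤ 1/2) (hb : |b| ≤ 1) (ht0 : 1/2 ≤ t0) :
    GPath t0 (fun t : ℝ => (b : ℂ) - 1 / ((a : ℂ) + t * I)) 3 := by
  have him : ∀ t : ℝ, ((b : ℂ) - 1 / ((a : ℂ) + t * I)).im = t / (a ^ 2 + t ^ 2) := by
    intro t
    simp [Complex.normSq_apply, pow_two, neg_div]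
  have ha2 : a ^ 2 ≤ 1/4 := by
    have := sq_le_sq' (by linarith [neg_abs_le a, abs_nonneg a]) (abs_le.1 ha).2
    nlinarith
  refine ⟨by linarith, by norm_num, ?_, ?_, ?_, ?_, ?_⟩
  · exact (by fun_prop : Measurable (fun t : ℝ => (b : ℂ) - 1 / ((a : ℂ) + t * I))).aestronglyMeasurable
  · intro t ht
    have h0 : 1/2 < t := by linarith
    have h1 : t ≤ ‖(a : ℂ) + t * I‖ := by
      calc t ≤ |((a : ℂ) + t * I).im| := by simp; exact le_abs_self t
        _ ≤ _ := Complex.abs_im_le_norm _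
    calc ‖(b : ℂ) - 1 / ((a : ℂ) + t * I)‖ ≤ ‖(b : ℂ)‖ + ‖1 / ((a : ℂ) + t * I)‖ := norm_sub_le _ _
      _ ≤ 1 + 1 / t := by
        rw [norm_div, norm_one, Complex.norm_real, Real.norm_eq_abs]
        gcongr
      _ ≤ 1 + 2 := by
        gcongr; rw [div_le_iff₀ (by linarith)]; linarith
      _ ≤ _ := by linarith
  · intro t ht
    have h0 : 1/2 < t := by linarith
    rw [him]; positivity
  · intro t ht
    have h0 : 1/2 < t := by linarith
    rw [him, inv_div, div_le_iff₀ (by linarith)]; nlinarith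
  · intro t ht
    have h0 : 1/2 < t := by linarith
    rw [him, div_le_iff₀ (by positivity)]
    nlinarith [sq_nonneg a, sq_nonneg t]

theorem gpathI : GPath 1 (fun t : ℝ => (t : ℂ) * I) 1 := by
  refine ⟨by norm_num, by norm_num, ?_, ?_, ?_, ?_, ?_⟩
  · exact (by fun_prop : Measurable (fun t : ℝ => (t : ℂ) * I)).aestronglyMeasurable
  · intro t ht
    simp; rw [abs_of_pos (by linarith)]; linarith
  · intro t ht; simp; linarith
  · intro t ht; simp
    have : t⁻¹ ≤ 1 := inv_le_one_of_one_le₀ ht.le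
    linarith
  · intro t ht; simp

theorem norm_vert_ge (a t : ℝ) : |t| ≤ ‖(a : ℂ) + t * I‖ := by
  calc |t| = |((a : ℂ) + t * I).im| := by simp
    _ ≤ _ := Complex.abs_im_le_norm _

theorem measA {h : ℂ → ℂ} (hh : ContinuousOn h {z | 0 < z.im}) {a t0 : ℝ} (ht0 : 0 ≤ t0) :
    AEStronglyMeasurable (fun t : ℝ => h ((a : ℂ) + t * I)) (volume.restrict (Ioi t0)) := by
  apply ContinuousOn.aestronglyMeasurable _ measurableSet_Ioi
  refine hh.comp (by fun_prop) ?_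
  intro t ht
  have : t0 < t := ht
  simp; linarith

theorem wtA {h : ℂ → ℂ} (hh : ContinuousOn h {z | 0 < z.im}) {C : ℝ} (hC : 0 ≤ C)
    (hdec : ∀ w : ℂ, 1/2 ≤ w.im → ‖h w‖ ≤ C * Real.exp (-Real.pi * w.im))
    {a t0 : ℝ} (ht0 : 1/2 ≤ t0) :
    Wt t0 (fun t : ℝ => h ((a : ℂ) + t * I) * (((a : ℂ) + t * I) ^ 12)⁻¹ * I) := by
  refine ⟨((measA hh (by linarith)).mul ?_).mul_const I, C * 2 ^ 12, 0, by positivity, ?_⟩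
  · exact (by fun_prop : Measurable (fun t : ℝ => (((a : ℂ) + t * I) ^ 12)⁻¹)).aestronglyMeasurable
  · intro t ht
    have h0 : 1/2 < t := by linarith
    have h1 := hdec ((a : ℂ) + t * I) (by simp; linarith)
    have h2 := norm_vert_ge a t
    rw [abs_of_pos (by linarith)] at h2
    have h3 : ((‖(a : ℂ) + t * I‖) ^ 12)⁻¹ ≤ 2 ^ 12 := by
      rw [← inv_pow]
      have : ‖(a : ℂ) + t * I‖⁻¹ ≤ 2 := by
        rw [inv_le_comm₀ (by linarith) (by norm_num)]; linarith
      gcongr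
    rw [norm_mul, norm_mul, norm_inv, norm_pow, Complex.norm_I]
    have him : ((a : ℂ) + t * I).im = t := by simp
    rw [him] at h1
    calc ‖h ((a : ℂ) + t * I)‖ * ((‖(a : ℂ) + t * I‖) ^ 12)⁻¹ * 1 ≤
        (C * Real.exp (-Real.pi * t)) * 2 ^ 12 * 1 := by gcongr
      _ = _ := by ring

theorem wtI {h : ℂ → ℂ} (hh : ContinuousOn h {z | 0 < z.im}) {C : ℝ} (hC : 0 ≤ C)
    (hdec : ∀ w : ℂ, 1/2 ≤ w.im → ‖h w‖ ≤ C * Real.exp (-Real.pi * w.im)) :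
    Wt 1 (fun t : ℝ => h ((t : ℂ) * I) * I) := by
  have := measA hh (a := 0) (t0 := 1) (by norm_num)
  simp only [ofReal_zero, zero_add] at this
  refine ⟨this.mul_const I, C, 0, hC, ?_⟩
  intro t ht
  have h1 := hdec ((t : ℂ) * I) (by simp; linarith)
  simpa using h1

/-- functions with zero derivative on the upper half-plane are constant -/
theorem const_of_deriv_zero {S : ℂ → ℂ} (hS : ∀ z : ℂ, 0 < z.im → HasDerivAt S 0 z) {z w : ℂ}
    (hz : 0 < z.im) (hw : 0 < w.im) : S z = S w := by
  have hconv : Convex ℝ {z : ℂ | 0 < z.im} := convex_halfSpace_im_gt 0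
  have := hconv.norm_image_sub_le_of_norm_hasDerivWithin_le (f := S) (f' := fun _ => 0) (C := 0)
    (fun x hx => (hS x hx).hasDerivWithinAt) (by simp) hw hz
  simpa [sub_eq_zero] using this

theorem hasDerivAt_gs_prim (j : ℤ) (hj : j ≠ 0) (z : ℂ) :
    HasDerivAt (fun z => gs z (2 * j) / (2 * Real.pi * I * j)) (gs z (2 * j)) z := by
  have h := (hasDerivAt_gs_z z (2 * j)).div_const (2 * Real.pi * I * j : ℂ)
  refine h.congr_deriv ?_
  have : (j : ℂ) ≠ 0 := by exact_mod_cast hj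
  have hpi : (Real.pi : ℂ) ≠ 0 := by exact_mod_cast Real.pi_ne_zero
  have := I_ne_zero
  push_cast
  field_simp

theorem gs_int_add (j : ℤ) (z : ℂ) : gs (z + 1) (2 * j) = gs z (2 * j) := by
  rw [gs_add]
  have : gs 1 (2 * j) = 1 := by
    rw [gs]
    rw [show (Real.pi * I * 1 * ((2 * j : ℝ) : ℂ) : ℂ) = j * (2 * Real.pi * I) by push_cast; ring]
    exact Complex.exp_int_mul_two_pi_mul_I j
  rw [this, mul_one]

theorem limit_diff {F f : ℂ → ℂ} (hF : ∀ z : ℂ, 0 < z.im → HasDerivAt F (f z) z) {c : ℂ} {j : ℤ} {C : ℝ}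
    (hb : ∀ z : ℂ, 1 ≤ z.im → |z.re| ≤ 1 → ‖f z - c * gs z (2 * j)‖ ≤ C * Real.exp (-Real.pi * z.im)) :
    Tendsto (fun y : ℝ => F (y * I) - F (y * I - 1)) atTop (𝓝 (if j = 0 then c else 0)) := by
  obtain ⟨p, hp, hp2⟩ : ∃ p : ℂ → ℂ, (∀ z, HasDerivAt p (gs z (2 * j)) z) ∧
      ∀ z, p z - p (z - 1) = if j = 0 then 1 else 0 := by
    by_cases hj : j = 0
    · refine ⟨fun z => z, fun z => ?_, fun z => by simp [hj]⟩
      simpa [hj, gs] using hasDerivAt_id' z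
    · refine ⟨_, hasDerivAt_gs_prim j hj, fun z => ?_⟩
      have := gs_int_add j (z - 1)
      rw [sub_add_cancel] at this
      simp [hj, this]
  have key : ∀ y : ℝ, 1 ≤ y → ‖(F (y * I) - F (y * I - 1)) - (if j = 0 then c else 0)‖ ≤ C * Real.exp (-Real.pi * y) := by
    intro y hy
    have hconv : Convex ℝ (segment ℝ ((y : ℂ) * I - 1) (y * I)) := convex_segment _ _
    have hseg : ∀ z ∈ segment ℝ ((y : ℂ) * I - 1) (y * I), z.im = y ∧ |z.re| ≤ 1 := by
      intro z hz
      rw [segment_eq_image] at hz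
      obtain ⟨θ, ⟨h0, h1⟩, rfl⟩ := hz
      constructor
      · simp; ring
      · simp; rw [abs_le]; constructor <;> linarith
    have := hconv.norm_image_sub_le_of_norm_hasDerivWithin_le (f := fun z => F z - c * p z)
      (f' := fun z => f z - c * gs z (2 * j)) (C := C * Real.exp (-Real.pi * y))
      (fun z hz => ((hF z (by rw [(hseg z hz).1]; linarith)).sub ((hp z).const_mul c)).hasDerivWithinAt)
      (fun z hz => by
        have h := hb z (by rw [(hseg z hz).1]; exact hy) (hseg z hz).2
        rwa [(hseg z hz).1] at h) (left_mem_segment _ _ _) (right_mem_segment _ _ _)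
    have e : F (y * I) - c * p (y * I) - (F (y * I - 1) - c * p (y * I - 1)) =
      (F (y * I) - F (y * I - 1)) - (if j = 0 then c else 0) := by
      have := hp2 (y * I)
      have e2 : (if j = 0 then c else 0) = c * (p (y * I) - p (y * I - 1)) := by
        rw [this]; split_ifs <;> simp
      rw [e2]; ring
    rw [e] at this
    simpa using this
  rw [tendsto_iff_norm_sub_tendsto_zero]
  have hz : Tendsto (fun y : ℝ => C * Real.exp (-Real.pi * y)) atTop (𝓝 0) := by
    rw [show (0:ℝ) = C * 0 by simp]
    apply Tendsto.const_mul
    apply Real.tendsto_exp_atBot.comp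
    exact tendsto_id.const_mul_atTop_of_neg (by linarith [Real.pi_pos])
  refine squeeze_zero' (Eventually.of_forall fun _ => norm_nonneg _) ?_ hz
  filter_upwards [eventually_ge_atTop 1] with y hy using key y hy

end I24
end D1

section D2
namespace I24
open Complex Filter Topology MeasureTheory Set

theorem im_neg_inv_pos {z : ℂ} (hz : 0 < z.im) : 0 < (-1 / z).im := by
  have : z ≠ 0 := by rintro rfl; simp at hz
  have h2 : 0 < Complex.normSq z := Complex.normSq_pos.2 this
  rw [neg_div, one_div, Complex.neg_im, Complex.inv_im]
  rw [neg_div, neg_neg]; positivity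

theorem hasDerivAt_comp_neg_inv {P : ℂ → ℂ} {p : ℂ} {z : ℂ} (hz : 0 < z.im)
    (hP : HasDerivAt P p (-1 / z)) : HasDerivAt (fun z => P (-1 / z)) (p * (z ^ 2)⁻¹) z := by
  have : z ≠ 0 := by rintro rfl; simp at hz
  have h1 : HasDerivAt (fun z : ℂ => -1 / z) ((z ^ 2)⁻¹) z := by
    have := (hasDerivAt_inv this).const_mul (-1 : ℂ)
    refine (this.congr_deriv (by ring)).congr_of_eventuallyEq (Eventually.of_forall fun w => by simp [div_eq_mul_inv])
  exact hP.comp z h1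

/-- the analytic core: integrals and their values at nodes -/
theorem node_values {ε : ℂ} {h k : ℂ → ℂ} (hh : DifferentiableOn ℂ h {z | 0 < z.im}) {C : ℝ} (hC : 0 ≤ C)
    (hdec : ∀ w : ℂ, 1/2 ≤ w.im → ‖h w‖ ≤ C * Real.exp (-Real.pi * w.im))
    (hk : ∀ z : ℂ, 0 < z.im → k z = z ^ 10 * h (-1 / z))
    (hrec : ∀ z : ℂ, 0 < z.im → k (z + 1) + k (z - 1) - 2 * k z = 2 * ε * h z)
    {m : ℤ} {δ δ' : ℂ} {C1 : ℝ}
    (h1 : ∀ z : ℂ, 1 ≤ z.im → |z.re| ≤ 1 → ‖k (z + 1) - k z - δ * gs z (2 * (-m : ℤ))‖ ≤ C1 * Real.exp (3 * Real.pi * z.im))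
    (h2 : ∀ z : ℂ, 1 ≤ z.im → |z.re| ≤ 1 →
      ‖z * (k (z + 1) - k z) - k z - δ' * gs z (2 * (-m : ℤ))‖ ≤ C1 * Real.exp (3 * Real.pi * z.im))
    (n : ℤ) (hn : 2 ≤ n) :
    ∃ P P1 Q Q1 : ℂ → ℂ,
      (∀ x t0 : ℝ, 1/2 ≤ t0 → ∫ t in Ioi t0, h (x + t * I) * (((x:ℂ) + t * I) ^ 12)⁻¹ * gs (-1 / (x + t * I)) (2 * n) * I = - P (x + t0 * I)) ∧
      (∀ x t0 : ℝ, 1/2 ≤ t0 → ∫ t in Ioi t0, (-1 / (x + t * I)) * (h (x + t * I) * (((x:ℂ) + t * I) ^ 12)⁻¹ * gs (-1 / (x + t * I)) (2 * n)) * I = - P1 (x + t0 * I)) ∧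
      (∀ t0 : ℝ, 1/2 ≤ t0 → ∫ t in Ioi t0, h (t * I) * gs (t * I) (2 * n) * I = - Q (t0 * I)) ∧
      (∫ t in Ioi (1:ℝ), (t * I) * (h (t * I) * gs (t * I) (2 * n)) * I = - Q1 I) ∧
      (-P (-1/2+I/2) - P (1/2 + I/2) + 2 * P I + 2 * ε * Q I = if n = m then -δ else 0) ∧
      (-P1 (-1/2+I/2) - P1 (1/2 + I/2) + 2 * P1 I + P (-1/2+I/2) - P (1/2+I/2) + 2 * ε * Q1 I = if n = m then -δ' else 0) := by
  have hpi := Real.pi_pos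
  have hn0 : (0:ℝ) ≤ 2 * n := by have : (2:ℝ) ≤ n := by exact_mod_cast hn
                                 linarith
  have hne : ∀ z : ℂ, 0 < z.im → z ≠ 0 := by rintro z hz rfl; simp at hz
  have hdiffinv : DifferentiableOn ℂ (fun z : ℂ => -1 / z) {z | 0 < z.im} := by
    intro z hz; exact ((differentiableAt_const _).div differentiableAt_id (hne z hz)).differentiableWithinAt
  have hgs : ∀ z : ℂ, DifferentiableAt ℂ (fun z => gs z (2 * n)) z := fun z => (hasDerivAt_gs_z z _).differentiableAt
  have hΦd : DifferentiableOn ℂ (fun w => h w * (w ^ 12)⁻¹ * gs (-1 / w) (2 * n)) {z | 0 < z.im} := by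
    intro z hz
    have i1 : DifferentiableWithinAt ℂ (fun w : ℂ => (w ^ 12)⁻¹) {z | 0 < z.im} z :=
      ((differentiableAt_id.pow 12).inv (pow_ne_zero _ (hne z hz))).differentiableWithinAt
    exact ((hh z hz).mul i1).mul ((hgs (-1 / z)).comp_differentiableWithinAt z (hdiffinv z hz))
  have hnw : ∀ w : ℂ, 1/2 ≤ w.im → ‖w‖⁻¹ ≤ 2 := by
    intro w hw
    have : 1/2 ≤ ‖w‖ := hw.trans ((le_abs_self _).trans (Complex.abs_im_le_norm w))
    rw [inv_le_comm₀ (by linarith) (by norm_num)]; linarith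
  have hΦb : ∀ w : ℂ, 1/2 ≤ w.im → ‖h w * (w ^ 12)⁻¹ * gs (-1 / w) (2 * n)‖ ≤ (C * 2 ^ 12) * Real.exp (-Real.pi * w.im) := by
    intro w hw
    rw [norm_mul, norm_mul, norm_inv, norm_pow, ← inv_pow]
    have a1 := hdec w hw
    have a2 := hnw w hw
    have a3 := norm_gs_le (im_neg_inv_pos (z := w) (by linarith)).le hn0
    calc ‖h w‖ * ‖w‖⁻¹ ^ 12 * ‖gs (-1 / w) (2 * n)‖ ≤ (C * Real.exp (-Real.pi * w.im)) * 2 ^ 12 * 1 := by gcongr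
      _ = _ := by ring
  obtain ⟨P, hP, hPi, hPb⟩ := exists_primitive_decay hpi (by norm_num) hΦd hΦb
  obtain ⟨P1, hP1, hP1i, hP1b⟩ := exists_primitive_decay (f := fun w => (-1 / w) * (h w * (w ^ 12)⁻¹ * gs (-1 / w) (2 * n)))
    (C := 2 * (C * 2 ^ 12)) hpi (by norm_num : (0:ℝ) < 1/2) (hdiffinv.mul hΦd) (by
      intro w hw
      rw [norm_mul, norm_div, norm_neg, norm_one, one_div]
      calc _ ≤ 2 * ((C * 2 ^ 12) * Real.exp (-Real.pi * w.im)) := by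
            gcongr; exacts [hnw w hw, hΦb w hw]
        _ = _ := by ring)
  have hqd : DifferentiableOn ℂ (fun w => h w * gs w (2 * n)) {z | 0 < z.im} :=
    fun z hz => (hh z hz).mul (hgs z).differentiableWithinAt
  have hqb : ∀ w : ℂ, 1/2 ≤ w.im → ‖h w * gs w (2 * n)‖ ≤ C * Real.exp (-Real.pi * w.im) := by
    intro w hw
    rw [norm_mul]
    have a3 := norm_gs_le (z := w) (by linarith) hn0
    calc _ ≤ (C * Real.exp (-Real.pi * w.im)) * 1 := by gcongr; exact hdec w hw
      _ = _ := by ring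
  obtain ⟨Q, hQ, hQi, hQb⟩ := exists_primitive_decay hpi (by norm_num) hqd hqb
  have hQd : DifferentiableOn ℂ Q {z | 0 < z.im} := fun z hz => (hQ z hz).differentiableAt.differentiableWithinAt
  obtain ⟨Q2, hQ2, hQ2i, hQ2b⟩ := exists_primitive_decay hpi (by norm_num) hQd hQb
  have hexp0 : ∀ D : ℝ, Tendsto (fun y : ℝ => D * Real.exp (-Real.pi * y)) atTop (𝓝 0) := by
    intro D
    rw [show (0:ℝ) = D * 0 by simp]
    apply Tendsto.const_mul
    apply Real.tendsto_exp_atBot.comp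
    exact tendsto_id.const_mul_atTop_of_neg (by linarith [Real.pi_pos])
  have hQlim : Tendsto (fun y : ℝ => Q (y * I)) atTop (𝓝 0) := by
    apply squeeze_zero_norm' _ (hexp0 (C / Real.pi))
    filter_upwards [eventually_ge_atTop 1] with y hy
    have := hQb (y * I) (by simp; linarith)
    simpa using this
  have hQ1lim : Tendsto (fun y : ℝ => (y * I) * Q (y * I) - Q2 (y * I)) atTop (𝓝 0) := by
    rw [show (0:ℂ) = 0 - 0 by simp]
    apply Tendsto.sub
    · have ht : Tendsto (fun y : ℝ => (C / Real.pi) * (y ^ 1 * Real.exp (-Real.pi * y))) atTop (𝓝 0) := by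
        rw [show (0:ℝ) = (C / Real.pi) * 0 by simp]
        apply Tendsto.const_mul
        have := tendsto_rpow_mul_exp_neg_mul_atTop_nhds_zero 1 Real.pi hpi
        simpa using this
      apply squeeze_zero_norm' _ ht
      filter_upwards [eventually_ge_atTop 1] with y hy
      have := hQb (y * I) (by simp; linarith)
      rw [norm_mul, norm_mul, Complex.norm_I, Complex.norm_real, Real.norm_of_nonneg (by linarith)]
      simp only [mul_im, ofReal_re, I_im, mul_one, ofReal_im, I_re, mul_zero, add_zero] at this
      calc _ ≤ y * 1 * (C / Real.pi * Real.exp (-Real.pi * y)) := by gcongr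
        _ = _ := by ring
    · apply squeeze_zero_norm' _ (hexp0 (C / Real.pi / Real.pi))
      filter_upwards [eventually_ge_atTop 1] with y hy
      have := hQ2b (y * I) (by simp; linarith)
      simpa using this
  have hQ1d : ∀ z : ℂ, 0 < z.im → HasDerivAt (fun z => z * Q z - Q2 z) (z * (h z * gs z (2 * n))) z := by
    intro z hz
    exact (((hasDerivAt_id' z).mul (hQ z hz)).sub (hQ2 z hz)).congr_deriv (by ring)
  refine ⟨P, P1, Q, fun z => z * Q z - Q2 z, hPi, hP1i, ?_, ?_, ?_, ?_⟩
  · intro t0 ht0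
    have := hQi 0 t0 ht0
    simpa using this
  · have hintg := (((wtI hh.continuousOn hC hdec).mul gpathI).integrable gpathI (u := 2 * n) (by linarith)).const_mul (Real.pi * I)⁻¹
    have hpic : (Real.pi : ℂ) ≠ 0 := by exact_mod_cast hpi.ne'
    have hint2 : IntegrableOn (fun t : ℝ => (t * I) * (h (t * I) * gs (t * I) (2 * n)) * I) (Ioi 1) := by
      refine hintg.congr (Eventually.of_forall fun t => ?_)
      have := I_ne_zero
      simp only
      field_simp
    have hv : ∀ t : ℝ, t ∈ Ici (1:ℝ) → HasDerivAt (fun y : ℝ => (y * I) * Q (y * I) - Q2 (y * I))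
        ((t * I) * (h (t * I) * gs (t * I) (2 * n)) * I) t := by
      intro t ht
      have ht' : (1:ℝ) ≤ t := ht
      have := hasDerivAt_vert (F := fun z => z * Q z - Q2 z) (f := fun z => z * (h z * gs z (2 * n))) (x := 0) (t := t)
        (hQ1d _ (by simp; linarith))
      simpa using this
    have := integral_Ioi_of_hasDerivAt_of_tendsto' hv hint2 hQ1lim
    rw [this]; simp
  all_goals
    have hK : ∀ z : ℂ, 0 < z.im → HasDerivAt (fun z => P (-1 / z)) (k z * gs z (2 * n)) z := by
      intro z hz
      refine (hasDerivAt_comp_neg_inv hz (hP _ (im_neg_inv_pos hz))).congr_deriv ?_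
      have := hne z hz
      have e : -1 / (-1 / z) = z := by field_simp
      rw [e, hk z hz]
      field_simp
    have hp1 : ∀ {z : ℂ}, 0 < z.im → 0 < (z + 1).im := by intro z hz; simpa using hz
    have hm1 : ∀ {z : ℂ}, 0 < z.im → 0 < (z - 1).im := by intro z hz; simpa using hz
    have gp : ∀ z, gs (z + 1) (2 * n) = gs z (2 * n) := gs_int_add n
    have gm : ∀ z, gs (z - 1) (2 * n) = gs z (2 * n) := fun z => by rw [← gp, sub_add_cancel]
    have hKp : ∀ z : ℂ, 0 < z.im → HasDerivAt (fun z => P (-1 / (z + 1))) (k (z + 1) * gs z (2 * n)) z := by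
      intro z hz
      have := (hK (z + 1) (hp1 hz)).comp_add_const z 1
      rwa [gp] at this
    have hKm : ∀ z : ℂ, 0 < z.im → HasDerivAt (fun z => P (-1 / (z - 1))) (k (z - 1) * gs z (2 * n)) z := by
      intro z hz
      have := (hK (z - 1) (hm1 hz)).comp_sub_const z 1
      rwa [gm] at this
    have e1 : (-1 / (I + 1) : ℂ) = -1/2 + I/2 := by
      have : (I + 1 : ℂ) ≠ 0 := fun h => by simpa using congrArg Complex.im h
      field_simp; ring_nf; simp; norm_num
    have e2 : (-1 / (I - 1) : ℂ) = 1/2 + I/2 := by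
      have : (I - 1 : ℂ) ≠ 0 := fun h => by simpa using congrArg Complex.im h
      field_simp; ring_nf; simp; norm_num
    have e3 : (-1 / I : ℂ) = I := by
      have := I_ne_zero
      field_simp; simp
    have hgsmul : ∀ z, gs z (2 * n) * gs z (2 * (-m : ℤ)) = gs z (2 * (n - m : ℤ)) := by
      intro z; rw [gs, gs, gs, ← Complex.exp_add]; congr 1; push_cast; ring
    have hbnd : ∀ (f : ℂ → ℂ) (δ : ℂ), (∀ z : ℂ, 1 ≤ z.im → |z.re| ≤ 1 → ‖f z - δ * gs z (2 * (-m : ℤ))‖ ≤ C1 * Real.exp (3 * Real.pi * z.im)) →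
      ∀ z : ℂ, 1 ≤ z.im → |z.re| ≤ 1 → ‖f z * gs z (2 * n) - δ * gs z (2 * (n - m : ℤ))‖ ≤ C1 * Real.exp (-Real.pi * z.im) := by
      intro f δ hf z hz hz2
      have hC1 : 0 ≤ C1 := by
        have := (norm_nonneg _).trans (hf z hz hz2)
        exact nonneg_of_mul_nonneg_left this (Real.exp_pos _)
      rw [← hgsmul, show f z * gs z (2 * n) - δ * (gs z (2 * n) * gs z (2 * (-m : ℤ))) =
        (f z - δ * gs z (2 * (-m : ℤ))) * gs z (2 * n) by ring, norm_mul, norm_gs]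
      have hn' : (2:ℝ) ≤ n := by exact_mod_cast hn
      calc _ ≤ (C1 * Real.exp (3 * Real.pi * z.im)) * Real.exp (-Real.pi * z.im * (2 * 2)) := by
            gcongr ?_ * Real.exp ?_
            · exact hf z hz hz2
            · have : 0 ≤ Real.pi * z.im := by positivity
              nlinarith
        _ = _ := by rw [mul_assoc, ← Real.exp_add]; congr 2; ring
    have hnm : (n - m = 0) ↔ n = m := sub_eq_zero
  · have hS : ∀ z : ℂ, 0 < z.im → HasDerivAt (fun z => P (-1/(z+1)) + P (-1/(z-1)) - 2 * P (-1/z) - 2 * ε * Q z) 0 z := by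
      intro z hz
      refine ((((hKp z hz).add (hKm z hz)).sub ((hK z hz).const_mul 2)).sub ((hQ z hz).const_mul (2 * ε))).congr_deriv ?_
      have := hrec z hz
      linear_combination gs z (2 * n) * this
    have hlim := limit_diff (F := fun z => P (-1/(z+1)) - P (-1/z)) (f := fun z => (k (z+1) - k z) * gs z (2 * n))
      (fun z hz => ((hKp z hz).sub (hK z hz)).congr_deriv (by ring)) (hbnd _ _ h1)
    have hlim2 := hlim.sub (hQlim.const_mul (2 * ε))
    have hev : (fun y : ℝ => P (-1 / ((y:ℂ) * I + 1)) - P (-1 / (y * I)) - (P (-1 / (y * I - 1 + 1)) - P (-1 / (y * I - 1))) - 2 * ε * Q (y * I))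
      =ᶠ[atTop] fun _ => P (-1/(I+1)) + P (-1/(I-1)) - 2 * P (-1/I) - 2 * ε * Q I := by
      filter_upwards [eventually_gt_atTop 0] with y hy
      have := const_of_deriv_zero hS (z := y * I) (w := I) (by simpa using hy) (by simp)
      rw [← this, sub_add_cancel]; ring
    have hc := (tendsto_congr' hev).1 hlim2
    have := tendsto_nhds_unique tendsto_const_nhds hc
    rw [e1, e2, e3] at this
    simp only [hnm] at this
    rw [← neg_inj]
    rw [show (-if n = m then -δ else 0) = (if n = m then δ else 0) by split_ifs <;> simp]
    linear_combination this
  · have hK1 : ∀ z : ℂ, 0 < z.im → HasDerivAt (fun z => P1 (-1 / z)) (z * k z * gs z (2 * n)) z := by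
      intro z hz
      refine (hasDerivAt_comp_neg_inv hz (hP1 _ (im_neg_inv_pos hz))).congr_deriv ?_
      have := hne z hz
      have e : -1 / (-1 / z) = z := by field_simp
      rw [e, hk z hz]
      field_simp
    have hK1p : ∀ z : ℂ, 0 < z.im → HasDerivAt (fun z => P1 (-1 / (z + 1))) ((z + 1) * k (z + 1) * gs z (2 * n)) z := by
      intro z hz
      have := (hK1 (z + 1) (hp1 hz)).comp_add_const z 1
      rwa [gp] at this
    have hK1m : ∀ z : ℂ, 0 < z.im → HasDerivAt (fun z => P1 (-1 / (z - 1))) ((z - 1) * k (z - 1) * gs z (2 * n)) z := by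
      intro z hz
      have := (hK1 (z - 1) (hm1 hz)).comp_sub_const z 1
      rwa [gm] at this
    have hS : ∀ z : ℂ, 0 < z.im → HasDerivAt (fun z => P1 (-1/(z+1)) + P1 (-1/(z-1)) - 2 * P1 (-1/z) - P (-1/(z+1)) + P (-1/(z-1)) - 2 * ε * (z * Q z - Q2 z)) 0 z := by
      intro z hz
      refine ((((((hK1p z hz).add (hK1m z hz)).sub ((hK1 z hz).const_mul 2)).sub (hKp z hz)).add (hKm z hz)).sub ((hQ1d z hz).const_mul (2 * ε))).congr_deriv ?_
      have := hrec z hz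
      linear_combination z * gs z (2 * n) * this
    have hlim := limit_diff (F := fun z => P1 (-1/(z+1)) - P1 (-1/z) - P (-1/(z+1)) - P (-1/z)) (f := fun z => (z * (k (z+1) - k z) - k z) * gs z (2 * n))
      (fun z hz => ((((hK1p z hz).sub (hK1 z hz)).sub (hKp z hz)).sub (hK z hz)).congr_deriv (by ring)) (hbnd _ _ h2)
    have hlim2 := hlim.sub (hQ1lim.const_mul (2 * ε))
    have hev : (fun y : ℝ => P1 (-1 / ((y:ℂ) * I + 1)) - P1 (-1 / (y * I)) - P (-1 / (y * I + 1)) - P (-1 / (y * I)) - (P1 (-1 / (y * I - 1 + 1)) - P1 (-1 / (y * I - 1)) - P (-1 / (y * I - 1 + 1)) - P (-1 / (y * I - 1))) - 2 * ε * (y * I * Q (y * I) - Q2 (y * I)))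
      =ᶠ[atTop] fun _ => P1 (-1/(I+1)) + P1 (-1/(I-1)) - 2 * P1 (-1/I) - P (-1/(I+1)) + P (-1/(I-1)) - 2 * ε * (I * Q I - Q2 I) := by
      filter_upwards [eventually_gt_atTop 0] with y hy
      have := const_of_deriv_zero hS (z := y * I) (w := I) (by simpa using hy) (by simp)
      rw [← this, sub_add_cancel]; ring
    have hc := (tendsto_congr' hev).1 hlim2
    have := tendsto_nhds_unique tendsto_const_nhds hc
    rw [e1, e2, e3] at this
    simp only [hnm] at this
    rw [← neg_inj]
    rw [show (-if n = m then -δ' else 0) = (if n = m then δ' else 0) by split_ifs <;> simp]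
    linear_combination this

end I24
end D2

section D3
namespace I24
open Complex Filter Topology MeasureTheory Set

theorem FT_add (f g : SchwartzMap E24 ℂ) : FT (f + g) = FT f + FT g := by
  simp only [FT, map_add]
theorem FT_smul (c : ℂ) (f : SchwartzMap E24 ℂ) : FT (c • f) = c • FT f := by
  simp only [FT, map_smul]

theorem Wt.FT {t0 A : ℝ} {z m : ℝ → ℂ} (hz : GPath t0 z A) (hm : Wt t0 m) (f : SchwartzMap E24 ℂ)
    (hf : ∀ x, f x = ∫ t in Ioi t0, m t * gs (z t) (‖x‖ ^ 2)) (y : E24) :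
    FT f y = ∫ t in Ioi t0, m t * ((z t) ^ 12)⁻¹ * gs (-1 / z t) (‖y‖ ^ 2) := by
  refine FT_super hm.1 hz.meas ?_ (hm.integrable_inv hz 12) f hf y
  rw [ae_restrict_iff' measurableSet_Ioi]
  exact ae_of_all _ fun t ht => hz.im t ht

theorem eigen_exists {ε : ℂ} (hε : ε * ε = 1) {h k : ℂ → ℂ} (hh : DifferentiableOn ℂ h {z | 0 < z.im}) {C : ℝ} (hC : 0 ≤ C)
    (hdec : ∀ w : ℂ, 1/2 ≤ w.im → ‖h w‖ ≤ C * Real.exp (-Real.pi * w.im))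
    (hper : ∀ z : ℂ, 0 < z.im → h (z + 1) = ε * h z)
    (hk : ∀ z : ℂ, 0 < z.im → k z = z ^ 10 * h (-1 / z))
    (hrec : ∀ z : ℂ, 0 < z.im → k (z + 1) + k (z - 1) - 2 * k z = 2 * ε * h z)
    {m : ℕ} {δ δ' : ℂ} {C1 : ℝ}
    (h1 : ∀ z : ℂ, 1 ≤ z.im → |z.re| ≤ 1 → ‖k (z + 1) - k z - δ * gs z (-(2 * m))‖ ≤ C1 * Real.exp (3 * Real.pi * z.im))
    (h2 : ∀ z : ℂ, 1 ≤ z.im → |z.re| ≤ 1 →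
      ‖z * (k (z + 1) - k z) - k z - δ' * gs z (-(2 * m))‖ ≤ C1 * Real.exp (3 * Real.pi * z.im)) :
    ∃ g : SchwartzMap E24 ℂ, IsRadial g ∧ (∀ x, FT g x = ε * g x) ∧
      ∀ n : ℕ, 2 ≤ n → radVal g (Real.sqrt (2 * n)) = (if n = m then -δ else 0) ∧
        radDeriv g (Real.sqrt (2 * n)) = 2 * Real.sqrt (2 * n) * (Real.pi * I * (if n = m then -δ' else 0)) := by
  let w1 : ℝ → ℂ := fun t => ((-(1/2) : ℝ) : ℂ) + t * I
  let w2 : ℝ → ℂ := fun t => ((1/2 : ℝ) : ℂ) + t * I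
  let w3 : ℝ → ℂ := fun t => ((0 : ℝ) : ℂ) + t * I
  let z1 : ℝ → ℂ := fun t => ((-1 : ℝ) : ℂ) - 1 / w1 t
  let z2 : ℝ → ℂ := fun t => ((1 : ℝ) : ℂ) - 1 / w2 t
  let z3 : ℝ → ℂ := fun t => ((0 : ℝ) : ℂ) - 1 / w3 t
  let z4 : ℝ → ℂ := fun t => t * I
  have p1 : GPath (1/2) z1 3 := gpathA (a := -(1/2)) (by norm_num [abs_of_pos]) (by norm_num) (by norm_num)
  have p2 : GPath (1/2) z2 3 := gpathA (a := 1/2) (by norm_num [abs_of_pos]) (by norm_num) (by norm_num)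
  have p3 : GPath 1 z3 3 := gpathA (a := 0) (by norm_num) (by norm_num) (by norm_num)
  have p4 : GPath 1 z4 1 := gpathI
  let m1 : ℝ → ℂ := fun t => h (w1 t) * ((w1 t) ^ 12)⁻¹ * I
  let m2 : ℝ → ℂ := fun t => h (w2 t) * ((w2 t) ^ 12)⁻¹ * I
  let m3 : ℝ → ℂ := fun t => h (w3 t) * ((w3 t) ^ 12)⁻¹ * I
  let m4 : ℝ → ℂ := fun t => h (t * I) * I
  have q1 : Wt (1/2) m1 := wtA hh.continuousOn hC hdec (by norm_num)
  have q2 : Wt (1/2) m2 := wtA hh.continuousOn hC hdec (by norm_num)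
  have q3 : Wt 1 m3 := wtA hh.continuousOn hC hdec (by norm_num)
  have q4 : Wt 1 m4 := wtI hh.continuousOn hC hdec
  obtain ⟨f1, hf1⟩ := q1.schwartz p1
  obtain ⟨f2, hf2⟩ := q2.schwartz p2
  obtain ⟨f3, hf3⟩ := q3.schwartz p3
  obtain ⟨f4, hf4⟩ := q4.schwartz p4
  have hne : ∀ z : ℂ, 0 < z.im → z ≠ 0 := by rintro z hz rfl; simp at hz
  have hw12 : ∀ t, w2 t = w1 t + 1 := by intro t; simp only [w1, w2]; push_cast; ring
  have hw1i : ∀ t, (w1 t).im = t := by intro t; simp [w1]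
  have hw2i : ∀ t, (w2 t).im = t := by intro t; simp [w2]
  have F12 : ∀ y, FT f1 y = ε * f2 y := by
    intro y
    rw [q1.FT p1 f1 hf1, hf2, ← integral_const_mul]
    refine setIntegral_congr_fun measurableSet_Ioi fun t ht => ?_
    have ht' : (1:ℝ)/2 < t := ht
    have n1 := hne (w1 t) (by rw [hw1i]; linarith)
    have n2 := hne (w2 t) (by rw [hw2i]; linarith)
    have e1 : z1 t = - w2 t / w1 t := by simp only [z1]; rw [hw12]; push_cast; field_simp; ring
    have e2 : -1 / z1 t = z2 t := by
      rw [e1]; simp only [z2]; push_cast; field_simp; rw [hw12]; ring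
    have e3 : h (w1 t) = ε * h (w2 t) := by
      rw [hw12, hper _ (by rw [hw1i]; linarith), ← mul_assoc, hε, one_mul]
    simp only [m1, m2]
    rw [e2, e3, e1]
    field_simp
  have F21 : ∀ y, FT f2 y = ε * f1 y := by
    intro y
    rw [q2.FT p2 f2 hf2, hf1, ← integral_const_mul]
    refine setIntegral_congr_fun measurableSet_Ioi fun t ht => ?_
    have ht' : (1:ℝ)/2 < t := ht
    have n1 := hne (w1 t) (by rw [hw1i]; linarith)
    have n2 := hne (w2 t) (by rw [hw2i]; linarith)
    have e1 : z2 t = w1 t / w2 t := by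
      simp only [z2]; push_cast; field_simp; rw [hw12]; ring
    have e2 : -1 / z2 t = z1 t := by
      rw [e1]; simp only [z1]; push_cast; field_simp; rw [hw12]; ring
    have e3 : h (w2 t) = ε * h (w1 t) := by
      rw [hw12, hper _ (by rw [hw1i]; linarith)]
    simp only [m1, m2]
    rw [e2, e3, e1]
    field_simp
  have F34 : ∀ y, FT f3 y = f4 y := by
    intro y
    rw [q3.FT p3 f3 hf3, hf4]
    refine setIntegral_congr_fun measurableSet_Ioi fun t ht => ?_
    have ht' : (1:ℝ) < t := ht
    have e0 : w3 t = t * I := by simp [w3]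
    have n1 : ((t : ℂ) * I) ≠ 0 := hne _ (by simp; linarith)
    have e2 : -1 / z3 t = z4 t := by
      simp only [z3, z4, e0]; push_cast; field_simp; norm_num
    simp only [m3, m4]
    rw [e2]
    simp only [z3, e0]
    push_cast
    field_simp
    norm_num
    have nt : (t : ℂ) ≠ 0 := by exact_mod_cast (by linarith : (0:ℝ) < t).ne'
    field_simp
  have F43 : ∀ y, FT f4 y = f3 y := by
    intro y
    rw [q4.FT p4 f4 hf4, hf3]
    refine setIntegral_congr_fun measurableSet_Ioi fun t ht => ?_
    have ht' : (1:ℝ) < t := ht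
    have e0 : w3 t = t * I := by simp [w3]
    have e2 : -1 / z4 t = z3 t := by
      simp only [z3, z4, e0]; push_cast; ring
    simp only [m3, m4]
    rw [e2, e0]
    ring
  let g : SchwartzMap E24 ℂ := f1 + f2 + (-2 : ℂ) • f3 + (-2 * ε) • f4
  have hg : ∀ x, g x = f1 x + f2 x - 2 * f3 x - 2 * ε * f4 x := by
    intro x; simp [g]; ring
  let G : ℝ → ℂ := fun u => (∫ t in Ioi (1/2:ℝ), m1 t * gs (z1 t) u) + (∫ t in Ioi (1/2:ℝ), m2 t * gs (z2 t) u)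
    - 2 * (∫ t in Ioi (1:ℝ), m3 t * gs (z3 t) u) - 2 * ε * (∫ t in Ioi (1:ℝ), m4 t * gs (z4 t) u)
  have hG : ∀ x, g x = G (‖x‖ ^ 2) := by
    intro x; rw [hg, hf1, hf2, hf3, hf4]
  have hGd : ∀ u : ℝ, 0 < u → HasDerivAt G ((∫ t in Ioi (1/2:ℝ), (Real.pi * I * z1 t * m1 t) * gs (z1 t) u)
    + (∫ t in Ioi (1/2:ℝ), (Real.pi * I * z2 t * m2 t) * gs (z2 t) u)
    - 2 * (∫ t in Ioi (1:ℝ), (Real.pi * I * z3 t * m3 t) * gs (z3 t) u) - 2 * ε * (∫ t in Ioi (1:ℝ), (Real.pi * I * z4 t * m4 t) * gs (z4 t) u)) u := by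
    intro u hu
    have hu' : -3/4 < u := by linarith
    exact (((q1.hasDerivAt p1 hu').add (q2.hasDerivAt p2 hu')).sub ((q3.hasDerivAt p3 hu').const_mul 2)).sub
      ((q4.hasDerivAt p4 hu').const_mul (2 * ε))
  refine ⟨g, isRadial_of hG, ?_, ?_⟩
  · intro y
    simp only [g, FT_add, FT_smul, add_apply, smul_apply, smul_eq_mul]
    rw [F12, F21, F34, F43]
    linear_combination (2 * f4 y) * hε
  · intro n hn
    have hsq : Real.sqrt (2 * n) ^ 2 = 2 * n := Real.sq_sqrt (by positivity)
    have hn0 : (0:ℝ) < 2 * n := by have : (2:ℝ) ≤ n := by exact_mod_cast hn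
                                   linarith
    rw [radVal_of hG, radDeriv_of hG (r := Real.sqrt (2 * n)) (by rw [hsq]; exact hGd _ hn0), hsq]
    obtain ⟨P, P1, Q, Q1, r1, r2, r3, r4, r5, r6⟩ := node_values hh hC hdec hk hrec (m := m) (δ := δ) (δ' := δ') (C1 := C1)
      (by intro z hz hz2; have := h1 z hz hz2; push_cast; rwa [mul_neg]) (by intro z hz hz2; have := h2 z hz hz2; push_cast; rwa [mul_neg]) n (by exact_mod_cast hn)
    have gp : ∀ z, gs (z + 1) (2 * n) = gs z (2 * n) := by
      intro z; have := gs_int_add n z; simpa using this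
    have g1 : ∀ t, gs (z1 t) (2 * n) = gs (-1 / w1 t) (2 * n) := by
      intro t; rw [← gp]; congr 1; simp only [z1]; push_cast; ring
    have g2 : ∀ t, gs (z2 t) (2 * n) = gs (-1 / w2 t) (2 * n) := by
      intro t; rw [← gp (-1 / w2 t)]; congr 1; simp only [z2]; push_cast; ring
    have g3 : ∀ t, z3 t = (-1 / w3 t) := by
      intro t; simp only [z3]; push_cast; ring
    have I1 : ∫ t in Ioi (1/2:ℝ), m1 t * gs (z1 t) (2 * n) = - P (-1/2 + I/2) := by
      have := r1 (-(1/2)) (1/2) le_rfl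
      push_cast at this
      rw [show (-1/2 + I/2 : ℂ) = (-(1/2) + 1/2 * I) by ring, ← this]
      congr 1; ext t; rw [g1]; simp only [m1, w1]; push_cast; ring
    have I2 : ∫ t in Ioi (1/2:ℝ), m2 t * gs (z2 t) (2 * n) = - P (1/2 + I/2) := by
      have := r1 (1/2) (1/2) le_rfl
      push_cast at this
      rw [show (1/2 + I/2 : ℂ) = (1/2 + 1/2 * I) by ring, ← this]
      congr 1; ext t; rw [g2]; simp only [m2, w2]; push_cast; ring
    have I3 : ∫ t in Ioi (1:ℝ), m3 t * gs (z3 t) (2 * n) = - P I := by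
      have := r1 0 1 (by norm_num)
      push_cast at this
      rw [show (I : ℂ) = (0 + 1 * I) by ring, ← this]
      congr 1; ext t; rw [g3]; simp only [m3, w3]; push_cast; ring
    have I4 : ∫ t in Ioi (1:ℝ), m4 t * gs (z4 t) (2 * n) = - Q I := by
      have := r3 1 (by norm_num)
      push_cast at this
      rw [show (I : ℂ) = (1 * I) by ring, ← this]
      congr 1; ext t; simp only [m4, z4]; ring
    have s1 := q1.integrable p1 (u := 2 * n) (by linarith)
    have s2 := q2.integrable p2 (u := 2 * n) (by linarith)
    have s1' := (q1.mul p1).integrable p1 (u := 2 * n) (by linarith)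
    have s2' := (q2.mul p2).integrable p2 (u := 2 * n) (by linarith)
    have J1 : ∫ t in Ioi (1/2:ℝ), (Real.pi * I * z1 t * m1 t) * gs (z1 t) (2 * n) =
        Real.pi * I * (- P1 (-1/2 + I/2) + P (-1/2 + I/2)) := by
      have h0 := r2 (-(1/2)) (1/2) le_rfl
      have h1 := integral_add s1' (s1.const_mul (Real.pi * I))
      have h2 : ∫ t in Ioi (1/2:ℝ), ((Real.pi * I * z1 t * m1 t) * gs (z1 t) (2 * n) + Real.pi * I * (m1 t * gs (z1 t) (2 * n)))
        = Real.pi * I * (- P1 (-1/2 + I/2)) := by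
        push_cast at h0
        rw [show (-1/2 + I/2 : ℂ) = (-(1/2) + 1/2 * I) by ring, ← h0, ← integral_const_mul]
        congr 1; ext t; rw [g1]; simp only [m1, z1, w1]; push_cast; ring
      rw [h2, integral_const_mul, I1] at h1
      linear_combination -h1
    have J2 : ∫ t in Ioi (1/2:ℝ), (Real.pi * I * z2 t * m2 t) * gs (z2 t) (2 * n) =
        Real.pi * I * (- P1 (1/2 + I/2) - P (1/2 + I/2)) := by
      have h0 := r2 (1/2) (1/2) le_rfl
      have h1 := integral_sub s2' (s2.const_mul (Real.pi * I))
      have h2 : ∫ t in Ioi (1/2:ℝ), ((Real.pi * I * z2 t * m2 t) * gs (z2 t) (2 * n) - Real.pi * I * (m2 t * gs (z2 t) (2 * n)))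
        = Real.pi * I * (- P1 (1/2 + I/2)) := by
        push_cast at h0
        rw [show (1/2 + I/2 : ℂ) = (1/2 + 1/2 * I) by ring, ← h0, ← integral_const_mul]
        congr 1; ext t; rw [g2]; simp only [m2, z2, w2]; push_cast; ring
      rw [h2, integral_const_mul, I2] at h1
      linear_combination -h1
    have J3 : ∫ t in Ioi (1:ℝ), (Real.pi * I * z3 t * m3 t) * gs (z3 t) (2 * n) = Real.pi * I * (- P1 I) := by
      have := r2 0 1 (by norm_num)
      push_cast at this
      rw [show - P1 I = - P1 (0 + 1 * I) by simp, ← this, ← integral_const_mul]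
      congr 1; ext t; rw [g3]; simp only [m3, w3]; push_cast; ring
    have J4 : ∫ t in Ioi (1:ℝ), (Real.pi * I * z4 t * m4 t) * gs (z4 t) (2 * n) = Real.pi * I * (- Q1 I) := by
      rw [← r4, ← integral_const_mul]
      congr 1; ext t; simp only [m4, z4]; push_cast; ring
    constructor
    · simp only [G]
      rw [I1, I2, I3, I4]
      have : ((n : ℤ) = (m : ℤ)) ↔ n = m := by norm_cast
      simp only [this] at r5
      rw [← r5]; ring
    · rw [J1, J2, J3, J4]
      have : ((n : ℤ) = (m : ℤ)) ↔ n = m := by norm_cast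
      simp only [this] at r6
      rw [← r6]; ring

end I24
end D3

section B1
namespace I24
open Complex Filter Topology MeasureTheory Set

/-- The nome `q = e^{2πiz}`. -/
def qq (z : ℂ) : ℂ := cexp (2 * Real.pi * I * z)

theorem qq_ne (z : ℂ) : qq z ≠ 0 := Complex.exp_ne_zero _

theorem norm_qq (z : ℂ) : ‖qq z‖ = Real.exp (-(2 * Real.pi * z.im)) := by
  rw [qq, norm_exp]; congr 1; simp

theorem norm_qq_lt {z : ℂ} (hz : 0 < z.im) : ‖qq z‖ < 1 := by
  rw [norm_qq, Real.exp_lt_one_iff]; have := Real.pi_pos; nlinarith [mul_pos this hz]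

theorem qq_mem {z : ℂ} (hz : 0 < z.im) : qq z ∈ Metric.ball (0:ℂ) 1 := by
  simpa using norm_qq_lt hz

theorem qq_add_one (z : ℂ) : qq (z + 1) = qq z := by
  rw [qq, qq, mul_add, Complex.exp_add, mul_one, Complex.exp_two_pi_mul_I, mul_one]

theorem hasDerivAt_qq (z : ℂ) : HasDerivAt qq (2 * Real.pi * I * qq z) z := by
  have := ((hasDerivAt_id' z).const_mul (2 * Real.pi * I)).cexp
  exact this.congr_deriv (by rw [qq]; ring)

theorem differentiable_qq : Differentiable ℂ qq := fun z => (hasDerivAt_qq z).differentiableAt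

theorem exists_qq {w : ℂ} (h0 : w ≠ 0) (h1 : ‖w‖ < 1) : ∃ z : ℂ, 0 < z.im ∧ qq z = w := by
  refine ⟨Complex.log w / (2 * Real.pi * I), ?_, ?_⟩
  · have : Complex.log w / (2 * Real.pi * I) = ((1 / (2 * Real.pi) : ℝ) : ℂ) * (-I * Complex.log w) := by
      push_cast
      have := Real.pi_pos.ne'
      field_simp
      rw [I_sq]; ring
    rw [this, im_ofReal_mul]
    have hl : Real.log ‖w‖ < 0 := Real.log_neg (norm_pos_iff.2 h0) h1
    simp [Complex.log_re]
    have := Real.pi_pos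
    have h2 : 0 < (Real.pi)⁻¹ := by positivity
    nlinarith [mul_pos h2 (neg_pos.2 hl)]
  · rw [qq, mul_div_cancel₀, Complex.exp_log h0]
    simp [Real.pi_ne_zero]

/-- polynomially bounded sequences -/
def PolyB (a : ℕ → ℂ) : Prop := ∃ C : ℝ, ∃ A : ℕ, 0 ≤ C ∧ ∀ n, ‖a n‖ ≤ C * ((n:ℝ) + 1) ^ A

/-- power series -/
def ps (a : ℕ → ℂ) (q : ℂ) : ℂ := ∑' n, a n * q ^ n

theorem summable_poly_geo (A : ℕ) {r : ℝ} (h0 : 0 ≤ r) (h1 : r < 1) :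
    Summable (fun n : ℕ => ((n:ℝ) + 1) ^ A * r ^ n) := by
  rcases h0.eq_or_lt with h | h
  · subst h
    refine summable_of_ne_finset_zero (s := {0}) ?_
    intro n hn
    have : n ≠ 0 := by simpa using hn
    simp [this]
  have := (summable_pow_mul_geometric_of_norm_lt_one A (r := r) (by rwa [Real.norm_of_nonneg h0]))
  have h2 := (summable_nat_add_iff 1).2 this
  have h3 := h2.mul_left r⁻¹
  refine h3.congr fun n => ?_
  push_cast
  rw [pow_succ]; field_simp

theorem PolyB.summable {a : ℕ → ℂ} (ha : PolyB a) {r : ℝ} (h0 : 0 ≤ r) (h1 : r < 1) :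
    Summable (fun n => ‖a n‖ * r ^ n) := by
  obtain ⟨C, A, hC, h⟩ := ha
  refine Summable.of_nonneg_of_le (fun n => by positivity) (fun n => ?_)
    ((summable_poly_geo A h0 h1).mul_left C)
  rw [← mul_assoc]
  exact mul_le_mul_of_nonneg_right (h n) (by positivity)

theorem PolyB.hasSum {a : ℕ → ℂ} (ha : PolyB a) {q : ℂ} (h1 : ‖q‖ < 1) :
    HasSum (fun n => a n * q ^ n) (ps a q) := by
  apply Summable.hasSum
  apply Summable.of_norm
  refine (ha.summable (norm_nonneg q) h1).congr fun n => ?_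
  simp

theorem ps_diff {a : ℕ → ℂ} (ha : PolyB a) : DifferentiableOn ℂ (ps a) (Metric.ball 0 1) := by
  intro q hq
  obtain ⟨r, hr0, hr1⟩ := exists_between (show ‖q‖ < 1 by simpa using hq)
  have hr : 0 ≤ r := (norm_nonneg q).trans hr0.le
  have := differentiableOn_tsum_of_summable_norm (F := fun n q => a n * q ^ n)
    (u := fun n => ‖a n‖ * r ^ n) (U := Metric.ball (0:ℂ) r) (ha.summable hr hr1)
    (fun n => by fun_prop) Metric.isOpen_ball (fun n w hw => by
      rw [norm_mul, norm_pow]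
      have : ‖w‖ < r := by simpa using hw
      gcongr)
  have h2 : DifferentiableAt ℂ (ps a) q :=
    this.differentiableAt (Metric.isOpen_ball.mem_nhds (by simpa using hr0))
  exact h2.differentiableWithinAt

theorem ps_zero (a : ℕ → ℂ) : ps a 0 = a 0 := by
  rw [ps, tsum_eq_single 0]
  · simp
  · intro n hn; simp [hn]

theorem PolyB.shift {a : ℕ → ℂ} (ha : PolyB a) : PolyB (fun n => a (n + 1)) := by
  obtain ⟨C, A, hC, h⟩ := ha
  refine ⟨C * 2 ^ A, A, by positivity, fun n => (h (n+1)).trans ?_⟩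
  rw [mul_assoc, ← mul_pow]
  gcongr; push_cast; linarith [(Nat.cast_nonneg n : (0:ℝ) ≤ n)]

theorem ps_shift {a : ℕ → ℂ} (ha : PolyB a) {q : ℂ} (h1 : ‖q‖ < 1) :
    ps a q = a 0 + q * ps (fun n => a (n + 1)) q := by
  rw [ps, (ha.hasSum h1).summable.tsum_eq_zero_add, ps, ← tsum_mul_left]
  simp only [pow_zero, mul_one, pow_succ]
  congr 1
  exact tsum_congr fun n => by ring

/-- growth of a power series in `q` -/
theorem ps_growth' {a : ℕ → ℂ} {C : ℝ} {A : ℕ} (hC : 0 ≤ C) (h : ∀ n, ‖a n‖ ≤ C * ((n:ℝ) + 1) ^ A) {z : ℂ}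
    (hz : 0 < z.im) : ‖ps a (qq z)‖ ≤ (C * A.factorial * Real.exp 1 * 2) * (1 + 1 / z.im) ^ (A + 1) := by
  have ha : PolyB a := ⟨C, A, hC, h⟩
  -- (n+1)^A ≤ A! (1+1/y)^A exp ((n+1) y) ; choose s = y
  set y := z.im with hy
  have hpi := Real.pi_gt_three
  have hterm : ∀ n : ℕ, ‖a n * qq z ^ n‖ ≤ C * A.factorial * Real.exp 1 * (1 + 1 / y) ^ A * (Real.exp (-y)) ^ n := by
    intro n
    set s := y / (1 + y)
    have hs : 0 < s := by positivity
    have h1 : ((n:ℝ) + 1) ^ A ≤ A.factorial * (1 + 1 / y) ^ A * Real.exp (((n:ℝ) + 1) * s) := by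
      have := Real.pow_div_factorial_le_exp (((n:ℝ) + 1) * s) (by positivity) A
      rw [div_le_iff₀ (by positivity), mul_pow] at this
      have h2 : (1 + 1 / y) ^ A * s ^ A = 1 := by
        rw [← mul_pow]
        have : (1 + 1 / y) * s = 1 := by simp only [s]; field_simp; try ring
        rw [this, one_pow]
      calc ((n:ℝ) + 1) ^ A = (((n:ℝ) + 1) ^ A * s ^ A) * (1 + 1 / y) ^ A := by
            rw [mul_assoc, mul_comm (s ^ A), h2, mul_one]
        _ ≤ (Real.exp (((n:ℝ) + 1) * s) * A.factorial) * (1 + 1 / y) ^ A := by gcongr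
        _ = _ := by ring
    have hs1 : s ≤ 1 := by simp only [s]; rw [div_le_one (by positivity)]; linarith
    have hsy : s ≤ y := by simp only [s]; rw [div_le_iff₀ (by positivity)]; nlinarith
    have h3 : Real.exp (((n:ℝ) + 1) * s) * ‖qq z‖ ^ n ≤ Real.exp 1 * Real.exp (-y) ^ n := by
      rw [norm_qq, ← Real.exp_nat_mul, ← Real.exp_nat_mul, ← Real.exp_add, ← Real.exp_add, Real.exp_le_exp]
      have hn : (0:ℝ) ≤ n := Nat.cast_nonneg n
      have : 0 ≤ (n:ℝ) * y := by positivity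
      have h4 : (n:ℝ) * s ≤ n * y := by gcongr
      nlinarith
    rw [norm_mul, norm_pow]
    calc ‖a n‖ * ‖qq z‖ ^ n ≤ (C * (A.factorial * (1 + 1 / y) ^ A * Real.exp (((n:ℝ) + 1) * s))) * ‖qq z‖ ^ n := by
          gcongr; exact (h n).trans (by gcongr)
      _ = C * A.factorial * (1 + 1 / y) ^ A * (Real.exp (((n:ℝ) + 1) * s) * ‖qq z‖ ^ n) := by ring
      _ ≤ C * A.factorial * (1 + 1 / y) ^ A * (Real.exp 1 * Real.exp (-y) ^ n) := by gcongr
      _ = _ := by ring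
  have hlt : Real.exp (-y) < 1 := by rw [Real.exp_lt_one_iff]; linarith
  have hg := (hasSum_geometric_of_lt_one (Real.exp_pos (-y)).le hlt).mul_left
    (C * A.factorial * Real.exp 1 * (1 + 1 / y) ^ A)
  have := tsum_of_norm_bounded hg hterm
  refine (show ‖ps a (qq z)‖ ≤ _ from this).trans ?_
  have h5 : (1 - Real.exp (-y))⁻¹ ≤ 1 + 1 / y := by
    have : Real.exp (-y) ≤ (1 + y)⁻¹ := by
      rw [Real.exp_neg]; exact inv_anti₀ (by positivity) (by linarith [Real.add_one_le_exp y])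
    rw [inv_le_comm₀ (by linarith) (by positivity)]
    have h6 : (1 + 1 / y)⁻¹ = 1 - (1 + y)⁻¹ := by field_simp; ring
    rw [h6]; linarith
  calc _ ≤ C * A.factorial * Real.exp 1 * (1 + 1 / y) ^ A * (1 + 1 / y) := by gcongr
    _ = C * A.factorial * Real.exp 1 * (1 + 1 / y) ^ (A+1) * 1 := by ring
    _ ≤ C * A.factorial * Real.exp 1 * (1 + 1 / y) ^ (A+1) * 2 := by gcongr; norm_num
    _ = _ := by ring

theorem ps_growth {a : ℕ → ℂ} (ha : PolyB a) : ∃ C : ℝ, ∃ A : ℕ, 0 ≤ C ∧ ∀ z : ℂ, 0 < z.im →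
    ‖ps a (qq z)‖ ≤ C * (1 + 1 / z.im) ^ A := by
  obtain ⟨C, A, hC, h⟩ := ha
  exact ⟨_, _, by positivity, fun z hz => ps_growth' hC h hz⟩

end I24
end B1

section B2
namespace I24
open Complex Filter Topology MeasureTheory Set
open ArithmeticFunction

/-- coefficients `1, c σ_k(n)` -/
def sc (k : ℕ) (c : ℂ) (n : ℕ) : ℂ := if n = 0 then 1 else c * ((sigma k n : ℕ) : ℂ)

theorem sc_polyB (k : ℕ) (c : ℂ) : PolyB (sc k c) := by
  refine ⟨1 + ‖c‖, k + 1, by positivity, fun n => ?_⟩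
  have h1 : (1:ℝ) ≤ ((n:ℝ) + 1) ^ (k+1) := one_le_pow₀ (by linarith [(Nat.cast_nonneg n : (0:ℝ) ≤ n)])
  unfold sc
  split_ifs
  · rw [norm_one]; nlinarith [norm_nonneg c]
  · rw [norm_mul, norm_natCast]
    have : ((sigma k n : ℕ):ℝ) ≤ ((n:ℝ) + 1) ^ (k+1) := by
      calc ((sigma k n : ℕ):ℝ) ≤ ((n ^ (k+1) : ℕ) : ℝ) := by exact_mod_cast sigma_le_pow_succ k n
        _ ≤ _ := by push_cast; gcongr; linarith
    nlinarith [norm_nonneg c, mul_le_mul_of_nonneg_left this (norm_nonneg c)]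

/-- Eisenstein series of weight 2 -/
def E2 (z : ℂ) : ℂ := ps (sc 1 (-24)) (qq z)
/-- Eisenstein series of weight 4 -/
def E4 (z : ℂ) : ℂ := ps (sc 3 240) (qq z)
/-- Eisenstein series of weight 6 -/
def E6 (z : ℂ) : ℂ := ps (sc 5 (-504)) (qq z)
/-- The discriminant -/
def Dl (z : ℂ) : ℂ := (E4 z ^ 3 - E6 z ^ 2) / 1728

open UpperHalfPlane in
theorem E2_eq (z : ℍ) : EisensteinSeries.E2 z = E2 z := by
  rw [E2]
  refine (EisensteinSeries.hasSum_qExpansion_E2 z).unique ?_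
  have := (sc_polyB 1 (-24)).hasSum (norm_qq_lt z.2)
  refine this.congr_fun ?_
  intro n
  simp only [sc, smul_eq_mul]
  try congr 2
  try simp [qq, Function.Periodic.qParam]

open UpperHalfPlane in
theorem E_eq {k : ℕ} (hk : 3 ≤ k) (hk2 : Even k) (c : ℂ) (hc : c = -(2 * k / bernoulli k)) (z : ℍ) :
    ModularForm.E hk z = ps (sc (k-1) c) (qq z) := by
  rw [EisensteinSeries.q_expansion_bernoulli hk hk2, ps_shift (sc_polyB _ _) (norm_qq_lt z.2)]
  rw [ps, tsum_pnat_eq_tsum_succ (f := fun n => ((sigma (k-1) n : ℕ) : ℂ) * cexp (2 * Real.pi * Complex.I * z) ^ (n:ℤ))]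
  rw [sub_eq_add_neg, ← neg_mul, ← hc, ← tsum_mul_left, ← tsum_mul_left]
  simp only [sc]
  congr 1
  refine tsum_congr fun n => ?_
  rw [if_neg (Nat.succ_ne_zero n)]
  change c * (_ * qq z ^ (((n + 1 : ℕ)) : ℤ)) = _
  rw [zpow_natCast, pow_succ]; ring

theorem bern_four : bernoulli 4 = -1 / 30 := by
  rw [bernoulli_eq_bernoulli'_of_ne_one (by norm_num), bernoulli'_four]

theorem bern_six : bernoulli 6 = 1 / 42 := by
  have h5 : bernoulli' 5 = 0 := bernoulli'_eq_zero_of_odd (by decide) (by norm_num)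
  rw [bernoulli_eq_bernoulli'_of_ne_one (by norm_num), bernoulli'_def]
  norm_num [Finset.sum_range_succ, h5, Nat.choose]

open UpperHalfPlane in
theorem E4_eq (z : ℍ) : ModularForm.E (k := 4) (by norm_num) z = E4 z := by
  apply E_eq (by norm_num) (by decide)
  norm_num [bern_four]

open UpperHalfPlane in
theorem E6_eq (z : ℍ) : ModularForm.E (k := 6) (by norm_num) z = E6 z := by
  apply E_eq (by norm_num) (by decide)
  norm_num [bern_six]

open UpperHalfPlane in
theorem Dl_ne {z : ℂ} (hz : 0 < z.im) : Dl z ≠ 0 := by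
  have h := ModularForm.discriminant_eq_E₄_cube_sub_E₆_sq ⟨z, hz⟩
  have h0 := ModularForm.discriminant_ne_zero ⟨z, hz⟩
  rw [h] at h0
  erw [E4_eq, E6_eq] at h0
  exact h0

open UpperHalfPlane MatrixGroups in
theorem E_S {k : ℕ} (hk : 3 ≤ k) (z : ℍ) :
    ModularForm.E hk (ModularGroup.S • z) = (z:ℂ) ^ k * ModularForm.E hk z := by
  have hm : (ModularGroup.S : GL (Fin 2) ℝ) ∈ 𝒮ℒ := ⟨ModularGroup.S, rfl⟩
  have := SlashInvariantForm.slash_action_eqn'' (ModularForm.E hk) hm z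
  refine this.trans ?_
  have hd : denom (ModularGroup.S : GL (Fin 2) ℝ) z = z := by
    change (((ModularGroup.S.1 1 0 : ℤ) : ℝ) : ℂ) * z + (((ModularGroup.S.1 1 1 : ℤ) : ℝ) : ℂ) = z
    simp [ModularGroup.S]
  rw [hd, zpow_natCast]

open UpperHalfPlane in
theorem coe_S (z : ℍ) : ((ModularGroup.S • z : ℍ) : ℂ) = -1 / (z:ℂ) := by
  rw [modular_S_smul]; simp [neg_div, inv_neg]

theorem E4_S {z : ℂ} (hz : 0 < z.im) : E4 (-1 / z) = z ^ 4 * E4 z := by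
  have := E_S (k := 4) (by norm_num) ⟨z, hz⟩
  rwa [E4_eq, E4_eq, coe_S] at this

theorem E6_S {z : ℂ} (hz : 0 < z.im) : E6 (-1 / z) = z ^ 6 * E6 z := by
  have := E_S (k := 6) (by norm_num) ⟨z, hz⟩
  rwa [E6_eq, E6_eq, coe_S] at this

theorem Dl_S {z : ℂ} (hz : 0 < z.im) : Dl (-1 / z) = z ^ 12 * Dl z := by
  rw [Dl, Dl, E4_S hz, E6_S hz]; ring

/-- the constant in the quasi-modularity of `E2` -/
def kap : ℂ := 6 / (Real.pi * I)

theorem E2_S {z : ℂ} (hz : 0 < z.im) : E2 (-1 / z) = z ^ 2 * E2 z + kap * z := by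
  have := EisensteinSeries.G2_S_transform ⟨z, hz⟩
  have h2 := E2_eq ⟨z, hz⟩
  have h3 := E2_eq (ModularGroup.S • ⟨z, hz⟩)
  rw [coe_S] at h3
  rw [EisensteinSeries.E2] at h2 h3
  simp only [Pi.smul_apply, smul_eq_mul, riemannZeta_two] at h2 h3
  rw [this] at h2
  change _ = E2 z at h2
  change _ = E2 (-1 / z) at h3
  rw [← h2, ← h3, kap]
  have hz0 : z ≠ 0 := by rintro rfl; simp at hz
  have : (Real.pi:ℂ) ≠ 0 := by simp [Real.pi_ne_zero]
  field_simp
  ring_nf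
  simp [I_sq]
  try ring

theorem E2_T (z : ℂ) : E2 (z + 1) = E2 z := by rw [E2, E2, qq_add_one]
theorem E4_T (z : ℂ) : E4 (z + 1) = E4 z := by rw [E4, E4, qq_add_one]
theorem E6_T (z : ℂ) : E6 (z + 1) = E6 z := by rw [E6, E6, qq_add_one]
theorem Dl_T (z : ℂ) : Dl (z + 1) = Dl z := by rw [Dl, Dl, E4_T, E6_T]

end I24
end B2

section B3
namespace I24
open Complex Filter Topology MeasureTheory Set

/-- `f = q^k (c + O(q))`, with a holomorphic expansion on the unit disc -/
def Ord (k : ℤ) (f : ℂ → ℂ) (c : ℂ) : Prop :=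
  ∃ A : ℂ → ℂ, DifferentiableOn ℂ A (Metric.ball 0 1) ∧ A 0 = c ∧
    ∀ z : ℂ, 0 < z.im → f z = qq z ^ k * A (qq z)

theorem Ord.congr {k : ℤ} {f g : ℂ → ℂ} {c : ℂ} (h : Ord k f c) (hfg : ∀ z : ℂ, 0 < z.im → g z = f z) :
    Ord k g c := by
  obtain ⟨A, h1, h2, h3⟩ := h
  exact ⟨A, h1, h2, fun z hz => (hfg z hz).trans (h3 z hz)⟩

theorem Ord.mul {k l : ℤ} {f g : ℂ → ℂ} {c d : ℂ} (hf : Ord k f c) (hg : Ord l g d) :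
    Ord (k + l) (fun z => f z * g z) (c * d) := by
  obtain ⟨A, h1, h2, h3⟩ := hf
  obtain ⟨B, g1, g2, g3⟩ := hg
  refine ⟨fun q => A q * B q, h1.mul g1, by simp only [h2, g2], fun z hz => ?_⟩
  beta_reduce; rw [h3 z hz, g3 z hz, zpow_add₀ (qq_ne z)]; ring

theorem Ord.add {k : ℤ} {f g : ℂ → ℂ} {c d : ℂ} (hf : Ord k f c) (hg : Ord k g d) :
    Ord k (fun z => f z + g z) (c + d) := by
  obtain ⟨A, h1, h2, h3⟩ := hf
  obtain ⟨B, g1, g2, g3⟩ := hg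
  refine ⟨fun q => A q + B q, h1.add g1, by simp only [h2, g2], fun z hz => ?_⟩
  beta_reduce; rw [h3 z hz, g3 z hz]; ring

theorem Ord.const_mul {k : ℤ} {f : ℂ → ℂ} {c : ℂ} (hf : Ord k f c) (s : ℂ) :
    Ord k (fun z => s * f z) (s * c) := by
  obtain ⟨A, h1, h2, h3⟩ := hf
  refine ⟨fun q => s * A q, h1.const_mul s, by simp only [h2], fun z hz => ?_⟩
  beta_reduce; rw [h3 z hz]; ring

theorem Ord.sub {k : ℤ} {f g : ℂ → ℂ} {c d : ℂ} (hf : Ord k f c) (hg : Ord k g d) :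
    Ord k (fun z => f z - g z) (c - d) := by
  have := hf.add (hg.const_mul (-1))
  rw [show c + -1 * d = c - d by ring] at this
  exact this.congr fun z _ => by ring

theorem ord_zero (k : ℤ) : Ord k (fun _ => 0) 0 := ⟨fun _ => 0, differentiableOn_const _, rfl, by simp⟩

theorem ord_const (c : ℂ) : Ord 0 (fun _ => c) c := ⟨fun _ => c, differentiableOn_const _, rfl, by simp⟩

theorem ord_qq (k : ℤ) : Ord k (fun z => qq z ^ k) 1 :=
  ⟨fun _ => 1, differentiableOn_const _, rfl, by simp⟩

theorem Ord.lower {k : ℤ} {f : ℂ → ℂ} {c : ℂ} (hf : Ord k f c) : Ord (k - 1) f 0 := by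
  obtain ⟨A, h1, h2, h3⟩ := hf
  refine ⟨fun q => q * A q, differentiableOn_id.mul h1, by simp, fun z hz => ?_⟩
  rw [h3 z hz, zpow_sub_one₀ (qq_ne z)]
  field_simp [qq_ne z]

theorem Ord.raise {k : ℤ} {f : ℂ → ℂ} (hf : Ord k f 0) : ∃ c, Ord (k + 1) f c := by
  obtain ⟨A, h1, h2, h3⟩ := hf
  refine ⟨_, dslope A 0, (differentiableOn_dslope (Metric.isOpen_ball.mem_nhds (by simp))).2 h1, rfl, fun z hz => ?_⟩
  rw [h3 z hz, zpow_add_one₀ (qq_ne z), dslope_of_ne _ (qq_ne z), slope_def_field, h2]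
  field_simp [qq_ne z]; ring

theorem Ord.pow {k : ℤ} {f : ℂ → ℂ} {c : ℂ} (hf : Ord k f c) (n : ℕ) :
    Ord (n * k) (fun z => f z ^ n) (c ^ n) := by
  obtain ⟨A, h1, h2, h3⟩ := hf
  refine ⟨fun q => A q ^ n, h1.pow n, by simp only [h2], fun z hz => ?_⟩
  beta_reduce; rw [h3 z hz, mul_pow, mul_comm (n:ℤ) k, zpow_mul, zpow_natCast]

theorem Ord.inv {k : ℤ} {f : ℂ → ℂ} {c : ℂ} (hf : Ord k f c) (hc : c ≠ 0)
    (hn : ∀ z : ℂ, 0 < z.im → f z ≠ 0) : Ord (-k) (fun z => (f z)⁻¹) c⁻¹ := by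
  obtain ⟨A, h1, h2, h3⟩ := hf
  refine ⟨fun q => (A q)⁻¹, h1.inv fun q hq => ?_, by simp only [h2], fun z hz => ?_⟩
  · by_cases h0 : q = 0
    · rw [h0, h2]; exact hc
    · obtain ⟨z, hz, rfl⟩ := exists_qq h0 (by simpa using hq)
      intro h; exact hn z hz (by rw [h3 z hz, h, mul_zero])
  · beta_reduce; rw [h3 z hz, mul_inv, zpow_neg]

theorem Ord.diff {k : ℤ} {f : ℂ → ℂ} {c : ℂ} (hf : Ord k f c) : DifferentiableOn ℂ f {z | 0 < z.im} := by
  obtain ⟨A, h1, h2, h3⟩ := hf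
  refine DifferentiableOn.congr (f := fun z => qq z ^ k * A (qq z)) ?_ h3
  refine DifferentiableOn.mul ?_ (h1.comp differentiable_qq.differentiableOn fun z hz => qq_mem hz)
  exact DifferentiableOn.zpow differentiable_qq.differentiableOn (Or.inl fun z _ => qq_ne z)

theorem Ord.periodic {k : ℤ} {f : ℂ → ℂ} {c : ℂ} (hf : Ord k f c) {z : ℂ} (hz : 0 < z.im) : f (z + 1) = f z := by
  obtain ⟨A, h1, h2, h3⟩ := hf
  rw [h3 z hz, h3 (z+1) (by simpa using hz), qq_add_one]

theorem Ord.bound {k : ℤ} {f : ℂ → ℂ} {c : ℂ} (hf : Ord k f c) :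
    ∃ C : ℝ, 0 ≤ C ∧ ∀ z : ℂ, 1 / 2 ≤ z.im → ‖f z‖ ≤ C * Real.exp (-(2 * Real.pi * k * z.im)) := by
  obtain ⟨A, h1, h2, h3⟩ := hf
  set R := Real.exp (-Real.pi)
  have hR : R < 1 := by rw [Real.exp_lt_one_iff]; linarith [Real.pi_pos]
  obtain ⟨C, hC⟩ := (isCompact_closedBall (0:ℂ) R).exists_bound_of_continuousOn
    (h1.continuousOn.mono (Metric.closedBall_subset_ball hR))
  refine ⟨C, (norm_nonneg _).trans (hC 0 (by simp [R, Real.exp_nonneg])), fun z hz => ?_⟩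
  have hz0 : 0 < z.im := by linarith
  rw [h3 z hz0, norm_mul, norm_zpow, norm_qq, mul_comm, ← Real.rpow_intCast, ← Real.exp_mul, mul_comm _ (k:ℝ)]
  rw [show (k:ℝ) * -(2 * Real.pi * z.im) = -(2 * Real.pi * k * z.im) by ring]
  refine mul_le_mul_of_nonneg_right (hC _ ?_) (Real.exp_nonneg _)
  simp only [mem_closedBall_zero_iff, norm_qq, R, Real.exp_le_exp]
  nlinarith [Real.pi_pos]

theorem ord_ps {a : ℕ → ℂ} (ha : PolyB a) : Ord 0 (fun z => ps a (qq z)) (a 0) :=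
  ⟨ps a, ps_diff ha, ps_zero a, by simp⟩

theorem ord_ps_one {a : ℕ → ℂ} (ha : PolyB a) : Ord 1 (fun z => ps a (qq z) - a 0) (a 1) :=
  ⟨ps (fun n => a (n + 1)), ps_diff ha.shift, ps_zero _, fun z hz => by
    beta_reduce; rw [ps_shift ha (norm_qq_lt hz)]; simp⟩

theorem ord_E2 : Ord 0 E2 1 := ord_ps (sc_polyB 1 (-24))
theorem ord_E4 : Ord 0 E4 1 := ord_ps (sc_polyB 3 240)
theorem ord_E6 : Ord 0 E6 1 := ord_ps (sc_polyB 5 (-504))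
theorem ord_E2_one : Ord 1 (fun z => E2 z - 1) (-24) := by
  have := ord_ps_one (sc_polyB 1 (-24)); simp [sc] at this; exact this
theorem ord_E4_one : Ord 1 (fun z => E4 z - 1) 240 := by
  have := ord_ps_one (sc_polyB 3 240); simp [sc] at this; exact this
theorem ord_E6_one : Ord 1 (fun z => E6 z - 1) (-504) := by
  have := ord_ps_one (sc_polyB 5 (-504)); simp [sc] at this; exact this

theorem Ord.mul_one {f g : ℂ → ℂ} {c d c1 d1 : ℂ} (hf : Ord 0 f c) (hf1 : Ord 1 (fun z => f z - c) c1)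
    (hg1 : Ord 1 (fun z => g z - d) d1) : Ord 1 (fun z => f z * g z - c * d) (c * d1 + d * c1) := by
  have h1 := hf.mul hg1
  have h2 := hf1.const_mul d
  rw [zero_add] at h1
  exact (h1.add h2).congr fun z _ => by ring

theorem ord_Dl : Ord 1 Dl 1 := by
  have h4 := ord_E4.mul_one ord_E4_one ord_E4_one
  have h44 := ord_E4.mul_one ord_E4_one h4
  have h6 := ord_E6.mul_one ord_E6_one ord_E6_one
  have := (h44.sub h6).const_mul (1 / 1728)
  norm_num at this
  exact this.congr fun z _ => by rw [Dl]; ring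

theorem ord_Dl_inv : Ord (-1) (fun z => (Dl z)⁻¹) 1 := by
  simpa using ord_Dl.inv one_ne_zero fun z hz => Dl_ne hz

/-- the `j`-function -/
def Jf (z : ℂ) : ℂ := E4 z ^ 3 * (Dl z)⁻¹

theorem ord_Jf : Ord (-1) Jf 1 := by
  have := (ord_E4.pow 3).mul ord_Dl_inv
  norm_num at this
  exact this

theorem Jf_S {z : ℂ} (hz : 0 < z.im) : Jf (-1 / z) = Jf z := by
  have hz0 : z ≠ 0 := by rintro rfl; simp at hz
  rw [Jf, Jf, E4_S hz, Dl_S hz]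
  field_simp [Dl_ne hz]

/-- weakly holomorphic modular form of weight `-w` with expansion of order `k` -/
structure WM (w : ℕ) (k : ℤ) (f : ℂ → ℂ) (c : ℂ) : Prop where
  ord : Ord k f c
  S : ∀ z : ℂ, 0 < z.im → z ^ w * f (-1 / z) = f z

theorem wm_J {w : ℕ} {k : ℤ} {f : ℂ → ℂ} {c : ℂ} (h : WM w k f c) (n : ℕ) :
    WM w (k - n) (fun z => f z * Jf z ^ n) c := by
  constructor
  · have := h.ord.mul (ord_Jf.pow n)
    simp only [one_pow, _root_.mul_one] at this
    rwa [show k + n * (-1:ℤ) = k - n by ring] at this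
  · intro z hz; simp only [Jf_S hz]; rw [← mul_assoc, h.S z hz]

theorem wm_8 : WM 8 (-1) (fun z => E4 z * (Dl z)⁻¹) 1 := by
  constructor
  · simpa using ord_E4.mul ord_Dl_inv
  · intro z hz
    have hz0 : z ≠ 0 := by rintro rfl; simp at hz
    simp only [E4_S hz, Dl_S hz]; field_simp [Dl_ne hz]

theorem wm_10 : WM 10 (-2) (fun z => E4 z ^ 2 * E6 z * (Dl z)⁻¹ ^ 2) 1 := by
  constructor
  · simpa using ((ord_E4.pow 2).mul ord_E6).mul (ord_Dl_inv.pow 2)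
  · intro z hz
    have hz0 : z ≠ 0 := by rintro rfl; simp at hz
    simp only [E4_S hz, E6_S hz, Dl_S hz]; field_simp [Dl_ne hz]

theorem wm_12 : WM 12 (-1) (fun z => (Dl z)⁻¹) 1 := by
  constructor
  · simpa using ord_Dl_inv
  · intro z hz
    have hz0 : z ≠ 0 := by rintro rfl; simp at hz
    simp only [Dl_S hz]; field_simp [Dl_ne hz]

theorem wm_14 : WM 14 (-2) (fun z => E4 z * E6 z * (Dl z)⁻¹ ^ 2) 1 := by
  constructor
  · simpa using ((ord_E4).mul ord_E6).mul (ord_Dl_inv.pow 2)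
  · intro z hz
    have hz0 : z ≠ 0 := by rintro rfl; simp at hz
    simp only [E4_S hz, E6_S hz, Dl_S hz]; field_simp [Dl_ne hz]

/-- The elimination lemma -/
theorem elimination (V : (ℂ → ℂ) → (ℂ → ℂ) → (ℂ → ℂ) → Prop)
    (h0 : V (fun _ => 0) (fun _ => 0) (fun _ => 0))
    (hadd : ∀ x y w x' y' w', V x y w → V x' y' w' →
      V (fun z => x z + x' z) (fun z => y z + y' z) (fun z => w z + w' z))
    (hex : ∀ N : ℕ, ∀ c1 c2 c3 : ℂ, ∃ x y w, V x y w ∧ Ord (-(N + 2 : ℕ)) x c1 ∧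
      Ord (-(N + 2 : ℕ)) y c2 ∧ Ord (-(N + 2 : ℕ)) w c3) :
    ∀ N : ℕ, ∀ t1 t2 t3 : ℂ → ℂ, ∀ c1 c2 c3 : ℂ, Ord (-(N + 1 : ℕ)) t1 c1 → Ord (-(N + 1 : ℕ)) t2 c2 →
      Ord (-(N + 1 : ℕ)) t3 c3 → ∃ x y w, V x y w ∧ (∃ d1, Ord (-1) (fun z => t1 z - x z) d1) ∧
        (∃ d2, Ord (-1) (fun z => t2 z - y z) d2) ∧ (∃ d3, Ord (-1) (fun z => t3 z - w z) d3) := by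
  intro N
  induction N with
  | zero =>
    intro t1 t2 t3 c1 c2 c3 h1 h2 h3
    exact ⟨_, _, _, h0, ⟨c1, by simpa using h1⟩, ⟨c2, by simpa using h2⟩, ⟨c3, by simpa using h3⟩⟩
  | succ N ih =>
    intro t1 t2 t3 c1 c2 c3 h1 h2 h3
    obtain ⟨x, y, w, hV, hx, hy, hw⟩ := hex N c1 c2 c3
    have key : ∀ t u c, Ord (-(N + 1 + 1 : ℕ)) t c → Ord (-(N + 2 : ℕ)) u c →
        ∃ d, Ord (-(N + 1 : ℕ)) (fun z => t z - u z) d := by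
      intro t u c ht hu
      have := ht.sub hu
      rw [sub_self] at this
      obtain ⟨d, hd⟩ := this.raise
      refine ⟨d, ?_⟩
      rwa [show (-((N + 1 + 1 : ℕ):ℤ) + 1) = -((N + 1 : ℕ):ℤ) by push_cast; ring] at hd
    obtain ⟨e1, he1⟩ := key _ _ _ h1 hx
    obtain ⟨e2, he2⟩ := key _ _ _ h2 hy
    obtain ⟨e3, he3⟩ := key _ _ _ h3 hw
    obtain ⟨x', y', w', hV', ⟨d1, g1⟩, ⟨d2, g2⟩, ⟨d3, g3⟩⟩ := ih _ _ _ _ _ _ he1 he2 he3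
    exact ⟨_, _, _, hadd _ _ _ _ _ _ hV hV', ⟨d1, g1.congr fun z _ => by ring⟩,
      ⟨d2, g2.congr fun z _ => by ring⟩, ⟨d3, g3.congr fun z _ => by ring⟩⟩

end I24
end B3

section B4
namespace I24
open Complex Filter Topology MeasureTheory Set

/-- linear transformation law in the even case -/
def VP (x y w : ℂ → ℂ) : Prop := ∀ z : ℂ, 0 < z.im →
  z ^ 10 * x (-1 / z) = z ^ 2 * x z + kap * z * y z + kap ^ 2 * w z

theorem VP.add {x y w x' y' w' : ℂ → ℂ} (h : VP x y w) (h' : VP x' y' w') :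
    VP (fun z => x z + x' z) (fun z => y z + y' z) (fun z => w z + w' z) := by
  intro z hz; beta_reduce; linear_combination h z hz + h' z hz

theorem VP.smul {x y w : ℂ → ℂ} (h : VP x y w) (s : ℂ) :
    VP (fun z => s * x z) (fun z => s * y z) (fun z => s * w z) := by
  intro z hz; beta_reduce; linear_combination s * h z hz

theorem vp_zero : VP (fun _ => 0) (fun _ => 0) (fun _ => 0) := by intro z hz; simp

theorem vp0 {k c f} (h : WM 8 k f c) : VP f (fun _ => 0) (fun _ => 0) := by
  intro z hz; beta_reduce; linear_combination z ^ 2 * h.S z hz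

theorem vp1 {k c f} (h : WM 10 k f c) : VP (fun z => f z * E2 z) f (fun _ => 0) := by
  intro z hz; beta_reduce; rw [E2_S hz]; linear_combination (z ^ 2 * E2 z + kap * z) * h.S z hz

theorem vp2 {k c f} (h : WM 12 k f c) : VP (fun z => f z * E2 z ^ 2) (fun z => 2 * (f z * E2 z)) f := by
  intro z hz; beta_reduce; rw [E2_S hz]
  linear_combination (z * E2 z + kap) ^ 2 * h.S z hz

theorem ord_E2_sq : Ord 0 (fun z => E2 z ^ 2) 1 := by simpa using ord_E2.pow 2

theorem vp_exists (N : ℕ) (c1 c2 c3 : ℂ) : ∃ x y w, VP x y w ∧ Ord (-(N + 2 : ℕ)) x c1 ∧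
      Ord (-(N + 2 : ℕ)) y c2 ∧ Ord (-(N + 2 : ℕ)) w c3 := by
  have w8 := wm_J wm_8 (N + 1)
  have w10 := wm_J wm_10 N
  have w12 := wm_J wm_12 (N + 1)
  rw [show (-1 - ((N + 1 : ℕ):ℤ)) = -((N + 2 : ℕ) : ℤ) by push_cast; ring] at w8 w12
  rw [show (-2 - (N:ℤ)) = -((N + 2 : ℕ) : ℤ) by push_cast; ring] at w10
  refine ⟨_, _, _, (((vp0 w8).smul (c1 - c2 + c3)).add ((vp1 w10).smul (c2 - 2 * c3))).add
    ((vp2 w12).smul c3), ?_, ?_, ?_⟩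
  · have h1 := w8.ord.const_mul (c1 - c2 + c3)
    have h2 := (w10.ord.mul ord_E2).const_mul (c2 - 2 * c3)
    have h3 := (w12.ord.mul ord_E2_sq).const_mul c3
    rw [add_zero] at h2 h3
    have := (h1.add h2).add h3
    ring_nf at this ⊢
    exact this
  · have h2 := w10.ord.const_mul (c2 - 2 * c3)
    have h3 := ((w12.ord.mul ord_E2).const_mul 2).const_mul c3
    rw [add_zero] at h3
    have := ((ord_zero (-((N + 2 : ℕ) : ℤ))).const_mul (c1 - c2 + c3)).add h2 |>.add h3
    ring_nf at this ⊢
    exact this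
  · have h3 := w12.ord.const_mul c3
    have := (((ord_zero (-((N + 2 : ℕ) : ℤ))).const_mul (c1 - c2 + c3)).add
      ((ord_zero (-((N + 2 : ℕ) : ℤ))).const_mul (c2 - 2 * c3))).add h3
    ring_nf at this ⊢
    exact this

theorem gs_qq (z : ℂ) (m : ℕ) : gs z (-(2 * m)) = qq z ^ (-(m:ℤ)) := by
  rw [gs, qq, ← Complex.exp_int_mul]; congr 1; push_cast; ring

/-- Any prescribed principal parts can be matched. -/
theorem vp_match (m : ℕ) (hm : 2 ≤ m) (s t : ℂ) : ∃ x y w, VP x y w ∧ (∃ c, Ord 1 x c) ∧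
    (∃ c, Ord (-1) (fun z => s * qq z ^ (-(m:ℤ)) - y z) c) ∧
    (∃ c, Ord (-1) (fun z => t * qq z ^ (-(m:ℤ)) - w z) c) := by
  obtain ⟨N, rfl⟩ : ∃ N, m = N + 1 := ⟨m - 1, by omega⟩
  obtain ⟨x, y, w, hV, ⟨d1, h1⟩, h2, h3⟩ := elimination VP vp_zero (fun _ _ _ _ _ _ h h' => h.add h') vp_exists N
    (fun _ => 0) (fun z => s * qq z ^ (-((N + 1 : ℕ):ℤ))) (fun z => t * qq z ^ (-((N + 1 : ℕ):ℤ))) _ _ _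
    (ord_zero _) ((ord_qq _).const_mul s) ((ord_qq _).const_mul t)
  -- kill the `q^{-1}` coefficient of `x`
  have w8 := wm_8
  have hx1 : Ord (-1) (fun z => x z + d1 * (E4 z * (Dl z)⁻¹)) 0 := by
    have := (h1.const_mul (-1)).add (w8.ord.const_mul d1)
    ring_nf at this
    exact this.congr fun z _ => by ring
  obtain ⟨d0, hx0⟩ := hx1.raise
  rw [show (-1:ℤ) + 1 = 0 by norm_num] at hx0
  have hV1 := hV.add ((vp0 w8).smul d1)
  -- the element `(E2² - E4)/Δ`
  have hV2 := (vp2 wm_12).add ((vp0 wm_8).smul (-1))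
  have ho : Ord 0 (fun z => (Dl z)⁻¹ * E2 z ^ 2 + -1 * (E4 z * (Dl z)⁻¹)) (-288) := by
    have a1 := (ord_E2.mul_one ord_E2_one ord_E2_one).sub ord_E4_one
    have a2 := a1.mul ord_Dl_inv
    norm_num at a2
    exact a2.congr fun z _ => by ring
  refine ⟨_, _, _, hV1.add (hV2.smul (d0 / 288)), ?_, ?_, ?_⟩
  · have := hx0.add (ho.const_mul (d0 / 288))
    rw [show d0 + d0 / 288 * -288 = 0 by ring] at this
    obtain ⟨c, hc⟩ := this.raise
    exact ⟨c, by simpa using hc⟩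
  · obtain ⟨d, hd⟩ := h2
    have := hd.sub (((ord_Dl_inv.mul ord_E2).const_mul 2).const_mul (d0 / 288))
    exact ⟨_, this.congr fun z _ => by ring⟩
  · obtain ⟨d, hd⟩ := h3
    have := hd.sub (ord_Dl_inv.const_mul (d0 / 288))
    exact ⟨_, this.congr fun z _ => by ring⟩

theorem kap_ne : kap ≠ 0 := by
  rw [kap]; simp [Real.pi_ne_zero]

theorem poly_exp_bound {y : ℝ} (hy : 0 ≤ y) : (1 + y) ^ 2 ≤ 2 * Real.exp (2 * Real.pi * y) := by
  have h1 := Real.quadratic_le_exp_of_nonneg (x := 2 * y) (by linarith)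
  have h2 : Real.exp (2 * y) ≤ Real.exp (2 * Real.pi * y) := by
    rw [Real.exp_le_exp]; nlinarith [Real.pi_gt_three]
  nlinarith [sq_nonneg y]

theorem norm_le_strip {z : ℂ} (hz : 1 ≤ z.im) (hr : |z.re| ≤ 1) : ‖z‖ ≤ 1 + z.im := by
  have := Complex.norm_le_abs_re_add_abs_im z
  rw [abs_of_nonneg (by linarith : 0 ≤ z.im)] at this
  linarith

theorem eig_plus (m : ℕ) (hm : 2 ≤ m) (δ δ' : ℂ) : ∃ g : SchwartzMap E24 ℂ, IsRadial g ∧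
    (∀ x, FT g x = 1 * g x) ∧ ∀ n : ℕ, 2 ≤ n → radVal g (Real.sqrt (2 * n)) = (if n = m then -δ else 0) ∧
      radDeriv g (Real.sqrt (2 * n)) = 2 * Real.sqrt (2 * n) * (Real.pi * I * (if n = m then -δ' else 0)) := by
  obtain ⟨x, y, w, hV, ⟨c, hx⟩, ⟨c2, hy⟩, ⟨c3, hw⟩⟩ := vp_match m hm (δ / kap) (-δ' / kap ^ 2)
  obtain ⟨C, hC, hxb⟩ := hx.bound
  obtain ⟨C2, hC2, hyb⟩ := hy.bound
  obtain ⟨C3, hC3, hwb⟩ := hw.bound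
  have hk := kap_ne
  have hpi := Real.pi_pos
  have hyd : Ord (-(m:ℤ)) (fun z => y z) ((δ / kap) * 1 - 0) := by
    have hl : ∀ j : ℕ, ∃ d, Ord (-1 - (j+1:ℕ)) (fun z => δ / kap * qq z ^ (-(m:ℤ)) - y z) d ∧ d = 0 := by
      intro j
      induction j with
      | zero => exact ⟨_, by simpa using hy.lower, rfl⟩
      | succ j ih =>
        obtain ⟨d, hd, rfl⟩ := ih
        refine ⟨0, ?_, rfl⟩
        have := hd.lower
        push_cast at this ⊢
        ring_nf at this ⊢
        exact this
    obtain ⟨d, hd, rfl⟩ := hl (m - 2)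
    rw [show (-1 - ((m - 2 + 1 : ℕ):ℤ)) = -(m:ℤ) by omega] at hd
    exact (((ord_qq (-(m:ℤ))).const_mul (δ / kap)).sub hd).congr fun z _ => by ring
  have hwd : ∀ z : ℂ, 0 < z.im → w (z + 1) = w z := by
    intro z hz
    have := hw.periodic hz
    rw [qq_add_one] at this
    linear_combination -this
  have hxp : ∀ z : ℂ, 0 < z.im → x (z + 1) = x z := fun z hz => hx.periodic hz
  have hyp : ∀ z : ℂ, 0 < z.im → y (z + 1) = y z := fun z hz => hyd.periodic hz
  have him : ∀ z : ℂ, (z + 1).im = z.im := by simp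
  have him' : ∀ z : ℂ, (z - 1).im = z.im := by simp
  have hkz : ∀ z : ℂ, 0 < z.im → (z + 1) ^ 10 * x (-1 / (z + 1)) =
      (z + 1) ^ 2 * x z + kap * (z + 1) * y z + kap ^ 2 * w z := by
    intro z hz
    have := hV (z + 1) (by rwa [him])
    rw [hxp z hz, hyp z hz, hwd z hz] at this
    exact this
  have hkz' : ∀ z : ℂ, 0 < z.im → (z - 1) ^ 10 * x (-1 / (z - 1)) =
      (z - 1) ^ 2 * x z + kap * (z - 1) * y z + kap ^ 2 * w z := by
    intro z hz
    have hz' : 0 < (z - 1).im := by rwa [him']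
    have := hV (z - 1) hz'
    rw [← hxp (z - 1) hz', ← hyp (z-1) hz', ← hwd (z-1) hz', sub_add_cancel] at this
    exact this
  have hexp : ∀ z : ℂ, 1 ≤ z.im → Real.exp (-(2 * Real.pi * ((-1 : ℤ) : ℝ) * z.im)) ≤ Real.exp (3 * Real.pi * z.im) := by
    intro z hz
    rw [Real.exp_le_exp]; push_cast; nlinarith [mul_pos hpi (by linarith : 0 < z.im)]
  have hexp1 : ∀ z : ℂ, 1 ≤ z.im → |z.re| ≤ 1 → ∀ p : ℂ, ‖p‖ ≤ 3 * (1 + z.im) ^ 2 →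
      ‖p * x z‖ ≤ 6 * C * Real.exp (3 * Real.pi * z.im) := by
    intro z hz hr p hp
    have h1 := hxb z (by linarith)
    have h2 := poly_exp_bound (y := z.im) (by linarith)
    rw [norm_mul]
    calc ‖p‖ * ‖x z‖ ≤ (3 * (2 * Real.exp (2 * Real.pi * z.im))) * (C * Real.exp (-(2 * Real.pi * ((1:ℤ):ℝ) * z.im))) := by
          gcongr; exact hp.trans (by gcongr)
      _ = 6 * C * (Real.exp (2 * Real.pi * z.im) * Real.exp (-(2 * Real.pi * ((1:ℤ):ℝ) * z.im))) := by ring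
      _ = 6 * C * 1 := by rw [← Real.exp_add]; simp
      _ ≤ _ := by gcongr; exact Real.one_le_exp (by nlinarith [mul_pos hpi (by linarith : 0 < z.im)])
  refine eigen_exists (ε := 1) (by norm_num) (h := x) (k := fun z => z ^ 10 * x (-1 / z)) hx.diff (C := C) hC ?_ ?_
    (fun z _ => rfl) ?_ (m := m) (δ := δ) (δ' := δ') (C1 := 6 * C + ‖kap‖ * C2 + ‖kap‖ ^ 2 * C3) ?_ ?_
  · intro z hz
    refine (hxb z hz).trans ?_
    gcongr
    push_cast
    nlinarith [mul_pos hpi (by linarith : 0 < z.im)]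
  · intro z hz; rw [hxp z hz, one_mul]
  · intro z hz
    rw [hkz z hz, hkz' z hz, hV z hz]; ring
  · intro z hz hr
    have hz0 : 0 < z.im := by linarith
    have hB := (hyb z (by linarith)).trans (mul_le_mul_of_nonneg_left (hexp z hz) hC2)
    have hX := hexp1 z hz hr (2 * z + 1) (by
      have := norm_le_strip hz hr
      refine (norm_add_le _ _).trans ?_
      rw [norm_mul]; norm_num
      nlinarith)
    rw [hkz z hz0, hV z hz0, gs_qq]
    have e : (z + 1) ^ 2 * x z + kap * (z + 1) * y z + kap ^ 2 * w z - (z ^ 2 * x z + kap * z * y z + kap ^ 2 * w z)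
        - δ * qq z ^ (-(m:ℤ)) = (2 * z + 1) * x z - kap * (δ / kap * qq z ^ (-(m:ℤ)) - y z) := by
      field_simp; ring
    rw [e]
    refine (norm_sub_le _ _).trans ?_
    rw [norm_mul kap]
    have := mul_le_mul_of_nonneg_left hB (norm_nonneg kap)
    have h9 : 0 ≤ ‖kap‖ ^ 2 * C3 * Real.exp (3 * Real.pi * z.im) := by positivity
    linarith
  · intro z hz hr
    have hz0 : 0 < z.im := by linarith
    have hB := (hwb z (by linarith)).trans (mul_le_mul_of_nonneg_left (hexp z hz) hC3)
    have hX := hexp1 z hz hr (z ^ 2 + z) (by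
      have := norm_le_strip hz hr
      refine (norm_add_le _ _).trans ?_
      rw [norm_pow]
      nlinarith [norm_nonneg z])
    rw [hkz z hz0, hV z hz0, gs_qq]
    have e : z * ((z + 1) ^ 2 * x z + kap * (z + 1) * y z + kap ^ 2 * w z - (z ^ 2 * x z + kap * z * y z + kap ^ 2 * w z))
        - (z ^ 2 * x z + kap * z * y z + kap ^ 2 * w z)
        - δ' * qq z ^ (-(m:ℤ)) = (z ^ 2 + z) * x z + kap ^ 2 * (-δ' / kap ^ 2 * qq z ^ (-(m:ℤ)) - w z) := by
      field_simp; ring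
    rw [e]
    refine (norm_add_le _ _).trans ?_
    rw [norm_mul (kap ^ 2), norm_pow]
    have := mul_le_mul_of_nonneg_left hB (by positivity : 0 ≤ ‖kap‖ ^ 2)
    have h9 : 0 ≤ ‖kap‖ * C2 * Real.exp (3 * Real.pi * z.im) := by positivity
    linarith

end I24
end B4

section B5
namespace I24
open Complex Filter Topology MeasureTheory Set
open ArithmeticFunction

theorem PolyB.add {a b : ℕ → ℂ} (ha : PolyB a) (hb : PolyB b) : PolyB (fun n => a n + b n) := by
  obtain ⟨C, A, hC, h⟩ := ha
  obtain ⟨D, B, hD, g⟩ := hb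
  refine ⟨C + D, A + B, by positivity, fun n => (norm_add_le _ _).trans ?_⟩
  have h1 : (1:ℝ) ≤ (n:ℝ) + 1 := by linarith [(Nat.cast_nonneg n : (0:ℝ) ≤ n)]
  have h2 : ((n:ℝ) + 1) ^ A ≤ ((n:ℝ) + 1) ^ (A + B) := pow_le_pow_right₀ h1 (by omega)
  have h3 : ((n:ℝ) + 1) ^ B ≤ ((n:ℝ) + 1) ^ (A + B) := pow_le_pow_right₀ h1 (by omega)
  nlinarith [h n, g n, mul_le_mul_of_nonneg_left h2 hC, mul_le_mul_of_nonneg_left h3 hD]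

theorem PolyB.const_mul {a : ℕ → ℂ} (ha : PolyB a) (s : ℂ) : PolyB (fun n => s * a n) := by
  obtain ⟨C, A, hC, h⟩ := ha
  refine ⟨‖s‖ * C, A, by positivity, fun n => ?_⟩
  rw [norm_mul, mul_assoc]; exact mul_le_mul_of_nonneg_left (h n) (norm_nonneg s)

theorem PolyB.nat_mul {a : ℕ → ℂ} (ha : PolyB a) : PolyB (fun n => n * a n) := by
  obtain ⟨C, A, hC, h⟩ := ha
  refine ⟨C, A + 1, hC, fun n => ?_⟩
  have : (0:ℝ) ≤ n := Nat.cast_nonneg n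
  rw [norm_mul, norm_natCast]
  calc (n:ℝ) * ‖a n‖ ≤ (n + 1) * (C * ((n:ℝ) + 1) ^ A) := by gcongr; linarith; exact h n
    _ = _ := by ring

theorem PolyB.of_le {a b : ℕ → ℂ} (ha : PolyB a) (h : ∀ n, ‖b n‖ ≤ ‖a n‖) : PolyB b := by
  obtain ⟨C, A, hC, h'⟩ := ha
  exact ⟨C, A, hC, fun n => (h n).trans (h' n)⟩

theorem PolyB.even {a : ℕ → ℂ} (ha : PolyB a) : PolyB (fun n => a (2 * n)) := by
  obtain ⟨C, A, hC, h⟩ := ha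
  refine ⟨C * 2 ^ A, A, by positivity, fun n => (h _).trans ?_⟩
  rw [mul_assoc, ← mul_pow]
  gcongr; push_cast; linarith [(Nat.cast_nonneg n : (0:ℝ) ≤ n)]

theorem PolyB.odd {a : ℕ → ℂ} (ha : PolyB a) : PolyB (fun n => a (2 * n + 1)) := by
  simpa using ha.shift.even

theorem ps_add {a b : ℕ → ℂ} (ha : PolyB a) (hb : PolyB b) {q : ℂ} (h : ‖q‖ < 1) :
    ps (fun n => a n + b n) q = ps a q + ps b q := by
  have := (ha.hasSum h).add (hb.hasSum h)
  rw [← this.tsum_eq, ps]; exact tsum_congr fun n => by ring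

theorem ps_const_mul (a : ℕ → ℂ) (s q : ℂ) : ps (fun n => s * a n) q = s * ps a q := by
  rw [ps, ps, ← tsum_mul_left]; exact tsum_congr fun n => by ring

theorem ps_even_odd {a : ℕ → ℂ} (ha : PolyB a) {r : ℂ} (h : ‖r‖ < 1) :
    ps a r = ps (fun n => a (2 * n)) (r ^ 2) + r * ps (fun n => a (2 * n + 1)) (r ^ 2) := by
  have h2 : ‖r ^ 2‖ < 1 := by rw [norm_pow]; nlinarith [norm_nonneg r]
  have h1 := ha.even.hasSum h2
  have h3 := (ha.odd.hasSum h2).mul_left r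
  have := HasSum.even_add_odd (f := fun n => a n * r ^ n) (by simpa only [pow_mul] using h1) (by
    refine h3.congr_fun fun n => ?_
    rw [pow_succ, pow_mul]; ring)
  exact this.tsum_eq

theorem hasDerivAt_ps {a : ℕ → ℂ} (ha : PolyB a) {q : ℂ} (hq : ‖q‖ < 1) :
    HasDerivAt (ps a) (ps (fun n => (n + 1 : ℕ) * a (n + 1)) q) q := by
  obtain ⟨r, hr0, hr1⟩ := exists_between hq
  have hr : 0 ≤ r := (norm_nonneg q).trans hr0.le
  have hs := ((ha.nat_mul.shift).summable hr hr1)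
  have hs' : Summable (fun n : ℕ => ‖(n:ℂ) * a n‖ * r ^ (n - 1)) := by
    rw [← summable_nat_add_iff 1]; simpa using hs
  have := hasDerivAt_tsum_of_isPreconnected (g := fun n q => a n * q ^ n) (g' := fun n q => a n * (n * q ^ (n-1)))
    (t := Metric.ball (0:ℂ) r) (y₀ := q) (y := q) hs' Metric.isOpen_ball (convex_ball _ _).isPreconnected
    (fun n y hy => (hasDerivAt_pow n y).const_mul (a n)) (fun n y hy => by
      have : ‖y‖ < r := by simpa using hy
      rw [norm_mul, norm_mul, norm_mul, norm_pow]
      calc ‖a n‖ * (‖(n:ℂ)‖ * ‖y‖ ^ (n-1)) = ‖(n:ℂ)‖ * ‖a n‖ * ‖y‖ ^ (n-1) := by ring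
        _ ≤ _ := by gcongr)
    (by simpa using hr0) (ha.hasSum hq).summable (by simpa using hr0)
  refine this.congr_deriv ?_
  have hs2 : Summable (fun n : ℕ => a n * (n * q ^ (n-1))) := by
    refine Summable.of_norm_bounded hs' fun n => ?_
    rw [norm_mul, norm_mul, norm_mul, norm_pow]
    calc ‖a n‖ * (‖(n:ℂ)‖ * ‖q‖ ^ (n-1)) = ‖(n:ℂ)‖ * ‖a n‖ * ‖q‖ ^ (n-1) := by ring
      _ ≤ _ := by gcongr
  rw [hs2.tsum_eq_zero_add, ps]
  simp only [Nat.cast_zero, zero_mul, mul_zero, zero_add, Nat.add_sub_cancel]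
  exact tsum_congr fun n => by ring

theorem hasDerivAt_ps_qq {a : ℕ → ℂ} (ha : PolyB a) {z : ℂ} (hz : 0 < z.im) :
    HasDerivAt (fun z => ps a (qq z)) (2 * Real.pi * I * ps (fun n => n * a n) (qq z)) z := by
  refine ((hasDerivAt_ps ha (norm_qq_lt hz)).comp z (hasDerivAt_qq z)).congr_deriv ?_
  rw [ps_shift ha.nat_mul (norm_qq_lt hz)]
  simp; ring

/-- `e^{πiz}` -/
def rr (z : ℂ) : ℂ := cexp (Real.pi * I * z)

theorem rr_sq (z : ℂ) : rr z ^ 2 = qq z := by rw [rr, qq, ← Complex.exp_nat_mul]; congr 1; push_cast; ring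
theorem qq_half (z : ℂ) : qq (z / 2) = rr z := by rw [rr, qq]; congr 1; ring
theorem rr_add_one (z : ℂ) : rr (z + 1) = - rr z := by
  rw [rr, mul_add, Complex.exp_add, mul_one, Complex.exp_pi_mul_I, rr]; ring
theorem qq_half' (z : ℂ) : qq ((z + 1) / 2) = - rr z := by rw [qq_half, rr_add_one]
theorem qq_two (z : ℂ) : qq (2 * z) = qq z ^ 2 := by
  rw [qq, qq, ← Complex.exp_nat_mul]; congr 1; push_cast; ring
theorem norm_rr (z : ℂ) : ‖rr z‖ = Real.exp (-(Real.pi * z.im)) := by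
  rw [rr, norm_exp]; congr 1; simp
theorem norm_rr_lt {z : ℂ} (hz : 0 < z.im) : ‖rr z‖ < 1 := by
  rw [norm_rr, Real.exp_lt_one_iff]; nlinarith [mul_pos Real.pi_pos hz]
theorem rr_ne (z : ℂ) : rr z ≠ 0 := Complex.exp_ne_zero _
theorem hasDerivAt_rr (z : ℂ) : HasDerivAt rr (Real.pi * I * rr z) z := by
  have := ((hasDerivAt_id' z).const_mul (Real.pi * I)).cexp
  exact this.congr_deriv (by rw [rr]; ring)

theorem sigma_two_pow (k j : ℕ) (hj : Odd j) : sigma 1 (2 ^ k * j) + sigma 1 j = 2 ^ (k + 1) * sigma 1 j := by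
  have hco : Nat.Coprime (2 ^ k) j := Nat.Coprime.pow_left _ (Nat.coprime_two_left.2 hj)
  rw [isMultiplicative_sigma.map_mul_of_coprime hco, sigma_one_apply_prime_pow Nat.prime_two, Nat.geomSum_eq le_rfl]
  have : 1 ≤ 2 ^ (k+1) := Nat.one_le_two_pow
  simp
  zify [this]; ring

theorem sigma_odd (n : ℕ) (hn : Odd n) : sigma 1 (2 * n) = 3 * sigma 1 n := by
  have := sigma_two_pow 1 n hn; norm_num at this; omega

theorem sigma_even (n : ℕ) (hn : n ≠ 0) : sigma 1 (2 * (2 * n)) + 2 * sigma 1 n = 3 * sigma 1 (2 * n) := by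
  obtain ⟨k, j, hj, rfl⟩ := Nat.exists_eq_two_pow_mul_odd hn
  have h0 := sigma_two_pow k j hj
  have h1 := sigma_two_pow (k+1) j hj
  have h2 := sigma_two_pow (k+2) j hj
  rw [show 2 * (2 ^ k * j) = 2 ^ (k+1) * j by ring, show 2 * (2 ^ (k+1) * j) = 2 ^ (k+2) * j by ring]
  simp only [pow_succ] at h0 h1 h2 ⊢
  nlinarith

theorem hecke {z : ℂ} (hz : 0 < z.im) : 4 * E2 (2 * z) + E2 (z / 2) + E2 ((z + 1) / 2) = 6 * E2 z := by
  have hp := sc_polyB 1 (-24)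
  have hr := norm_rr_lt hz
  have hq := norm_qq_lt hz
  simp only [E2, qq_half, rr_add_one, qq_two]
  rw [ps_even_odd hp hr, ps_even_odd hp (r := - rr z) (by rwa [norm_neg]), neg_sq, rr_sq]
  have hd : PolyB (fun n => 6 * sc 1 (-24) n + (-2) * sc 1 (-24) (2 * n)) := (hp.const_mul 6).add (hp.even.const_mul (-2))
  have e := ps_even_odd hd hq
  rw [ps_add (hp.const_mul 6) (hp.even.const_mul (-2)) hq, ps_const_mul, ps_const_mul] at e
  have e1 : (fun n => 6 * sc 1 (-24) (2 * n) + (-2) * sc 1 (-24) (2 * (2 * n))) = fun n => 4 * sc 1 (-24) n := by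
    ext n
    by_cases hn : n = 0
    · subst hn; simp [sc]; norm_num
    · have := sigma_even n hn
      simp only [sc, hn, if_false, mul_eq_zero, OfNat.ofNat_ne_zero, or_self]
      have h2 : ((sigma 1 (2 * (2 * n)) : ℕ) : ℂ) + 2 * (sigma 1 n : ℕ) = 3 * (sigma 1 (2 * n) : ℕ) := by exact_mod_cast this
      linear_combination 48 * h2
  have e2 : (fun n => 6 * sc 1 (-24) (2 * n + 1) + (-2) * sc 1 (-24) (2 * (2 * n + 1))) = fun n => 0 := by
    ext n
    have := sigma_odd (2 * n + 1) ⟨n, rfl⟩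
    have h2 : ((sigma 1 (2 * (2 * n + 1)) : ℕ) : ℂ) = 3 * (sigma 1 (2 * n + 1) : ℕ) := by exact_mod_cast this
    simp only [sc, Nat.add_eq_zero_iff, mul_eq_zero, one_ne_zero, OfNat.ofNat_ne_zero, and_false, or_self, if_false, h2]
    ring
  have e3 : ps (fun _ => 0) (qq z ^ 2) = 0 := by simp [ps]
  rw [e1, e2, ps_const_mul, e3] at e
  linear_combination -e

end I24
end B5

section B6
namespace I24
open Complex Filter Topology MeasureTheory Set
open ArithmeticFunction

def alc (n : ℕ) : ℂ := -2/3 * sc 1 (-24) (2 * n + 1)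
def fsc (n : ℕ) : ℂ := 4 * sc 1 (-24) n + (-2) * sc 1 (-24) (2 * n)
def lsc (n : ℕ) : ℂ := -alc n / (2 * n + 1)
def psc (n : ℕ) : ℂ := fsc n / (4 * n)

theorem alc_polyB : PolyB alc := (sc_polyB 1 (-24)).odd.const_mul (-2/3)
theorem fsc_polyB : PolyB fsc := ((sc_polyB 1 (-24)).const_mul 4).add ((sc_polyB 1 (-24)).even.const_mul (-2))
theorem lsc_polyB : PolyB lsc := alc_polyB.of_le fun n => by
  rw [lsc, norm_div, norm_neg]
  refine div_le_self (norm_nonneg _) ?_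
  rw [show (2 * (n:ℂ) + 1) = ((2 * n + 1 : ℕ) : ℂ) by push_cast; ring, norm_natCast]
  norm_cast; omega
theorem psc_polyB : PolyB psc := fsc_polyB.of_le fun n => by
  rw [psc, norm_div]
  rcases Nat.eq_zero_or_pos n with rfl | hn
  · simp
  refine div_le_self (norm_nonneg _) ?_
  rw [show (4 * (n:ℂ)) = ((4 * n : ℕ) : ℂ) by push_cast; ring, norm_natCast]
  norm_cast; omega
theorem alc_zero : alc 0 = 16 := by simp [alc, sc]; norm_num
theorem fsc_zero : fsc 0 = 2 := by simp [fsc, sc]; norm_num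
theorem psc_zero : psc 0 = 0 := by simp [psc]
theorem lsc_zero : lsc 0 = -16 := by simp [lsc, alc_zero]

def al (z : ℂ) : ℂ := ps alc (qq z)
def fa (z : ℂ) : ℂ := rr z * al z
def fs (z : ℂ) : ℂ := ps fsc (qq z)
def ll (z : ℂ) : ℂ := ps lsc (qq z)
def LS (z : ℂ) : ℂ := rr z * ll z
def LL (z : ℂ) : ℂ := LS (-1 / z)

theorem fa_eq {z : ℂ} (hz : 0 < z.im) : fa z = (E2 ((z + 1) / 2) - E2 (z / 2)) / 3 := by
  have hp := sc_polyB 1 (-24)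
  have hr := norm_rr_lt hz
  simp only [E2, qq_half, rr_add_one]
  rw [ps_even_odd hp hr, ps_even_odd hp (r := - rr z) (by rwa [norm_neg]), neg_sq, rr_sq]
  have : al z = -2/3 * ps (fun n => sc 1 (-24) (2 * n + 1)) (qq z) := ps_const_mul _ _ _
  rw [fa, this]; ring

theorem fs_eq {z : ℂ} (hz : 0 < z.im) : fs z = 4 * E2 z - E2 (z / 2) - E2 ((z + 1) / 2) := by
  have hp := sc_polyB 1 (-24)
  have hr := norm_rr_lt hz
  simp only [E2, qq_half, rr_add_one]
  rw [ps_even_odd hp hr, ps_even_odd hp (r := - rr z) (by rwa [norm_neg]), neg_sq, rr_sq]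
  have : fs z = _ := ps_add (hp.const_mul 4) (hp.even.const_mul (-2)) (norm_qq_lt hz)
  rw [this, ps_const_mul, ps_const_mul]; ring

theorem im_half {z : ℂ} (hz : 0 < z.im) : 0 < (z / 2).im := by
  have : (z / 2).im = z.im / 2 := by
    simpa using Complex.div_ofReal_im z 2
  rw [this]; linarith

theorem E2_Sh {z : ℂ} (hz : 0 < z.im) : E2 (-1 / z / 2) = 4 * z ^ 2 * E2 (2 * z) + 2 * kap * z := by
  have := E2_S (z := 2 * z) (by simpa using hz)
  rw [show -1 / z / 2 = -1 / (2 * z) by rw [div_div, mul_comm], this]; ring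

theorem E2_Sh' {z : ℂ} (hz : 0 < z.im) : E2 ((-1 / z + 1) / 2) = z ^ 2 * E2 ((z + 1) / 2) + 2 * kap * z := by
  have hz0 : z ≠ 0 := by rintro rfl; simp at hz
  -- p = (z-1)/(2z); v = (z-1)/2
  set v := (z - 1) / 2 with hv
  have hvi : 0 < v.im := im_half (z := z - 1) (by simpa using hz)
  have hv0 : v ≠ 0 := by intro h; rw [h] at hvi; simp at hvi
  have hz1 : z - 1 ≠ 0 := by intro h; rw [hv, h] at hv0; simp at hv0
  have e1 : E2 (v + 1) = E2 v := E2_T v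
  have e2 := E2_S hvi
  set w := -1 / v with hw
  have hwi : 0 < w.im := im_neg_inv_pos hvi
  have e3 : E2 (w - 2) = E2 w := by
    rw [← E2_T (w - 2), ← E2_T (w - 2 + 1)]; congr 1; ring
  have hwi2 : 0 < (w - 2).im := by simpa using hwi
  have e4 := E2_S hwi2
  have e5 : w - 2 = - z / v := by rw [hw, hv]; field_simp; ring
  have e6 : -1 / (w - 2) = (-1 / z + 1) / 2 := by rw [e5, hv]; field_simp; ring
  rw [e6, e3, e2] at e4
  rw [e4, show (z + 1) / 2 = v + 1 by rw [hv]; ring, e1, e5]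
  have : z = 2 * v + 1 := by rw [hv]; ring
  field_simp
  rw [this]; ring

theorem fa_S {z : ℂ} (hz : 0 < z.im) : fa (-1 / z) = - z ^ 2 * (fs z - fa z) / 2 := by
  rw [fa_eq (im_neg_inv_pos hz), fa_eq hz, fs_eq hz, E2_Sh hz, E2_Sh' hz]
  linear_combination -z^2/3 * hecke hz

theorem fs_S {z : ℂ} (hz : 0 < z.im) : fs (-1 / z) = - z ^ 2 * (fs z + 3 * fa z) / 2 := by
  rw [fs_eq (im_neg_inv_pos hz), fa_eq hz, fs_eq hz, E2_Sh hz, E2_Sh' hz, E2_S hz]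
  linear_combination -z^2 * hecke hz

theorem fa_T (z : ℂ) : fa (z + 1) = - fa z := by rw [fa, fa, al, al, qq_add_one, rr_add_one]; ring
theorem fs_T (z : ℂ) : fs (z + 1) = fs z := by rw [fs, fs, qq_add_one]
theorem LS_T (z : ℂ) : LS (z + 1) = - LS z := by rw [LS, LS, ll, ll, qq_add_one, rr_add_one]; ring

theorem hasDerivAt_LS {z : ℂ} (hz : 0 < z.im) : HasDerivAt LS (-(Real.pi * I * fa z)) z := by
  refine ((hasDerivAt_rr z).mul (hasDerivAt_ps_qq lsc_polyB hz)).congr_deriv ?_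
  have h1 := ps_add lsc_polyB (lsc_polyB.nat_mul.const_mul 2) (norm_qq_lt hz)
  rw [ps_const_mul] at h1
  have h2 : (fun n => lsc n + 2 * (n * lsc n)) = fun n => (-1) * alc n := by
    ext n
    have : (2 * (n:ℂ) + 1) ≠ 0 := by exact_mod_cast (by omega : 2 * n + 1 ≠ 0)
    rw [lsc]; field_simp; ring
  rw [h2, ps_const_mul] at h1
  rw [fa, al]
  linear_combination -(Real.pi * I * rr z) * h1

theorem hasDerivAt_LL {z : ℂ} (hz : 0 < z.im) : HasDerivAt LL (Real.pi * I * (fs z - fa z) / 2) z := by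
  have hz0 : z ≠ 0 := by rintro rfl; simp at hz
  refine (hasDerivAt_comp_neg_inv hz (hasDerivAt_LS (im_neg_inv_pos hz))).congr_deriv ?_
  rw [fa_S hz]; field_simp

theorem LL_S {z : ℂ} (hz : 0 < z.im) : LL (-1 / z) = LS z := by
  have hz0 : z ≠ 0 := by rintro rfl; simp at hz
  rw [LL]; congr 1; field_simp

def PP (z : ℂ) : ℂ := LL z - Real.pi * I * z - LS z / 2
def PP0 : ℂ := PP I - ps psc (qq I)

theorem PP_eq {z : ℂ} (hz : 0 < z.im) : PP z = ps psc (qq z) + PP0 := by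
  have := const_of_deriv_zero (S := fun z => PP z - ps psc (qq z)) (fun z hz => by
    have h1 := ((hasDerivAt_LL hz).sub ((hasDerivAt_id' z).const_mul (Real.pi * I))).sub ((hasDerivAt_LS hz).div_const 2)
    refine (h1.sub (hasDerivAt_ps_qq psc_polyB hz)).congr_deriv ?_
    have h2 := ps_shift fsc_polyB (norm_qq_lt hz)
    have h3 := ps_shift psc_polyB.nat_mul (norm_qq_lt hz)
    have h4 : (fun n : ℕ => ((n + 1 : ℕ) : ℂ) * psc (n + 1)) = fun n => (1/4) * fsc (n + 1) := by
      ext n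
      have : (n:ℂ) + 1 ≠ 0 := by exact_mod_cast n.succ_ne_zero
      rw [psc]; push_cast; field_simp
    rw [h3, h4, ps_const_mul, psc_zero]
    rw [← fs, fsc_zero] at h2
    linear_combination (Real.pi * I) / 2 * h2) hz (w := I) (by simp)
  beta_reduce at this
  rw [PP0]; linear_combination this

theorem PP_T {z : ℂ} (hz : 0 < z.im) : PP (z + 1) = PP z := by
  rw [PP_eq hz, PP_eq (by simpa using hz), qq_add_one]

theorem LL_T {z : ℂ} (hz : 0 < z.im) : LL (z + 1) = LL z - LS z + Real.pi * I := by
  have := PP_T hz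
  rw [PP, PP, LS_T] at this
  linear_combination this

theorem ord_al : Ord 0 al 16 := by rw [← alc_zero]; exact ord_ps alc_polyB
theorem ord_fs : Ord 0 fs 2 := by rw [← fsc_zero]; exact ord_ps fsc_polyB
theorem ord_ll : Ord 0 ll (-16) := by rw [← lsc_zero]; exact ord_ps lsc_polyB
theorem ord_PP : Ord 0 PP PP0 := by
  have := (ord_ps psc_polyB).add (ord_const PP0)
  rw [psc_zero, zero_add] at this
  exact this.congr fun z hz => PP_eq hz

/-- linear transformation law in the odd case -/
def VM (x B C : ℂ → ℂ) : Prop := ∀ z : ℂ, 0 < z.im →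
  z ^ 10 * (rr (-1 / z) * x (-1 / z)) = z * B z + C z + rr z * x z / 2

theorem VM.add {x y w x' y' w' : ℂ → ℂ} (h : VM x y w) (h' : VM x' y' w') :
    VM (fun z => x z + x' z) (fun z => y z + y' z) (fun z => w z + w' z) := by
  intro z hz; beta_reduce; linear_combination h z hz + h' z hz

theorem VM.smul {x y w : ℂ → ℂ} (h : VM x y w) (s : ℂ) :
    VM (fun z => s * x z) (fun z => s * y z) (fun z => s * w z) := by
  intro z hz; beta_reduce; linear_combination s * h z hz

theorem vm_zero : VM (fun _ => 0) (fun _ => 0) (fun _ => 0) := by intro z hz; simp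

theorem vm0 {k c f} (h : WM 12 k f c) : VM (fun z => al z * f z) (fun _ => 0) (fun z => (-1/2) * (fs z * f z)) := by
  intro z hz; beta_reduce
  have := fa_S hz
  rw [fa, fa] at this
  linear_combination z^10 * f (-1/z) * this - (fs z - rr z * al z) / 2 * h.S z hz

theorem vm1 {k c f} (h : WM 14 k f c) : VM (fun z => al z * fs z * f z) (fun _ => 0)
    (fun z => (1/4) * ((fs z ^ 2 - 3 * (qq z * al z ^ 2)) * f z)) := by
  intro z hz; beta_reduce
  have h1 := fa_S hz
  have h2 := fs_S hz
  rw [fa, fa] at h1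
  rw [fa] at h2
  rw [h2, ← rr_sq]
  linear_combination z^10 * f (-1/z) * (- z ^ 2 * (fs z + 3 * (rr z * al z)) / 2) * h1
     + (fs z - rr z * al z) * (fs z + 3 * (rr z * al z)) / 4 * h.S z hz

theorem vm2 {k c f} (h : WM 10 k f c) : VM (fun z => (Real.pi * I)⁻¹ * (f z * ll z)) f
    (fun z => (Real.pi * I)⁻¹ * (f z * PP z)) := by
  intro z hz; beta_reduce
  have h1 : LL z = rr (-1/z) * ll (-1/z) := rfl
  have h2 : PP z = LL z - Real.pi * I * z - rr z * ll z / 2 := rfl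
  have hpi : (Real.pi : ℂ) * I * (Real.pi * I)⁻¹ = 1 := by
    refine mul_inv_cancel₀ ?_; simp [Real.pi_ne_zero]
  rw [h2]
  linear_combination (Real.pi * I)⁻¹ * LL z * h.S z hz - z^10 * f (-1/z) * (Real.pi * I)⁻¹ * h1
    + z * f z * hpi

theorem vm_exists (N : ℕ) (c1 c2 c3 : ℂ) : ∃ x y w, VM x y w ∧ Ord (-(N + 2 : ℕ)) x c1 ∧
      Ord (-(N + 2 : ℕ)) y c2 ∧ Ord (-(N + 2 : ℕ)) w c3 := by
  have w12 := wm_J wm_12 (N + 1)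
  have w14 := wm_J wm_14 N
  have w10 := wm_J wm_10 N
  rw [show (-1 - ((N + 1 : ℕ):ℤ)) = -((N + 2 : ℕ) : ℤ) by push_cast; ring] at w12
  rw [show (-2 - (N:ℤ)) = -((N + 2 : ℕ) : ℤ) by push_cast; ring] at w10 w14
  set p : ℂ := (Real.pi * I)⁻¹
  set u := c1 + 16 * c2 * p with hu
  set v := c3 - PP0 * c2 * p with hv
  refine ⟨_, _, _, (((vm0 w12).smul ((u + 16 * v) / 48 - v)).add ((vm1 w14).smul ((u + 16 * v) / 48))).add
    ((vm2 w10).smul c2), ?_, ?_, ?_⟩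
  · have h1 := (ord_al.mul w12.ord).const_mul ((u + 16 * v) / 48 - v)
    have h2 := ((ord_al.mul ord_fs).mul w14.ord).const_mul ((u + 16 * v) / 48)
    have h3 := ((w10.ord.mul ord_ll).const_mul p).const_mul c2
    simp only [add_zero, zero_add] at h1 h2 h3
    have := (h1.add h2).add h3
    convert this using 1
    rw [hu, hv]; ring
  · have z1 := (ord_zero (-((N + 2 : ℕ) : ℤ))).const_mul ((u + 16 * v) / 48 - v)
    have z2 := (ord_zero (-((N + 2 : ℕ) : ℤ))).const_mul ((u + 16 * v) / 48)
    have := (z1.add z2).add (w10.ord.const_mul c2)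
    convert this using 1
    ring
  · have h1 := ((ord_fs.mul w12.ord).const_mul (-1/2)).const_mul ((u + 16 * v) / 48 - v)
    have hq : Ord 0 (fun z => qq z * al z ^ 2) 0 := by
      have := ((ord_qq 1).mul (ord_al.pow 2)).lower
      norm_num at this
      exact this
    have h2 := ((((ord_fs.pow 2).sub (hq.const_mul 3)).mul w14.ord).const_mul (1/4)).const_mul ((u + 16 * v) / 48)
    have h3 := ((w10.ord.mul ord_PP).const_mul p).const_mul c2
    simp only [add_zero, zero_add, mul_zero] at h1 h2 h3
    have := (h1.add h2).add h3
    convert this using 1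
    rw [hu, hv]; ring

theorem vm_match (m : ℕ) (hm : 2 ≤ m) (s t : ℂ) : ∃ x y w, VM x y w ∧ (∃ c, Ord 0 x c) ∧
    (∃ c, Ord (-1) (fun z => s * qq z ^ (-(m:ℤ)) - y z) c) ∧
    (∃ c, Ord (-1) (fun z => t * qq z ^ (-(m:ℤ)) - w z) c) := by
  obtain ⟨N, rfl⟩ : ∃ N, m = N + 1 := ⟨m - 1, by omega⟩
  obtain ⟨x, y, w, hV, ⟨d1, h1⟩, ⟨d2, h2⟩, ⟨d3, h3⟩⟩ := elimination VM vm_zero (fun _ _ _ _ _ _ h h' => h.add h') vm_exists N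
    (fun _ => 0) (fun z => s * qq z ^ (-((N + 1 : ℕ):ℤ))) (fun z => t * qq z ^ (-((N + 1 : ℕ):ℤ))) _ _ _
    (ord_zero _) ((ord_qq _).const_mul s) ((ord_qq _).const_mul t)
  refine ⟨_, _, _, hV.add ((vm0 wm_12).smul (d1 / 16)), ?_, ?_, ?_⟩
  · have := (h1.const_mul (-1)).add ((ord_al.mul ord_Dl_inv).const_mul (d1 / 16))
    rw [show -1 * d1 + d1 / 16 * (16 * 1) = 0 by ring] at this
    obtain ⟨c, hc⟩ := this.raise
    exact ⟨c, hc.congr fun z _ => by ring⟩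
  · exact ⟨_, h2.congr fun z _ => by ring⟩
  · have := h3.sub (((ord_fs.mul ord_Dl_inv).const_mul (-1/2)).const_mul (d1 / 16))
    exact ⟨_, this.congr fun z _ => by ring⟩

theorem ord_of_match {m : ℕ} (hm : 2 ≤ m) {s c : ℂ} {y : ℂ → ℂ}
    (hy : Ord (-1) (fun z => s * qq z ^ (-(m:ℤ)) - y z) c) (z : ℂ) (hz : 0 < z.im) : y (z + 1) = y z := by
  have := hy.periodic hz
  rw [qq_add_one] at this
  linear_combination -this

theorem eig_minus (m : ℕ) (hm : 2 ≤ m) (δ δ' : ℂ) : ∃ g : SchwartzMap E24 ℂ, IsRadial g ∧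
    (∀ x, FT g x = (-1) * g x) ∧ ∀ n : ℕ, 2 ≤ n → radVal g (Real.sqrt (2 * n)) = (if n = m then -δ else 0) ∧
      radDeriv g (Real.sqrt (2 * n)) = 2 * Real.sqrt (2 * n) * (Real.pi * I * (if n = m then -δ' else 0)) := by
  obtain ⟨x, y, w, hV, ⟨c, hx⟩, ⟨c2, hy⟩, ⟨c3, hw⟩⟩ := vm_match m hm δ (-δ')
  obtain ⟨C, hC, hxb⟩ := hx.bound
  obtain ⟨C2, hC2, hyb⟩ := hy.bound
  obtain ⟨C3, hC3, hwb⟩ := hw.bound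
  have hpi := Real.pi_pos
  have hwd := ord_of_match hm hw
  have hyp := ord_of_match hm hy
  have hxp : ∀ z : ℂ, 0 < z.im → x (z + 1) = x z := fun z hz => hx.periodic hz
  have him : ∀ z : ℂ, (z + 1).im = z.im := by simp
  have him' : ∀ z : ℂ, (z - 1).im = z.im := by simp
  have hkz : ∀ z : ℂ, 0 < z.im → (z + 1) ^ 10 * (rr (-1 / (z + 1)) * x (-1 / (z + 1))) =
      (z + 1) * y z + w z - rr z * x z / 2 := by
    intro z hz
    have := hV (z + 1) (by rwa [him])
    rw [hxp z hz, hyp z hz, hwd z hz, rr_add_one] at this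
    linear_combination this
  have hkz' : ∀ z : ℂ, 0 < z.im → (z - 1) ^ 10 * (rr (-1 / (z - 1)) * x (-1 / (z - 1))) =
      (z - 1) * y z + w z - rr z * x z / 2 := by
    intro z hz
    have hz' : 0 < (z - 1).im := by rwa [him']
    have := hV (z - 1) hz'
    rw [← hxp (z - 1) hz', ← hyp (z-1) hz', ← hwd (z-1) hz', sub_add_cancel] at this
    have e := rr_add_one (z - 1)
    rw [sub_add_cancel] at e
    rw [this, e]; ring
  have hexp : ∀ z : ℂ, 1 ≤ z.im → Real.exp (-(2 * Real.pi * ((-1 : ℤ) : ℝ) * z.im)) ≤ Real.exp (3 * Real.pi * z.im) := by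
    intro z hz
    rw [Real.exp_le_exp]; push_cast; nlinarith [mul_pos hpi (by linarith : 0 < z.im)]
  have hhb : ∀ z : ℂ, 1 / 2 ≤ z.im → ‖rr z * x z‖ ≤ C * Real.exp (-Real.pi * z.im) := by
    intro z hz
    have := hxb z hz
    simp only [Int.cast_zero, mul_zero, zero_mul, neg_zero, Real.exp_zero, mul_one] at this
    rw [norm_mul, norm_rr, mul_comm, neg_mul]
    gcongr
  have hexp1 : ∀ z : ℂ, 1 ≤ z.im → |z.re| ≤ 1 → ∀ p : ℂ, ‖p‖ ≤ 3 * (1 + z.im) ^ 2 →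
      ‖p * (rr z * x z)‖ ≤ 6 * C * Real.exp (3 * Real.pi * z.im) := by
    intro z hz hr p hp
    have h1 := hhb z (by linarith)
    have h2 := poly_exp_bound (y := z.im) (by linarith)
    rw [norm_mul]
    calc ‖p‖ * ‖rr z * x z‖ ≤ (3 * (2 * Real.exp (2 * Real.pi * z.im))) * (C * Real.exp (-Real.pi * z.im)) := by
          gcongr; exact hp.trans (by gcongr)
      _ = 6 * C * (Real.exp (2 * Real.pi * z.im) * Real.exp (-Real.pi * z.im)) := by ring
      _ ≤ _ := by
        rw [← Real.exp_add]; gcongr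
        nlinarith [mul_pos hpi (by linarith : 0 < z.im)]
  refine eigen_exists (ε := -1) (by norm_num) (h := fun z => rr z * x z) (k := fun z => z ^ 10 * (rr (-1 / z) * x (-1 / z)))
    (fun z hz => ((hasDerivAt_rr z).differentiableAt.differentiableWithinAt.mul (hx.diff z hz))) (C := C) hC hhb ?_
    (fun z _ => rfl) ?_ (m := m) (δ := δ) (δ' := δ') (C1 := 6 * C + C2 + C3) ?_ ?_
  · intro z hz; beta_reduce; rw [hxp z hz, rr_add_one]; ring
  · intro z hz
    beta_reduce
    rw [hkz z hz, hkz' z hz, hV z hz]; ring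
  · intro z hz hr
    beta_reduce
    have hz0 : 0 < z.im := by linarith
    have hB := (hyb z (by linarith)).trans (mul_le_mul_of_nonneg_left (hexp z hz) hC2)
    have hX := hexp1 z hz hr (-1) (by simp; nlinarith)
    rw [hkz z hz0, hV z hz0, gs_qq]
    have e : (z + 1) * y z + w z - rr z * x z / 2 - (z * y z + w z + rr z * x z / 2)
        - δ * qq z ^ (-(m:ℤ)) = -1 * (rr z * x z) - (δ * qq z ^ (-(m:ℤ)) - y z) := by
      ring
    rw [e]
    refine (norm_sub_le _ _).trans ?_
    have h9 : 0 ≤ C3 * Real.exp (3 * Real.pi * z.im) := by positivity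
    linarith
  · intro z hz hr
    beta_reduce
    have hz0 : 0 < z.im := by linarith
    have hB := (hwb z (by linarith)).trans (mul_le_mul_of_nonneg_left (hexp z hz) hC3)
    have hX := hexp1 z hz hr (-z - 1/2) (by
      have := norm_le_strip hz hr
      refine (norm_sub_le _ _).trans ?_
      rw [norm_neg]; norm_num
      nlinarith)
    rw [hkz z hz0, hV z hz0, gs_qq]
    have e : z * ((z + 1) * y z + w z - rr z * x z / 2 - (z * y z + w z + rr z * x z / 2))
        - (z * y z + w z + rr z * x z / 2)
        - δ' * qq z ^ (-(m:ℤ)) = (-z - 1/2) * (rr z * x z) + (-δ' * qq z ^ (-(m:ℤ)) - w z) := by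
      ring
    rw [e]
    refine (norm_add_le _ _).trans ?_
    have h9 : 0 ≤ C2 * Real.exp (3 * Real.pi * z.im) := by positivity
    linarith

end I24
end B6

section C1
namespace I24
open Complex Filter Topology MeasureTheory Set

abbrev SLZ := Matrix.SpecialLinearGroup (Fin 2) ℤ

def den (g : SLZ) (z : ℂ) : ℂ := g 1 0 * z + g 1 1
def num (g : SLZ) (z : ℂ) : ℂ := g 0 0 * z + g 0 1
def mob (g : SLZ) (z : ℂ) : ℂ := num g z / den g z

theorem sl_det (g : SLZ) : g 0 0 * g 1 1 - g 0 1 * g 1 0 = 1 := by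
  have := g.det_coe; rw [Matrix.det_fin_two] at this; exact this

theorem sl_detC (g : SLZ) : (g 0 0 : ℂ) * g 1 1 - g 0 1 * g 1 0 = 1 := by
  exact_mod_cast sl_det g

theorem den_ne (g : SLZ) {z : ℂ} (hz : 0 < z.im) : den g z ≠ 0 := by
  intro h
  have h1 := congrArg Complex.im h
  have h2 := congrArg Complex.re h
  simp [den] at h1 h2
  have hc : g 1 0 = 0 := by
    rcases h1 with h1 | h1
    · exact h1
    · exact absurd h1 hz.ne'
  have hd : g 1 1 = 0 := by simpa [hc] using h2
  have := sl_det g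
  simp [hc, hd] at this

theorem mob_im (g : SLZ) {z : ℂ} (hz : 0 < z.im) : (mob g z).im = z.im / ‖den g z‖ ^ 2 := by
  have h : (g 0 0 : ℝ) * g 1 1 - g 0 1 * g 1 0 = 1 := by exact_mod_cast sl_det g
  rw [mob, Complex.div_im, ← Complex.normSq_eq_norm_sq]
  have : normSq (den g z) ≠ 0 := by simpa using den_ne g hz
  field_simp
  simp [num, den]
  linear_combination z.im * h

theorem mob_im_pos (g : SLZ) {z : ℂ} (hz : 0 < z.im) : 0 < (mob g z).im := by
  rw [mob_im g hz]; have := norm_pos_iff.2 (den_ne g hz); positivity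

theorem mob_mul_den (h : SLZ) {z : ℂ} (hz : 0 < z.im) : mob h z * den h z = num h z :=
  div_mul_cancel₀ _ (den_ne h hz)

theorem den_mul (g h : SLZ) {z : ℂ} (hz : 0 < z.im) : den (g * h) z = den g (mob h z) * den h z := by
  have e : den g (mob h z) * den h z = g 1 0 * (mob h z * den h z) + g 1 1 * den h z := by
    rw [den.eq_1 g]; ring
  rw [e, mob_mul_den h hz]
  simp [den, num, Matrix.mul_apply, Fin.sum_univ_two]; ring

theorem num_mul (g h : SLZ) {z : ℂ} (hz : 0 < z.im) : num (g * h) z = num g (mob h z) * den h z := by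
  have e : num g (mob h z) * den h z = g 0 0 * (mob h z * den h z) + g 0 1 * den h z := by
    rw [num.eq_1 g]; ring
  rw [e, mob_mul_den h hz]
  simp [den, num, Matrix.mul_apply, Fin.sum_univ_two]; ring

theorem mob_mul (g h : SLZ) {z : ℂ} (hz : 0 < z.im) : mob (g * h) z = mob g (mob h z) := by
  rw [mob, num_mul g h hz, den_mul g h hz, mul_div_mul_right _ _ (den_ne h hz)]; rfl

open ModularGroup in
theorem den_S (z : ℂ) : den S z = z := by simp [den, ModularGroup.coe_S]
open ModularGroup in
theorem den_T (z : ℂ) : den T z = 1 := by simp [den, ModularGroup.coe_T]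
open ModularGroup in
theorem mob_S (z : ℂ) : mob S z = -1 / z := by simp [mob, num, den, ModularGroup.coe_S]
open ModularGroup in
theorem mob_T (z : ℂ) : mob T z = z + 1 := by simp [mob, num, den, ModularGroup.coe_T]

theorem den_neg (g : SLZ) (z : ℂ) : den (-g) z = - den g z := by simp [den]; ring
theorem num_neg (g : SLZ) (z : ℂ) : num (-g) z = - num g z := by simp [num]; ring
theorem mob_neg (g : SLZ) (z : ℂ) : mob (-g) z = mob g z := by rw [mob, mob, den_neg, num_neg, neg_div_neg_eq]

/-- the slashed exponential -/
def ph (u : ℝ) (g : SLZ) (z : ℂ) : ℂ := (den g z ^ 12)⁻¹ * gs (mob g z) u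

theorem ph_neg (u : ℝ) (g : SLZ) (z : ℂ) : ph u (-g) z = ph u g z := by
  rw [ph, ph, mob_neg, den_neg]; congr 2; ring

open ModularGroup in
theorem ph_T (u : ℝ) (g : SLZ) {z : ℂ} (hz : 0 < z.im) : ph u g (z + 1) = ph u (g * T) z := by
  rw [ph, ph, mob_mul g T hz, den_mul g T hz, mob_T, den_T, mul_one]

open ModularGroup in
theorem ph_S (u : ℝ) (g : SLZ) {z : ℂ} (hz : 0 < z.im) : (z ^ 12)⁻¹ * ph u g (-1 / z) = ph u (g * S) z := by
  rw [ph, ph, mob_mul g S hz, den_mul g S hz, mob_S, den_S, mul_pow, mul_inv]; ring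

open ModularGroup in
theorem ph_T_left (u : ℝ) (g : SLZ) {z : ℂ} (hz : 0 < z.im) : ph u (T * g) z = gs 1 u * ph u g z := by
  rw [ph, ph, mob_mul T g hz, den_mul T g hz, mob_T, den_T, gs_add]; ring

/-- weight function -/
def rho (z : ℂ) : ℝ := (1 + 1 / z.im) * (1 + ‖z‖)

theorem one_le_rho {z : ℂ} (hz : 0 < z.im) : 1 ≤ rho z := by
  have h1 : 0 ≤ 1 / z.im := by positivity
  have := norm_nonneg z
  rw [rho]; nlinarith

theorem norm_le_rho {z : ℂ} (hz : 0 < z.im) : ‖z‖ ≤ rho z := by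
  have h1 : 0 ≤ 1 / z.im := by positivity
  have := norm_nonneg z
  rw [rho]; nlinarith

theorem inv_le_rho {z : ℂ} (hz : 0 < z.im) : 1 + 1 / z.im ≤ rho z := by
  have h1 : 0 ≤ 1 / z.im := by positivity
  have := norm_nonneg z
  rw [rho]; nlinarith

theorem rho_T {z : ℂ} (hz : 0 < z.im) : rho (z + 1) ≤ 2 * rho z := by
  have h1 : 0 ≤ 1 / z.im := by positivity
  have h2 : ‖z + 1‖ ≤ ‖z‖ + 1 := by simpa using norm_add_le z 1
  have := norm_nonneg z
  rw [rho, rho]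
  simp only [add_im, one_im, add_zero]
  nlinarith

/-- bottom row norm -/
def bn (g : SLZ) : ℝ := ‖(g 1 : Fin 2 → ℤ)‖

theorem abs_le_bn (g : SLZ) (i : Fin 2) : |(g 1 i : ℝ)| ≤ bn g := by
  have := norm_le_pi_norm (g 1 : Fin 2 → ℤ) i
  simpa [bn, Int.norm_eq_abs] using this

theorem one_le_bn (g : SLZ) : 1 ≤ bn g := by
  have h0 := abs_le_bn g 0
  have h1 := abs_le_bn g 1
  by_contra! h
  have a0 : g 1 0 = 0 := by
    have : |(g 1 0 : ℝ)| < 1 := by linarith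
    exact Int.abs_lt_one_iff.1 (by exact_mod_cast this)
  have a1 : g 1 1 = 0 := by
    have : |(g 1 1 : ℝ)| < 1 := by linarith
    exact Int.abs_lt_one_iff.1 (by exact_mod_cast this)
  have := sl_det g
  simp [a0, a1] at this

theorem bn_le (g : SLZ) {z : ℂ} (hz : 0 < z.im) : bn g ≤ ‖den g z‖ * rho z := by
  have hr := one_le_rho hz
  have hy : 0 ≤ 1 / z.im := by positivity
  have hn := norm_nonneg z
  have hc : |(g 1 0 : ℝ)| ≤ ‖den g z‖ * (1 / z.im) := by
    have h1 := Complex.abs_im_le_norm (den g z)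
    have h2 : (den g z).im = g 1 0 * z.im := by simp [den]
    rw [h2, abs_mul, abs_of_pos hz] at h1
    rw [mul_one_div, le_div_iff₀ hz]; exact h1
  have hd : |(g 1 1 : ℝ)| ≤ ‖den g z‖ + |(g 1 0 : ℝ)| * ‖z‖ := by
    have h1 : (g 1 1 : ℂ) = den g z - g 1 0 * z := by rw [den]; ring
    have h2 := norm_sub_le (den g z) (g 1 0 * z)
    rw [← h1, norm_mul] at h2
    simpa using h2
  have h0 := norm_nonneg (den g z)
  rw [bn]
  refine (pi_norm_le_iff_of_nonneg (by positivity)).2 fun i => ?_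
  fin_cases i
  · simp only [Fin.zero_eta, Int.norm_eq_abs]
    refine hc.trans ?_
    gcongr; rw [rho]; nlinarith
  · simp only [Fin.mk_one, Int.norm_eq_abs]
    calc |(g 1 1 : ℝ)| ≤ ‖den g z‖ + ‖den g z‖ * (1 / z.im) * ‖z‖ := by
          refine hd.trans ?_; gcongr
      _ ≤ _ := by rw [rho]; nlinarith [mul_nonneg h0 hy, mul_nonneg h0 hn]

theorem inv_den_le (g : SLZ) {z : ℂ} (hz : 0 < z.im) : ‖den g z‖⁻¹ ≤ rho z / bn g := by
  have h1 := bn_le g hz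
  have h2 := one_le_bn g
  have h3 := norm_pos_iff.2 (den_ne g hz)
  rw [inv_eq_one_div, div_le_div_iff₀ h3 (by linarith)]; linarith

end I24
end C1

section C2
namespace I24
open Complex Filter Topology MeasureTheory Set
open ModularGroup

/-- bottom rows -/
abbrev PI := {p : ℤ × ℤ // 1 ≤ p.1 ∧ IsCoprime p.1 p.2}

def IsRep (g : SLZ) (c d : ℤ) : Prop := g 1 0 = c ∧ g 1 1 = d ∧ 0 ≤ g 0 0 ∧ g 0 0 < c

theorem rep_exists (p : PI) : ∃ g : SLZ, IsRep g p.1.1 p.1.2 := by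
  obtain ⟨⟨c, d⟩, hc, x, y, hxy⟩ := p
  simp only at hc hxy ⊢
  refine ⟨⟨!![y % c, -x - (y / c) * d; c, d], ?_⟩, ?_, ?_, ?_, ?_⟩
  · have := Int.emod_add_mul_ediv y c
    rw [Matrix.det_fin_two_of]
    linear_combination hxy + d * this
  · simp
  · simp
  · simpa using Int.emod_nonneg _ (by omega)
  · simpa using Int.emod_lt_of_pos _ (by omega)

theorem rep_unique {g h : SLZ} {c d : ℤ} (hg : IsRep g c d) (hh : IsRep h c d) : g = h := by
  obtain ⟨g1, g2, g3, g4⟩ := hg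
  obtain ⟨h1, h2, h3, h4⟩ := hh
  have dg := sl_det g
  have dh := sl_det h
  rw [g1, g2] at dg
  rw [h1, h2] at dh
  have hdvd : c ∣ g 0 0 - h 0 0 := by
    refine ⟨h 0 0 * g 0 1 - g 0 0 * h 0 1, ?_⟩
    linear_combination (h 0 0) * dg - (g 0 0) * dh
  have e0 : g 0 0 = h 0 0 := by
    have := Int.eq_zero_of_abs_lt_dvd hdvd (by rw [abs_lt]; constructor <;> omega)
    omega
  have e1 : g 0 1 = h 0 1 := by
    have : (g 0 1 - h 0 1) * c = 0 := by rw [e0] at dg; linear_combination dh - dg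
    rcases mul_eq_zero.1 this with h' | h' <;> omega
  ext i j
  fin_cases i <;> fin_cases j
  · exact e0
  · exact e1
  · exact g1.trans h1.symm
  · exact g2.trans h2.symm

def rep (p : PI) : SLZ := (rep_exists p).choose
theorem rep_spec (p : PI) : IsRep (rep p) p.1.1 p.1.2 := (rep_exists p).choose_spec
theorem rep_eq {p : PI} {g : SLZ} (h : IsRep g p.1.1 p.1.2) : rep p = g := rep_unique (rep_spec p) h

theorem bn_rep (p : PI) : bn (rep p) = ‖(![p.1.1, p.1.2] : Fin 2 → ℤ)‖ := by
  rw [bn]; congr 1; ext i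
  obtain ⟨h1, h2, -, -⟩ := rep_spec p
  fin_cases i
  · simpa using h1
  · simpa using h2

theorem summable_bn : Summable (fun p : PI => (bn (rep p))⁻¹ ^ 8) := by
  have h := EisensteinSeries.summable_one_div_norm_rpow (k := 8) (by norm_num)
  have hinj : Function.Injective (fun p : PI => (![p.1.1, p.1.2] : Fin 2 → ℤ)) := by
    intro p q hpq
    have h0 := congrFun hpq 0
    have h1 := congrFun hpq 1
    simp at h0 h1
    exact Subtype.ext (Prod.ext h0 h1)
  refine (h.comp_injective hinj).congr fun p => ?_
  rw [Function.comp_apply, bn_rep, Real.rpow_neg (norm_nonneg _), inv_pow]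
  norm_cast

def K0 : ℝ := ∑' p : PI, (bn (rep p))⁻¹ ^ 8
theorem K0_nonneg : 0 ≤ K0 := tsum_nonneg fun p => by have := one_le_bn (rep p); positivity

theorem term_le (g : SLZ) {z : ℂ} (hz : 0 < z.im) {K : ℝ} (hK : 0 ≤ K) :
    K * bn g ^ 4 * ‖den g z‖⁻¹ ^ 12 ≤ K * rho z ^ 12 * (bn g)⁻¹ ^ 8 := by
  have h1 := inv_den_le g hz
  have h2 := one_le_bn g
  have h0 : 0 < bn g := by linarith
  calc K * bn g ^ 4 * ‖den g z‖⁻¹ ^ 12 ≤ K * bn g ^ 4 * (rho z / bn g) ^ 12 := by gcongr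
    _ = _ := by field_simp

theorem sum_bound {f : PI → ℂ} {z : ℂ} (hz : 0 < z.im) {K : ℝ} (hK : 0 ≤ K)
    (hf : ∀ p, ‖f p‖ ≤ K * bn (rep p) ^ 4 * ‖den (rep p) z‖⁻¹ ^ 12) :
    Summable f ∧ ‖∑' p, f p‖ ≤ K * K0 * rho z ^ 12 := by
  have hs := summable_bn.mul_left (K * rho z ^ 12)
  have hb : ∀ p, ‖f p‖ ≤ K * rho z ^ 12 * (bn (rep p))⁻¹ ^ 8 := fun p => (hf p).trans (term_le _ hz hK)
  refine ⟨Summable.of_norm_bounded hs hb, ?_⟩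
  refine (tsum_of_norm_bounded hs.hasSum hb).trans (le_of_eq ?_)
  rw [tsum_mul_left, K0]; ring

theorem norm_ph_le {u : ℝ} (hu : 0 ≤ u) (g : SLZ) {z : ℂ} (hz : 0 < z.im) : ‖ph u g z‖ ≤ ‖den g z‖⁻¹ ^ 12 := by
  rw [ph, norm_mul, norm_inv, norm_pow, ← inv_pow]
  exact mul_le_of_le_one_right (by positivity) (norm_gs_le (mob_im_pos g hz).le hu)

/-- Coefficient systems. -/
structure PC (ε : ℂ) (u : ℝ) (C : SLZ → ℂ) (K : ℝ) : Prop where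
  neg : ∀ g, C (-g) = C g
  S : ∀ g, C (g * S) = - ε * C g
  T : ∀ g, C (g * T * T) - 2 * C (g * T) + C g = 0
  base : ∀ n : ℤ, C (ModularGroup.S * ModularGroup.T ^ n) = ε * (gs 1 u - ε) + n * (ε * gs 1 u + 1)
  left : ∀ n : ℤ, gs 1 u * C (ModularGroup.T * (ModularGroup.S * ModularGroup.T ^ n)) = C (ModularGroup.S * ModularGroup.T ^ n)
  bound : ∀ p, ‖C (rep p)‖ ≤ K * bn (rep p) ^ 4

def PM (C : SLZ → ℂ) (u : ℝ) (z : ℂ) : ℂ := ∑' p : PI, C (rep p) * ph u (rep p) z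

section
variable {ε : ℂ} {u : ℝ} {C : SLZ → ℂ} {K : ℝ}

theorem PM_term_le (hC : ∀ p, ‖C (rep p)‖ ≤ K * bn (rep p) ^ 4) (hu : 0 ≤ u) {z : ℂ} (hz : 0 < z.im) (p : PI) :
    ‖C (rep p) * ph u (rep p) z‖ ≤ K * bn (rep p) ^ 4 * ‖den (rep p) z‖⁻¹ ^ 12 := by
  rw [norm_mul]
  exact mul_le_mul (hC p) (norm_ph_le hu _ hz) (norm_nonneg _) ((norm_nonneg _).trans (hC p))

theorem PM_summable (hC : ∀ p, ‖C (rep p)‖ ≤ K * bn (rep p) ^ 4) (hK : 0 ≤ K) (hu : 0 ≤ u) {z : ℂ} (hz : 0 < z.im) :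
    Summable (fun p : PI => C (rep p) * ph u (rep p) z) := (sum_bound hz hK (PM_term_le hC hu hz)).1

theorem PM_bound (hC : ∀ p, ‖C (rep p)‖ ≤ K * bn (rep p) ^ 4) (hK : 0 ≤ K) (hu : 0 ≤ u) {z : ℂ} (hz : 0 < z.im) :
    ‖PM C u z‖ ≤ K * K0 * rho z ^ 12 := (sum_bound hz hK (PM_term_le hC hu hz)).2

theorem ph_diff (u : ℝ) (g : SLZ) : DifferentiableOn ℂ (ph u g) {z | 0 < z.im} := by
  intro z hz
  have h := den_ne g hz
  have hd : DifferentiableAt ℂ (den g) z := by unfold den; fun_prop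
  have hn : DifferentiableAt ℂ (num g) z := by unfold num; fun_prop
  have h2 : DifferentiableAt ℂ (mob g) z := hn.div hd h
  have h3 : DifferentiableAt ℂ (fun z => gs (mob g z) u) z := ((hasDerivAt_gs_z _ u).differentiableAt).comp z h2
  exact (((hd.pow 12).inv (pow_ne_zero _ h)).mul h3).differentiableWithinAt

theorem PM_diff (hC : ∀ p, ‖C (rep p)‖ ≤ K * bn (rep p) ^ 4) (hK : 0 ≤ K) (hu : 0 ≤ u) :
    DifferentiableOn ℂ (PM C u) {z | 0 < z.im} := by
  intro z hz
  have hz' : 0 < z.im := hz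
  set U : Set ℂ := {w | z.im / 2 < w.im ∧ ‖w‖ < ‖z‖ + 1} with hU
  have hUo : IsOpen U := (isOpen_lt continuous_const Complex.continuous_im).inter
    (isOpen_lt continuous_norm continuous_const)
  have hzU : z ∈ U := ⟨by linarith, by linarith⟩
  set R := (1 + 1 / (z.im / 2)) * (1 + (‖z‖ + 1)) with hR
  have hrho : ∀ w ∈ U, 0 < w.im ∧ rho w ≤ R ∧ 0 ≤ rho w := by
    intro w hw
    have h0 : 0 < w.im := by linarith [hw.1]
    refine ⟨h0, ?_, by linarith [one_le_rho h0]⟩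
    rw [rho, hR]
    have := hw.1; have := hw.2
    gcongr
  have := differentiableOn_tsum_of_summable_norm (U := U) (F := fun p w => C (rep p) * ph u (rep p) w)
    (summable_bn.mul_left (K * R ^ 12)) (fun p => (((ph_diff u (rep p)).mono fun w hw => (hrho w hw).1)).const_mul _)
    hUo (fun p w hw => by
      obtain ⟨h0, h1, h2⟩ := hrho w hw
      refine (PM_term_le hC hu h0 p).trans ((term_le _ h0 hK).trans ?_)
      have := one_le_bn (rep p)
      gcongr)
  exact (this.differentiableAt (hUo.mem_nhds hzU)).differentiableWithinAt

/-- the shift on bottom rows -/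
def shT : PI ≃ PI where
  toFun p := ⟨(p.1.1, p.1.2 + p.1.1), p.2.1, by
    simpa using p.2.2.add_mul_left_right 1⟩
  invFun p := ⟨(p.1.1, p.1.2 - p.1.1), p.2.1, by
    have := p.2.2.add_mul_left_right (-1)
    simpa [sub_eq_add_neg] using this⟩
  left_inv p := by ext <;> simp
  right_inv p := by ext <;> simp

theorem rep_shT (p : PI) : rep (shT p) = rep p * T := by
  obtain ⟨h1, h2, h3, h4⟩ := rep_spec p
  refine rep_eq ⟨?_, ?_, ?_, ?_⟩
  all_goals simp [Matrix.mul_apply, Fin.sum_univ_two, ModularGroup.coe_T, shT, h1, h2, h3, h4]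
  ring

theorem PM_T (hC : PC ε u C K) (hK : 0 ≤ K) (hu : 0 ≤ u) {z : ℂ} (hz : 0 < z.im) :
    PM C u (z + 1 + 1) - 2 * PM C u (z + 1) + PM C u z = 0 := by
  have hz1 : 0 < (z + 1).im := by simpa using hz
  have hz2 : 0 < (z + 1 + 1).im := by simpa using hz
  have s2 := PM_summable hC.bound hK hu hz2
  have s1 := shT.summable_iff.2 (PM_summable hC.bound hK hu hz1)
  have s0 := shT.summable_iff.2 (shT.summable_iff.2 (PM_summable hC.bound hK hu hz))
  have e1 : PM C u (z + 1) = _ := (shT.tsum_eq (fun p : PI => C (rep p) * ph u (rep p) (z + 1))).symm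
  have e0 : PM C u z = _ := (shT.tsum_eq (fun p : PI => C (rep p) * ph u (rep p) z)).symm
  rw [← shT.tsum_eq] at e0
  have h := (s2.hasSum.sub (s1.hasSum.mul_left 2)).add s0.hasSum
  have hz' := h.unique (show HasSum _ (0:ℂ) by
    convert hasSum_zero using 2 with p
    simp only [Function.comp_apply, rep_shT]
    rw [ph_T u _ hz1, ph_T u _ hz]
    try rw [ph_T u _ hz]
    linear_combination ph u (rep p * T * T) z * hC.T (rep p))
  rw [e1, e0]
  simpa [PM, Function.comp_def] using hz'

end

end I24
end C2

section C3
namespace I24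
open Complex Filter Topology MeasureTheory Set
open ModularGroup

section
variable {ε : ℂ} {u : ℝ} {C : SLZ → ℂ} {K : ℝ}

/-- special bottom rows -/
def Spc (p : PI) : Prop := p.1.1 = 1 ∧ |p.1.2| ≤ 1

instance (p : PI) : Decidable (Spc p) := by unfold Spc; infer_instance

theorem ne_of_not_spc {p : PI} (h : ¬ Spc p) : p.1.2 ≠ 0 := by
  intro h0
  apply h
  have := p.2.2
  rw [h0, isCoprime_zero_right, Int.isUnit_iff] at this
  have := p.2.1
  refine ⟨by omega, by simp [h0]⟩

def thF (p : PI) : PI :=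
  if h : Spc p then p else
    if hd : 0 < p.1.2 then ⟨(p.1.2, -p.1.1), by show 1 ≤ p.1.2; omega, p.2.2.symm.neg_right⟩
    else ⟨(-p.1.2, p.1.1), by have := ne_of_not_spc h; show 1 ≤ -p.1.2; omega, p.2.2.symm.neg_left⟩

theorem thF_spc {p : PI} (h : Spc p) : thF p = p := by rw [thF, dif_pos h]
theorem thF_pos {p : PI} (h : ¬ Spc p) (hd : 0 < p.1.2) : (thF p).1 = (p.1.2, -p.1.1) := by rw [thF, dif_neg h, dif_pos hd]
theorem thF_neg {p : PI} (h : ¬ Spc p) (hd : ¬ 0 < p.1.2) : (thF p).1 = (-p.1.2, p.1.1) := by rw [thF, dif_neg h, dif_neg hd]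

theorem spc_iff (p : PI) : Spc p ↔ p.1.1 = 1 ∧ -1 ≤ p.1.2 ∧ p.1.2 ≤ 1 := by rw [Spc, abs_le]

theorem spc_thF {p : PI} (h : ¬ Spc p) : ¬ Spc (thF p) := by
  have hp := p.2.1
  have hn := ne_of_not_spc h
  by_cases hd : 0 < p.1.2
  · rw [spc_iff, thF_pos h hd]; rw [spc_iff] at h; simp only; omega
  · rw [spc_iff, thF_neg h hd]; rw [spc_iff] at h; simp only; omega

theorem thF_inv : Function.Involutive thF := by
  intro p
  by_cases h : Spc p
  · rw [thF_spc h, thF_spc h]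
  · have h' := spc_thF h
    have hn := ne_of_not_spc h
    have hp := p.2.1
    apply Subtype.ext
    by_cases hd : 0 < p.1.2
    · have e := thF_pos h hd
      rw [thF_neg h' (by rw [e]; simp only; omega), e]; simp
    · have e := thF_neg h hd
      rw [thF_pos h' (by rw [e]; simp only; omega), e]; simp

theorem rep_one {p : PI} (h : p.1.1 = 1) : rep p = S * T ^ p.1.2 := by
  refine rep_eq ⟨?_, ?_, ?_, ?_⟩
  all_goals simp [Matrix.mul_apply, Fin.sum_univ_two, ModularGroup.coe_S, ModularGroup.coe_T_zpow, h]

/-- the summand as a function on the group -/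
def Psi (C : SLZ → ℂ) (u : ℝ) (z : ℂ) (g : SLZ) : ℂ := C g * ph u g z

theorem Psi_neg (hC : PC ε u C K) (z : ℂ) (g : SLZ) : Psi C u z (-g) = Psi C u z g := by
  rw [Psi, Psi, hC.neg, ph_neg]

theorem S_mul_S : (S * S : SLZ) = -1 := by
  ext i j; fin_cases i <;> fin_cases j <;> simp [Matrix.mul_apply, Fin.sum_univ_two, ModularGroup.coe_S]

theorem Psi_SS (hC : PC ε u C K) (z : ℂ) (g : SLZ) : Psi C u z (g * S * S) = Psi C u z g := by
  rw [mul_assoc, S_mul_S, mul_neg_one, Psi_neg hC]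

theorem Psi_left (hC : PC ε u C K) {z : ℂ} (hz : 0 < z.im) (n : ℤ) :
    Psi C u z (T * (S * T ^ n)) = Psi C u z (S * T ^ n) := by
  rw [Psi, Psi, ph_T_left u _ hz, ← hC.left n]; ring

theorem Psi_leftS (hC : PC ε u C K) {z : ℂ} (hz : 0 < z.im) (n : ℤ) :
    Psi C u z (T * (S * T ^ n) * S) = Psi C u z (S * T ^ n * S) := by
  rw [Psi, Psi, hC.S, hC.S, mul_assoc T, ph_T_left u _ hz, ← hC.left n]; ring

theorem rep_thF_A {p : PI} (h : ¬ Spc p) (hd : 0 < p.1.2) (hc : p.1.1 ≠ 1) : rep (thF p) = rep p * S := by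
  obtain ⟨h1, h2, h3, h4⟩ := rep_spec p
  have hp := p.2.1
  have dt := sl_det (rep p)
  rw [h1, h2] at dt
  have e := thF_pos h hd
  have ha : 1 ≤ (rep p) 0 0 := by
    by_contra! hlt
    have h0 : (rep p) 0 0 = 0 := by omega
    rw [h0] at dt
    have : p.1.1 ∣ 1 := ⟨-(rep p) 0 1, by linear_combination -dt⟩
    have := Int.eq_one_of_dvd_one (by omega) this
    exact hc this
  refine rep_eq ?_
  rw [e]
  refine ⟨?_, ?_, ?_, ?_⟩
  · simp [Matrix.mul_apply, Fin.sum_univ_two, ModularGroup.coe_S, h2]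
  · simp [Matrix.mul_apply, Fin.sum_univ_two, ModularGroup.coe_S, h1]
  · simp [Matrix.mul_apply, Fin.sum_univ_two, ModularGroup.coe_S]
    by_contra! hb
    nlinarith
  · simp [Matrix.mul_apply, Fin.sum_univ_two, ModularGroup.coe_S]
    by_contra! hb
    nlinarith

theorem rep_thF_B {p : PI} (h : ¬ Spc p) (hd : 0 < p.1.2) (hc : p.1.1 = 1) :
    rep (thF p) = T * (S * T ^ p.1.2) * S := by
  have e := thF_pos h hd
  have hd2 : 2 ≤ p.1.2 := by rw [spc_iff] at h; omega
  refine rep_eq ?_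
  rw [e]
  refine ⟨?_, ?_, ?_, ?_⟩
  all_goals simp [Matrix.mul_apply, Fin.sum_univ_two, ModularGroup.coe_S, ModularGroup.coe_T, ModularGroup.coe_T_zpow, hc]
  all_goals omega

theorem rep_thF_C {p : PI} (h : ¬ Spc p) (hd : p.1.2 ≤ -2) : rep (thF p) = -(rep p * S) := by
  obtain ⟨h1, h2, h3, h4⟩ := rep_spec p
  have hp := p.2.1
  have dt := sl_det (rep p)
  rw [h1, h2] at dt
  have e := thF_neg h (by omega)
  refine rep_eq ?_
  rw [e]
  refine ⟨?_, ?_, ?_, ?_⟩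
  · simp [Matrix.mul_apply, Fin.sum_univ_two, ModularGroup.coe_S, h2]
  · simp [Matrix.mul_apply, Fin.sum_univ_two, ModularGroup.coe_S, h1]
  · simp [Matrix.mul_apply, Fin.sum_univ_two, ModularGroup.coe_S]
    by_contra! hb
    nlinarith
  · simp [Matrix.mul_apply, Fin.sum_univ_two, ModularGroup.coe_S]
    by_contra! hb
    nlinarith

def ff (C : SLZ → ℂ) (u : ℝ) (z : ℂ) (p : PI) : ℂ := Psi C u z (rep p) - Psi C u z (rep p * S)

theorem ff_B (hC : PC ε u C K) {z : ℂ} (hz : 0 < z.im) {p : PI} (h : ¬ Spc p) (hd : 0 < p.1.2) (hc : p.1.1 = 1) :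
    ff C u z (thF p) = - ff C u z p := by
  rw [ff, ff, rep_thF_B h hd hc, rep_one hc, Psi_SS hC, Psi_left hC hz, Psi_leftS hC hz]; ring

theorem ff_thF (hC : PC ε u C K) {z : ℂ} (hz : 0 < z.im) {p : PI} (h : ¬ Spc p) : ff C u z (thF p) = - ff C u z p := by
  have hn := ne_of_not_spc h
  have hp := p.2.1
  by_cases hd : 0 < p.1.2
  · by_cases hc : p.1.1 = 1
    · exact ff_B hC hz h hd hc
    · rw [ff, ff, rep_thF_A h hd hc, Psi_SS hC]; ring
  · by_cases hd2 : p.1.2 ≤ -2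
    · rw [ff, ff, rep_thF_C h hd2, neg_mul, Psi_neg hC, Psi_neg hC, Psi_SS hC]; ring
    · have e := thF_neg h hd
      have := ff_B hC hz (spc_thF h) (by rw [e]; simp only; omega) (by rw [e]; simp only; omega)
      rw [thF_inv p] at this
      rw [this, neg_neg]

def spt (n : ℤ) : PI := ⟨(1, n), le_rfl, isCoprime_one_left⟩

theorem PM_S (hC : PC ε u C K) (hε : ε * ε = 1) (hK : 0 ≤ K) (hu : 0 ≤ u) {z : ℂ} (hz : 0 < z.im) :
    PM C u z + ε * ((z ^ 12)⁻¹ * PM C u (-1 / z)) =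
      (gs 1 u - ε) * (gs z u + ε * ((z ^ 12)⁻¹ * gs (-1 / z) u)) := by
  have hz1 := im_neg_inv_pos hz
  have s0 := (PM_summable hC.bound hK hu hz).hasSum
  have s1 := (((PM_summable hC.bound hK hu hz1).hasSum.mul_left (z ^ 12)⁻¹).mul_left ε)
  have hs : HasSum (ff C u z) (PM C u z + ε * ((z ^ 12)⁻¹ * PM C u (-1 / z))) := by
    refine (s0.add s1).congr_fun fun p => ?_
    rw [ff, Psi, Psi, hC.S, ← ph_S u _ hz]; ring
  set g : PI → ℂ := fun p => if Spc p then 0 else ff C u z p with hg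
  have hgs : ∑' p, g p = 0 := by
    have h1 := (Function.Involutive.toPerm thF thF_inv).tsum_eq g
    have h2 : ∀ p, g ((Function.Involutive.toPerm thF thF_inv) p) = - g p := by
      intro p
      rw [Function.Involutive.coe_toPerm, hg]
      beta_reduce
      by_cases h : Spc p
      · rw [thF_spc h, if_pos h, neg_zero]
      · rw [if_neg h, if_neg (spc_thF h), ff_thF hC hz h]
    simp only [h2, tsum_neg] at h1
    have : (2:ℂ) * ∑' p, g p = 0 := by linear_combination -h1
    simpa using this
  have hfin : ∀ p ∉ ({spt 0, spt 1, spt (-1)} : Finset PI), ff C u z p - g p = 0 := by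
    intro p hp
    have : ¬ Spc p := by
      rw [spc_iff]
      intro h
      apply hp
      simp only [Finset.mem_insert, Finset.mem_singleton]
      have : p.1.2 = 0 ∨ p.1.2 = 1 ∨ p.1.2 = -1 := by omega
      rcases this with h' | h' | h'
      · left; exact Subtype.ext (Prod.ext h.1 h')
      · right; left; exact Subtype.ext (Prod.ext h.1 h')
      · right; right; exact Subtype.ext (Prod.ext h.1 h')
    rw [hg]; beta_reduce; rw [if_neg this, sub_self]
  have hd : HasSum (fun p => ff C u z p - g p) _ := hasSum_sum_of_ne_finset_zero hfin
  have hgsum : Summable g := by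
    have := hs.summable.sub hd.summable
    exact this.congr fun p => by ring
  have ht := hd.add hgsum.hasSum
  rw [hgs, add_zero] at ht
  have ht' : HasSum (ff C u z) _ := ht.congr_fun fun p => by ring
  rw [hs.unique ht']
  have hspc : ∀ n : ℤ, |n| ≤ 1 → g (spt n) = 0 := by
    intro n hn
    rw [hg]; beta_reduce; rw [if_pos ⟨rfl, hn⟩]
  have ne1 : spt 0 ≠ spt 1 := by intro h; simpa [spt] using congrArg (fun p : PI => p.1.2) h
  have ne2 : spt 0 ≠ spt (-1) := by intro h; simpa [spt] using congrArg (fun p : PI => p.1.2) h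
  have ne3 : spt 1 ≠ spt (-1) := by
    intro h
    have := congrArg (fun p : PI => p.1.2) h
    simp [spt] at this
  rw [Finset.sum_insert (by simp [ne1, ne2]), Finset.sum_insert (by simp [ne3]), Finset.sum_singleton,
    hspc 0 (by simp), hspc 1 (by simp), hspc (-1) (by simp)]
  have hr : ∀ n : ℤ, rep (spt n) = S * T ^ n := fun n => rep_one rfl
  simp only [ff, Psi, hr, hC.S, hC.base]
  have p1 : ph u (S * T ^ (-1 : ℤ)) z = gs 1 u * ph u (S * T ^ (1:ℤ) * S) z := by
    rw [← ph_T_left u _ hz]; congr 1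
    ext i j; fin_cases i <;> fin_cases j <;>
      simp [Matrix.mul_apply, Fin.sum_univ_two, ModularGroup.coe_S, ModularGroup.coe_T]
  have p2 : ph u (S * T ^ (-1 : ℤ) * S) z = gs 1 u * ph u (S * T ^ (1:ℤ)) z := by
    rw [← ph_T_left u _ hz, ← ph_neg]; congr 1
    ext i j; fin_cases i <;> fin_cases j <;>
      simp [Matrix.mul_apply, Fin.sum_univ_two, ModularGroup.coe_S, ModularGroup.coe_T]
  have p3 : ph u (S * T ^ (0 : ℤ)) z = (z ^ 12)⁻¹ * gs (-1 / z) u := by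
    simp [ph, mob_S, den_S]
  have p4 : ph u (S * T ^ (0 : ℤ) * S) z = gs z u := by
    rw [zpow_zero, mul_one, S_mul_S, ph_neg]
    simp [ph, mob, den, num]
  rw [p1, p2, p3, p4]
  push_cast
  linear_combination ((gs 1 u - ε) * gs z u
    + gs 1 u * ph u (S * T ^ (1:ℤ) * S) z - ε * gs 1 u * ph u (S * T ^ (1:ℤ)) z - ε * ph u (S * T ^ (1:ℤ) * S) z
    - ph u (S * T ^ (1:ℤ)) z) * hε
end

end I24
end C3

section C4
namespace I24
open Complex Filter Topology MeasureTheory Set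
open ModularGroup

/-- linear combination of coefficient systems -/
def Cw (c1 c2 c3 : SLZ → ℂ) (u : ℝ) (g : SLZ) : ℂ := gs 1 u * c1 g + (gs 1 u)⁻¹ * c2 g + c3 g

theorem gs1_norm (u : ℝ) : ‖gs 1 u‖ = 1 := by rw [norm_gs]; simp
theorem gs1_ne (u : ℝ) : gs 1 u ≠ 0 := by rw [← norm_ne_zero_iff, gs1_norm]; exact one_ne_zero

theorem rep_top (p : PI) : |((rep p) 0 0 : ℝ)| ≤ bn (rep p) ∧ |((rep p) 0 1 : ℝ)| ≤ 2 * bn (rep p) := by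
  obtain ⟨h1, h2, h3, h4⟩ := rep_spec p
  have b0 := abs_le_bn (rep p) 0
  have b1 := abs_le_bn (rep p) 1
  have hb := one_le_bn (rep p)
  have dt := sl_det (rep p)
  have dtR : ((rep p) 0 0 : ℝ) * (rep p) 1 1 - (rep p) 0 1 * (rep p) 1 0 = 1 := by exact_mod_cast dt
  have hc : (1:ℝ) ≤ (rep p) 1 0 := by rw [h1]; exact_mod_cast p.2.1
  have h3' : (0:ℝ) ≤ (rep p) 0 0 := by exact_mod_cast h3
  have h4' : ((rep p) 0 0 : ℝ) ≤ (rep p) 1 0 := by rw [h1]; exact_mod_cast h4.le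
  refine ⟨?_, ?_⟩
  · rw [abs_of_nonneg h3']; exact h4'.trans ((le_abs_self _).trans b0)
  · have e : ((rep p) 0 1 : ℝ) * (rep p) 1 0 = (rep p) 0 0 * (rep p) 1 1 - 1 := by linarith
    have h5 : |((rep p) 0 1 : ℝ)| * (rep p) 1 0 ≤ (rep p) 1 0 * bn (rep p) + 1 := by
      rw [← abs_of_pos (show (0:ℝ) < (rep p) 1 0 by linarith), ← abs_mul, e]
      refine (abs_sub _ _).trans ?_
      rw [abs_mul, abs_one, abs_of_nonneg h3', abs_of_pos (show (0:ℝ) < (rep p) 1 0 by linarith)]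
      gcongr
    by_contra! hlt
    nlinarith

theorem PC_plus : ∃ c1 c2 c3 : SLZ → ℂ, ∃ K : ℝ, 0 ≤ K ∧
    (∀ p, ‖c1 (rep p)‖ ≤ K * bn (rep p) ^ 4 ∧ ‖c2 (rep p)‖ ≤ K * bn (rep p) ^ 4 ∧ ‖c3 (rep p)‖ ≤ K * bn (rep p) ^ 4) ∧
    ∀ u, (∀ K', (∀ p, ‖Cw c1 c2 c3 u (rep p)‖ ≤ K' * bn (rep p) ^ 4) → PC 1 u (Cw c1 c2 c3 u) K') := by
  refine ⟨fun g => g 0 0 * g 0 1 - (g 0 0 * g 1 1 + g 0 1 * g 1 0) + g 1 0 * g 1 1, fun g => g 0 0 * g 0 1,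
    fun g => - 2 * (g 0 0 * g 0 1) + (g 0 0 * g 1 1 + g 0 1 * g 1 0) + g 1 0 * g 1 1, 8, by norm_num, ?_, ?_⟩
  · intro p
    obtain ⟨ha, hb⟩ := rep_top p
    have hc := abs_le_bn (rep p) 0
    have hd := abs_le_bn (rep p) 1
    have h1 := one_le_bn (rep p)
    set B := bn (rep p)
    have h0 : 0 ≤ B := by linarith
    have hB : B ^ 2 ≤ B ^ 4 := pow_le_pow_right₀ h1 (by norm_num)
    rw [← Complex.norm_intCast] at ha hb hc hd
    have m1 : ‖((rep p) 0 0 * (rep p) 0 1 : ℂ)‖ ≤ 2 * B ^ 2 := by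
      rw [norm_mul]; calc _ ≤ B * (2 * B) := by gcongr
                        _ = _ := by ring
    have m2 : ‖((rep p) 0 0 * (rep p) 1 1 : ℂ)‖ ≤ B ^ 2 := by
      rw [norm_mul]; calc _ ≤ B * B := by gcongr
                        _ = _ := by ring
    have m3 : ‖((rep p) 0 1 * (rep p) 1 0 : ℂ)‖ ≤ 2 * B ^ 2 := by
      rw [norm_mul]; calc _ ≤ (2 * B) * B := by gcongr
                        _ = _ := by ring
    have m4 : ‖((rep p) 1 0 * (rep p) 1 1 : ℂ)‖ ≤ B ^ 2 := by
      rw [norm_mul]; calc _ ≤ B * B := by gcongr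
                        _ = _ := by ring
    refine ⟨?_, ?_, ?_⟩
    · refine (norm_add_le _ _).trans ?_
      have e1 := norm_sub_le ((rep p) 0 0 * (rep p) 0 1 : ℂ) ((rep p) 0 0 * (rep p) 1 1 + (rep p) 0 1 * (rep p) 1 0)
      have e2 := norm_add_le ((rep p) 0 0 * (rep p) 1 1 : ℂ) ((rep p) 0 1 * (rep p) 1 0)
      nlinarith
    · nlinarith
    · refine (norm_add_le _ _).trans ?_
      have e1 := norm_add_le (-2 * ((rep p) 0 0 * (rep p) 0 1) : ℂ) ((rep p) 0 0 * (rep p) 1 1 + (rep p) 0 1 * (rep p) 1 0)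
      have e2 := norm_add_le ((rep p) 0 0 * (rep p) 1 1 : ℂ) ((rep p) 0 1 * (rep p) 1 0)
      have e3 : ‖(-2 * ((rep p) 0 0 * (rep p) 0 1) : ℂ)‖ = 2 * ‖((rep p) 0 0 * (rep p) 0 1 : ℂ)‖ := by
        rw [norm_mul]; simp
      nlinarith
  · intro u K' hb
    have hw := gs1_ne u
    refine ⟨?_, ?_, ?_, ?_, ?_, hb⟩
    · intro g; simp [Cw]
    · intro g; simp [Cw, Matrix.mul_apply, Fin.sum_univ_two, ModularGroup.coe_S]; ring
    · intro g; simp [Cw, Matrix.mul_apply, Fin.sum_univ_two, ModularGroup.coe_T]; ring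
    · intro n; simp [Cw, Matrix.mul_apply, Fin.sum_univ_two, ModularGroup.coe_S, ModularGroup.coe_T_zpow]; ring
    · intro n
      simp [Cw, Matrix.mul_apply, Fin.sum_univ_two, ModularGroup.coe_S, ModularGroup.coe_T_zpow, ModularGroup.coe_T]
      field_simp
      ring

/-- transformation of `LS` under the modular group -/
def IsY (g : SLZ) (y v1 v2 : ℂ) : Prop := ∀ z : ℂ, 0 < z.im → LS (mob g z) = y + v1 * LL z + v2 * LS z

theorem IsY.unique {g : SLZ} {y v1 v2 y' v1' v2' : ℂ} (h : IsY g y v1 v2) (h' : IsY g y' v1' v2') : y = y' := by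
  have hI : 0 < (I : ℂ).im := by simp
  have hI1 : 0 < (I + 1 : ℂ).im := by simp
  have hI2 : 0 < (I + 1 + 1 : ℂ).im := by simp
  have e0 := (h I hI).symm.trans (h' I hI)
  have e1 := (h _ hI1).symm.trans (h' _ hI1)
  have e2 := (h _ hI2).symm.trans (h' _ hI2)
  rw [LL_T hI1, LS_T, LL_T hI, LS_T] at e2
  rw [LL_T hI, LS_T] at e1
  have hLS := LS_T I
  have hv : v1 = v1' := by
    have hp : (Real.pi * I : ℂ) ≠ 0 := by simp [Real.pi_ne_zero]
    have : 2 * (v1 - v1') * (Real.pi * I : ℂ) = 0 := by linear_combination e2 - e0 + (v2 - v2') * hLS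
    simp only [mul_eq_zero, hp, or_false] at this
    have := this.resolve_left two_ne_zero
    linear_combination this
  subst hv
  linear_combination (e0 + e1) / 2

theorem IsY.neg {g : SLZ} {y v1 v2 : ℂ} (h : IsY g y v1 v2) : IsY (-g) y v1 v2 := by
  intro z hz; rw [mob_neg]; exact h z hz

theorem IsY.mulS {g : SLZ} {y v1 v2 : ℂ} (h : IsY g y v1 v2) : IsY (g * S) y v2 v1 := by
  intro z hz; rw [mob_mul _ _ hz, mob_S, h _ (im_neg_inv_pos hz), LL_S hz]; rw [LL]; ring

theorem IsY.mulT {g : SLZ} {y v1 v2 : ℂ} (h : IsY g y v1 v2) : IsY (g * T) (y + Real.pi * I * v1) v1 (-v1 - v2) := by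
  intro z hz; rw [mob_mul _ _ hz, mob_T, h _ (by simpa using hz), LL_T hz, LS_T]; ring

theorem mob_Tinv {z : ℂ} : mob T⁻¹ z = z - 1 := by
  simp [mob, num, den]; ring

theorem IsY.mulTinv {g : SLZ} {y v1 v2 : ℂ} (h : IsY g y v1 v2) :
    IsY (g * T⁻¹) (y - Real.pi * I * v1) v1 (-v1 - v2) := by
  intro z hz
  have hz1 : 0 < (z - 1).im := by simpa using hz
  have e1 := LL_T hz1
  have e2 := LS_T (z - 1)
  rw [sub_add_cancel] at e1 e2
  rw [mob_mul _ _ hz, mob_Tinv, h _ hz1, e1, e2]; ring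

theorem IsY.Tmul {g : SLZ} {y v1 v2 : ℂ} (h : IsY g y v1 v2) : IsY (T * g) (-y) (-v1) (-v2) := by
  intro z hz; rw [mob_mul _ _ hz, mob_T, LS_T, h z hz]; ring

theorem IsY.Tinvmul {g : SLZ} {y v1 v2 : ℂ} (h : IsY g y v1 v2) : IsY (T⁻¹ * g) (-y) (-v1) (-v2) := by
  intro z hz
  have e2 := LS_T (mob g z - 1)
  rw [sub_add_cancel, h z hz] at e2
  rw [mob_mul _ _ hz, mob_Tinv]; linear_combination e2

theorem isY_one : IsY 1 0 0 1 := by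
  intro z hz; simp [mob, num, den]

theorem isY_S : IsY S 0 1 0 := by have := isY_one.mulS; rwa [one_mul] at this

theorem S_inv_eq : (S⁻¹ : SLZ) = -S := by
  rw [inv_eq_iff_mul_eq_one, mul_neg, S_mul_S, neg_neg]

theorem isY_exists (g : SLZ) : ∃ y v1 v2, IsY g y v1 v2 ∧ ‖v1‖ ≤ 1 ∧ ‖v2‖ ≤ 1 ∧ ‖v1 + v2‖ ≤ 1 := by
  have hg : g ∈ Subgroup.closure {S, T} := by simp [SpecialLinearGroup.SL2Z_generators]
  induction hg using Subgroup.closure_induction_right with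
  | one => exact ⟨_, _, _, isY_one, by simp, by simp, by simp⟩
  | mul_right x hx w hw ih =>
    obtain ⟨y, v1, v2, h, b1, b2, b3⟩ := ih
    simp only [mem_insert_iff, mem_singleton_iff] at hw
    rcases hw with rfl | rfl
    · exact ⟨_, _, _, h.mulS, b2, b1, by rwa [add_comm]⟩
    · refine ⟨_, _, _, h.mulT, b1, ?_, ?_⟩
      · rw [show -v1 - v2 = -(v1 + v2) by ring, norm_neg]; exact b3
      · rw [show v1 + (-v1 - v2) = -v2 by ring, norm_neg]; exact b2
  | mul_inv_cancel x hx w hw ih =>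
    obtain ⟨y, v1, v2, h, b1, b2, b3⟩ := ih
    simp only [mem_insert_iff, mem_singleton_iff] at hw
    rcases hw with rfl | rfl
    · refine ⟨y, v2, v1, ?_, b2, b1, by rwa [add_comm]⟩
      rw [S_inv_eq, mul_neg]; exact h.mulS.neg
    · refine ⟨_, _, _, h.mulTinv, b1, ?_, ?_⟩
      · rw [show -v1 - v2 = -(v1 + v2) by ring, norm_neg]; exact b3
      · rw [show v1 + (-v1 - v2) = -v2 by ring, norm_neg]; exact b2

def yy (g : SLZ) : ℂ := (isY_exists g).choose
theorem yy_eq {g : SLZ} {y v1 v2 : ℂ} (h : IsY g y v1 v2) : yy g = y := by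
  obtain ⟨v1', v2', h', -⟩ := (isY_exists g).choose_spec
  exact IsY.unique h' h

theorem isY_T (n : ℤ) : ∃ v2, IsY (T ^ n) 0 0 v2 := by
  induction n with
  | zero => exact ⟨1, by simpa using isY_one⟩
  | succ n ih => obtain ⟨v, h⟩ := ih; exact ⟨_, by have := h.mulT; rw [← zpow_add_one] at this; simpa using this⟩
  | pred n ih => obtain ⟨v, h⟩ := ih; exact ⟨_, by have := h.mulTinv; rw [← zpow_sub_one] at this; simpa using this⟩

theorem isY_ST (n : ℤ) : ∃ v2, IsY (S * T ^ n) (n * (Real.pi * I)) 1 v2 := by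
  induction n with
  | zero => exact ⟨0, by simpa using isY_S⟩
  | succ n ih =>
    obtain ⟨v, h⟩ := ih
    refine ⟨-1 - v, ?_⟩
    have := h.mulT
    rw [mul_assoc, ← zpow_add_one] at this
    convert this using 1
    push_cast; ring
  | pred n ih =>
    obtain ⟨v, h⟩ := ih
    refine ⟨-1 - v, ?_⟩
    have := h.mulTinv
    rw [mul_assoc, ← zpow_sub_one] at this
    convert this using 1
    push_cast; ring

theorem LS_bound : ∃ C : ℝ, 0 ≤ C ∧ ∀ z : ℂ, 0 < z.im → ‖LS z‖ ≤ C * (1 + 1 / z.im) ^ 2 := by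
  have h : ∀ n, ‖lsc n‖ ≤ 32 * ((n:ℝ) + 1) ^ 1 := by
    intro n
    have hs : ((ArithmeticFunction.sigma 1 (2 * n + 1) : ℕ) : ℝ) ≤ (2 * n + 1) ^ 2 := by
      exact_mod_cast ArithmeticFunction.sigma_le_pow_succ 1 (2 * n + 1)
    have e : ‖lsc n‖ = 16 * (ArithmeticFunction.sigma 1 (2 * n + 1) : ℕ) / (2 * n + 1) := by
      rw [lsc, alc, sc, if_neg (by omega)]
      have : (2 * (n:ℂ) + 1) = ((2 * n + 1 : ℕ) : ℂ) := by push_cast; ring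
      rw [this, norm_div, Complex.norm_natCast, norm_neg, norm_mul, norm_mul, Complex.norm_natCast]
      push_cast
      norm_num
      ring
    rw [e, div_le_iff₀ (by positivity)]
    nlinarith [Nat.cast_nonneg (α := ℝ) n]
  refine ⟨32 * (1:ℕ).factorial * Real.exp 1 * 2, by positivity, fun z hz => ?_⟩
  rw [LS, norm_mul]
  refine (mul_le_of_le_one_left (norm_nonneg _) (norm_rr_lt hz).le).trans ?_
  exact ps_growth' (by norm_num) h hz

theorem yy_bound : ∃ C : ℝ, 0 ≤ C ∧ ∀ g : SLZ, ‖yy g‖ ≤ C * bn g ^ 4 := by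
  obtain ⟨C, hC, h⟩ := LS_bound
  refine ⟨9 * C + ‖LL I‖ + ‖LS I‖, by positivity, fun g => ?_⟩
  obtain ⟨y, v1, v2, hy, b1, b2, -⟩ := isY_exists g
  have hI : 0 < (I : ℂ).im := by simp
  have e := hy I hI
  rw [yy_eq hy]
  have hb := h _ (mob_im_pos g hI)
  rw [mob_im g hI] at hb
  have hB := one_le_bn g
  have hd : ‖den g I‖ ^ 2 ≤ 2 * bn g ^ 2 := by
    rw [den, ← Complex.normSq_eq_norm_sq, Complex.normSq_apply]
    have h0 := abs_le_bn g 0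
    have h1 := abs_le_bn g 1
    have h0' := sq_le_sq' (by linarith [neg_abs_le (g 1 0 : ℝ)]) ((le_abs_self _).trans h0)
    have h1' := sq_le_sq' (by linarith [neg_abs_le (g 1 1 : ℝ)]) ((le_abs_self _).trans h1)
    simp
    nlinarith
  have hb2 : ‖LS (mob g I)‖ ≤ C * (3 * bn g ^ 2) ^ 2 := by
    refine hb.trans ?_
    rw [Complex.I_im, one_div_div, div_one]
    gcongr
    nlinarith
  have ey : y = LS (mob g I) - v1 * LL I - v2 * LS I := by rw [e]; ring
  rw [ey]
  have hB4 : 1 ≤ bn g ^ 4 := one_le_pow₀ hB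
  calc _ ≤ ‖LS (mob g I)‖ + ‖v1 * LL I‖ + ‖v2 * LS I‖ := by
        refine (norm_sub_le _ _).trans ?_; gcongr; exact norm_sub_le _ _
    _ ≤ C * (3 * bn g ^ 2) ^ 2 + 1 * ‖LL I‖ + 1 * ‖LS I‖ := by rw [norm_mul, norm_mul]; gcongr
    _ ≤ C * (3 * bn g ^ 2) ^ 2 + bn g ^ 4 * ‖LL I‖ + bn g ^ 4 * ‖LS I‖ := by gcongr
    _ = _ := by ring

theorem yy_neg (g : SLZ) : yy (-g) = yy g := by
  obtain ⟨y, v1, v2, hy, -⟩ := isY_exists g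
  rw [yy_eq hy, yy_eq hy.neg]
theorem yy_S (g : SLZ) : yy (g * S) = yy g := by
  obtain ⟨y, v1, v2, hy, -⟩ := isY_exists g
  rw [yy_eq hy, yy_eq hy.mulS]
theorem yy_T (g : SLZ) : yy (g * T * T) - 2 * yy (g * T) + yy g = 0 := by
  obtain ⟨y, v1, v2, hy, -⟩ := isY_exists g
  rw [yy_eq hy, yy_eq hy.mulT, yy_eq hy.mulT.mulT]; ring

theorem STST (n : ℤ) : (S * (T * (S * T ^ n)) : SLZ) = T⁻¹ * (S * T ^ (n - 1)) := by
  ext i j; fin_cases i <;> fin_cases j <;>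
      simp [Matrix.mul_apply, Fin.sum_univ_two, ModularGroup.coe_S, ModularGroup.coe_T, ModularGroup.coe_T_zpow]
  · ring
  · ring

theorem PC_minus : ∃ c1 c2 c3 : SLZ → ℂ, ∃ K : ℝ, 0 ≤ K ∧
    (∀ p, ‖c1 (rep p)‖ ≤ K * bn (rep p) ^ 4 ∧ ‖c2 (rep p)‖ ≤ K * bn (rep p) ^ 4 ∧ ‖c3 (rep p)‖ ≤ K * bn (rep p) ^ 4) ∧
    ∀ u, (∀ K', (∀ p, ‖Cw c1 c2 c3 u (rep p)‖ ≤ K' * bn (rep p) ^ 4) → PC (-1) u (Cw c1 c2 c3 u) K') := by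
  obtain ⟨C, hC, hy⟩ := yy_bound
  set k : ℂ := (Real.pi * I : ℂ)⁻¹ with hk
  have hp : (Real.pi * I : ℂ) ≠ 0 := by simp [Real.pi_ne_zero]
  have hkn : ‖k‖ ≤ 1 := by
    rw [hk, norm_inv]
    refine inv_le_one_of_one_le₀ ?_
    simp [abs_of_pos Real.pi_pos]; linarith [Real.pi_gt_three]
  refine ⟨fun g => k * yy (S * g) - k * yy g - 1, fun g => - (k * yy (S * g)), fun g => k * yy g - 1,
    17 * C + 1, by positivity, ?_, ?_⟩
  · intro p
    have h1 := one_le_bn (rep p)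
    have h4 : 1 ≤ bn (rep p) ^ 4 := one_le_pow₀ h1
    have hxb : bn (S * rep p) ≤ 2 * bn (rep p) := by
      obtain ⟨ha, hb⟩ := rep_top p
      rw [bn, pi_norm_le_iff_of_nonneg (by linarith)]
      intro i
      fin_cases i
      · simp [Matrix.mul_apply, Fin.sum_univ_two, ModularGroup.coe_S, Int.norm_eq_abs]; linarith
      · simpa [Matrix.mul_apply, Fin.sum_univ_two, ModularGroup.coe_S, Int.norm_eq_abs] using hb
    have hx : ‖yy (S * rep p)‖ ≤ 16 * C * bn (rep p) ^ 4 := by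
      refine (hy _).trans ?_
      have : 0 ≤ bn (S * rep p) := norm_nonneg _
      calc C * bn (S * rep p) ^ 4 ≤ C * (2 * bn (rep p)) ^ 4 := by gcongr
        _ = _ := by ring
    have hy1 := hy (rep p)
    have kx : ‖k * yy (S * rep p)‖ ≤ 16 * C * bn (rep p) ^ 4 := by
      rw [norm_mul]; exact (mul_le_of_le_one_left (norm_nonneg _) hkn).trans hx
    have ky : ‖k * yy (rep p)‖ ≤ C * bn (rep p) ^ 4 := by
      rw [norm_mul]; exact (mul_le_of_le_one_left (norm_nonneg _) hkn).trans hy1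
    have hCB : 0 ≤ C * bn (rep p) ^ 4 := by positivity
    refine ⟨?_, ?_, ?_⟩
    · have e1 := norm_sub_le (k * yy (S * rep p)) (k * yy (rep p))
      refine (norm_sub_le _ _).trans ?_
      rw [norm_one]; nlinarith
    · rw [norm_neg]; nlinarith
    · refine (norm_sub_le _ _).trans ?_
      rw [norm_one]; nlinarith
  · intro u K' hb
    have hw := gs1_ne u
    have y1 : ∀ n : ℤ, yy (S * T ^ n) = n * (Real.pi * I) := fun n => by obtain ⟨v, h⟩ := isY_ST n; exact yy_eq h
    have y2 : ∀ n : ℤ, yy (T * (S * T ^ n)) = - (n * (Real.pi * I)) := fun n => by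
      obtain ⟨v, h⟩ := isY_ST n; exact yy_eq h.Tmul
    have y3 : ∀ n : ℤ, yy (S * (S * T ^ n)) = 0 := fun n => by
      obtain ⟨v, h⟩ := isY_T n
      rw [← mul_assoc, S_mul_S, neg_one_mul]; exact yy_eq h.neg
    have y4 : ∀ n : ℤ, yy (S * (T * (S * T ^ n))) = - ((n - 1) * (Real.pi * I)) := fun n => by
      obtain ⟨v, h⟩ := isY_ST (n - 1)
      rw [STST, yy_eq h.Tinvmul]; push_cast; ring
    have kk : (Real.pi * I : ℂ) * k = 1 := mul_inv_cancel₀ hp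
    refine ⟨?_, ?_, ?_, ?_, ?_, hb⟩
    · intro g; simp only [Cw, mul_neg, yy_neg]
    · intro g; simp only [Cw, ← mul_assoc, yy_S]; ring
    · intro g
      have e1 := yy_T g
      have e2 := yy_T (S * g)
      simp only [Cw]
      simp only [← mul_assoc] at e2 ⊢
      linear_combination (gs 1 u * k - (gs 1 u)⁻¹ * k) * e2 + (k - gs 1 u * k) * e1
    · intro n
      simp only [Cw, y1, y3]
      linear_combination (n - n * gs 1 u) * kk
    · intro n
      simp only [Cw, y1, y2, y3, y4]
      have hi : gs 1 u * (gs 1 u)⁻¹ = 1 := mul_inv_cancel₀ hw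
      linear_combination ((n-1) * (Real.pi * I * k)) * hi + (-(gs 1 u)^2 * (n-1) + (gs 1 u)^2 * n + (n - 1)
        - gs 1 u * n - n + n * gs 1 u) * kk
end I24
end C4

section C5
namespace I24
open Complex Filter Topology MeasureTheory Set
open ModularGroup

theorem gs_lip {z : ℂ} (hz : 0 ≤ z.im) {u v : ℝ} (hu : 0 ≤ u) (hv : 0 ≤ v) :
    ‖gs z u - gs z v‖ ≤ Real.pi * ‖z‖ * |u - v| := by
  have := Convex.norm_image_sub_le_of_norm_hasDerivWithin_le (f := fun v : ℝ => gs z v)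
    (f' := fun v => Real.pi * I * z * gs z v) (s := Ici 0) (C := Real.pi * ‖z‖) (x := v) (y := u)
    (fun x _ => (hasDerivAt_gs_u z x).hasDerivWithinAt) (fun x hx => by
      rw [norm_mul, norm_mul, norm_mul, Complex.norm_real, Complex.norm_I, Real.norm_eq_abs, abs_of_pos Real.pi_pos, mul_one]
      exact mul_le_of_le_one_right (by positivity) (norm_gs_le hz hx)) (convex_Ici 0) hv hu
  simpa using this

theorem mob_rep_le (p : PI) {z : ℂ} (hz : 0 < z.im) : ‖mob (rep p) z‖ ≤ 2 * rho z := by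
  obtain ⟨h1, h2, h3, h4⟩ := rep_spec p
  have hd := den_ne (rep p) hz
  have dt := sl_detC (rep p)
  have hc1 : (1:ℤ) ≤ (rep p) 1 0 := by rw [h1]; exact p.2.1
  have hc0 : ((rep p) 1 0 : ℂ) ≠ 0 := by exact_mod_cast (by omega : (rep p) 1 0 ≠ 0)
  have e : mob (rep p) z = (rep p) 0 0 / (rep p) 1 0 - ((rep p) 1 0 : ℂ)⁻¹ * (den (rep p) z)⁻¹ := by
    rw [mob, eq_sub_iff_add_eq]
    field_simp
    rw [num, den]
    linear_combination -dt
  have hcn : (1:ℝ) ≤ ‖((rep p) 1 0 : ℂ)‖ := by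
    rw [Complex.norm_intCast]; exact (by exact_mod_cast hc1 : (1:ℝ) ≤ (rep p) 1 0).trans (le_abs_self _)
  have i1 := inv_den_le (rep p) hz
  have hb := one_le_bn (rep p)
  have hr := one_le_rho hz
  have i2 : rho z / bn (rep p) ≤ rho z := div_le_self (by linarith) hb
  rw [e]
  refine (norm_sub_le _ _).trans ?_
  have j1 : ‖((rep p) 0 0 / (rep p) 1 0 : ℂ)‖ ≤ 1 := by
    rw [norm_div]
    refine div_le_one_of_le₀ ?_ (norm_nonneg _)
    rw [Complex.norm_intCast, Complex.norm_intCast]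
    rw [← h1] at h4
    rw [abs_of_nonneg (by exact_mod_cast h3), abs_of_nonneg (by exact_mod_cast h3.trans h4.le)]
    exact_mod_cast h4.le
  have j2 : ‖((rep p) 1 0 : ℂ)⁻¹ * (den (rep p) z)⁻¹‖ ≤ rho z := by
    rw [norm_mul, norm_inv, norm_inv]
    exact (mul_le_of_le_one_left (by positivity) (inv_le_one_of_one_le₀ hcn)).trans (i1.trans i2)
  linarith

/-- properties of the kernel family -/
structure KF (ε : ℂ) (K : ℝ) (A : ℕ) (M : ℝ → ℂ → ℂ) : Prop where
  diff : ∀ u, 0 ≤ u → DifferentiableOn ℂ (M u) {z | 0 < z.im}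
  T2 : ∀ u, 0 ≤ u → ∀ z : ℂ, 0 < z.im → M u (z + 1 + 1) - 2 * M u (z + 1) + M u z = 0
  S : ∀ u, 0 ≤ u → ∀ z : ℂ, 0 < z.im → M u z + ε * ((z ^ 12)⁻¹ * M u (-1 / z)) =
      (gs 1 u - ε) * (gs z u + ε * ((z ^ 12)⁻¹ * gs (-1 / z) u))
  bound : ∀ u, 0 ≤ u → ∀ z : ℂ, 0 < z.im → ‖M u z‖ ≤ K * rho z ^ A
  lip : ∀ u, 0 ≤ u → ∀ v, 0 ≤ v → ∀ z : ℂ, 0 < z.im → ‖M u z - M v z‖ ≤ K * |u - v| * rho z ^ A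

theorem KF_of {ε : ℂ} (hε : ε * ε = 1) {c1 c2 c3 : SLZ → ℂ} {K : ℝ} (hK : 0 ≤ K)
    (hb : ∀ p, ‖c1 (rep p)‖ ≤ K * bn (rep p) ^ 4 ∧ ‖c2 (rep p)‖ ≤ K * bn (rep p) ^ 4 ∧ ‖c3 (rep p)‖ ≤ K * bn (rep p) ^ 4)
    (hPC : ∀ u, (∀ K', (∀ p, ‖Cw c1 c2 c3 u (rep p)‖ ≤ K' * bn (rep p) ^ 4) → PC ε u (Cw c1 c2 c3 u) K')) :
    KF ε (8 * Real.pi * K * K0) 13 (fun u => PM (Cw c1 c2 c3 u) u) := by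
  have hpi := Real.pi_gt_three
  have hbd : ∀ u p, ‖Cw c1 c2 c3 u (rep p)‖ ≤ (3 * K) * bn (rep p) ^ 4 := by
    intro u p
    obtain ⟨h1, h2, h3⟩ := hb p
    have e1 := norm_add_le (gs 1 u * c1 (rep p) + (gs 1 u)⁻¹ * c2 (rep p)) (c3 (rep p))
    have e2 := norm_add_le (gs 1 u * c1 (rep p)) ((gs 1 u)⁻¹ * c2 (rep p))
    rw [norm_mul, norm_mul, norm_inv, gs1_norm, inv_one, one_mul, one_mul] at e2
    rw [Cw]; linarith
  have h3K : 0 ≤ 3 * K := by positivity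
  have hk0 := K0_nonneg
  refine ⟨?_, ?_, ?_, ?_, ?_⟩
  · intro u hu; exact PM_diff (hbd u) h3K hu
  · intro u hu z hz; exact PM_T (hPC u _ (hbd u)) h3K hu hz
  · intro u hu z hz; exact PM_S (hPC u _ (hbd u)) hε h3K hu hz
  · intro u hu z hz
    refine (PM_bound (hbd u) h3K hu hz).trans ?_
    have hr := one_le_rho hz
    have : rho z ^ 12 ≤ rho z ^ 13 := pow_le_pow_right₀ hr (by norm_num)
    have : 3 * K * K0 ≤ 8 * Real.pi * K * K0 := by gcongr; linarith
    gcongr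
  · intro u hu v hv z hz
    have hr := one_le_rho hz
    have s1 := PM_summable (hbd u) h3K hu hz
    have s2 := PM_summable (hbd v) h3K hv hz
    have key := sum_bound (f := fun p => Cw c1 c2 c3 u (rep p) * ph u (rep p) z - Cw c1 c2 c3 v (rep p) * ph v (rep p) z)
      hz (K := 8 * Real.pi * K * |u - v| * rho z) (by positivity) (fun p => by
        obtain ⟨h1, h2, h3⟩ := hb p
        have l1 : ‖gs 1 u - gs 1 v‖ ≤ Real.pi * |u - v| := by simpa using gs_lip (z := 1) (by simp) hu hv
        have l2 : ‖(gs 1 u)⁻¹ - (gs 1 v)⁻¹‖ ≤ Real.pi * |u - v| := by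
          rw [inv_sub_inv (gs1_ne u) (gs1_ne v), norm_div, norm_mul, gs1_norm, gs1_norm, mul_one, div_one, norm_sub_rev]
          exact l1
        have d1 : ‖Cw c1 c2 c3 u (rep p) - Cw c1 c2 c3 v (rep p)‖ ≤ 2 * (Real.pi * |u - v|) * (K * bn (rep p) ^ 4) := by
          have : Cw c1 c2 c3 u (rep p) - Cw c1 c2 c3 v (rep p) = (gs 1 u - gs 1 v) * c1 (rep p)
            + ((gs 1 u)⁻¹ - (gs 1 v)⁻¹) * c2 (rep p) := by rw [Cw, Cw]; ring
          rw [this]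
          refine (norm_add_le _ _).trans ?_
          rw [norm_mul, norm_mul]
          calc _ ≤ (Real.pi * |u - v|) * (K * bn (rep p) ^ 4) + (Real.pi * |u - v|) * (K * bn (rep p) ^ 4) := by gcongr
            _ = _ := by ring
        have d2 : ‖ph u (rep p) z - ph v (rep p) z‖ ≤ ‖den (rep p) z‖⁻¹ ^ 12 * (Real.pi * (2 * rho z) * |u - v|) := by
          rw [ph, ph, ← mul_sub, norm_mul, norm_inv, norm_pow, ← inv_pow]
          gcongr
          refine (gs_lip (mob_im_pos _ hz).le hu hv).trans ?_
          gcongr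
          exact mob_rep_le p hz
        have e : Cw c1 c2 c3 u (rep p) * ph u (rep p) z - Cw c1 c2 c3 v (rep p) * ph v (rep p) z =
          (Cw c1 c2 c3 u (rep p) - Cw c1 c2 c3 v (rep p)) * ph u (rep p) z
            + Cw c1 c2 c3 v (rep p) * (ph u (rep p) z - ph v (rep p) z) := by ring
        rw [e]
        refine (norm_add_le _ _).trans ?_
        rw [norm_mul, norm_mul]
        have hB := one_le_bn (rep p)
        calc _ ≤ (2 * (Real.pi * |u - v|) * (K * bn (rep p) ^ 4)) * ‖den (rep p) z‖⁻¹ ^ 12 +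
              ((3 * K) * bn (rep p) ^ 4) * (‖den (rep p) z‖⁻¹ ^ 12 * (Real.pi * (2 * rho z) * |u - v|)) := by
              gcongr
              · exact norm_ph_le hu _ hz
              · exact hbd v p
          _ = (Real.pi * |u - v| * K * bn (rep p) ^ 4 * ‖den (rep p) z‖⁻¹ ^ 12) * (2 + 6 * rho z) := by ring
          _ ≤ (Real.pi * |u - v| * K * bn (rep p) ^ 4 * ‖den (rep p) z‖⁻¹ ^ 12) * (8 * rho z) := by gcongr; linarith
          _ = _ := by ring)
    have e : PM (Cw c1 c2 c3 u) u z - PM (Cw c1 c2 c3 v) v z = _ := (Summable.tsum_sub s1 s2).symm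
    rw [e]
    refine key.2.trans (le_of_eq ?_)
    ring

theorem KF_plus : ∃ K M, 0 ≤ K ∧ KF 1 K 13 M := by
  obtain ⟨c1, c2, c3, K, hK, h1, h2⟩ := PC_plus
  have := K0_nonneg
  have := Real.pi_pos
  exact ⟨_, _, by positivity, KF_of (by norm_num) hK h1 h2⟩

theorem KF_minus : ∃ K M, 0 ≤ K ∧ KF (-1) K 13 M := by
  obtain ⟨c1, c2, c3, K, hK, h1, h2⟩ := PC_minus
  have := K0_nonneg
  have := Real.pi_pos
  exact ⟨_, _, by positivity, KF_of (by norm_num) hK h1 h2⟩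
end I24
end C5

section C6
namespace I24
open Complex Filter Topology MeasureTheory Set

theorem qParam_one (z : ℂ) : Function.Periodic.qParam 1 z = qq z := by
  rw [Function.Periodic.qParam, qq]; simp

theorem invQ_re (q : ℂ) : |(Function.Periodic.invQParam 1 q).re| ≤ 1 / 2 := by
  have : (Function.Periodic.invQParam 1 q).re = Complex.arg q / (2 * Real.pi) := by
    rw [Function.Periodic.invQParam]
    have h : ((1:ℝ):ℂ) / (2 * Real.pi * I) = -((1 / (2 * Real.pi) : ℝ) : ℂ) * I := by
      have := Real.pi_ne_zero
      push_cast
      field_simp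
      rw [Complex.I_sq]; ring
    rw [h]
    simp [Complex.log_im]
    field_simp
  rw [this, abs_div, abs_of_pos Real.two_pi_pos, div_le_iff₀ Real.two_pi_pos]
  linarith [Complex.abs_arg_le_pi q]

theorem rho_le_of_re {z : ℂ} (hz : 0 < z.im) (hr : |z.re| ≤ 1 / 2) : rho z ≤ (1 + 1 / z.im) * (3 / 2 + z.im) := by
  rw [rho]
  have h := Complex.norm_le_abs_re_add_abs_im z
  rw [abs_of_pos hz] at h
  exact mul_le_mul_of_nonneg_left (by linarith) (by positivity)

theorem extract_per {g : ℂ → ℂ} {K : ℝ} {A : ℕ} (hK : 0 ≤ K) (hd : DifferentiableOn ℂ g {z | 0 < z.im})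
    (hp : ∀ z : ℂ, 0 < z.im → g (z + 1) = g z) (hb : ∀ z : ℂ, 0 < z.im → ‖g z‖ ≤ K * rho z ^ A) :
    ∃ a : ℕ → ℂ, (∀ n, ‖a n‖ ≤ K * (5 ^ A * Real.exp (2 * Real.pi)) * ((n:ℝ) + 1) ^ A) ∧
      ∀ z : ℂ, 0 < z.im → g z = ps a (qq z) := by
  have hpi := Real.pi_pos
  set f : ℂ → ℂ := fun z => if 0 < z.im then g z else 0 with hf
  have hfe : ∀ z : ℂ, 0 < z.im → f z = g z := fun z hz => by rw [hf]; exact if_pos hz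
  have hfp : Function.Periodic f ((1:ℝ):ℂ) := by
    intro z
    rw [Complex.ofReal_one, hf]
    beta_reduce
    by_cases h : 0 < z.im
    · rw [if_pos h, if_pos (by simpa using h), hp z h]
    · rw [if_neg h, if_neg (by simpa using h)]
  have hHo : IsOpen {z : ℂ | 0 < z.im} := isOpen_lt continuous_const Complex.continuous_im
  have hfd : ∀ z : ℂ, 0 < z.im → DifferentiableAt ℂ f z := by
    intro z hz
    have := hd.differentiableAt (hHo.mem_nhds hz)
    refine this.congr_of_eventuallyEq ?_
    filter_upwards [hHo.mem_nhds hz] with w hw using hfe w hw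
  set F := Function.Periodic.cuspFunction 1 f with hF
  have hFz : ∀ z : ℂ, 0 < z.im → F (qq z) = g z := by
    intro z hz
    rw [← qParam_one, hF, Function.Periodic.eq_cuspFunction one_ne_zero hfp, hfe z hz]
  have him : ∀ q : ℂ, q ≠ 0 → ‖q‖ < 1 → 0 < (Function.Periodic.invQParam 1 q).im := by
    intro q h0 h1
    rw [Function.Periodic.im_invQParam]
    have := Real.log_neg (norm_pos_iff.2 h0) h1
    have : 0 < -1 / (2 * Real.pi) * Real.log ‖q‖ := by
      rw [neg_div, neg_mul, neg_pos]; exact mul_neg_of_pos_of_neg (by positivity) this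
    exact this
  have hFd0 : DifferentiableOn ℂ (f ∘ Function.Periodic.invQParam 1) (Metric.ball 0 1 \ {0}) := by
    intro q hq
    have h1 : ‖q‖ < 1 := by simpa using hq.1
    have h0 : q ≠ 0 := hq.2
    obtain ⟨z, hz, rfl⟩ := exists_qq h0 h1
    have := Function.Periodic.differentiableAt_cuspFunction one_ne_zero hfp (hfd z hz)
    rw [qParam_one] at this
    refine (this.congr_of_eventuallyEq ?_).differentiableWithinAt
    filter_upwards [isOpen_ne.mem_nhds h0] with w hw
    rw [Function.Periodic.cuspFunction_eq_of_nonzero _ _ hw]; rfl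
  have hFbd : ∀ q : ℂ, q ≠ 0 → ‖q‖ < 1 → ‖(f ∘ Function.Periodic.invQParam 1) q‖ ≤
      K * ((1 + 1 / (Function.Periodic.invQParam 1 q).im) * (3 / 2 + (Function.Periodic.invQParam 1 q).im)) ^ A := by
    intro q h0 h1
    have h := him q h0 h1
    rw [Function.comp_apply, hfe _ h]
    refine (hb _ h).trans ?_
    have := one_le_rho h
    gcongr
    exact rho_le_of_re h (invQ_re q)
  have hFd : DifferentiableOn ℂ F (Metric.ball 0 1) := by
    refine Complex.differentiableOn_update_limUnder_of_isLittleO (Metric.ball_mem_nhds _ one_pos) hFd0 ?_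
    simp only [sub_zero]
    have hlim : Tendsto (fun q : ℂ => ‖q‖ * ‖(f ∘ Function.Periodic.invQParam 1) q‖) (𝓝[≠] 0) (𝓝 0) := by
      have t1 : Tendsto (fun y : ℝ => K * 5 ^ A * (y ^ A * Real.exp (-y))) atTop (𝓝 (K * 5 ^ A * 0)) :=
        (Real.tendsto_pow_mul_exp_neg_atTop_nhds_zero A).const_mul _
      rw [mul_zero] at t1
      have t2 : Tendsto (fun q : ℂ => (Function.Periodic.invQParam 1 q).im) (𝓝[≠] 0) atTop :=
        tendsto_comap_iff.1 (Function.Periodic.invQParam_tendsto one_pos)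
      refine squeeze_zero' (Eventually.of_forall fun q => by positivity) ?_ (t1.comp t2)
      have e1 : ∀ᶠ q : ℂ in 𝓝[≠] 0, ‖q‖ < 1 := by
        filter_upwards [nhdsWithin_le_nhds (Metric.ball_mem_nhds (0:ℂ) one_pos)] with q hq using by simpa using hq
      filter_upwards [self_mem_nhdsWithin, e1, t2.eventually_ge_atTop 1] with q h0 h1 h2
      have h0' : q ≠ 0 := h0
      have hb1 := hFbd q h0' h1
      set y := (Function.Periodic.invQParam 1 q).im with hy
      have hq : ‖q‖ = Real.exp (-(2 * Real.pi * y)) := by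
        conv_lhs => rw [← Function.Periodic.qParam_right_inv one_ne_zero h0']
        rw [qParam_one, norm_qq]
      have h3 : (1 + 1 / y) * (3 / 2 + y) ≤ 5 * y := by
        have : 1 / y ≤ 1 := by rw [div_le_one (by linarith)]; exact h2
        calc (1 + 1 / y) * (3 / 2 + y) ≤ (1 + 1) * (3 / 2 * y + y) := by gcongr; linarith
          _ = _ := by ring
      have h4 : Real.exp (-(2 * Real.pi * y)) ≤ Real.exp (-y) := by
        rw [Real.exp_le_exp]; nlinarith [Real.pi_gt_three]
      simp only [Function.comp_apply] at hb1 ⊢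
      rw [hq]
      calc _ ≤ Real.exp (-y) * (K * (5 * y) ^ A) := by
            gcongr; exact hb1.trans (by gcongr)
        _ = _ := by rw [mul_pow]; ring
    have hq0 : Tendsto (fun q : ℂ => ‖q‖ * ‖(f ∘ Function.Periodic.invQParam 1) 0‖) (𝓝[≠] 0) (𝓝 0) := by
      have : Tendsto (fun q : ℂ => ‖q‖ * ‖(f ∘ Function.Periodic.invQParam 1) 0‖) (𝓝 0) (𝓝 (‖(0:ℂ)‖ * ‖(f ∘ Function.Periodic.invQParam 1) 0‖)) :=
        (continuous_norm.mul continuous_const).tendsto 0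
      rw [norm_zero, zero_mul] at this
      exact this.mono_left nhdsWithin_le_nhds
    have hsum := hlim.add hq0
    rw [add_zero] at hsum
    rw [Asymptotics.isLittleO_iff]
    intro c hc
    have := hsum.eventually (gt_mem_nhds hc)
    filter_upwards [this, self_mem_nhdsWithin] with q hq h0
    have h0' : 0 < ‖q‖ := norm_pos_iff.2 h0
    rw [norm_inv, ← div_eq_mul_inv, le_div_iff₀ h0']
    have := norm_sub_le ((f ∘ Function.Periodic.invQParam 1) q) ((f ∘ Function.Periodic.invQParam 1) 0)
    nlinarith
  refine ⟨fun n => (n.factorial : ℂ)⁻¹ * iteratedDeriv n F 0, ?_, ?_⟩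
  · intro n
    have hn : (0:ℝ) < n + 1 := by positivity
    set R := Real.exp (-(2 * Real.pi * (1 / ((n:ℝ) + 1)))) with hR
    have hR0 : 0 < R := Real.exp_pos _
    have hR1 : R < 1 := by rw [hR, Real.exp_lt_one_iff]; have : 0 < 2 * Real.pi * (1 / ((n:ℝ) + 1)) := by positivity
                           linarith
    have hsph : ∀ q ∈ Metric.sphere (0:ℂ) R, ‖F q‖ ≤ K * (5 * ((n:ℝ) + 1)) ^ A := by
      intro q hq
      have hqR : ‖q‖ = R := by simpa using hq
      have h0 : q ≠ 0 := by rw [← norm_pos_iff, hqR]; exact hR0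
      rw [hF, Function.Periodic.cuspFunction_eq_of_nonzero _ _ h0]
      refine (hFbd q h0 (hqR ▸ hR1)).trans ?_
      have hy : (Function.Periodic.invQParam 1 q).im = 1 / ((n:ℝ) + 1) := by
        rw [Function.Periodic.im_invQParam, hqR, hR, Real.log_exp]; field_simp
      rw [hy, one_div_one_div]
      have h2 : 1 / ((n:ℝ) + 1) ≤ 1 := by rw [div_le_one hn]; linarith [Nat.cast_nonneg (α := ℝ) n]
      have h3 : (1 + ((n:ℝ) + 1)) * (3 / 2 + 1 / ((n:ℝ) + 1)) ≤ 5 * ((n:ℝ) + 1) := by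
        have h4 : (1 + ((n:ℝ) + 1)) * (3 / 2 + 1 / ((n:ℝ) + 1)) ≤ (1 + ((n:ℝ) + 1)) * (3 / 2 + 1) :=
          mul_le_mul_of_nonneg_left (by linarith) (by positivity)
        linarith [Nat.cast_nonneg (α := ℝ) n]
      exact mul_le_mul_of_nonneg_left (pow_le_pow_left₀ (by positivity) h3 A) hK
    have hc := Complex.norm_iteratedDeriv_le_of_forall_mem_sphere_norm_le n hR0
      (hFd.diffContOnCl_ball (by exact Metric.closedBall_subset_ball hR1)) hsph
    rw [norm_mul, norm_inv, Complex.norm_natCast]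
    have hfac : (0:ℝ) < n.factorial := by positivity
    rw [inv_mul_le_iff₀ hfac]
    refine hc.trans ?_
    rw [mul_div_assoc]
    gcongr
    rw [div_le_iff₀ (by positivity), mul_pow]
    have hRn : 1 ≤ Real.exp (2 * Real.pi) * R ^ n := by
      rw [hR, ← Real.exp_nat_mul, ← Real.exp_add, Real.one_le_exp_iff]
      have : (n:ℝ) * (1 / ((n:ℝ) + 1)) ≤ 1 := by rw [mul_one_div, div_le_one hn]; linarith
      nlinarith
    calc K * (5 ^ A * ((n:ℝ) + 1) ^ A) = (K * 5 ^ A * ((n:ℝ) + 1) ^ A) * 1 := by ring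
      _ ≤ (K * 5 ^ A * ((n:ℝ) + 1) ^ A) * (Real.exp (2 * Real.pi) * R ^ n) := by gcongr
      _ = _ := by ring
  · intro z hz
    rw [← hFz z hz]
    have := Complex.hasSum_taylorSeries_on_ball hFd (qq_mem hz)
    rw [ps, ← this.tsum_eq]
    refine tsum_congr fun n => ?_
    simp only [sub_zero, smul_eq_mul]; ring

theorem ps_eq_zero : ∀ (n : ℕ) (b : ℕ → ℂ), PolyB b → (∀ z : ℂ, 0 < z.im → ps b (qq z) = 0) → b n = 0 := by
  have h0 : ∀ b : ℕ → ℂ, PolyB b → (∀ z : ℂ, 0 < z.im → ps b (qq z) = 0) → b 0 = 0 := by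
    intro b hb h
    have hc : ContinuousAt (ps b) 0 := ((ps_diff hb).differentiableAt (Metric.ball_mem_nhds _ one_pos)).continuousAt
    have h1 : Tendsto (ps b) (𝓝[≠] 0) (𝓝 (b 0)) := by
      rw [← ps_zero b]; exact hc.tendsto.mono_left nhdsWithin_le_nhds
    have h2 : Tendsto (ps b) (𝓝[≠] 0) (𝓝 0) := by
      refine tendsto_const_nhds.congr' ?_
      filter_upwards [self_mem_nhdsWithin, nhdsWithin_le_nhds (Metric.ball_mem_nhds (0:ℂ) one_pos)] with q hq hq1
      obtain ⟨z, hz, rfl⟩ := exists_qq hq (by simpa using hq1)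
      rw [h z hz]
    exact tendsto_nhds_unique h1 h2
  intro n
  induction n with
  | zero => exact h0
  | succ n ih =>
    intro b hb h
    refine ih (fun n => b (n + 1)) hb.shift fun z hz => ?_
    have e := ps_shift hb (norm_qq_lt hz)
    rw [h z hz, h0 b hb h] at e
    rw [zero_add] at e
    exact (mul_eq_zero.1 e.symm).resolve_left (qq_ne z)

theorem ps_unique {a b : ℕ → ℂ} (ha : PolyB a) (hb : PolyB b)
    (h : ∀ z : ℂ, 0 < z.im → ps a (qq z) + z * ps b (qq z) = 0) : a = 0 ∧ b = 0 := by
  have hb0 : ∀ z : ℂ, 0 < z.im → ps b (qq z) = 0 := by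
    intro z hz
    have e1 := h z hz
    have e2 := h (z + 1) (by simpa using hz)
    rw [qq_add_one] at e2
    linear_combination e2 - e1
  have ha0 : ∀ z : ℂ, 0 < z.im → ps a (qq z) = 0 := by
    intro z hz
    have e1 := h z hz
    rw [hb0 z hz] at e1
    linear_combination e1
  exact ⟨funext fun n => ps_eq_zero n a ha ha0, funext fun n => ps_eq_zero n b hb hb0⟩

theorem extract (A : ℕ) : ∃ K' : ℝ, 0 ≤ K' ∧ ∀ (K : ℝ) (M : ℂ → ℂ), 0 ≤ K → DifferentiableOn ℂ M {z | 0 < z.im} →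
    (∀ z : ℂ, 0 < z.im → M (z + 1 + 1) - 2 * M (z + 1) + M z = 0) → (∀ z : ℂ, 0 < z.im → ‖M z‖ ≤ K * rho z ^ A) →
    ∃ a b : ℕ → ℂ, (∀ n, ‖a n‖ ≤ K * K' * ((n:ℝ) + 1) ^ (A + 1) ∧ ‖b n‖ ≤ K * K' * ((n:ℝ) + 1) ^ (A + 1)) ∧
      ∀ z : ℂ, 0 < z.im → M z = ps a (qq z) + z * ps b (qq z) := by
  refine ⟨(2 ^ A + 2) * (5 ^ (A + 1) * Real.exp (2 * Real.pi)), by positivity, ?_⟩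
  intro K M hK hd hT hb
  have hHo : IsOpen {z : ℂ | 0 < z.im} := isOpen_lt continuous_const Complex.continuous_im
  have hd1 : DifferentiableOn ℂ (fun z => M (z + 1) - M z) {z | 0 < z.im} := by
    refine DifferentiableOn.sub ?_ hd
    refine hd.comp (f := fun z => z + 1) (by fun_prop) fun z hz => ?_
    have hz' : 0 < z.im := hz
    show 0 < (z + 1).im
    simpa using hz'
  have hb1 : ∀ z : ℂ, 0 < z.im → ‖M (z + 1) - M z‖ ≤ K * (2 ^ A + 1) * rho z ^ A := by
    intro z hz
    have h1 := hb (z + 1) (by simpa using hz)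
    have h2 := hb z hz
    have h3 := rho_T hz
    have h4 := one_le_rho (z := z + 1) (by simpa using hz)
    have h5 : K * rho (z + 1) ^ A ≤ K * (2 * rho z) ^ A := by gcongr
    rw [mul_pow] at h5
    refine (norm_sub_le _ _).trans ?_
    linarith
  obtain ⟨b, hbb, hbe⟩ := extract_per (g := fun z => M (z + 1) - M z) (K := K * (2 ^ A + 1)) (A := A) (by positivity) hd1
    (fun z hz => by have := hT z hz; linear_combination this) hb1
  obtain ⟨a, hab, hae⟩ := extract_per (g := fun z => M z - z * (M (z + 1) - M z)) (K := K * (2 ^ A + 2)) (A := A + 1)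
    (by positivity) (hd.sub (differentiableOn_id.mul hd1))
    (fun z hz => by have := hT z hz; linear_combination - (z + 1) * this) (fun z hz => by
      have h1 := hb1 z hz
      have h2 := hb z hz
      have h3 := one_le_rho hz
      refine (norm_sub_le _ _).trans ?_
      rw [norm_mul]
      calc _ ≤ K * rho z ^ A * rho z + rho z * (K * (2 ^ A + 1) * rho z ^ A) := by
            gcongr
            · exact h2.trans (le_mul_of_one_le_right (by positivity) h3)
            · exact norm_le_rho hz
        _ = _ := by ring)
  refine ⟨a, b, fun n => ⟨?_, ?_⟩, fun z hz => ?_⟩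
  · refine (hab n).trans (le_of_eq ?_); ring
  · refine (hbb n).trans ?_
    have hn : (1:ℝ) ≤ (n:ℝ) + 1 := by linarith [Nat.cast_nonneg (α := ℝ) n]
    have h1 : ((n:ℝ) + 1) ^ A ≤ ((n:ℝ) + 1) ^ (A + 1) := pow_le_pow_right₀ hn (by omega)
    have h2 : (5:ℝ) ^ A ≤ 5 ^ (A + 1) := pow_le_pow_right₀ (by norm_num) (by omega)
    calc K * (2 ^ A + 1) * (5 ^ A * Real.exp (2 * Real.pi)) * ((n:ℝ) + 1) ^ A
        ≤ K * (2 ^ A + 2) * (5 ^ (A + 1) * Real.exp (2 * Real.pi)) * ((n:ℝ) + 1) ^ (A + 1) := by gcongr; norm_num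
      _ = _ := by ring
  · rw [← hae z hz, ← hbe z hz]; ring
end I24
end C6

section C7
namespace I24
open Complex Filter Topology MeasureTheory Set

/-- periodic functions with polynomially bounded `q`-expansion and prescribed first two coefficients -/
def Tm (f : ℂ → ℂ) (c d : ℂ) : Prop :=
  ∃ a : ℕ → ℂ, PolyB a ∧ a 0 = c ∧ a 1 = d ∧ ∀ z : ℂ, 0 < z.im → f z = ps a (qq z)

theorem Tm.congr {f g : ℂ → ℂ} {c d c' d' : ℂ} (h : Tm f c d) (hfg : ∀ z : ℂ, 0 < z.im → g z = f z)
    (hc : c' = c) (hd : d' = d) : Tm g c' d' := by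
  obtain ⟨a, h1, h2, h3, h4⟩ := h
  exact ⟨a, h1, h2.trans hc.symm, h3.trans hd.symm, fun z hz => (hfg z hz).trans (h4 z hz)⟩

theorem Tm.add {f g : ℂ → ℂ} {c d c' d' : ℂ} (hf : Tm f c d) (hg : Tm g c' d') :
    Tm (fun z => f z + g z) (c + c') (d + d') := by
  obtain ⟨a, h1, h2, h3, h4⟩ := hf
  obtain ⟨b, g1, g2, g3, g4⟩ := hg
  exact ⟨_, h1.add g1, by rw [h2, g2], by rw [h3, g3], fun z hz => by
    beta_reduce; rw [ps_add h1 g1 (norm_qq_lt hz), h4 z hz, g4 z hz]⟩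

theorem Tm.smul {f : ℂ → ℂ} {c d : ℂ} (hf : Tm f c d) (s : ℂ) : Tm (fun z => s * f z) (s * c) (s * d) := by
  obtain ⟨a, h1, h2, h3, h4⟩ := hf
  exact ⟨_, h1.const_mul s, by rw [h2], by rw [h3], fun z hz => by beta_reduce; rw [ps_const_mul, h4 z hz]⟩

theorem Tm.mul {f g : ℂ → ℂ} {c d c' d' : ℂ} (hf : Tm f c d) (hg : Tm g c' d') :
    Tm (fun z => f z * g z) (c * c') (c * d' + d * c') := by
  obtain ⟨a, h1, h2, h3, h4⟩ := hf
  obtain ⟨b, g1, g2, g3, g4⟩ := hg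
  refine ⟨fun n => ∑ k ∈ Finset.HasAntidiagonal.antidiagonal n, a k.1 * b k.2, ?_, by simp [h2, g2], ?_, fun z hz => ?_⟩
  · obtain ⟨C, A, hC, h⟩ := h1
    obtain ⟨D, B, hD, g⟩ := g1
    refine ⟨C * D, A + B + 1, by positivity, fun n => ?_⟩
    have : ∀ k ∈ Finset.HasAntidiagonal.antidiagonal n, ‖a k.1 * b k.2‖ ≤ C * D * ((n:ℝ) + 1) ^ (A + B) := by
      intro k hk
      rw [Finset.HasAntidiagonal.mem_antidiagonal] at hk
      have e1 : (k.1 : ℝ) ≤ n := by exact_mod_cast (by omega : k.1 ≤ n)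
      have e2 : (k.2 : ℝ) ≤ n := by exact_mod_cast (by omega : k.2 ≤ n)
      rw [norm_mul]
      calc _ ≤ (C * ((k.1:ℝ) + 1) ^ A) * (D * ((k.2:ℝ) + 1) ^ B) := by gcongr; exact h _; exact g _
        _ ≤ (C * ((n:ℝ) + 1) ^ A) * (D * ((n:ℝ) + 1) ^ B) := by gcongr
        _ = _ := by rw [pow_add]; ring
    refine (norm_sum_le_of_le _ this).trans (le_of_eq ?_)
    rw [Finset.sum_const, Finset.Nat.card_antidiagonal, nsmul_eq_mul]; push_cast; ring
  · beta_reduce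
    rw [show (Finset.HasAntidiagonal.antidiagonal 1 : Finset (ℕ × ℕ)) = {(0, 1), (1, 0)} by decide]
    rw [Finset.sum_pair (by decide)]
    simp only [h2, h3, g2, g3]
  · beta_reduce
    rw [h4 z hz, g4 z hz, ps, ps, ps, tsum_mul_tsum_eq_tsum_sum_antidiagonal_of_summable_norm]
    · refine tsum_congr fun n => ?_
      rw [Finset.sum_mul]
      refine Finset.sum_congr rfl fun k hk => ?_
      rw [Finset.HasAntidiagonal.mem_antidiagonal] at hk
      rw [← hk, pow_add]; ring
    · simpa [norm_mul, norm_pow] using h1.summable (norm_nonneg (qq z)) (norm_qq_lt hz)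
    · simpa [norm_mul, norm_pow] using g1.summable (norm_nonneg (qq z)) (norm_qq_lt hz)

theorem tm_ps {a : ℕ → ℂ} (h : PolyB a) : Tm (fun z => ps a (qq z)) (a 0) (a 1) := ⟨a, h, rfl, rfl, fun _ _ => rfl⟩
theorem tm_one : Tm (fun _ => 1) 1 0 := by
  refine ⟨fun n => if n = 0 then 1 else 0, ⟨1, 0, by norm_num, fun n => by beta_reduce; split_ifs <;> simp⟩, rfl, rfl, fun z hz => ?_⟩
  rw [ps, tsum_eq_single 0] <;> simp +contextual
theorem tm_qq : Tm qq 0 1 := by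
  refine ⟨fun n => if n = 1 then 1 else 0, ⟨1, 0, by norm_num, fun n => by beta_reduce; split_ifs <;> simp⟩, rfl, rfl, fun z hz => ?_⟩
  rw [ps, tsum_eq_single 1] <;> simp +contextual
theorem tm_E2 : Tm E2 1 (-24) := (tm_ps (sc_polyB 1 (-24))).congr (fun _ _ => rfl) (by simp [sc]) (by simp [sc])
theorem tm_E4 : Tm E4 1 240 := (tm_ps (sc_polyB 3 240)).congr (fun _ _ => rfl) (by simp [sc]) (by simp [sc])
theorem tm_E6 : Tm E6 1 (-504) := (tm_ps (sc_polyB 5 (-504))).congr (fun _ _ => rfl) (by simp [sc]) (by simp [sc])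
theorem tm_Dl : Tm Dl 0 1 :=
  (((tm_E4.mul tm_E4).mul tm_E4).add ((tm_E6.mul tm_E6).smul (-1)) |>.smul (1 / 1728)).congr
    (fun z _ => by rw [Dl]; ring) (by norm_num) (by norm_num)
theorem tm_al : Tm al 16 (alc 1) := (tm_ps alc_polyB).congr (fun _ _ => rfl) alc_zero.symm rfl
theorem tm_ll : Tm ll (-16) (lsc 1) := (tm_ps lsc_polyB).congr (fun _ _ => rfl) lsc_zero.symm rfl
theorem tm_fs : Tm fs 2 48 := (tm_ps fsc_polyB).congr (fun _ _ => rfl) fsc_zero.symm (by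
  have h1 : ArithmeticFunction.sigma 1 1 = 1 := by decide
  have h2 : ArithmeticFunction.sigma 1 2 = 3 := by decide
  simp [fsc, sc, h2]; norm_num)
theorem tm_PP : Tm PP PP0 (psc 1) := ((tm_ps psc_polyB).add (tm_one.smul PP0)).congr
  (fun z hz => by rw [PP_eq hz]; ring) (by rw [psc_zero]; ring) (by ring)

/-- solutions of the homogeneous equation -/
def Hm (ε a0 b0 a1 b1 : ℂ) : Prop :=
  ∃ f g : ℂ → ℂ, Tm f a0 a1 ∧ Tm g b0 b1 ∧ ∀ z : ℂ, 0 < z.im →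
    f z + z * g z + ε * ((z ^ 12)⁻¹ * (f (-1 / z) + (-1 / z) * g (-1 / z))) = 0

theorem Hm.lin {ε a0 b0 a1 b1 a0' b0' a1' b1' : ℂ} (h : Hm ε a0 b0 a1 b1) (h' : Hm ε a0' b0' a1' b1') (s t : ℂ) :
    Hm ε (s * a0 + t * a0') (s * b0 + t * b0') (s * a1 + t * a1') (s * b1 + t * b1') := by
  obtain ⟨f, g, h1, h2, h3⟩ := h
  obtain ⟨f', g', h1', h2', h3'⟩ := h'
  refine ⟨_, _, (h1.smul s).add (h1'.smul t), (h2.smul s).add (h2'.smul t), fun z hz => ?_⟩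
  linear_combination s * h3 z hz + t * h3' z hz

theorem ne_zero_of_im {z : ℂ} (hz : 0 < z.im) : z ≠ 0 := by rintro rfl; simp at hz

theorem hm_p1 : Hm 1 0 1 0 (-24) := by
  refine ⟨_, _, (tm_one.smul 0).congr (fun _ _ => rfl) (by ring) (by ring),
    ((tm_E4.mul tm_E4).mul tm_E6).congr (fun _ _ => rfl) (by norm_num) (by norm_num), fun z hz => ?_⟩
  have := ne_zero_of_im hz
  rw [E4_S hz, E6_S hz]; field_simp; ring

theorem hm_p2 : Hm 1 0 0 (kap / 2) 1 := by
  refine ⟨_, _, (tm_Dl.smul (kap / 2)).congr (fun _ _ => rfl) (by ring) (by ring),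
    (tm_Dl.mul tm_E2).congr (fun _ _ => rfl) (by norm_num) (by norm_num), fun z hz => ?_⟩
  have := ne_zero_of_im hz
  rw [Dl_S hz, E2_S hz]; field_simp; ring

theorem hm_p3 : Hm 1 (kap / 2) 1 (360 * kap) 696 := by
  refine ⟨_, _, (((tm_E4.mul tm_E4).mul tm_E4).smul (kap / 2)).congr (fun _ _ => rfl) (by ring) (by ring),
    (((tm_E4.mul tm_E4).mul tm_E4).mul tm_E2).congr (fun _ _ => rfl) (by norm_num) (by norm_num), fun z hz => ?_⟩
  have := ne_zero_of_im hz
  rw [E4_S hz, E2_S hz]; field_simp; ring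

theorem hm_p4 : Hm 1 kap 1 (-288 * kap) (-312) := by
  refine ⟨_, _, (((tm_E4.mul tm_E6).mul tm_E2).smul kap).congr (fun _ _ => rfl) (by ring) (by ring),
    ((tm_E4.mul tm_E6).mul (tm_E2.mul tm_E2)).congr (fun _ _ => rfl) (by norm_num) (by norm_num), fun z hz => ?_⟩
  have := ne_zero_of_im hz
  rw [E4_S hz, E2_S hz, E6_S hz]; field_simp; ring

theorem hm_m1 : Hm (-1) 1 0 720 0 := by
  refine ⟨_, _, ((tm_E4.mul tm_E4).mul tm_E4).congr (fun _ _ => rfl) (by norm_num) (by norm_num),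
    (tm_one.smul 0).congr (fun _ _ => rfl) (by ring) (by ring), fun z hz => ?_⟩
  have := ne_zero_of_im hz
  rw [E4_S hz]; field_simp; ring

theorem hm_m2 : Hm (-1) 0 0 1 0 := by
  refine ⟨_, _, tm_Dl.congr (fun _ _ => rfl) rfl rfl,
    (tm_one.smul 0).congr (fun _ _ => rfl) (by ring) (by ring), fun z hz => ?_⟩
  have := ne_zero_of_im hz
  rw [Dl_S hz]; field_simp; ring

theorem hm_of {f g H : ℂ → ℂ} {a0 a1 b0 b1 : ℂ} (hf : Tm f a0 a1) (hg : Tm g b0 b1)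
    (hH : ∀ z : ℂ, 0 < z.im → f z + z * g z = H z) (hS : ∀ z : ℂ, 0 < z.im → H (-1 / z) = z ^ 12 * H z) :
    Hm (-1) a0 b0 a1 b1 := by
  refine ⟨f, g, hf, hg, fun z hz => ?_⟩
  have := ne_zero_of_im hz
  rw [hH z hz, hH _ (im_neg_inv_pos hz), hS z hz]
  field_simp; ring

theorem hm_m3 : ∃ x y, Hm (-1) x (2 * (Real.pi * I)) y (-480 * (Real.pi * I)) := by
  refine ⟨_, _, hm_of (H := fun z => E4 z * E6 z * (fs z * LL z - (fs z + 3 * fa z) / 2 * LS z))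
    ((tm_E4.mul tm_E6).mul ((tm_fs.mul tm_PP).add (((tm_qq.mul tm_al).mul tm_ll).smul (-3 / 2))))
    ((((tm_E4.mul tm_E6).mul tm_fs).smul (Real.pi * I)).congr (fun _ _ => rfl) (by ring) (by ring))
    (fun z hz => ?_) fun z hz => ?_⟩
  · rw [PP, fa, LS, ← rr_sq]; ring
  · have := ne_zero_of_im hz
    rw [E4_S hz, E6_S hz, LL_S hz, fs_S hz, fa_S hz, show LS (-1 / z) = LL z from rfl]; ring

theorem hm_m4 : ∃ x y, Hm (-1) x (2 * (Real.pi * I)) y (672 * (Real.pi * I)) := by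
  refine ⟨_, _, hm_of (H := fun z => E4 z ^ 2 * ((fs z ^ 2 - 3 * fa z ^ 2) / 2 * LL z +
      (3 * fa z ^ 2 + 6 * fa z * fs z - fs z ^ 2) / 4 * LS z))
    ((tm_E4.mul tm_E4).mul (((((tm_fs.mul tm_fs).add ((tm_qq.mul (tm_al.mul tm_al)).smul (-3))).smul (1 / 2)).mul tm_PP).add
      ((tm_fs.mul ((tm_qq.mul tm_al).mul tm_ll)).smul (3 / 2))))
    ((((tm_E4.mul tm_E4).mul (((tm_fs.mul tm_fs).add ((tm_qq.mul (tm_al.mul tm_al)).smul (-3))).smul (1 / 2))).smul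
      (Real.pi * I)).congr (fun _ _ => rfl) (by ring) (by ring))
    (fun z hz => ?_) fun z hz => ?_⟩
  · rw [PP, fa, LS, ← rr_sq]; ring
  · have := ne_zero_of_im hz
    rw [E4_S hz, LL_S hz, fs_S hz, fa_S hz, show LS (-1 / z) = LL z from rfl]; ring

/-- all initial data are attained by homogeneous solutions -/
def HmAll (ε : ℂ) : Prop := Hm ε 1 0 0 0 ∧ Hm ε 0 1 0 0 ∧ Hm ε 0 0 1 0 ∧ Hm ε 0 0 0 1

theorem Hm.cast {ε a0 b0 a1 b1 a0' b0' a1' b1' : ℂ} (h : Hm ε a0 b0 a1 b1) (h0 : a0' = a0) (h1 : b0' = b0)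
    (h2 : a1' = a1) (h3 : b1' = b1) : Hm ε a0' b0' a1' b1' := by subst h0 h1 h2 h3; exact h

theorem hmAll_plus : HmAll 1 := by
  have hk := kap_ne
  have w3 : Hm 1 1 0 0 0 := ((hm_p3.lin (hm_p1.lin hm_p2 1 720) 1 (-1)).lin hm_p1 (2 / kap) 0).cast
    (by field_simp; ring) (by ring) (by ring) (by ring)
  have w4 : Hm 1 0 0 1 0 := (((hm_p4.lin (hm_p1.lin hm_p2 1 (-288)) 1 (-1)).lin w3 1 (-kap)).lin hm_p1 (-1 / (144 * kap)) 0).cast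
    (by ring) (by ring) (by field_simp; ring) (by ring)
  have w2 : Hm 1 0 0 0 1 := (hm_p2.lin w4 1 (-kap / 2)).cast (by ring) (by ring) (by ring) (by ring)
  exact ⟨w3, (hm_p1.lin w2 1 24).cast (by ring) (by ring) (by ring) (by ring), w4, w2⟩

theorem hmAll_minus : HmAll (-1) := by
  have hp : (Real.pi : ℂ) * I ≠ 0 := by simp [Real.pi_ne_zero]
  obtain ⟨x, y, h3⟩ := hm_m3
  obtain ⟨x', y', h4⟩ := hm_m4
  have w1 : Hm (-1) 1 0 0 0 := (hm_m1.lin hm_m2 1 (-720)).cast (by ring) (by ring) (by ring) (by ring)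
  have w4 : Hm (-1) 0 0 0 1 := (((h4.lin h3 1 (-1)).lin (w1.lin hm_m2 (x' - x) (y' - y)) 1 (-1)).lin w1
    (1 / (1152 * (Real.pi * I))) 0).cast (by ring) (by ring) (by ring) (by field_simp; ring)
  have w2 : Hm (-1) 0 1 0 0 := (((h3.lin w4 1 (480 * (Real.pi * I))).lin (w1.lin hm_m2 x y) 1 (-1)).lin w1
    (1 / (2 * (Real.pi * I))) 0).cast (by ring) (by field_simp; ring) (by ring) (by ring)
  exact ⟨w1, w2, hm_m2, w4⟩
end I24
end C7

section C8
namespace I24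
open Complex Filter Topology MeasureTheory Set

/-- families of coefficients solving the functional equation -/
structure Fam (ε : ℂ) (K : ℝ) (A : ℕ) (α β : ℝ → ℕ → ℂ) : Prop where
  nonneg : 0 ≤ K
  bound : ∀ u : ℝ, 0 ≤ u → ∀ n : ℕ, ‖α u n‖ ≤ K * ((n:ℝ) + 1) ^ A ∧ ‖β u n‖ ≤ K * ((n:ℝ) + 1) ^ A
  lip : ∀ u : ℝ, 0 ≤ u → ∀ v : ℝ, 0 ≤ v → ∀ n : ℕ, ‖α u n - α v n‖ ≤ K * |u - v| * ((n:ℝ) + 1) ^ A ∧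
    ‖β u n - β v n‖ ≤ K * |u - v| * ((n:ℝ) + 1) ^ A
  eq : ∀ u : ℝ, 0 ≤ u → ∀ z : ℂ, 0 < z.im →
    (ps (α u) (qq z) + z * ps (β u) (qq z)) + ε * ((z ^ 12)⁻¹ * (ps (α u) (qq (-1 / z)) + (-1 / z) * ps (β u) (qq (-1 / z))))
      = (gs 1 u - ε) * (gs z u + ε * ((z ^ 12)⁻¹ * gs (-1 / z) u))

theorem Fam.polyB {ε : ℂ} {K : ℝ} {A : ℕ} {α β : ℝ → ℕ → ℂ} (h : Fam ε K A α β) {u : ℝ} (hu : 0 ≤ u) :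
    PolyB (α u) ∧ PolyB (β u) := ⟨⟨K, A, h.nonneg, fun n => (h.bound u hu n).1⟩, ⟨K, A, h.nonneg, fun n => (h.bound u hu n).2⟩⟩

theorem fam_of_KF {ε : ℂ} {K : ℝ} {A : ℕ} {M : ℝ → ℂ → ℂ} (hK : 0 ≤ K) (h : KF ε K A M) :
    ∃ K' A' α β, Fam ε K' A' α β := by
  obtain ⟨K', hK', hex⟩ := extract A
  have : ∀ u : ℝ, ∃ a b : ℕ → ℂ, 0 ≤ u → (∀ n : ℕ, ‖a n‖ ≤ K * K' * ((n:ℝ) + 1) ^ (A + 1) ∧ ‖b n‖ ≤ K * K' * ((n:ℝ) + 1) ^ (A + 1)) ∧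
      ∀ z : ℂ, 0 < z.im → M u z = ps a (qq z) + z * ps b (qq z) := by
    intro u
    by_cases hu : 0 ≤ u
    · obtain ⟨a, b, h1⟩ := hex K (M u) hK (h.diff u hu) (h.T2 u hu) (h.bound u hu)
      exact ⟨a, b, fun _ => h1⟩
    · exact ⟨0, 0, fun h => absurd h hu⟩
  choose α β hab using this
  have hpa : ∀ u : ℝ, 0 ≤ u → PolyB (α u) := fun u hu => ⟨K * K', A + 1, by positivity, fun n => ((hab u hu).1 n).1⟩
  have hpb : ∀ u : ℝ, 0 ≤ u → PolyB (β u) := fun u hu => ⟨K * K', A + 1, by positivity, fun n => ((hab u hu).1 n).2⟩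
  refine ⟨K * K', A + 1, α, β, by positivity, fun u hu => (hab u hu).1, ?_, ?_⟩
  · intro u hu v hv
    obtain ⟨a, b, h1, h2⟩ := hex (K * |u - v|) (fun z => M u z - M v z) (by positivity) ((h.diff u hu).sub (h.diff v hv))
      (fun z hz => by linear_combination h.T2 u hu z hz - h.T2 v hv z hz) (h.lip u hu v hv)
    have pa : PolyB a := ⟨K * |u - v| * K', A + 1, by positivity, fun n => (h1 n).1⟩
    have pb : PolyB b := ⟨K * |u - v| * K', A + 1, by positivity, fun n => (h1 n).2⟩
    have hu' := ps_unique (((hpa u hu).add ((hpa v hv).const_mul (-1))).add (pa.const_mul (-1)))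
      (((hpb u hu).add ((hpb v hv).const_mul (-1))).add (pb.const_mul (-1))) (fun z hz => by
        have q := norm_qq_lt hz
        rw [ps_add ((hpa u hu).add ((hpa v hv).const_mul (-1))) (pa.const_mul (-1)) q,
          ps_add (hpa u hu) ((hpa v hv).const_mul (-1)) q,
          ps_add ((hpb u hu).add ((hpb v hv).const_mul (-1))) (pb.const_mul (-1)) q,
          ps_add (hpb u hu) ((hpb v hv).const_mul (-1)) q, ps_const_mul, ps_const_mul, ps_const_mul, ps_const_mul]
        linear_combination h2 z hz - (hab u hu).2 z hz + (hab v hv).2 z hz)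
    intro n
    have e1 := congrFun hu'.1 n
    have e2 := congrFun hu'.2 n
    simp only [Pi.zero_apply] at e1 e2
    rw [show α u n - α v n = a n by linear_combination e1, show β u n - β v n = b n by linear_combination e2,
      show K * K' * |u - v| = K * |u - v| * K' by ring]
    exact h1 n
  · intro u hu z hz
    rw [← (hab u hu).2 z hz, ← (hab u hu).2 _ (im_neg_inv_pos hz)]
    exact h.S u hu z hz

theorem Fam.corr {ε : ℂ} {K : ℝ} {A : ℕ} {α β : ℝ → ℕ → ℂ} (h : Fam ε K A α β) {a0 b0 a1 b1 : ℂ} (hm : Hm ε a0 b0 a1 b1)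
    {L : ℝ} (hL : 0 ≤ L) {c : ℝ → ℂ} (hc : ∀ u : ℝ, 0 ≤ u → ‖c u‖ ≤ L)
    (hcl : ∀ u : ℝ, 0 ≤ u → ∀ v : ℝ, 0 ≤ v → ‖c u - c v‖ ≤ L * |u - v|) :
    ∃ K' A' α' β', Fam ε K' A' α' β' ∧ ∀ u, α' u 0 = α u 0 - c u * a0 ∧ β' u 0 = β u 0 - c u * b0 ∧
      α' u 1 = α u 1 - c u * a1 ∧ β' u 1 = β u 1 - c u * b1 := by
  obtain ⟨f, g, ⟨p, hp, hp0, hp1, hpf⟩, ⟨r, hr, hr0, hr1, hrg⟩, heq⟩ := hm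
  have hp' := hp
  have hr' := hr
  obtain ⟨P, B, hP, hpb⟩ := hp'
  obtain ⟨R, B', hR, hrb⟩ := hr'
  have pw : ∀ n : ℕ, ∀ j, j ≤ A + B + B' → ((n:ℝ) + 1) ^ j ≤ ((n:ℝ) + 1) ^ (A + B + B') := fun n j hj =>
    pow_le_pow_right₀ (by linarith [Nat.cast_nonneg (α := ℝ) n]) hj
  have key : ∀ (n : ℕ) (t : ℝ) (x y : ℂ), 0 ≤ t → ‖x‖ ≤ K * t * ((n:ℝ) + 1) ^ A → ‖y‖ ≤ L * t →
      ‖x - y * p n‖ ≤ (K + L * P + L * R) * t * ((n:ℝ) + 1) ^ (A + B + B') ∧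
      ‖x - y * r n‖ ≤ (K + L * P + L * R) * t * ((n:ℝ) + 1) ^ (A + B + B') := by
    intro n t x y ht hx hy
    have hK := h.nonneg
    have q1 : K * t * ((n:ℝ) + 1) ^ A ≤ K * t * ((n:ℝ) + 1) ^ (A + B + B') :=
      mul_le_mul_of_nonneg_left (pw n _ (by omega)) (by positivity)
    have q0 : (0:ℝ) ≤ ((n:ℝ) + 1) ^ (A + B + B') := by positivity
    constructor
    · refine (norm_sub_le _ _).trans ?_
      rw [norm_mul]
      have q2 : ‖y‖ * ‖p n‖ ≤ L * t * (P * ((n:ℝ) + 1) ^ (A + B + B')) := by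
        refine mul_le_mul hy ((hpb n).trans ?_) (norm_nonneg _) (by positivity)
        exact mul_le_mul_of_nonneg_left (pw n _ (by omega)) hP
      have q3 : 0 ≤ L * R * t * ((n:ℝ) + 1) ^ (A + B + B') := by positivity
      linarith
    · refine (norm_sub_le _ _).trans ?_
      rw [norm_mul]
      have q2 : ‖y‖ * ‖r n‖ ≤ L * t * (R * ((n:ℝ) + 1) ^ (A + B + B')) := by
        refine mul_le_mul hy ((hrb n).trans ?_) (norm_nonneg _) (by positivity)
        exact mul_le_mul_of_nonneg_left (pw n _ (by omega)) hR
      have q3 : 0 ≤ L * P * t * ((n:ℝ) + 1) ^ (A + B + B') := by positivity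
      linarith
  have hK := h.nonneg
  refine ⟨K + L * P + L * R, A + B + B', fun u n => α u n - c u * p n, fun u n => β u n - c u * r n,
    ⟨by positivity, ?_, ?_, ?_⟩, fun u => ⟨by beta_reduce; rw [hp0], by beta_reduce; rw [hr0], by beta_reduce; rw [hp1], by beta_reduce; rw [hr1]⟩⟩
  · intro u hu n
    have k1 := (key n 1 (α u n) (c u) zero_le_one (by rw [mul_one]; exact (h.bound u hu n).1) (by rw [mul_one]; exact hc u hu)).1
    have k2 := (key n 1 (β u n) (c u) zero_le_one (by rw [mul_one]; exact (h.bound u hu n).2) (by rw [mul_one]; exact hc u hu)).2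
    rw [mul_one] at k1 k2
    exact ⟨k1, k2⟩
  · intro u hu v hv n
    have k1 := (key n |u - v| (α u n - α v n) (c u - c v) (abs_nonneg _) (h.lip u hu v hv n).1 (hcl u hu v hv)).1
    have k2 := (key n |u - v| (β u n - β v n) (c u - c v) (abs_nonneg _) (h.lip u hu v hv n).2 (hcl u hu v hv)).2
    refine ⟨le_trans (le_of_eq ?_) k1, le_trans (le_of_eq ?_) k2⟩
    · congr 1; ring
    · congr 1; ring
  · intro u hu z hz
    have e : ∀ w : ℂ, 0 < w.im → ps (fun n => α u n - c u * p n) (qq w) = ps (α u) (qq w) - c u * f w ∧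
        ps (fun n => β u n - c u * r n) (qq w) = ps (β u) (qq w) - c u * g w := by
      intro w hw
      have q := norm_qq_lt hw
      have e1 := ps_add (h.polyB hu).1 (hp.const_mul (-c u)) q
      have e2 := ps_add (h.polyB hu).2 (hr.const_mul (-c u)) q
      rw [ps_const_mul, ← hpf w hw] at e1
      rw [ps_const_mul, ← hrg w hw] at e2
      constructor
      · rw [show (fun n => α u n - c u * p n) = fun n => α u n + -c u * p n by funext n; ring, e1]; ring
      · rw [show (fun n => β u n - c u * r n) = fun n => β u n + -c u * r n by funext n; ring, e2]; ring
    have hz' := im_neg_inv_pos hz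
    rw [(e z hz).1, (e z hz).2, (e _ hz').1, (e _ hz').2]
    linear_combination h.eq u hu z hz - c u * heq z hz

/-- the coefficient families with vanishing first two coefficients -/
theorem fam_final {ε : ℂ} (hm : HmAll ε) {K : ℝ} {A : ℕ} {α β : ℝ → ℕ → ℂ} (h : Fam ε K A α β) :
    ∃ K' A' α' β', Fam ε K' A' α' β' ∧ ∀ u, α' u 0 = 0 ∧ β' u 0 = 0 ∧ α' u 1 = 0 ∧ β' u 1 = 0 := by
  have hK := h.nonneg
  have L1 : (0:ℝ) ≤ K * 2 ^ A := by positivity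
  have p2 : (1:ℝ) ≤ 2 ^ A := one_le_pow₀ (by norm_num)
  have b0 : ∀ u : ℝ, 0 ≤ u → ‖α u 0‖ ≤ K * 2 ^ A ∧ ‖β u 0‖ ≤ K * 2 ^ A := fun u hu => by
    have := h.bound u hu 0
    simp only [Nat.cast_zero, zero_add, one_pow, mul_one] at this
    constructor <;> nlinarith
  have b1 : ∀ u : ℝ, 0 ≤ u → ‖α u 1‖ ≤ K * 2 ^ A ∧ ‖β u 1‖ ≤ K * 2 ^ A := fun u hu => by
    have := h.bound u hu 1
    rwa [Nat.cast_one, one_add_one_eq_two] at this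
  have l0 : ∀ u : ℝ, 0 ≤ u → ∀ v : ℝ, 0 ≤ v → ‖α u 0 - α v 0‖ ≤ K * 2 ^ A * |u - v| ∧ ‖β u 0 - β v 0‖ ≤ K * 2 ^ A * |u - v| := by
    intro u hu v hv
    have := h.lip u hu v hv 0
    simp only [Nat.cast_zero, zero_add, one_pow, mul_one] at this
    have : 0 ≤ K * |u - v| := by positivity
    constructor <;> nlinarith
  have l1 : ∀ u : ℝ, 0 ≤ u → ∀ v : ℝ, 0 ≤ v → ‖α u 1 - α v 1‖ ≤ K * 2 ^ A * |u - v| ∧ ‖β u 1 - β v 1‖ ≤ K * 2 ^ A * |u - v| := by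
    intro u hu v hv
    have := h.lip u hu v hv 1
    rw [Nat.cast_one, one_add_one_eq_two] at this
    constructor <;> linarith
  obtain ⟨h1, h2, h3, h4⟩ := hm
  obtain ⟨_, _, _, _, f1, e1⟩ := h.corr h1 L1 (fun u hu => (b0 u hu).1) (fun u hu v hv => (l0 u hu v hv).1)
  obtain ⟨_, _, _, _, f2, e2⟩ := f1.corr h2 L1 (fun u hu => (b0 u hu).2) (fun u hu v hv => (l0 u hu v hv).2)
  obtain ⟨_, _, _, _, f3, e3⟩ := f2.corr h3 L1 (fun u hu => (b1 u hu).1) (fun u hu v hv => (l1 u hu v hv).1)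
  obtain ⟨_, _, _, _, f4, e4⟩ := f3.corr h4 L1 (fun u hu => (b1 u hu).2) (fun u hu v hv => (l1 u hu v hv).2)
  refine ⟨_, _, _, _, f4, fun u => ?_⟩
  obtain ⟨x1, x2, x3, x4⟩ := e1 u
  obtain ⟨y1, y2, y3, y4⟩ := e2 u
  obtain ⟨z1, z2, z3, z4⟩ := e3 u
  obtain ⟨w1, w2, w3, w4⟩ := e4 u
  refine ⟨?_, ?_, ?_, ?_⟩
  · rw [w1, z1, y1, x1]; ring
  · rw [w2, z2, y2, x2]; ring
  · rw [w3, z3, y3, x3]; ring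
  · rw [w4, z4, y4, x4]; ring

/-- the final coefficient families -/
def Fin0 (ε : ℂ) : Prop := ∃ K A α β, Fam ε K A α β ∧ ∀ u, α u 0 = 0 ∧ β u 0 = 0 ∧ α u 1 = 0 ∧ β u 1 = 0

theorem fin0_plus : Fin0 1 := by
  obtain ⟨K, M, hK, h⟩ := KF_plus
  obtain ⟨_, _, _, _, h⟩ := fam_of_KF hK h
  exact fam_final hmAll_plus h

theorem fin0_minus : Fin0 (-1) := by
  obtain ⟨K, M, hK, h⟩ := KF_minus
  obtain ⟨_, _, _, _, h⟩ := fam_of_KF hK h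
  exact fam_final hmAll_minus h
end I24
end C8

section E1
namespace I24
open Complex Filter Topology MeasureTheory Set
open scoped ContDiff

/-- The basic radial bump. -/
def bump (x : E24) : ℂ := ((Real.smoothTransition (2 - ‖x‖ ^ 2) : ℝ) : ℂ)

theorem bump_contDiff : ContDiff ℝ ∞ bump := by
  unfold bump
  have h1 : ContDiff ℝ ∞ (fun x : E24 => Real.smoothTransition (2 - ‖x‖ ^ 2)) :=
    Real.smoothTransition.contDiff.comp (contDiff_const.sub (contDiff_norm_sq ℝ))
  exact Complex.ofRealCLM.contDiff.comp h1

theorem bump_one {x : E24} (hx : ‖x‖ ≤ 1) : bump x = 1 := by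
  unfold bump
  rw [Real.smoothTransition.one_of_one_le]
  · simp
  · nlinarith [norm_nonneg x]

theorem bump_zero {x : E24} (hx : 2 ≤ ‖x‖) : bump x = 0 := by
  unfold bump
  rw [Real.smoothTransition.zero_of_nonpos]
  · simp
  · nlinarith [norm_nonneg x]

theorem bump_compact : HasCompactSupport bump := by
  refine HasCompactSupport.intro (isCompact_closedBall (0 : E24) 2) fun x hx => ?_
  apply bump_zero
  simp only [Metric.mem_closedBall, dist_zero_right, not_le] at hx
  exact hx.le

/-- The bound on derivatives of `1 - bump`. -/
theorem wbump_bound (i : ℕ) : ∃ C : ℝ, 0 ≤ C ∧ ∀ x, ‖iteratedFDeriv ℝ i (fun x => 1 - bump x) x‖ ≤ C := by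
  set ψ := bump_compact.toSchwartzMap bump_contDiff with hψ
  refine ⟨1 + SchwartzMap.seminorm ℝ 0 i ψ, by positivity, fun x => ?_⟩
  have h1 : iteratedFDeriv ℝ i (fun x => 1 - bump x) x =
      iteratedFDeriv ℝ i (fun _ : E24 => (1 : ℂ)) x - iteratedFDeriv ℝ i bump x := by
    have := iteratedFDeriv_sub_apply (𝕜 := ℝ) (i := i) (x := x) (f := fun _ : E24 => (1 : ℂ)) (g := bump)
      contDiff_const.contDiffAt (bump_contDiff.contDiffAt.of_le (mod_cast le_top))
    exact this
  rw [h1]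
  refine (norm_sub_le _ _).trans (add_le_add ?_ ?_)
  · rcases Nat.eq_zero_or_pos i with rfl | hi
    · simp
    · rw [iteratedFDeriv_const_of_ne hi.ne']; simp
  · exact SchwartzMap.norm_iteratedFDeriv_le_seminorm ℝ ψ i x

/-- Scaled bump. -/
def bumpS (j : ℕ) (x : E24) : ℂ := bump (((j : ℝ) + 1)⁻¹ • x)

theorem bumpS_contDiff (j : ℕ) : ContDiff ℝ ∞ (bumpS j) :=
  bump_contDiff.comp (contDiff_const_smul _)

theorem bumpS_one {j : ℕ} {x : E24} (hx : ‖x‖ ≤ j + 1) : bumpS j x = 1 := by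
  apply bump_one
  rw [norm_smul, norm_inv, Real.norm_of_nonneg (by positivity), inv_mul_le_iff₀ (by positivity)]
  linarith

theorem bumpS_zero {j : ℕ} {x : E24} (hx : 2 * (j + 1) ≤ ‖x‖) : bumpS j x = 0 := by
  apply bump_zero
  rw [norm_smul, norm_inv, Real.norm_of_nonneg (by positivity), le_inv_mul_iff₀ (by positivity)]
  linarith

theorem bumpS_compact (j : ℕ) (g : E24 → ℂ) : HasCompactSupport (fun x => bumpS j x * g x) := by
  refine HasCompactSupport.intro (isCompact_closedBall (0 : E24) (2 * (j + 1))) fun x hx => ?_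
  simp only [Metric.mem_closedBall, dist_zero_right, not_le] at hx
  rw [bumpS_zero hx.le, zero_mul]

/-- The cut-off of a Schwartz function. -/
def cutS (j : ℕ) (g : SchwartzMap E24 ℂ) : SchwartzMap E24 ℂ :=
  (bumpS_compact j g).toSchwartzMap ((bumpS_contDiff j).mul (g.smooth ⊤))

theorem cutS_apply (j : ℕ) (g : SchwartzMap E24 ℂ) (x : E24) : cutS j g x = bumpS j x * g x := rfl

theorem wbumpS_bound (j i : ℕ) {C : ℝ} (hC : ∀ x, ‖iteratedFDeriv ℝ i (fun x => 1 - bump x) x‖ ≤ C) (x : E24) :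
    ‖iteratedFDeriv ℝ i (fun x => 1 - bumpS j x) x‖ ≤ C := by
  set L : E24 →L[ℝ] E24 := ((j : ℝ) + 1)⁻¹ • ContinuousLinearMap.id ℝ E24 with hL
  have hLn : ‖L‖ ≤ 1 := by
    rw [hL, norm_smul, norm_inv, Real.norm_of_nonneg (by positivity)]
    have h1 := ContinuousLinearMap.norm_id_le (𝕜 := ℝ) (E := E24)
    have h2 : ((j : ℝ) + 1)⁻¹ ≤ 1 := inv_le_one_of_one_le₀ (by linarith [(Nat.cast_nonneg j : (0 : ℝ) ≤ j)])
    exact mul_le_one₀ h2 (norm_nonneg _) h1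
  have h := ContinuousLinearMap.iteratedFDeriv_comp_right (i := i) L (f := fun x => 1 - bump x)
    (contDiff_const.sub bump_contDiff) x (mod_cast le_top)
  have he : (fun x => 1 - bumpS j x) = (fun x => 1 - bump x) ∘ L := by
    ext y; simp [bumpS, hL]
  rw [he, h]
  refine (ContinuousMultilinearMap.norm_compContinuousLinearMap_le _ _).trans ?_
  calc _ ≤ C * 1 := by
        refine mul_le_mul (hC _) ?_ (by positivity) ((norm_nonneg _).trans (hC 0))
        exact Finset.prod_le_one (fun _ _ => norm_nonneg _) fun _ _ => hLn
    _ = C := mul_one C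

theorem cutS_tendsto (g : SchwartzMap E24 ℂ) : Tendsto (fun j => cutS j g) atTop (𝓝 g) := by
  rw [(schwartz_withSeminorms ℝ E24 ℂ).tendsto_nhds]
  rintro ⟨k, n⟩ ε hε
  choose C hC0 hC using wbump_bound
  set S : ℝ := ∑ i ∈ Finset.range (n + 1), (n.choose i : ℝ) * C i * SchwartzMap.seminorm ℝ (k + 1) (n - i) g with hS
  have hS0 : 0 ≤ S := Finset.sum_nonneg fun i _ => mul_nonneg (mul_nonneg (by positivity) (hC0 i)) (apply_nonneg _ _)
  have key : ∀ j : ℕ, SchwartzMap.seminorm ℝ k n (cutS j g - g) ≤ S * ((j : ℝ) + 1)⁻¹ := by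
    intro j
    refine SchwartzMap.seminorm_le_bound ℝ k n _ (by positivity) fun x => ?_
    have hfun : ((cutS j g - g : SchwartzMap E24 ℂ) : E24 → ℂ) = fun x => -((1 - bumpS j x) * g x) := by
      ext y; rw [sub_apply, cutS_apply]; ring
    rw [hfun]
    have hneg : ‖iteratedFDeriv ℝ n (fun x => -((1 - bumpS j x) * g x)) x‖ =
        ‖iteratedFDeriv ℝ n (fun x => ((1 - bumpS j x) * g x)) x‖ := by
      have h := iteratedFDeriv_neg_apply (𝕜 := ℝ) (i := n) (f := fun x => ((1 - bumpS j x) * g x)) (x := x)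
      exact (congrArg norm h).trans (norm_neg _)
    rw [hneg]
    rcases lt_or_ge ‖x‖ (j + 1) with hx | hx
    · have he : (fun x => ((1 - bumpS j x) * g x)) =ᶠ[𝓝 x] fun _ => 0 := by
        have : {y : E24 | ‖y‖ < j + 1} ∈ 𝓝 x := (isOpen_lt continuous_norm continuous_const).mem_nhds hx
        filter_upwards [this] with y hy
        rw [bumpS_one (le_of_lt hy)]; ring
      rw [(he.iteratedFDeriv ℝ n).eq_of_nhds]
      have : iteratedFDeriv ℝ n (fun _ : E24 => (0 : ℂ)) x = 0 := by
        simp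
      rw [this]; simp; positivity
    · have hL := norm_iteratedFDeriv_mul_le (𝕜 := ℝ) (N := ∞) (f := fun x => 1 - bumpS j x) (g := g)
        (contDiff_const.sub (bumpS_contDiff j)) (g.smooth ⊤) x (n := n) (mod_cast le_top)
      have h1 : 1 ≤ ‖x‖ * ((j : ℝ) + 1)⁻¹ := by
        rw [← div_eq_mul_inv, one_le_div (by positivity)]; exact hx
      calc _ ≤ ‖x‖ ^ k * ∑ i ∈ Finset.range (n + 1), (n.choose i : ℝ) *
              ‖iteratedFDeriv ℝ i (fun x => 1 - bumpS j x) x‖ * ‖iteratedFDeriv ℝ (n - i) g x‖ := by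
            gcongr
        _ ≤ ‖x‖ ^ k * (‖x‖ * ((j : ℝ) + 1)⁻¹) * ∑ i ∈ Finset.range (n + 1), (n.choose i : ℝ) *
              C i * ‖iteratedFDeriv ℝ (n - i) g x‖ := by
            refine mul_le_mul ?_ ?_ ?_ ?_
            · exact le_mul_of_one_le_right (by positivity) h1
            · refine Finset.sum_le_sum fun i _ => ?_
              refine mul_le_mul_of_nonneg_right ?_ (norm_nonneg _)
              exact mul_le_mul_of_nonneg_left (wbumpS_bound j i (hC i) x) (by positivity)
            · positivity
            · positivity
        _ = (∑ i ∈ Finset.range (n + 1), (n.choose i : ℝ) *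
              C i * (‖x‖ ^ (k + 1) * ‖iteratedFDeriv ℝ (n - i) g x‖)) * ((j : ℝ) + 1)⁻¹ := by
            rw [Finset.mul_sum, Finset.sum_mul]
            refine Finset.sum_congr rfl fun i _ => ?_
            ring
        _ ≤ S * ((j : ℝ) + 1)⁻¹ := by
            refine mul_le_mul_of_nonneg_right ?_ (by positivity)
            refine Finset.sum_le_sum fun i _ => ?_
            exact mul_le_mul_of_nonneg_left (SchwartzMap.le_seminorm ℝ (k + 1) (n - i) g x)
              (mul_nonneg (by positivity) (hC0 i))
  have hlim : Tendsto (fun j : ℕ => S * ((j : ℝ) + 1)⁻¹) atTop (𝓝 0) := by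
    have := (tendsto_one_div_add_atTop_nhds_zero_nat (𝕜 := ℝ)).const_mul S
    simpa using this
  filter_upwards [hlim.eventually (gt_mem_nhds hε)] with j hj
  exact (key j).trans_lt hj

end I24
end E1

section E2
namespace I24
open Complex Filter Topology MeasureTheory Set
open scoped ContDiff

theorem FT_eq (g : SchwartzMap E24 ℂ) (w : E24) :
    FT g w = ∫ y : E24, cexp (((-2 * Real.pi * inner ℝ y w : ℝ) : ℂ) * I) * g y := by
  unfold FT
  rw [SchwartzMap.fourierTransformCLM_apply, SchwartzMap.fourier_coe, Real.fourier_eq']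
  rfl

theorem FT_radial {g : SchwartzMap E24 ℂ} (hg : IsRadial g) : IsRadial (FT g) := by
  intro x y hxy
  unfold FT
  rw [SchwartzMap.fourierTransformCLM_apply, SchwartzMap.fourier_coe]
  set A : E24 ≃ₗᵢ[ℝ] E24 := (Submodule.span ℝ {x - y})ᗮ.reflection with hA
  have hAx : A x = y := Submodule.reflection_sub hxy
  have h := Real.fourier_comp_linearIsometry A (g : E24 → ℂ) x
  have hc : (g : E24 → ℂ) ∘ A = g := by
    ext z; exact hg _ _ (A.norm_map z)
  rw [hc, hAx] at h
  exact h

theorem FT_FT {g : SchwartzMap E24 ℂ} (hg : IsRadial g) : FT (FT g) = g := by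
  ext x
  have h1 : FourierTransformInv.fourierInv (FourierTransform.fourier g) = g :=
    FourierTransform.fourierInv_fourier_eq g
  have h2 : FT (FT g) (-x) = g x := by
    conv_rhs => rw [← h1]
    unfold FT
    simp only [SchwartzMap.fourierTransformCLM_apply]
    rw [SchwartzMap.fourierInv_coe, Real.fourierInv_eq_fourier_neg, ← SchwartzMap.fourier_coe]
  rw [← h2]
  exact FT_radial (FT_radial hg) _ _ (norm_neg x).symm

theorem FT_continuous : Continuous FT := (SchwartzMap.fourierTransformCLM ℂ).continuous

theorem entire_of_compact {g : SchwartzMap E24 ℂ} (hg : IsRadial g) (hc : HasCompactSupport g) :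
    ∃ G : ℝ → ℂ, ContDiff ℝ ∞ G ∧ ∀ x, FT g x = G (‖x‖ ^ 2) := by
  obtain ⟨R, hR⟩ := hc.isCompact.isBounded.exists_norm_le
  set M : ℝ := ∫ y : E24, ‖g y‖ with hM
  have hM0 : 0 ≤ M := integral_nonneg fun _ => norm_nonneg _
  set B : ℝ := 2 * Real.pi * |R| with hB
  have hB0 : 0 ≤ B := by positivity
  set p : E24 → ℝ := fun y => 2 * Real.pi * inner ℝ y e₁ with hp
  have hpB : ∀ y, g y ≠ 0 → |p y| ≤ B := by
    intro y hy
    have h1 : ‖y‖ ≤ |R| := (hR y (subset_tsupport _ hy)).trans (le_abs_self R)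
    have h2 := abs_real_inner_le_norm y e₁
    rw [norm_e₁, mul_one] at h2
    rw [hp, hB]; beta_reduce
    rw [abs_mul, abs_of_pos Real.two_pi_pos]
    exact mul_le_mul_of_nonneg_left (h2.trans h1) Real.two_pi_pos.le
  have hpc : Continuous p := by rw [hp]; fun_prop
  set F : ℕ → E24 → ℂ := fun n y => ((-1) ^ n * (p y : ℂ) ^ (2 * n) / ((2 * n).factorial : ℂ)) * g y with hF
  have hFb : ∀ n y, ‖F n y‖ ≤ B ^ (2 * n) / ((2 * n).factorial : ℝ) * ‖g y‖ := by
    intro n y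
    rw [hF]; beta_reduce
    rw [norm_mul]
    by_cases hy : g y = 0
    · rw [hy]; simp
    · refine mul_le_mul_of_nonneg_right ?_ (norm_nonneg _)
      rw [norm_div, norm_mul, norm_pow, norm_neg, norm_one, one_pow, one_mul, norm_pow, Complex.norm_real,
        Complex.norm_natCast, Real.norm_eq_abs]
      gcongr
      exact hpB y hy
  have hFint : ∀ n, Integrable (F n) := by
    intro n
    refine Integrable.mono' (g.integrable.norm.const_mul (B ^ (2 * n) / ((2 * n).factorial : ℝ))) ?_
      (Eventually.of_forall (hFb n))
    refine Continuous.aestronglyMeasurable ?_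
    rw [hF]
    have := g.continuous
    fun_prop
  set c : ℕ → ℂ := fun n => ∫ y, F n y with hcdef
  have hFn : ∀ n, ∫ y, ‖F n y‖ ≤ B ^ (2 * n) / ((2 * n).factorial : ℝ) * M := by
    intro n
    rw [hM, ← integral_const_mul]
    exact integral_mono (hFint n).norm (g.integrable.norm.const_mul _) (hFb n)
  have hcb : ∀ n, ‖c n‖ ≤ B ^ (2 * n) / ((2 * n).factorial : ℝ) * M := fun n =>
    (norm_integral_le_integral_norm _).trans (hFn n)
  have hsum : ∀ t : ℝ, Summable (fun n : ℕ => B ^ (2 * n) / ((2 * n).factorial : ℝ) * M * (t ^ 2) ^ n) := by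
    intro t
    have h := (Real.hasSum_cosh (B * t)).summable.mul_right M
    refine h.congr fun n => ?_
    rw [mul_pow, ← pow_mul]; ring
  set P := FormalMultilinearSeries.ofScalars ℂ c with hP
  have hrad : P.radius = ⊤ := by
    refine FormalMultilinearSeries.radius_eq_top_of_summable_norm _ fun r => ?_
    refine Summable.of_nonneg_of_le (fun n => by positivity) (fun n => ?_) (hsum (Real.sqrt r))
    have hr : Real.sqrt (r : ℝ) ^ 2 = r := Real.sq_sqrt r.coe_nonneg
    have hn : ‖P n‖ = ‖c n‖ := FormalMultilinearSeries.ofScalars_norm ℂ c n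
    rw [hr, hn]
    exact mul_le_mul_of_nonneg_right (hcb n) (by positivity)
  have hball := P.hasFPowerSeriesOnBall (by rw [hrad]; exact ENNReal.zero_lt_top)
  have hcd : ContDiff ℂ ∞ P.sum := by
    have : AnalyticOnNhd ℂ P.sum univ := by
      have := hball.analyticOnNhd
      rw [hrad] at this
      simpa using this
    exact this.contDiff
  refine ⟨fun u => P.sum (u : ℂ), (hcd.restrict_scalars ℝ).comp Complex.ofRealCLM.contDiff, fun x => ?_⟩
  set t : ℝ := ‖x‖ with ht
  have hFTr := FT_radial hg
  have e1 : FT g x = FT g (t • e₁) := hFTr _ _ (by rw [norm_smul, norm_e₁, ht]; simp)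
  have e2 : FT g x = FT g (-(t • e₁)) := hFTr _ _ (by rw [norm_neg, norm_smul, norm_e₁, ht]; simp)
  have hcos : FT g x = ∫ y, Complex.cos (p y * t) * g y := by
    have h2 : FT g x = (FT g (t • e₁) + FT g (-(t • e₁))) / 2 := by rw [← e1, ← e2]; ring
    rw [h2, FT_eq, FT_eq, ← integral_add, ← integral_div]
    · congr 1; ext y
      rw [Complex.cos]
      simp only [inner_neg_right, inner_smul_right, hp]
      push_cast
      ring_nf
    all_goals
      refine Integrable.mono' g.integrable.norm ?_ (Eventually.of_forall fun y => ?_)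
      · refine Continuous.aestronglyMeasurable ?_
        have := g.continuous
        fun_prop
      · rw [norm_mul, Complex.norm_exp_ofReal_mul_I, one_mul]
  have hs2 : Summable fun n : ℕ => ∫ y, ‖F n y * ((t : ℂ) ^ 2) ^ n‖ := by
    refine Summable.of_nonneg_of_le (fun n => integral_nonneg fun _ => norm_nonneg _) (fun n => ?_) (hsum t)
    simp only [norm_mul, norm_pow, Complex.norm_real]
    rw [integral_mul_const]
    rw [Real.norm_eq_abs, sq_abs]
    exact mul_le_mul_of_nonneg_right (hFn n) (by positivity)
  have hs3 := hasSum_integral_of_summable_integral_norm (fun n => (hFint n).mul_const (((t : ℂ) ^ 2) ^ n)) hs2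
  have hcosF : ∀ y, (∑' n : ℕ, F n y * ((t : ℂ) ^ 2) ^ n) = Complex.cos (p y * t) * g y := by
    intro y
    refine HasSum.tsum_eq ?_
    have := (Complex.hasSum_cos (p y * t)).mul_right (g y)
    refine this.congr_fun fun n => ?_
    rw [hF]; beta_reduce
    rw [mul_pow, pow_mul (t : ℂ)]; ring
  rw [hcos]
  simp only [hcosF] at hs3
  rw [← hs3.tsum_eq]
  have hPs : P.sum (((t ^ 2 : ℝ)) : ℂ) = ∑' n, c n • ((((t ^ 2 : ℝ)) : ℂ)) ^ n :=
    FormalMultilinearSeries.ofScalars_sum_eq c _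
  beta_reduce
  rw [hPs]
  refine tsum_congr fun n => ?_
  rw [integral_mul_const, smul_eq_mul]
  push_cast
  rfl

end I24
end E2

section E3
namespace I24
open Complex Filter Topology MeasureTheory Set
open scoped ContDiff

/-- The path of Gaussian parameters. -/
def zz (t : ℝ) : ℂ := 2 * t + I

theorem zz_im (t : ℝ) : (zz t).im = 1 := by simp [zz]

theorem zz_norm (t : ℝ) : 1 ≤ ‖zz t‖ := by
  have := Complex.abs_im_le_norm (zz t)
  rw [zz_im] at this; simpa using this

theorem zz_ne (t : ℝ) : zz t ≠ 0 := by
  intro h; have := zz_norm t; rw [h] at this; simp at this; linarith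

theorem zz_continuous : Continuous zz := by unfold zz; fun_prop

theorem zz_inv_norm (t : ℝ) : ‖-1 / zz t‖ ≤ 1 := by
  rw [norm_div, norm_neg, norm_one]
  exact div_le_one_of_le₀ (zz_norm t) (norm_nonneg _)

theorem zz_inv_im (t : ℝ) : (-1 / zz t).im = (‖zz t‖ ^ 2)⁻¹ := by
  rw [neg_div, one_div, neg_im, inv_im, zz_im, Complex.normSq_eq_norm_sq]
  field_simp

theorem zz_pow_inv (t : ℝ) : ‖(zz t ^ 12)⁻¹‖ ≤ 1 := by
  rw [norm_inv, norm_pow]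
  exact inv_le_one_of_one_le₀ (one_le_pow₀ (zz_norm t))

theorem zz_inv_continuous : Continuous (fun t => -1 / zz t) :=
  continuous_const.div zz_continuous zz_ne

theorem zz_pow_inv_continuous : Continuous (fun t => (zz t ^ 12)⁻¹) :=
  (zz_continuous.pow 12).inv₀ fun t => pow_ne_zero _ (zz_ne t)

theorem gs_zz_continuous (v : ℝ) : Continuous (fun t => gs (zz t) v) :=
  continuous_gs.comp (zz_continuous.prodMk continuous_const)

theorem gs_zz_inv_continuous (v : ℝ) : Continuous (fun t => gs (-1 / zz t) v) :=
  continuous_gs.comp (zz_inv_continuous.prodMk continuous_const)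

theorem integrable_zz (m : SchwartzMap ℝ ℂ) (N : ℕ) : Integrable (fun t => ‖m t‖ * ‖zz t‖ ^ N) := by
  have h1 : Integrable (fun t : ℝ => 2 ^ (N - 1) * (2 ^ N * (‖t‖ ^ N * ‖m t‖) + ‖m t‖)) :=
    (((m.integrable_pow_mul volume N).const_mul _).add m.integrable.norm).const_mul _
  refine h1.mono' ?_ (Eventually.of_forall fun t => ?_)
  · exact (m.continuous.norm.mul (zz_continuous.norm.pow N)).aestronglyMeasurable
  · rw [norm_mul, norm_norm, norm_pow, norm_norm]
    have h2 : ‖zz t‖ ≤ 2 * ‖t‖ + 1 := by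
      unfold zz
      refine (norm_add_le _ _).trans ?_
      rw [norm_mul, Complex.norm_real, Complex.norm_I, RCLike.norm_ofNat]
    have h3 := add_pow_le (by positivity : 0 ≤ 2 * ‖t‖) zero_le_one N
    calc ‖m t‖ * ‖zz t‖ ^ N ≤ ‖m t‖ * (2 ^ (N - 1) * ((2 * ‖t‖) ^ N + 1 ^ N)) := by
          refine mul_le_mul_of_nonneg_left ?_ (norm_nonneg _)
          exact (pow_le_pow_left₀ (norm_nonneg _) h2 N).trans h3
      _ = _ := by rw [one_pow, mul_pow]; ring

/-- Decay of Gaussian values in `n`, uniform along the path. -/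
theorem gs_decay (N : ℕ) {w : ℂ} {r : ℝ} (hr : 1 ≤ r) (hw : (r ^ 2)⁻¹ ≤ w.im) (n : ℕ) :
    ‖gs w (2 * n)‖ ≤ Real.exp (2 * Real.pi) * N.factorial * r ^ (2 * N) * (((n : ℝ) + 1) ^ N)⁻¹ := by
  have hr0 : 0 < r := by linarith
  have hc : 0 < (r ^ 2)⁻¹ := by positivity
  have hc1 : (r ^ 2)⁻¹ ≤ 1 := inv_le_one_of_one_le₀ (one_le_pow₀ hr)
  have h1 := pow_mul_exp_le N hc (by positivity : 0 ≤ (n : ℝ) + 1)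
  rw [inv_inv, ← pow_mul] at h1
  have hn : (0 : ℝ) < ((n : ℝ) + 1) ^ N := by positivity
  rw [norm_gs]
  have hpi := Real.pi_gt_three
  have h2 : Real.exp (-Real.pi * w.im * (2 * n)) ≤ Real.exp (2 * Real.pi) * Real.exp (-(r ^ 2)⁻¹ * ((n : ℝ) + 1)) := by
    rw [← Real.exp_add]
    apply Real.exp_le_exp.2
    have hn0 : (0 : ℝ) ≤ n := Nat.cast_nonneg n
    have : (r ^ 2)⁻¹ * n ≤ w.im * n := mul_le_mul_of_nonneg_right hw hn0
    have h4 : 0 ≤ (r ^ 2)⁻¹ * n := by positivity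
    have h5 : 2 * Real.pi * ((r ^ 2)⁻¹ * n) ≤ 2 * Real.pi * (w.im * n) := by gcongr
    nlinarith
  calc _ ≤ _ := h2
    _ ≤ Real.exp (2 * Real.pi) * ((N.factorial * r ^ (2 * N)) * (((n : ℝ) + 1) ^ N)⁻¹) := by
        refine mul_le_mul_of_nonneg_left ?_ (Real.exp_pos _).le
        rw [← div_eq_mul_inv, le_div_iff₀ hn, mul_comm]
        exact h1
    _ = _ := by ring

/-- normalised derivative data -/
def dv (φ : SchwartzMap E24 ℂ) (n : ℕ) : ℂ :=
  (Real.pi * I)⁻¹ * ((2 * Real.sqrt (2 * n) : ℝ) : ℂ)⁻¹ * radDeriv φ (Real.sqrt (2 * n))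

theorem hasDerivAt_zz (m : SchwartzMap ℝ ℂ) (n : ℕ) :
    HasDerivAt (fun v : ℝ => ∫ t, m t * gs (zz t) v) (∫ t, (Real.pi * I * zz t * m t) * gs (zz t) (2 * n)) (2 * n) := by
  refine hasDerivAt_super (b := fun t => Real.exp Real.pi * (‖m t‖ * ‖zz t‖ ^ 0)) m.continuous.aestronglyMeasurable
    zz_continuous.aestronglyMeasurable (Ioi_mem_nhds (show (-1 : ℝ) < 2 * n by linarith [(Nat.cast_nonneg n : (0 : ℝ) ≤ n)])) ?_ ?_ ?_
  · refine Eventually.of_forall fun t v hv => ?_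
    rw [mul_comm, pow_zero, mul_one]
    refine mul_le_mul_of_nonneg_right ?_ (norm_nonneg _)
    rw [norm_gs, zz_im]
    apply Real.exp_le_exp.2
    have : (-1 : ℝ) < v := hv
    nlinarith [Real.pi_pos]
  · exact (integrable_zz m 0).const_mul _
  · refine ((integrable_zz m 1).const_mul (Real.exp Real.pi)).congr (Eventually.of_forall fun t => ?_)
    beta_reduce; ring

theorem hasDerivAt_zz_inv (m : SchwartzMap ℝ ℂ) (n : ℕ) :
    HasDerivAt (fun v : ℝ => ∫ t, (m t * (zz t ^ 12)⁻¹) * gs (-1 / zz t) v)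
      (∫ t, (Real.pi * I * (-1 / zz t) * (m t * (zz t ^ 12)⁻¹)) * gs (-1 / zz t) (2 * n)) (2 * n) := by
  have hb : Integrable (fun t => Real.exp Real.pi * (‖m t‖ * ‖zz t‖ ^ 0)) := (integrable_zz m 0).const_mul _
  refine hasDerivAt_super (b := fun t => Real.exp Real.pi * (‖m t‖ * ‖zz t‖ ^ 0))
    (m.continuous.mul zz_pow_inv_continuous).aestronglyMeasurable
    zz_inv_continuous.aestronglyMeasurable (Ioi_mem_nhds (show (-1 : ℝ) < 2 * n by linarith [(Nat.cast_nonneg n : (0 : ℝ) ≤ n)])) ?_ hb ?_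
  · refine Eventually.of_forall fun t v hv => ?_
    have h1 : ‖gs (-1 / zz t) v‖ ≤ Real.exp Real.pi := by
      rw [norm_gs, zz_inv_im]
      apply Real.exp_le_exp.2
      have hv' : (-1 : ℝ) < v := hv
      have h2 : (‖zz t‖ ^ 2)⁻¹ ≤ 1 := inv_le_one_of_one_le₀ (one_le_pow₀ (zz_norm t))
      have h3 : 0 ≤ (‖zz t‖ ^ 2)⁻¹ := by positivity
      have h4 : -1 ≤ (‖zz t‖ ^ 2)⁻¹ * v := by nlinarith
      nlinarith [Real.pi_pos]
    change ‖m t * (zz t ^ 12)⁻¹‖ * _ ≤ _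
    rw [norm_mul, pow_zero, mul_one, mul_comm]
    refine mul_le_mul h1 ?_ (by positivity) (Real.exp_pos _).le
    exact mul_le_of_le_one_right (norm_nonneg _) (zz_pow_inv t)
  · refine hb.mono' (zz_inv_continuous.norm.mul (continuous_const.mul (m.continuous.norm.mul (zz_continuous.norm.pow 0)))).aestronglyMeasurable (Eventually.of_forall fun t => ?_)
    have h0 : 0 ≤ Real.exp Real.pi * (‖m t‖ * ‖zz t‖ ^ 0) := by positivity
    rw [norm_mul, norm_norm, Real.norm_of_nonneg h0]
    exact mul_le_of_le_one_left h0 (zz_inv_norm t)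

theorem gs_nat (z : ℂ) (n : ℕ) : gs z (2 * n) = qq z ^ n := by
  rw [gs, qq, ← Complex.exp_nat_mul]; congr 1; push_cast; ring

end I24
end E3

section E4
namespace I24
open Complex Filter Topology MeasureTheory Set
open scoped ContDiff

theorem sqrt_sq_two (n : ℕ) : Real.sqrt (2 * n) ^ 2 = 2 * n := Real.sq_sqrt (by positivity)

theorem dv_of {φ : SchwartzMap E24 ℂ} {G : ℝ → ℂ} (h : ∀ x, φ x = G (‖x‖ ^ 2)) {n : ℕ} (hn : n ≠ 0) {g : ℂ}
    (hG : HasDerivAt G g (2 * n)) : dv φ n = (Real.pi * I)⁻¹ * g := by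
  rw [← sqrt_sq_two] at hG
  have h0 : (2 * Real.sqrt (2 * n)) ≠ 0 := by
    have : 0 < Real.sqrt (2 * n) := Real.sqrt_pos.2 (by positivity)
    positivity
  have h0' : ((2 * Real.sqrt (2 * n) : ℝ) : ℂ) ≠ 0 := by exact_mod_cast h0
  rw [dv, radDeriv_of h hG]
  rw [mul_assoc]; congr 1
  have e : (2 * (Real.sqrt (2 * n) : ℂ) * g) = ((2 * Real.sqrt (2 * n) : ℝ) : ℂ) * g := by push_cast; ring
  rw [e, inv_mul_cancel_left₀ h0']

theorem class_formula {ε : ℂ} (hε : ‖ε‖ = 1) {K : ℝ} {A : ℕ} {α β : ℝ → ℕ → ℂ} (hF : Fam ε K A α β) (h0 : ∀ u, β u 0 = 0)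
    (m : SchwartzMap ℝ ℂ) (f : SchwartzMap E24 ℂ) (hf : ∀ x, f x = ∫ t, m t * gs (zz t) (‖x‖ ^ 2)) (x : E24) :
    HasSum (fun n : ℕ => α (‖x‖ ^ 2) n * radVal (f + ε • FT f) (Real.sqrt (2 * n)) + β (‖x‖ ^ 2) n * dv (f + ε • FT f) n)
      ((gs 1 (‖x‖ ^ 2) - ε) * (f + ε • FT f) x) := by
  set u : ℝ := ‖x‖ ^ 2 with hu
  have hu0 : 0 ≤ u := by positivity
  have hFT : ∀ y, FT f y = ∫ t, m t * (zz t ^ 12)⁻¹ * gs (-1 / zz t) (‖y‖ ^ 2) := fun y =>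
    FT_super m.continuous.aestronglyMeasurable zz_continuous.aestronglyMeasurable
      (Eventually.of_forall fun t => by rw [zz_im]; exact one_pos)
      (by simpa [zz_im] using m.integrable.norm) f hf y
  have iP1 : ∀ v, 0 ≤ v → Integrable (fun t => m t * gs (zz t) v) := fun v hv =>
    m.integrable.norm.mono' (m.continuous.mul (gs_zz_continuous v)).aestronglyMeasurable (Eventually.of_forall fun t => by
      rw [norm_mul]
      exact mul_le_of_le_one_right (norm_nonneg _) (norm_gs_le (by rw [zz_im]; exact zero_le_one) hv))
  have iP2 : ∀ v, 0 ≤ v → Integrable (fun t => m t * (zz t ^ 12)⁻¹ * gs (-1 / zz t) v) := fun v hv =>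
    m.integrable.norm.mono' ((m.continuous.mul zz_pow_inv_continuous).mul (gs_zz_inv_continuous v)).aestronglyMeasurable
      (Eventually.of_forall fun t => by
        rw [norm_mul, norm_mul]
        refine (mul_le_of_le_one_right (by positivity) (norm_gs_le (by rw [zz_inv_im]; positivity) hv)).trans ?_
        exact mul_le_of_le_one_right (norm_nonneg _) (zz_pow_inv t))
  set φ := f + ε • FT f with hφ
  set G : ℝ → ℂ := fun v => (∫ t, m t * gs (zz t) v) + ε * ∫ t, m t * (zz t ^ 12)⁻¹ * gs (-1 / zz t) v with hG
  have hφG : ∀ y, φ y = G (‖y‖ ^ 2) := by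
    intro y
    change f y + ε * FT f y = _
    rw [hf, hFT]
  -- integrands
  set P : ℕ → ℝ → ℂ := fun n t => m t * (gs (zz t) (2 * n) + ε * ((zz t ^ 12)⁻¹ * gs (-1 / zz t) (2 * n))) with hP
  set Q : ℕ → ℝ → ℂ := fun n t => m t * (zz t * gs (zz t) (2 * n) + ε * ((zz t ^ 12)⁻¹ * ((-1 / zz t) * gs (-1 / zz t) (2 * n)))) with hQ
  have hPc : ∀ n, Continuous (P n) := fun n =>
    m.continuous.mul ((gs_zz_continuous _).add (continuous_const.mul (zz_pow_inv_continuous.mul (gs_zz_inv_continuous _))))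
  have hQc : ∀ n, Continuous (Q n) := fun n =>
    m.continuous.mul ((zz_continuous.mul (gs_zz_continuous _)).add (continuous_const.mul (zz_pow_inv_continuous.mul
      (zz_inv_continuous.mul (gs_zz_inv_continuous _)))))
  set D : ℝ := Real.exp (2 * Real.pi) * (A + 2).factorial with hD
  have hD0 : 0 ≤ D := by positivity
  set W : ℝ → ℝ := fun t => 2 * D * (‖m t‖ * ‖zz t‖ ^ (2 * (A + 2) + 1)) with hW
  have hWi : Integrable W := (integrable_zz m _).const_mul _
  have hW0 : ∀ t, 0 ≤ W t := fun t => by positivity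
  have hg1 : ∀ t (n : ℕ), ‖gs (zz t) (2 * n)‖ ≤ D * ‖zz t‖ ^ (2 * (A + 2)) * (((n : ℝ) + 1) ^ (A + 2))⁻¹ := fun t n =>
    gs_decay (A + 2) (zz_norm t) (by rw [zz_im]; exact inv_le_one_of_one_le₀ (one_le_pow₀ (zz_norm t))) n
  have hg2 : ∀ t (n : ℕ), ‖gs (-1 / zz t) (2 * n)‖ ≤ D * ‖zz t‖ ^ (2 * (A + 2)) * (((n : ℝ) + 1) ^ (A + 2))⁻¹ := fun t n =>
    gs_decay (A + 2) (zz_norm t) (by rw [zz_inv_im]) n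
  have hPb : ∀ n t, ‖P n t‖ ≤ W t * (((n : ℝ) + 1) ^ (A + 2))⁻¹ := by
    intro n t
    have hz := zz_norm t
    set X := D * ‖zz t‖ ^ (2 * (A + 2)) * (((n : ℝ) + 1) ^ (A + 2))⁻¹ with hX
    have hX0 : 0 ≤ X := by positivity
    have : ‖gs (zz t) (2 * n) + ε * ((zz t ^ 12)⁻¹ * gs (-1 / zz t) (2 * n))‖ ≤ 2 * X := by
      refine (norm_add_le _ _).trans ?_
      rw [norm_mul, norm_mul, hε, one_mul, two_mul X]
      refine add_le_add (hg1 t n) ?_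
      exact (mul_le_of_le_one_left (norm_nonneg _) (zz_pow_inv t)).trans (hg2 t n)
    calc ‖P n t‖ ≤ ‖m t‖ * (2 * X) := by
          rw [hP]; beta_reduce; rw [norm_mul]; exact mul_le_mul_of_nonneg_left this (norm_nonneg _)
      _ ≤ ‖m t‖ * (2 * X) * ‖zz t‖ := le_mul_of_one_le_right (by positivity) hz
      _ = _ := by rw [hW, hX]; ring
  have hQb : ∀ n t, ‖Q n t‖ ≤ W t * (((n : ℝ) + 1) ^ (A + 2))⁻¹ := by
    intro n t
    have hz := zz_norm t
    set X := D * ‖zz t‖ ^ (2 * (A + 2)) * (((n : ℝ) + 1) ^ (A + 2))⁻¹ with hX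
    have hX0 : 0 ≤ X := by positivity
    have : ‖zz t * gs (zz t) (2 * n) + ε * ((zz t ^ 12)⁻¹ * ((-1 / zz t) * gs (-1 / zz t) (2 * n)))‖ ≤ ‖zz t‖ * (2 * X) := by
      refine (norm_add_le _ _).trans ?_
      rw [norm_mul, norm_mul, norm_mul, norm_mul, hε, one_mul, two_mul X, mul_add]
      refine add_le_add (mul_le_mul_of_nonneg_left (hg1 t n) (norm_nonneg _)) ?_
      refine (mul_le_of_le_one_left (by positivity) (zz_pow_inv t)).trans ?_
      refine (mul_le_of_le_one_left (by positivity) (zz_inv_norm t)).trans ?_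
      exact (hg2 t n).trans (le_mul_of_one_le_left hX0 hz)
    calc ‖Q n t‖ ≤ ‖m t‖ * (‖zz t‖ * (2 * X)) := by
          rw [hQ]; beta_reduce; rw [norm_mul]; exact mul_le_mul_of_nonneg_left this (norm_nonneg _)
      _ = _ := by rw [hW, hX]; ring
  have hPi : ∀ n, Integrable (P n) := fun n =>
    (hWi.mul_const _).mono' (hPc n).aestronglyMeasurable (Eventually.of_forall (hPb n))
  have hQi : ∀ n, Integrable (Q n) := fun n =>
    (hWi.mul_const _).mono' (hQc n).aestronglyMeasurable (Eventually.of_forall (hQb n))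
  have hPint : ∀ n, ∫ t, P n t = radVal φ (Real.sqrt (2 * n)) := by
    intro n
    rw [radVal_of hφG, sqrt_sq_two, hG]; beta_reduce
    rw [← integral_const_mul, ← integral_add (iP1 _ (by positivity)) ((iP2 _ (by positivity)).const_mul _)]
    congr 1; ext t; rw [hP]; ring
  have hQint : ∀ n, n ≠ 0 → ∫ t, Q n t = dv φ n := by
    intro n hn
    have h1 := (hasDerivAt_zz m n).add ((hasDerivAt_zz_inv m n).const_mul ε)
    rw [dv_of hφG hn h1]
    have hpi : (Real.pi * I : ℂ) ≠ 0 := mul_ne_zero (by exact_mod_cast Real.pi_ne_zero) I_ne_zero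
    rw [eq_inv_mul_iff_mul_eq₀ hpi, ← integral_const_mul, ← integral_const_mul, ← integral_add]
    · congr 1; ext t; rw [hQ]; ring
    · refine ((integrable_zz m 1).const_mul Real.pi).mono' ?_ (Eventually.of_forall fun t => ?_)
      · exact ((continuous_const.mul zz_continuous).mul m.continuous).mul (gs_zz_continuous _) |>.aestronglyMeasurable
      · rw [norm_mul]
        refine (mul_le_of_le_one_right (norm_nonneg _) (norm_gs_le (by rw [zz_im]; exact zero_le_one) (by positivity))).trans ?_
        simp only [norm_mul, Complex.norm_real, Complex.norm_I, Real.norm_of_nonneg Real.pi_pos.le, pow_one]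
        apply le_of_eq; ring
    · refine ((integrable_zz m 0).const_mul Real.pi).mono' ?_ (Eventually.of_forall fun t => ?_)
      · exact (continuous_const.mul (((continuous_const.mul zz_inv_continuous).mul (m.continuous.mul zz_pow_inv_continuous)).mul
          (gs_zz_inv_continuous _))).aestronglyMeasurable
      · rw [norm_mul, hε, one_mul, norm_mul]
        refine (mul_le_of_le_one_right (norm_nonneg _) (norm_gs_le (by rw [zz_inv_im]; positivity) (by positivity))).trans ?_
        rw [norm_mul, norm_mul, norm_mul, norm_mul, Complex.norm_real, Complex.norm_I, Real.norm_of_nonneg Real.pi_pos.le, pow_zero, mul_one, mul_one]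
        refine mul_le_mul ?_ ?_ (by positivity) Real.pi_pos.le
        · exact mul_le_of_le_one_right Real.pi_pos.le (zz_inv_norm t)
        · exact mul_le_of_le_one_right (norm_nonneg _) (zz_pow_inv t)
  set F : ℕ → ℝ → ℂ := fun n t => α u n * P n t + β u n * Q n t with hFd
  have hFi : ∀ n, Integrable (F n) := fun n => ((hPi n).const_mul _).add ((hQi n).const_mul _)
  have hFb : ∀ n t, ‖F n t‖ ≤ 2 * K * W t * (((n : ℝ) + 1) ^ 2)⁻¹ := by
    intro n t
    have hb := hF.bound u hu0 n
    have hK := hF.nonneg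
    have hWt := hW0 t
    have e1 : ‖α u n * P n t‖ ≤ K * ((n : ℝ) + 1) ^ A * (W t * (((n : ℝ) + 1) ^ (A + 2))⁻¹) := by
      rw [norm_mul]; exact mul_le_mul hb.1 (hPb n t) (norm_nonneg _) (by positivity)
    have e2 : ‖β u n * Q n t‖ ≤ K * ((n : ℝ) + 1) ^ A * (W t * (((n : ℝ) + 1) ^ (A + 2))⁻¹) := by
      rw [norm_mul]; exact mul_le_mul hb.2 (hQb n t) (norm_nonneg _) (by positivity)
    refine (norm_add_le _ _).trans ((add_le_add e1 e2).trans (le_of_eq ?_))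
    have hn : ((n : ℝ) + 1) ≠ 0 := by positivity
    rw [pow_add]; field_simp; ring
  have hsq : Summable (fun n : ℕ => (((n : ℝ) + 1) ^ 2)⁻¹) := by
    have := (summable_nat_add_iff 1).2 (Real.summable_nat_pow_inv.2 (by norm_num : 1 < 2))
    simpa using this
  have hs : Summable fun n : ℕ => ∫ t, ‖F n t‖ := by
    refine Summable.of_nonneg_of_le (fun n => integral_nonneg fun _ => norm_nonneg _) (fun n => ?_)
      (hsq.mul_left (∫ t, 2 * K * W t))
    rw [← integral_mul_const]
    exact integral_mono (hFi n).norm ((hWi.const_mul _).mul_const _) (hFb n)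
  have hmain := hasSum_integral_of_summable_integral_norm hFi hs
  have hFint : ∀ n, ∫ t, F n t = α u n * radVal φ (Real.sqrt (2 * n)) + β u n * dv φ n := by
    intro n
    rw [hFd]; beta_reduce
    rw [integral_add ((hPi n).const_mul _) ((hQi n).const_mul _), integral_const_mul, integral_const_mul, hPint]
    rcases eq_or_ne n 0 with rfl | hn
    · rw [h0]; simp
    · rw [hQint n hn]
  have hlim : ∀ t, ∑' n, F n t = (gs 1 u - ε) * (m t * gs (zz t) u + ε * (m t * (zz t ^ 12)⁻¹ * gs (-1 / zz t) u)) := by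
    intro t
    have hzi : 0 < (zz t).im := by rw [zz_im]; exact one_pos
    have hp := hF.polyB hu0
    have q1 : ‖qq (zz t)‖ < 1 := by
      rw [norm_qq, Real.exp_lt_one_iff]; have := Real.pi_pos; nlinarith [mul_pos this hzi]
    have q2 : ‖qq (-1 / zz t)‖ < 1 := by
      rw [norm_qq, Real.exp_lt_one_iff]; have := Real.pi_pos; nlinarith [mul_pos this (im_neg_inv_pos hzi)]
    have hh := (((hp.1.hasSum q1).add ((hp.2.hasSum q1).mul_left (zz t))).add
      ((((hp.1.hasSum q2).add ((hp.2.hasSum q2).mul_left (-1 / zz t))).mul_left ((zz t ^ 12)⁻¹)).mul_left ε)).mul_left (m t)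
    rw [hF.eq u hu0 (zz t) hzi] at hh
    refine (HasSum.tsum_eq (hh.congr_fun fun n => ?_)).trans ?_
    · rw [hFd, hP, hQ]; beta_reduce
      rw [gs_nat, gs_nat]; ring
    · ring
  simp only [hFint, hlim] at hmain
  rw [integral_const_mul, integral_add (iP1 _ hu0) ((iP2 _ hu0).const_mul _), integral_const_mul] at hmain
  rw [hφG]
  exact hmain

end I24
end E4

section E5
namespace I24
open Complex Filter Topology MeasureTheory Set
open scoped ContDiff

theorem exists_rep {G : ℝ → ℂ} (hG : ContDiff ℝ ∞ G) (j : ℕ) : ∃ m : SchwartzMap ℝ ℂ, ∀ x : E24,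
    bumpS j x * G (‖x‖ ^ 2) = ∫ t, m t * gs (zz t) (‖x‖ ^ 2) := by
  set a : ℝ := ((j : ℝ) + 1)⁻¹ ^ 2 with ha
  have ha0 : 0 < a := by positivity
  set h : ℝ → ℂ := fun u => ((Real.smoothTransition (2 - a * u) * Real.smoothTransition (u + 2) * Real.exp (Real.pi * u) : ℝ) : ℂ) * G u with hh
  have hs : ContDiff ℝ ∞ h := by
    refine ContDiff.mul ?_ hG
    refine Complex.ofRealCLM.contDiff.comp ?_
    refine ContDiff.mul (ContDiff.mul ?_ ?_) ?_
    · exact Real.smoothTransition.contDiff.comp (by fun_prop)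
    · exact Real.smoothTransition.contDiff.comp (by fun_prop)
    · exact Real.contDiff_exp.comp (by fun_prop)
  have hc : HasCompactSupport h := by
    refine HasCompactSupport.intro (isCompact_Icc (a := (-2 : ℝ)) (b := 2 * a⁻¹)) fun u hu => ?_
    rw [hh]; beta_reduce
    rcases lt_or_ge u (-2) with h1 | h1
    · rw [Real.smoothTransition.zero_of_nonpos (by linarith : u + 2 ≤ 0)]; simp
    · have h2 : 2 * a⁻¹ < u := by
        by_contra h3; exact hu ⟨h1, not_lt.1 h3⟩
      have h4 : 2 < a * u := by
        rw [← div_eq_mul_inv, div_lt_iff₀ ha0] at h2; linarith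
      rw [Real.smoothTransition.zero_of_nonpos (by linarith : 2 - a * u ≤ 0)]; simp
  set H : SchwartzMap ℝ ℂ := hc.toSchwartzMap hs with hH
  refine ⟨FourierTransform.fourier H, fun x => ?_⟩
  set u : ℝ := ‖x‖ ^ 2 with hu
  have hu0 : 0 ≤ u := by positivity
  have h1 : H u = ∫ t, cexp (((2 * Real.pi * inner ℝ t u : ℝ) : ℂ) * I) * (FourierTransform.fourier H) t := by
    have h2 : FourierTransformInv.fourierInv (FourierTransform.fourier H) = H :=
      FourierTransform.fourierInv_fourier_eq H
    conv_lhs => rw [← h2]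
    rw [SchwartzMap.fourierInv_coe, Real.fourierInv_eq']
    rfl
  have h3 : H u = (Real.exp (Real.pi * u) : ℂ) * (bumpS j x * G u) := by
    change h u = _
    rw [hh]; beta_reduce
    rw [Real.smoothTransition.one_of_one_le (by linarith : 1 ≤ u + 2), bumpS, bump, norm_smul, mul_pow, norm_inv,
      Real.norm_of_nonneg (by positivity : 0 ≤ (j : ℝ) + 1), ← ha, ← hu]
    push_cast; ring
  have he : (Real.exp (Real.pi * u) : ℂ) ≠ 0 := by exact_mod_cast (Real.exp_pos _).ne'
  apply mul_left_cancel₀ he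
  rw [← h3, h1, ← integral_const_mul]
  congr 1; ext t
  have e : cexp (((2 * Real.pi * inner ℝ t u : ℝ) : ℂ) * I) = (Real.exp (Real.pi * u) : ℂ) * gs (zz t) u := by
    rw [gs, zz, Complex.ofReal_exp, ← Complex.exp_add]
    congr 1
    have : inner ℝ t u = t * u := by simp [mul_comm]
    rw [this]
    push_cast
    linear_combination (-(Real.pi : ℂ) * u) * I_sq
  rw [e]; ring

/-- Seminorms used for tail bounds. -/
def SN (N : ℕ) : Seminorm ℝ (SchwartzMap E24 ℂ) := (Finset.Iic (2 * N, 1)).sup (schwartzSeminormFamily ℝ E24 ℂ)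

theorem SN_bound (N k : ℕ) (hk : k ≤ 1) (φ : SchwartzMap E24 ℂ) (n : ℕ) :
    ‖iteratedFDeriv ℝ k φ (Real.sqrt (2 * n) • e₁)‖ ≤ 2 ^ (2 * N) * SN N φ * (((n : ℝ) + 1) ^ N)⁻¹ := by
  have h := SchwartzMap.one_add_le_sup_seminorm_apply (𝕜 := ℝ) (m := (2 * N, 1)) (k := 2 * N) (n := k) le_rfl hk φ
    (Real.sqrt (2 * n) • e₁)
  have hn : ‖Real.sqrt (2 * n) • e₁‖ = Real.sqrt (2 * n) := by
    rw [norm_smul, norm_e₁, mul_one, Real.norm_of_nonneg (Real.sqrt_nonneg _)]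
  rw [hn] at h
  have hp : (0 : ℝ) < ((n : ℝ) + 1) ^ N := by positivity
  rw [← div_eq_mul_inv, le_div_iff₀ hp, mul_comm]
  refine le_trans (mul_le_mul_of_nonneg_right ?_ (norm_nonneg _)) h
  rw [pow_mul]
  refine pow_le_pow_left₀ (by positivity) ?_ N
  have h1 := sqrt_sq_two n
  have h2 := Real.sqrt_nonneg (2 * (n : ℝ))
  nlinarith [(Nat.cast_nonneg n : (0 : ℝ) ≤ n)]

theorem radVal_bound (N : ℕ) (φ : SchwartzMap E24 ℂ) (n : ℕ) :
    ‖radVal φ (Real.sqrt (2 * n))‖ ≤ 2 ^ (2 * N) * SN N φ * (((n : ℝ) + 1) ^ N)⁻¹ := by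
  have h := SN_bound N 0 zero_le_one φ n
  rwa [norm_iteratedFDeriv_zero] at h

theorem radDeriv_eq (φ : SchwartzMap E24 ℂ) (r : ℝ) : radDeriv φ r = fderiv ℝ φ (r • e₁) e₁ := by
  unfold radDeriv
  have h1 : HasDerivAt (fun t : ℝ => t • e₁) ((1 : ℝ) • e₁) r := (hasDerivAt_id' r).smul_const e₁
  have h2 := (φ.differentiableAt (x := r • e₁)).hasFDerivAt.comp_hasDerivAt r h1
  rw [one_smul] at h2
  exact h2.deriv

theorem radDeriv_bound (N : ℕ) (φ : SchwartzMap E24 ℂ) (n : ℕ) :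
    ‖radDeriv φ (Real.sqrt (2 * n))‖ ≤ 2 ^ (2 * N) * SN N φ * (((n : ℝ) + 1) ^ N)⁻¹ := by
  have h := SN_bound N 1 le_rfl φ n
  rw [norm_iteratedFDeriv_one] at h
  rw [radDeriv_eq]
  refine le_trans ?_ h
  have := (fderiv ℝ φ (Real.sqrt (2 * n) • e₁)).le_opNorm e₁
  rwa [norm_e₁, mul_one] at this

theorem dv_bound (N : ℕ) (φ : SchwartzMap E24 ℂ) (n : ℕ) :
    ‖dv φ n‖ ≤ 2 ^ (2 * N) * SN N φ * (((n : ℝ) + 1) ^ N)⁻¹ := by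
  refine le_trans ?_ (radDeriv_bound N φ n)
  rw [dv, norm_mul]
  refine mul_le_of_le_one_left (norm_nonneg _) ?_
  rw [norm_mul, norm_inv, norm_inv, norm_mul, Complex.norm_I, mul_one, Complex.norm_real, Complex.norm_real,
    Real.norm_of_nonneg Real.pi_pos.le, Real.norm_of_nonneg (by positivity)]
  have h1 : Real.pi⁻¹ ≤ 1 := inv_le_one_of_one_le₀ (by linarith [Real.pi_gt_three])
  refine mul_le_one₀ h1 (by positivity) ?_
  rcases Nat.eq_zero_or_pos n with rfl | hn
  · simp
  · apply inv_le_one_of_one_le₀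
    have : (1 : ℝ) ≤ Real.sqrt (2 * n) := by
      rw [Real.one_le_sqrt]
      have : (1 : ℝ) ≤ n := by exact_mod_cast hn
      linarith
    linarith

theorem radVal_sub (f g : SchwartzMap E24 ℂ) (r : ℝ) : radVal (f - g) r = radVal f r - radVal g r := rfl

theorem radVal_add (f g : SchwartzMap E24 ℂ) (r : ℝ) : radVal (f + g) r = radVal f r + radVal g r := rfl

theorem radVal_smul (c : ℂ) (g : SchwartzMap E24 ℂ) (r : ℝ) : radVal (c • g) r = c * radVal g r := rfl

theorem radDeriv_add (f g : SchwartzMap E24 ℂ) (r : ℝ) : radDeriv (f + g) r = radDeriv f r + radDeriv g r := by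
  rw [radDeriv_eq, radDeriv_eq, radDeriv_eq]
  have := fderiv_add (𝕜 := ℝ) (f.differentiableAt (x := r • e₁)) (g.differentiableAt (x := r • e₁))
  have h2 : ((f + g : SchwartzMap E24 ℂ) : E24 → ℂ) = (f : E24 → ℂ) + g := rfl
  rw [h2, this]; rfl

theorem radDeriv_smul (c : ℂ) (g : SchwartzMap E24 ℂ) (r : ℝ) : radDeriv (c • g) r = c * radDeriv g r := by
  rw [radDeriv_eq, radDeriv_eq]
  have := fderiv_const_smul (𝕜 := ℝ) (g.differentiableAt (x := r • e₁)) c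
  have h2 : ((c • g : SchwartzMap E24 ℂ) : E24 → ℂ) = c • (g : E24 → ℂ) := rfl
  rw [h2, this]; rfl

theorem radDeriv_sub (f g : SchwartzMap E24 ℂ) (r : ℝ) : radDeriv (f - g) r = radDeriv f r - radDeriv g r := by
  have : f - g = f + (-1 : ℂ) • g := by ext x; change f x - g x = f x + (-1) * g x; ring
  rw [this, radDeriv_add, radDeriv_smul]; ring

theorem dv_sub (f g : SchwartzMap E24 ℂ) (n : ℕ) : dv (f - g) n = dv f n - dv g n := by
  rw [dv, dv, dv, radDeriv_sub]; ring

/-- The summands of the formula. -/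
def trm (α β : ℝ → ℕ → ℂ) (u : ℝ) (φ : SchwartzMap E24 ℂ) (n : ℕ) : ℂ :=
  α u n * radVal φ (Real.sqrt (2 * n)) + β u n * dv φ n

theorem summable_sq : Summable (fun n : ℕ => (((n : ℝ) + 1) ^ 2)⁻¹) := by
  have := (summable_nat_add_iff 1).2 (Real.summable_nat_pow_inv.2 (by norm_num : 1 < 2))
  simpa using this

theorem trm_bound {ε : ℂ} {K : ℝ} {A : ℕ} {α β : ℝ → ℕ → ℂ} (hF : Fam ε K A α β) {u : ℝ} (hu : 0 ≤ u)
    (φ : SchwartzMap E24 ℂ) (n : ℕ) :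
    ‖trm α β u φ n‖ ≤ 2 * K * 2 ^ (2 * (A + 2)) * SN (A + 2) φ * (((n : ℝ) + 1) ^ 2)⁻¹ := by
  have hb := hF.bound u hu n
  have hK := hF.nonneg
  have hS : 0 ≤ SN (A + 2) φ := apply_nonneg _ _
  have e1 : ‖α u n * radVal φ (Real.sqrt (2 * n))‖ ≤ K * ((n : ℝ) + 1) ^ A * (2 ^ (2 * (A + 2)) * SN (A + 2) φ * (((n : ℝ) + 1) ^ (A + 2))⁻¹) := by
    rw [norm_mul]; exact mul_le_mul hb.1 (radVal_bound _ _ _) (norm_nonneg _) (by positivity)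
  have e2 : ‖β u n * dv φ n‖ ≤ K * ((n : ℝ) + 1) ^ A * (2 ^ (2 * (A + 2)) * SN (A + 2) φ * (((n : ℝ) + 1) ^ (A + 2))⁻¹) := by
    rw [norm_mul]; exact mul_le_mul hb.2 (dv_bound _ _ _) (norm_nonneg _) (by positivity)
  refine (norm_add_le _ _).trans ((add_le_add e1 e2).trans (le_of_eq ?_))
  have hn : ((n : ℝ) + 1) ≠ 0 := by positivity
  rw [pow_add ((n : ℝ) + 1)]; field_simp; ring

theorem trm_summable {ε : ℂ} {K : ℝ} {A : ℕ} {α β : ℝ → ℕ → ℂ} (hF : Fam ε K A α β) {u : ℝ} (hu : 0 ≤ u)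
    (φ : SchwartzMap E24 ℂ) : Summable (trm α β u φ) :=
  Summable.of_norm_bounded (summable_sq.mul_left _) (trm_bound hF hu φ)

theorem formula_limit {ε : ℂ} {K : ℝ} {A : ℕ} {α β : ℝ → ℕ → ℂ} (hF : Fam ε K A α β) (x : E24)
    {φ : ℕ → SchwartzMap E24 ℂ} {ψ : SchwartzMap E24 ℂ} (hlim : Tendsto φ atTop (𝓝 ψ))
    (h : ∀ j, HasSum (trm α β (‖x‖ ^ 2) (φ j)) ((gs 1 (‖x‖ ^ 2) - ε) * φ j x)) :
    HasSum (trm α β (‖x‖ ^ 2) ψ) ((gs 1 (‖x‖ ^ 2) - ε) * ψ x) := by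
  set u : ℝ := ‖x‖ ^ 2 with hu
  have hu0 : 0 ≤ u := by positivity
  have hK := hF.nonneg
  have hs := trm_summable hF hu0 ψ
  set T := ∑' n, trm α β u ψ n with hT
  suffices T = (gs 1 u - ε) * ψ x by rw [← this]; exact hs.hasSum
  set S := ∑' n : ℕ, (((n : ℝ) + 1) ^ 2)⁻¹ with hS
  have hS0 : 0 ≤ S := tsum_nonneg fun n => by positivity
  set C := 2 * K * 2 ^ (2 * (A + 2)) * S + ‖gs 1 u - ε‖ with hC
  have key : ∀ j, ‖T - (gs 1 u - ε) * ψ x‖ ≤ C * SN (A + 2) (φ j - ψ) := by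
    intro j
    have h1 : HasSum (trm α β u (φ j - ψ)) ((gs 1 u - ε) * φ j x - T) := by
      refine ((h j).sub hs.hasSum).congr_fun fun n => ?_
      rw [trm, trm, trm, radVal_sub, dv_sub]; ring
    have h2 : ‖(gs 1 u - ε) * φ j x - T‖ ≤ 2 * K * 2 ^ (2 * (A + 2)) * SN (A + 2) (φ j - ψ) * S := by
      rw [← h1.tsum_eq]
      exact tsum_of_norm_bounded (summable_sq.hasSum.mul_left _) (trm_bound hF hu0 _)
    have h3 : ‖(φ j - ψ) x‖ ≤ SN (A + 2) (φ j - ψ) := by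
      refine (SchwartzMap.norm_le_seminorm ℝ _ x).trans ?_
      have := Seminorm.le_def.1 (Finset.le_sup (f := schwartzSeminormFamily ℝ E24 ℂ)
        (Finset.mem_Iic.2 (show ((0, 0) : ℕ × ℕ) ≤ (2 * (A + 2), 1) from ⟨Nat.zero_le _, Nat.zero_le _⟩))) (φ j - ψ)
      exact this
    have e : T - (gs 1 u - ε) * ψ x = -((gs 1 u - ε) * φ j x - T) + (gs 1 u - ε) * (φ j - ψ) x := by
      rw [sub_apply]; ring
    rw [e]
    refine (norm_add_le _ _).trans ?_
    rw [norm_neg, norm_mul]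
    calc _ ≤ _ := add_le_add h2 (mul_le_mul_of_nonneg_left h3 (norm_nonneg _))
      _ = _ := by rw [hC]; ring
  have hz : Tendsto (fun j => C * SN (A + 2) (φ j - ψ)) atTop (𝓝 (C * 0)) := by
    refine Tendsto.const_mul C ?_
    rw [Metric.tendsto_nhds]
    intro r hr
    have := ((schwartz_withSeminorms ℝ E24 ℂ).tendsto_nhds' φ ψ).1 hlim (Finset.Iic (2 * (A + 2), 1)) r hr
    filter_upwards [this] with j hj
    rw [dist_zero_right, Real.norm_of_nonneg (apply_nonneg _ _)]
    exact hj
  rw [mul_zero] at hz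
  have := ge_of_tendsto' hz key
  exact sub_eq_zero.1 (norm_le_zero_iff.1 this)

/-- The functional equation transfers to all radial Schwartz functions. -/
theorem formula_all {ε : ℂ} (hε : ‖ε‖ = 1) {K : ℝ} {A : ℕ} {α β : ℝ → ℕ → ℂ} (hF : Fam ε K A α β) (h0 : ∀ u, β u 0 = 0)
    {f : SchwartzMap E24 ℂ} (hf : IsRadial f) (x : E24) :
    HasSum (trm α β (‖x‖ ^ 2) (f + ε • FT f)) ((gs 1 (‖x‖ ^ 2) - ε) * (f + ε • FT f) x) := by
  have hcont : Continuous (fun f : SchwartzMap E24 ℂ => f + ε • FT f) :=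
    continuous_id.add (FT_continuous.const_smul ε)
  -- Fourier transforms of compactly supported functions
  have step : ∀ g : SchwartzMap E24 ℂ, IsRadial g → HasCompactSupport g →
      HasSum (trm α β (‖x‖ ^ 2) (FT g + ε • FT (FT g))) ((gs 1 (‖x‖ ^ 2) - ε) * (FT g + ε • FT (FT g)) x) := by
    intro g hg hgc
    obtain ⟨G, hG, hGx⟩ := entire_of_compact hg hgc
    refine formula_limit hF x (φ := fun j => cutS j (FT g) + ε • FT (cutS j (FT g)))
      ((hcont.tendsto _).comp (cutS_tendsto (FT g))) fun j => ?_
    obtain ⟨m, hm⟩ := exists_rep hG j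
    exact class_formula hε hF h0 m (cutS j (FT g)) (fun y => by rw [cutS_apply, hGx, hm]) x
  set g := FT f with hg
  have hgr : IsRadial g := FT_radial hf
  have hgf : FT g = f := FT_FT hf
  have hcut : ∀ j, IsRadial (cutS j g) := by
    intro j y z hyz
    rw [cutS_apply, cutS_apply, hgr y z hyz]
    congr 1
    unfold bumpS bump
    rw [norm_smul, norm_smul, hyz]
  have hl : Tendsto (fun j => FT (cutS j g)) atTop (𝓝 f) := by
    have := (FT_continuous.tendsto g).comp (cutS_tendsto g)
    rwa [hgf] at this
  exact formula_limit hF x (φ := fun j => FT (cutS j g) + ε • FT (FT (cutS j g)))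
    ((hcont.tendsto _).comp hl) fun j => step (cutS j g) (hcut j) (bumpS_compact j g)

end I24
end E5

section F1
namespace I24
open Complex Filter Topology MeasureTheory Set
open scoped ContDiff

/-- Existence of eigenfunctions with prescribed data. -/
def EigP (ε : ℂ) : Prop := ∀ m : ℕ, 2 ≤ m → ∀ δ δ' : ℂ, ∃ g : SchwartzMap E24 ℂ, IsRadial g ∧ (∀ x, FT g x = ε * g x) ∧
  ∀ n : ℕ, 2 ≤ n → radVal g (Real.sqrt (2 * n)) = (if n = m then -δ else 0) ∧
    radDeriv g (Real.sqrt (2 * n)) = 2 * (Real.sqrt (2 * n) : ℂ) * (Real.pi * I * (if n = m then -δ' else 0))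

theorem eigP_plus : EigP 1 := fun m hm δ δ' => by simpa using eig_plus m hm δ δ'
theorem eigP_minus : EigP (-1) := fun m hm δ δ' => by simpa using eig_minus m hm δ δ'

theorem gs_one_lower {u v : ℝ} (h0 : v ≤ u) (h1 : u - v ≤ 1) : u - v ≤ ‖gs 1 u - gs 1 v‖ := by
  have e : gs 1 u - gs 1 v = gs 1 v * (cexp (I * ((Real.pi * (u - v) : ℝ) : ℂ)) - 1) := by
    rw [mul_sub, mul_one, gs, gs, ← Complex.exp_add]
    congr 2; push_cast; ring
  rw [e, norm_mul, gs1_norm, one_mul, Complex.norm_exp_I_mul_ofReal_sub_one, norm_mul]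
  have h2 : Real.pi * (u - v) / 2 ≤ Real.pi / 2 := by nlinarith [Real.pi_pos]
  have h3 : 0 ≤ Real.pi * (u - v) / 2 := by
    have := Real.pi_pos
    have : 0 ≤ u - v := by linarith
    positivity
  have h4 := Real.mul_le_sin h3 h2
  have h5 : 2 / Real.pi * (Real.pi * (u - v) / 2) = u - v := by
    have := Real.pi_ne_zero
    field_simp
  rw [h5] at h4
  have h6 := Real.le_norm_self (Real.sin (Real.pi * (u - v) / 2))
  have h7 : ‖(2 : ℝ)‖ = 2 := by norm_num
  rw [h7]; linarith

/-- Data values of the dual functions. -/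
theorem data_eq {ε : ℂ} (hε : ε * ε = 1) (hn : ‖ε‖ = 1) {K : ℝ} {A : ℕ} {α β : ℝ → ℕ → ℂ} (hF : Fam ε K A α β)
    (hz : ∀ u, α u 0 = 0 ∧ β u 0 = 0 ∧ α u 1 = 0 ∧ β u 1 = 0) {m : ℕ} (hm : 2 ≤ m) {δ δ' : ℂ}
    {g : SchwartzMap E24 ℂ} (hg : IsRadial g) (hgF : ∀ x, FT g x = ε * g x)
    (hd : ∀ n : ℕ, 2 ≤ n → radVal g (Real.sqrt (2 * n)) = (if n = m then -δ else 0) ∧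
      radDeriv g (Real.sqrt (2 * n)) = 2 * (Real.sqrt (2 * n) : ℂ) * (Real.pi * I * (if n = m then -δ' else 0))) (x : E24) :
    -(α (‖x‖ ^ 2) m * δ + β (‖x‖ ^ 2) m * δ') = (gs 1 (‖x‖ ^ 2) - ε) * g x := by
  have h := formula_all hn hF (fun u => (hz u).2.1) hg x
  have hφ : g + ε • FT g = (2 : ℂ) • g := by
    ext y
    change g y + ε * FT g y = 2 * g y
    rw [hgF]; linear_combination (g y) * hε
  rw [hφ] at h
  have hdv : ∀ n : ℕ, 2 ≤ n → dv ((2 : ℂ) • g) n = 2 * (if n = m then -δ' else 0) := by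
    intro n h2
    have hpi : (Real.pi * I : ℂ) ≠ 0 := mul_ne_zero (by exact_mod_cast Real.pi_ne_zero) I_ne_zero
    have hs : ((2 * Real.sqrt (2 * n) : ℝ) : ℂ) ≠ 0 := by
      have h2r : (2 : ℝ) ≤ n := by exact_mod_cast h2
      have : 0 < Real.sqrt (2 * n) := Real.sqrt_pos.2 (by linarith)
      exact_mod_cast (by positivity : (2 * Real.sqrt (2 * n)) ≠ 0)
    rw [dv, radDeriv_smul, (hd n h2).2]
    push_cast at hs ⊢
    have hs2 : (Real.sqrt (2 * n) : ℂ) ≠ 0 := right_ne_zero_of_mul hs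
    field_simp
  have h1 : HasSum (trm α β (‖x‖ ^ 2) ((2 : ℂ) • g)) (2 * -(α (‖x‖ ^ 2) m * δ + β (‖x‖ ^ 2) m * δ')) := by
    have : trm α β (‖x‖ ^ 2) ((2 : ℂ) • g) m = 2 * -(α (‖x‖ ^ 2) m * δ + β (‖x‖ ^ 2) m * δ') := by
      rw [trm, radVal_smul, (hd m hm).1, hdv m hm, if_pos rfl, if_pos rfl]; ring
    rw [← this]
    refine hasSum_single m fun n hnm => ?_
    obtain ⟨z0, z1, z2, z3⟩ := hz (‖x‖ ^ 2)
    rcases lt_or_ge n 2 with h2 | h2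
    · interval_cases n
      · rw [trm, z0, z1]; ring
      · rw [trm, z2, z3]; ring
    · rw [trm, radVal_smul, (hd n h2).1, hdv n h2, if_neg hnm, if_neg hnm]; ring
  have h3 := h1.unique h
  change _ = _ * (2 * g x) at h3
  linear_combination h3 / 2

theorem near_bound {ε : ℂ} {K : ℝ} {A : ℕ} {α β : ℝ → ℕ → ℂ} (hF : Fam ε K A α β)
    {a b : ℕ → SchwartzMap E24 ℂ}
    (ha : ∀ m, 2 ≤ m → ∀ x, α (‖x‖ ^ 2) m = (gs 1 (‖x‖ ^ 2) - ε) * a m x)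
    (hb : ∀ m, 2 ≤ m → ∀ x, β (‖x‖ ^ 2) m = (gs 1 (‖x‖ ^ 2) - ε) * b m x) {r : ℝ} (hr : 0 ≤ r) :
    ∃ C : ℝ, 0 ≤ C ∧ ∀ᶠ s in 𝓝[>] (0 : ℝ), gs 1 (‖(r + s) • e₁‖ ^ 2) ≠ ε ∧ ∀ m : ℕ, 2 ≤ m →
      ‖a m ((r + s) • e₁)‖ ≤ C * ((m : ℝ) + 1) ^ A ∧ ‖b m ((r + s) • e₁)‖ ≤ C * ((m : ℝ) + 1) ^ A := by
  have hnorm : ∀ s : ℝ, ‖(r + s) • e₁‖ ^ 2 = (r + s) ^ 2 := fun s => by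
    rw [norm_smul, norm_e₁, mul_one, Real.norm_eq_abs, sq_abs]
  have hK := hF.nonneg
  set u0 := r ^ 2 with hu0
  have hu00 : 0 ≤ u0 := by positivity
  have hr0 : ‖r • e₁‖ ^ 2 = u0 := by rw [norm_smul, norm_e₁, mul_one, Real.norm_eq_abs, sq_abs]
  -- a common conclusion
  have fin : ∀ (C : ℝ) (s d : ℝ), 0 < d → d ≤ ‖gs 1 ((r + s) ^ 2) - ε‖ →
      (∀ m : ℕ, 2 ≤ m → ‖α ((r + s) ^ 2) m‖ ≤ C * d * ((m : ℝ) + 1) ^ A ∧ ‖β ((r + s) ^ 2) m‖ ≤ C * d * ((m : ℝ) + 1) ^ A) →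
      gs 1 (‖(r + s) • e₁‖ ^ 2) ≠ ε ∧ ∀ m : ℕ, 2 ≤ m →
      ‖a m ((r + s) • e₁)‖ ≤ C * ((m : ℝ) + 1) ^ A ∧ ‖b m ((r + s) • e₁)‖ ≤ C * ((m : ℝ) + 1) ^ A := by
    intro C s d hd hds hm
    refine ⟨fun h => ?_, fun m h2 => ?_⟩
    · rw [hnorm] at h; rw [h, sub_self, norm_zero] at hds; linarith
    · have h1 := hm m h2
      have h3 := ha m h2 ((r + s) • e₁)
      have h4 := hb m h2 ((r + s) • e₁)
      rw [hnorm] at h3 h4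
      rw [h3, h4, norm_mul, norm_mul] at h1
      constructor
      · refine le_of_mul_le_mul_left ?_ hd
        refine (mul_le_mul_of_nonneg_right hds (norm_nonneg _)).trans (h1.1.trans (le_of_eq ?_)); ring
      · refine le_of_mul_le_mul_left ?_ hd
        refine (mul_le_mul_of_nonneg_right hds (norm_nonneg _)).trans (h1.2.trans (le_of_eq ?_)); ring
  by_cases h : gs 1 u0 = ε
  · refine ⟨K, hK, ?_⟩
    have hev : ∀ᶠ s in 𝓝[>] (0 : ℝ), s * (2 * r + s) < 1 := by
      have hc : Continuous (fun s : ℝ => s * (2 * r + s)) := by fun_prop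
      have := (hc.tendsto 0).mono_left (nhdsWithin_le_nhds (s := Ioi 0))
      rw [zero_mul] at this
      exact this.eventually (gt_mem_nhds one_pos)
    filter_upwards [hev, self_mem_nhdsWithin] with s hs hs0
    have hs0' : 0 < s := hs0
    set d := s * (2 * r + s) with hd
    have hd0 : 0 < d := by positivity
    have e : (r + s) ^ 2 - u0 = d := by rw [hu0, hd]; ring
    refine fin K s d hd0 ?_ fun m h2 => ?_
    · rw [← h, ← e]; exact gs_one_lower (by linarith) (by linarith)
    · have hl := hF.lip ((r + s) ^ 2) (by positivity) u0 hu00 m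
      have z1 := ha m h2 (r • e₁)
      have z2 := hb m h2 (r • e₁)
      rw [hr0, h, sub_self, zero_mul] at z1 z2
      rw [z1, z2, sub_zero, sub_zero, e, abs_of_pos hd0] at hl
      exact hl
  · set d := ‖gs 1 u0 - ε‖ / 2 with hd
    have hd0 : 0 < d := by
      have := norm_pos_iff.2 (sub_ne_zero.2 h)
      positivity
    refine ⟨K / d, by positivity, ?_⟩
    have hev : ∀ᶠ s in 𝓝[>] (0 : ℝ), d < ‖gs 1 ((r + s) ^ 2) - ε‖ := by
      have hc : Continuous (fun s : ℝ => ‖gs 1 ((r + s) ^ 2) - ε‖) :=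
        ((continuous_gs.comp (continuous_const.prodMk (by fun_prop : Continuous fun s : ℝ => (r + s) ^ 2))).sub continuous_const).norm
      have := (hc.tendsto 0).mono_left (nhdsWithin_le_nhds (s := Ioi 0))
      rw [add_zero] at this
      refine this.eventually (lt_mem_nhds ?_)
      rw [hd] at hd0 ⊢
      linarith
    filter_upwards [hev] with s hs
    refine fin (K / d) s d hd0 hs.le fun m h2 => ?_
    rw [div_mul_cancel₀ _ hd0.ne']
    exact hF.bound _ (by positivity) m

/-- Interpolation in an eigenspace. -/
theorem eig_interp {ε : ℂ} (hε : ε * ε = 1) (hn : ‖ε‖ = 1) (hfin : Fin0 ε) (heig : EigP ε) :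
    ∃ a b : ℕ → SchwartzMap E24 ℂ, (∀ n, IsRadial (a n)) ∧ (∀ n, IsRadial (b n)) ∧
      (∀ n < 2, a n = 0 ∧ b n = 0) ∧
      (∀ x, ∃ (C : ℝ) (A : ℕ), 0 ≤ C ∧ ∀ n, ‖a n x‖ ≤ C * ((n : ℝ) + 1) ^ A ∧ ‖b n x‖ ≤ C * ((n : ℝ) + 1) ^ A) ∧
      ∀ f : SchwartzMap E24 ℂ, IsRadial f → ∀ x, HasSum (fun n : ℕ => radVal (f + ε • FT f) (Real.sqrt (2 * n)) * a n x +
        dv (f + ε • FT f) n * b n x) ((f + ε • FT f) x) := by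
  obtain ⟨K, A, α, β, hF, hz⟩ := hfin
  have hK := hF.nonneg
  choose g hg hgF hgd using heig
  set a : ℕ → SchwartzMap E24 ℂ := fun m => if h : 2 ≤ m then g m h (-1) 0 else 0 with ha
  set b : ℕ → SchwartzMap E24 ℂ := fun m => if h : 2 ≤ m then g m h 0 (-1) else 0 with hb
  have har : ∀ n, IsRadial (a n) := by
    intro n; rw [ha]; beta_reduce; split_ifs with h
    · exact hg _ _ _ _
    · intro _ _ _; rfl
  have hbr : ∀ n, IsRadial (b n) := by
    intro n; rw [hb]; beta_reduce; split_ifs with h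
    · exact hg _ _ _ _
    · intro _ _ _; rfl
  have h0 : ∀ n < 2, a n = 0 ∧ b n = 0 := fun n hn2 =>
    ⟨dif_neg (not_le.2 hn2), dif_neg (not_le.2 hn2)⟩
  have haα : ∀ m, 2 ≤ m → ∀ x, α (‖x‖ ^ 2) m = (gs 1 (‖x‖ ^ 2) - ε) * a m x := by
    intro m hm x
    have := data_eq hε hn hF hz hm (hg m hm (-1) 0) (hgF m hm (-1) 0) (hgd m hm (-1) 0) x
    rw [ha]; beta_reduce; rw [dif_pos hm, ← this]; ring
  have hbβ : ∀ m, 2 ≤ m → ∀ x, β (‖x‖ ^ 2) m = (gs 1 (‖x‖ ^ 2) - ε) * b m x := by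
    intro m hm x
    have := data_eq hε hn hF hz hm (hg m hm 0 (-1)) (hgF m hm 0 (-1)) (hgd m hm 0 (-1)) x
    rw [hb]; beta_reduce; rw [dif_pos hm, ← this]; ring
  have hlimS : ∀ (ψ : SchwartzMap E24 ℂ) (r : ℝ), Tendsto (fun s : ℝ => ψ ((r + s) • e₁)) (𝓝[>] 0) (𝓝 (ψ (r • e₁))) := by
    intro ψ r
    have hc : Continuous (fun s : ℝ => ψ ((r + s) • e₁)) := ψ.continuous.comp (by fun_prop)
    have := (hc.tendsto 0).mono_left (nhdsWithin_le_nhds (s := Ioi 0))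
    rwa [add_zero] at this
  -- full bounds
  have hfull : ∀ r : ℝ, 0 ≤ r → ∃ C : ℝ, 0 ≤ C ∧ ∀ᶠ s in 𝓝[>] (0 : ℝ), gs 1 (‖(r + s) • e₁‖ ^ 2) ≠ ε ∧ ∀ m : ℕ,
      ‖a m ((r + s) • e₁)‖ ≤ C * ((m : ℝ) + 1) ^ A ∧ ‖b m ((r + s) • e₁)‖ ≤ C * ((m : ℝ) + 1) ^ A := by
    intro r hr
    obtain ⟨C, hC, hev⟩ := near_bound hF haα hbβ hr
    refine ⟨C, hC, hev.mono fun s hs => ⟨hs.1, fun m => ?_⟩⟩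
    rcases lt_or_ge m 2 with h2 | h2
    · rw [(h0 m h2).1, (h0 m h2).2]
      have : 0 ≤ C * ((m : ℝ) + 1) ^ A := by positivity
      constructor <;> simpa using this
    · exact hs.2 m h2
  have hgrow : ∀ x, ∃ (C : ℝ) (A : ℕ), 0 ≤ C ∧ ∀ n, ‖a n x‖ ≤ C * ((n : ℝ) + 1) ^ A ∧ ‖b n x‖ ≤ C * ((n : ℝ) + 1) ^ A := by
    intro x
    obtain ⟨C, hC, hev⟩ := hfull ‖x‖ (norm_nonneg _)
    refine ⟨C, A, hC, fun n => ?_⟩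
    have hx : ‖x‖ = ‖‖x‖ • e₁‖ := by rw [norm_smul, norm_e₁]; simp
    rw [har n _ _ hx, hbr n _ _ hx]
    exact ⟨le_of_tendsto (hlimS (a n) ‖x‖).norm (hev.mono fun s hs => (hs.2 n).1),
      le_of_tendsto (hlimS (b n) ‖x‖).norm (hev.mono fun s hs => (hs.2 n).2)⟩
  refine ⟨a, b, har, hbr, h0, hgrow, fun f hf x => ?_⟩
  set φ := f + ε • FT f with hφ
  have hφr : IsRadial φ := fun y z hyz => by
    change f y + ε * FT f y = f z + ε * FT f z
    rw [hf y z hyz, FT_radial hf y z hyz]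
  set T : E24 → ℕ → ℂ := fun x n => radVal φ (Real.sqrt (2 * n)) * a n x + dv φ n * b n x with hT
  have hTb : ∀ (C : ℝ) (y : E24), 0 ≤ C → (∀ m : ℕ, ‖a m y‖ ≤ C * ((m : ℝ) + 1) ^ A ∧ ‖b m y‖ ≤ C * ((m : ℝ) + 1) ^ A) → ∀ n : ℕ,
      ‖T y n‖ ≤ 2 * C * 2 ^ (2 * (A + 2)) * SN (A + 2) φ * (((n : ℝ) + 1) ^ 2)⁻¹ := by
    intro C y hC hb n
    have hS : 0 ≤ SN (A + 2) φ := apply_nonneg _ _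
    have e1 : ‖radVal φ (Real.sqrt (2 * n)) * a n y‖ ≤ (2 ^ (2 * (A + 2)) * SN (A + 2) φ * (((n : ℝ) + 1) ^ (A + 2))⁻¹) * (C * ((n : ℝ) + 1) ^ A) := by
      rw [norm_mul]; exact mul_le_mul (radVal_bound _ _ _) (hb n).1 (norm_nonneg _) (by positivity)
    have e2 : ‖dv φ n * b n y‖ ≤ (2 ^ (2 * (A + 2)) * SN (A + 2) φ * (((n : ℝ) + 1) ^ (A + 2))⁻¹) * (C * ((n : ℝ) + 1) ^ A) := by
      rw [norm_mul]; exact mul_le_mul (dv_bound _ _ _) (hb n).2 (norm_nonneg _) (by positivity)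
    refine (norm_add_le _ _).trans ((add_le_add e1 e2).trans (le_of_eq ?_))
    have hn : ((n : ℝ) + 1) ≠ 0 := by positivity
    rw [pow_add ((n : ℝ) + 1)]; field_simp; ring
  have hgen : ∀ y : E24, gs 1 (‖y‖ ^ 2) ≠ ε → HasSum (T y) (φ y) := by
    intro y hy
    have h1 := (formula_all hn hF (fun u => (hz u).2.1) hf y).mul_left ((gs 1 (‖y‖ ^ 2) - ε)⁻¹)
    have hne := sub_ne_zero.2 hy
    rw [inv_mul_cancel_left₀ hne] at h1
    refine h1.congr_fun fun n => ?_
    rw [hT]; beta_reduce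
    rw [trm]
    rcases lt_or_ge n 2 with h2 | h2
    · obtain ⟨z0, z1, z2, z3⟩ := hz (‖y‖ ^ 2)
      rw [(h0 n h2).1, (h0 n h2).2]
      interval_cases n
      · rw [z0, z1]; simp
      · rw [z2, z3]; simp
    · rw [haα n h2, hbβ n h2]; field_simp; ring
  set r := ‖x‖ with hr
  have hx : ‖x‖ = ‖r • e₁‖ := by rw [norm_smul, norm_e₁, hr]; simp
  have hTx : T x = T (r • e₁) := by
    ext n; rw [hT]; beta_reduce; rw [har n _ _ hx, hbr n _ _ hx]
  change HasSum (T x) (φ x)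
  rw [hTx, hφr _ _ hx]
  obtain ⟨C, hC, hev⟩ := hfull r (norm_nonneg _)
  have hbx : ∀ m : ℕ, ‖a m (r • e₁)‖ ≤ C * ((m : ℝ) + 1) ^ A ∧ ‖b m (r • e₁)‖ ≤ C * ((m : ℝ) + 1) ^ A := fun n =>
    ⟨le_of_tendsto (hlimS (a n) r).norm (hev.mono fun s hs => (hs.2 n).1),
      le_of_tendsto (hlimS (b n) r).norm (hev.mono fun s hs => (hs.2 n).2)⟩
  have hsum : Summable (T (r • e₁)) := Summable.of_norm_bounded (summable_sq.mul_left _) (hTb C _ hC hbx)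
  have hlim : Tendsto (fun s : ℝ => ∑' n, T ((r + s) • e₁) n) (𝓝[>] 0) (𝓝 (∑' n, T (r • e₁) n)) := by
    refine tendsto_tsum_of_dominated_convergence
      (summable_sq.mul_left (2 * C * 2 ^ (2 * (A + 2)) * SN (A + 2) φ)) (fun n => ?_) ?_
    · exact ((hlimS (a n) r).const_mul _).add ((hlimS (b n) r).const_mul _)
    · filter_upwards [hev] with s hs n
      exact hTb C _ hC hs.2 n
  have hlim2 : Tendsto (fun s : ℝ => ∑' n, T ((r + s) • e₁) n) (𝓝[>] 0) (𝓝 (φ (r • e₁))) := by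
    refine (hlimS φ r).congr' ?_
    filter_upwards [hev] with s hs
    exact (hgen _ hs.1).tsum_eq.symm
  rw [← tendsto_nhds_unique hlim hlim2]
  exact hsum.hasSum

end I24
end F1

section F2
namespace I24
open Complex Filter Topology MeasureTheory Set
open scoped ContDiff

theorem summable_of_decay {v w : ℕ → ℂ} (hv : ∀ N : ℕ, ∃ M : ℝ, 0 ≤ M ∧ ∀ n : ℕ, ‖v n‖ ≤ M * (((n : ℝ) + 1) ^ N)⁻¹)
    (hw : ∃ (C : ℝ) (A : ℕ), 0 ≤ C ∧ ∀ n : ℕ, ‖w n‖ ≤ C * ((n : ℝ) + 1) ^ A) : Summable (fun n => v n * w n) := by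
  obtain ⟨C, A, hC, hw⟩ := hw
  obtain ⟨M, hM, hv⟩ := hv (A + 2)
  refine Summable.of_norm_bounded (summable_sq.mul_left (M * C)) fun n => ?_
  rw [norm_mul]
  refine (mul_le_mul (hv n) (hw n) (norm_nonneg _) (by positivity)).trans (le_of_eq ?_)
  have hn : ((n : ℝ) + 1) ≠ 0 := by positivity
  rw [pow_add ((n : ℝ) + 1)]; field_simp

/-- Normalising factor in `dv`. -/
def kk (n : ℕ) : ℂ := (Real.pi * I)⁻¹ * ((2 * Real.sqrt (2 * n) : ℝ) : ℂ)⁻¹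

theorem dv_eq_kk (φ : SchwartzMap E24 ℂ) (n : ℕ) : dv φ n = kk n * radDeriv φ (Real.sqrt (2 * n)) := rfl

theorem tsum_ge_two {F : ℕ → ℂ} {a : ℕ → SchwartzMap E24 ℂ} {v : ℕ → ℂ} {x : E24} (hF : ∀ n, F n = v n * a n x)
    (h0 : ∀ n < 2, a n = 0) : ∑' n : {n : ℕ // 2 ≤ n}, v n * a n x = ∑' n, F n := by
  have h := Function.Injective.tsum_eq (f := F) (g := (Subtype.val : {n : ℕ // 2 ≤ n} → ℕ)) Subtype.val_injective ?_
  · rw [← h]; exact tsum_congr fun n => (hF n).symm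
  · intro n hn
    by_contra h2
    have h3 : ¬ 2 ≤ n := fun h => h2 ⟨⟨n, h⟩, rfl⟩
    refine hn ?_
    rw [hF, h0 n (not_le.1 h3)]
    exact mul_zero _

theorem isRadial_comb {f g : SchwartzMap E24 ℂ} (hf : IsRadial f) (hg : IsRadial g) (c d : ℂ) :
    IsRadial (c • f + d • g) := fun x y h => by
  change c * f x + d * g x = c * f y + d * g y
  rw [hf x y h, hg x y h]

set_option maxHeartbeats 400000 in
theorem main :
    ∃ a b c d : ℕ → SchwartzMap (EuclideanSpace ℝ (Fin 24)) ℂ,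
      (∀ n : ℕ, IsRadial (a n)) ∧ (∀ n : ℕ, IsRadial (b n)) ∧
      (∀ n : ℕ, IsRadial (c n)) ∧ (∀ n : ℕ, IsRadial (d n)) ∧
      ∀ f : SchwartzMap (EuclideanSpace ℝ (Fin 24)) ℂ, IsRadial f → ∀ x : EuclideanSpace ℝ (Fin 24),
        Summable (fun n : {n : ℕ // 2 ≤ n} =>
          ‖radVal f (Real.sqrt (2 * (n : ℕ))) * a n x‖) ∧
        Summable (fun n : {n : ℕ // 2 ≤ n} =>
          ‖radDeriv f (Real.sqrt (2 * (n : ℕ))) * b n x‖) ∧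
        Summable (fun n : {n : ℕ // 2 ≤ n} =>
          ‖radVal (FT f) (Real.sqrt (2 * (n : ℕ))) * c n x‖) ∧
        Summable (fun n : {n : ℕ // 2 ≤ n} =>
          ‖radDeriv (FT f) (Real.sqrt (2 * (n : ℕ))) * d n x‖) ∧
        f x = (∑' n : {n : ℕ // 2 ≤ n}, radVal f (Real.sqrt (2 * (n : ℕ))) * a n x)
            + (∑' n : {n : ℕ // 2 ≤ n}, radDeriv f (Real.sqrt (2 * (n : ℕ))) * b n x)
            + (∑' n : {n : ℕ // 2 ≤ n}, radVal (FT f) (Real.sqrt (2 * (n : ℕ))) * c n x)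
            + (∑' n : {n : ℕ // 2 ≤ n}, radDeriv (FT f) (Real.sqrt (2 * (n : ℕ))) * d n x) := by
  obtain ⟨p, q, hp, hq, hpq0, hpqg, hP⟩ := eig_interp (ε := 1) (by norm_num) (by norm_num) fin0_plus eigP_plus
  obtain ⟨s, t, hs, ht, hst0, hstg, hS⟩ := eig_interp (ε := -1) (by norm_num) (by norm_num) fin0_minus eigP_minus
  refine ⟨fun n => (1 / 2 : ℂ) • p n + (1 / 2 : ℂ) • s n, fun n => (kk n / 2) • q n + (kk n / 2) • t n,
    fun n => (1 / 2 : ℂ) • p n + (-(1 / 2) : ℂ) • s n, fun n => (kk n / 2) • q n + (-(kk n / 2)) • t n,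
    fun n => isRadial_comb (hp n) (hs n) _ _, fun n => isRadial_comb (hq n) (ht n) _ _,
    fun n => isRadial_comb (hp n) (hs n) _ _, fun n => isRadial_comb (hq n) (ht n) _ _, fun f hf x => ?_⟩
  have dV : ∀ φ : SchwartzMap E24 ℂ, ∀ N : ℕ, ∃ M : ℝ, 0 ≤ M ∧ ∀ n : ℕ,
      ‖radVal φ (Real.sqrt (2 * n))‖ ≤ M * (((n : ℝ) + 1) ^ N)⁻¹ := fun φ N =>
    ⟨2 ^ (2 * N) * SN N φ, mul_nonneg (by positivity) (apply_nonneg _ _), radVal_bound N φ⟩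
  have dD : ∀ φ : SchwartzMap E24 ℂ, ∀ N : ℕ, ∃ M : ℝ, 0 ≤ M ∧ ∀ n : ℕ,
      ‖dv φ n‖ ≤ M * (((n : ℝ) + 1) ^ N)⁻¹ := fun φ N =>
    ⟨2 ^ (2 * N) * SN N φ, mul_nonneg (by positivity) (apply_nonneg _ _), dv_bound N φ⟩
  obtain ⟨C, A, hC, hCA⟩ := hpqg x
  obtain ⟨C', A', hC', hCA'⟩ := hstg x
  have sP := fun φ => summable_of_decay (dV φ) ⟨C, A, hC, fun n => (hCA n).1⟩
  have sQ := fun φ => summable_of_decay (dD φ) ⟨C, A, hC, fun n => (hCA n).2⟩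
  have sS := fun φ => summable_of_decay (dV φ) ⟨C', A', hC', fun n => (hCA' n).1⟩
  have sT := fun φ => summable_of_decay (dD φ) ⟨C', A', hC', fun n => (hCA' n).2⟩
  have s1 := ((sP f).mul_left (1 / 2)).add ((sS f).mul_left (1 / 2))
  have s2 := ((sQ f).mul_left (1 / 2)).add ((sT f).mul_left (1 / 2))
  have s3 := ((sP (FT f)).mul_left (1 / 2)).sub ((sS (FT f)).mul_left (1 / 2))
  have s4 := ((sQ (FT f)).mul_left (1 / 2)).sub ((sT (FT f)).mul_left (1 / 2))
  have e1 : ∀ n : ℕ, 1 / 2 * (radVal f (Real.sqrt (2 * n)) * p n x) + 1 / 2 * (radVal f (Real.sqrt (2 * n)) * s n x) =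
      radVal f (Real.sqrt (2 * n)) * ((1 / 2 : ℂ) • p n + (1 / 2 : ℂ) • s n) x := fun n => by
    change _ = _ * (1 / 2 * p n x + 1 / 2 * s n x); ring
  have e2 : ∀ n : ℕ, 1 / 2 * (dv f n * q n x) + 1 / 2 * (dv f n * t n x) =
      radDeriv f (Real.sqrt (2 * n)) * ((kk n / 2) • q n + (kk n / 2) • t n) x := fun n => by
    rw [dv_eq_kk]; change _ = _ * (kk n / 2 * q n x + kk n / 2 * t n x); ring
  have e3 : ∀ n : ℕ, 1 / 2 * (radVal (FT f) (Real.sqrt (2 * n)) * p n x) - 1 / 2 * (radVal (FT f) (Real.sqrt (2 * n)) * s n x) =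
      radVal (FT f) (Real.sqrt (2 * n)) * ((1 / 2 : ℂ) • p n + (-(1 / 2) : ℂ) • s n) x := fun n => by
    change _ = _ * (1 / 2 * p n x + -(1 / 2) * s n x); ring
  have e4 : ∀ n : ℕ, 1 / 2 * (dv (FT f) n * q n x) - 1 / 2 * (dv (FT f) n * t n x) =
      radDeriv (FT f) (Real.sqrt (2 * n)) * ((kk n / 2) • q n + (-(kk n / 2)) • t n) x := fun n => by
    rw [dv_eq_kk]; change _ = _ * (kk n / 2 * q n x + -(kk n / 2) * t n x); ring
  have z1 : ∀ n < 2, (1 / 2 : ℂ) • p n + (1 / 2 : ℂ) • s n = 0 := fun n hn => by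
    rw [(hpq0 n hn).1, (hst0 n hn).1]; simp
  have z2 : ∀ n < 2, (kk n / 2) • q n + (kk n / 2) • t n = 0 := fun n hn => by
    rw [(hpq0 n hn).2, (hst0 n hn).2]; simp
  have z3 : ∀ n < 2, (1 / 2 : ℂ) • p n + (-(1 / 2) : ℂ) • s n = 0 := fun n hn => by
    rw [(hpq0 n hn).1, (hst0 n hn).1]; simp
  have z4 : ∀ n < 2, (kk n / 2) • q n + (-(kk n / 2)) • t n = 0 := fun n hn => by
    rw [(hpq0 n hn).2, (hst0 n hn).2]; simp
  have u1 := s1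
  have u2 := s2
  have u3 := s3
  have u4 := s4
  simp only [e1] at u1
  simp only [e2] at u2
  simp only [e3] at u3
  simp only [e4] at u4
  have hi : Function.Injective (Subtype.val : {n : ℕ // 2 ≤ n} → ℕ) := Subtype.val_injective
  beta_reduce
  refine ⟨u1.norm.comp_injective hi, u2.norm.comp_injective hi, u3.norm.comp_injective hi, u4.norm.comp_injective hi, ?_⟩
  have t1 := tsum_ge_two (v := fun n : ℕ => radVal f (Real.sqrt (2 * n))) (x := x) e1 z1
  have t2 := tsum_ge_two (v := fun n : ℕ => radDeriv f (Real.sqrt (2 * n))) (x := x) e2 z2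
  have t3 := tsum_ge_two (v := fun n : ℕ => radVal (FT f) (Real.sqrt (2 * n))) (x := x) e3 z3
  have t4 := tsum_ge_two (v := fun n : ℕ => radDeriv (FT f) (Real.sqrt (2 * n))) (x := x) e4 z4
  beta_reduce at t1 t2 t3 t4
  rw [t1, t2, t3, t4]
  have hsum := ((s1.hasSum.add s2.hasSum).add s3.hasSum).add s4.hasSum
  have hfin := ((hP f hf x).mul_left (1 / 2)).add ((hS f hf x).mul_left (1 / 2))
  have hval : 1 / 2 * (f + (1 : ℂ) • FT f) x + 1 / 2 * (f + (-1 : ℂ) • FT f) x = f x := by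
    change 1 / 2 * (f x + 1 * FT f x) + 1 / 2 * (f x + (-1) * FT f x) = f x
    ring
  rw [hval] at hfin
  refine (hfin.congr_fun fun n => ?_).unique hsum
  rw [dv_eq_kk (f + (1 : ℂ) • FT f), dv_eq_kk (f + (-1 : ℂ) • FT f), radVal_add, radVal_add, radVal_smul, radVal_smul,
    radDeriv_add, radDeriv_add, radDeriv_smul, radDeriv_smul, dv_eq_kk, dv_eq_kk]
  ring

end I24
end F2

/-- The interpolation theorem in dimension 8: there is an interpolation basis of radial
Schwartz functions reconstructing every radial Schwartz function from the values and radial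
derivatives of it and its Fourier transform at the radii `√(2n)`, `n ≥ 2`, with all four
series converging absolutely. -/
theorem interpolation_dim24 :
    ∃ a b c d : ℕ → SchwartzMap (EuclideanSpace ℝ (Fin 24)) ℂ,
      (∀ n : ℕ, IsRadial (a n)) ∧ (∀ n : ℕ, IsRadial (b n)) ∧
      (∀ n : ℕ, IsRadial (c n)) ∧ (∀ n : ℕ, IsRadial (d n)) ∧
      ∀ f : SchwartzMap (EuclideanSpace ℝ (Fin 24)) ℂ, IsRadial f → ∀ x : EuclideanSpace ℝ (Fin 24),
        Summable (fun n : {n : ℕ // 2 ≤ n} =>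
          ‖radVal f (Real.sqrt (2 * (n : ℕ))) * a n x‖) ∧
        Summable (fun n : {n : ℕ // 2 ≤ n} =>
          ‖radDeriv f (Real.sqrt (2 * (n : ℕ))) * b n x‖) ∧
        Summable (fun n : {n : ℕ // 2 ≤ n} =>
          ‖radVal (FT f) (Real.sqrt (2 * (n : ℕ))) * c n x‖) ∧
        Summable (fun n : {n : ℕ // 2 ≤ n} =>
          ‖radDeriv (FT f) (Real.sqrt (2 * (n : ℕ))) * d n x‖) ∧
        f x = (∑' n : {n : ℕ // 2 ≤ n}, radVal f (Real.sqrt (2 * (n : ℕ))) * a n x)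
            + (∑' n : {n : ℕ // 2 ≤ n}, radDeriv f (Real.sqrt (2 * (n : ℕ))) * b n x)
            + (∑' n : {n : ℕ // 2 ≤ n}, radVal (FT f) (Real.sqrt (2 * (n : ℕ))) * c n x)
            + (∑' n : {n : ℕ // 2 ≤ n}, radDeriv (FT f) (Real.sqrt (2 * (n : ℕ))) * d n x) :=
  I24.main

end
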